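/- Let (R, m, k) be a Noetherian local ring of Krull dimension d that contains a field, and let P be a tiny complex over R, i.e., a complex of finite rank free R-modules of the form 0 → P_d → ⋯ → P_1 → P_0 → 0 whose homology is nonzero and of finite length. Then ∑_{j=0}^{d} rank_R(P_j) ≥ 2^d. -/

import Mathlib

/-- Length of the subquotient `Z / (Z ∩ B)`. -/
noncomputable def relLen (k : Type) [Field k] {V : Type} [AddCommGroup V] [Module k V]
    (Z B : Submodule k V) : ℕ∞ :=
  Module.length k (Z ⧸ B.comap Z.subtype)

section
variable {k : Type} [Field k]

theorem length_le_of_maps {W B C A W' : Type} [AddCommGroup W] [AddCommGroup B] [AddCommGroup C]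
    [AddCommGroup A] [AddCommGroup W'] [Module k W] [Module k B] [Module k C] [Module k A]
    [Module k W'] (f : W →ₗ[k] C) (g : W →ₗ[k] B) (q : W' →ₗ[k] C) (r : W' →ₗ[k] A)
    (hf : Function.Surjective f) (hr : ∀ w, r w = 0 → q w = 0)
    (h : ∀ w, g w = 0 → ∃ w', q w' = f w) :
    Module.length k C ≤ Module.length k A + Module.length k B := by
  have h1 : Module.length k (LinearMap.range q) ≤ Module.length k A := by
    have e := q.quotKerEquivRange.length_eq
    have e2 := r.quotKerEquivRange.length_eq
    have hle : LinearMap.ker r ≤ LinearMap.ker q := fun w hw => hr w hw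
    calc _ = _ := e.symm
      _ ≤ Module.length k (W' ⧸ LinearMap.ker r) :=
        Module.length_le_of_surjective (Submodule.factor hle) (Submodule.factor_surjective hle)
      _ = _ := e2
      _ ≤ _ := Module.length_le_of_injective _ (Submodule.subtype_injective _)
  have h2 : Module.length k (C ⧸ LinearMap.range q) ≤ Module.length k B := by
    let φ := (LinearMap.range q).mkQ ∘ₗ f
    have hφ : Function.Surjective φ := (Submodule.mkQ_surjective _).comp hf
    have e := (φ.quotKerEquivOfSurjective hφ).length_eq
    have e2 := g.quotKerEquivRange.length_eq
    have hle : LinearMap.ker g ≤ LinearMap.ker φ := fun w hw => by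
      obtain ⟨w', hw'⟩ := h w hw
      simp [φ, LinearMap.mem_ker, ← hw']
    calc _ = _ := e.symm
      _ ≤ Module.length k (W ⧸ LinearMap.ker g) :=
        Module.length_le_of_surjective (Submodule.factor hle) (Submodule.factor_surjective hle)
      _ = _ := e2
      _ ≤ _ := Module.length_le_of_injective _ (Submodule.subtype_injective _)
  calc _ = _ := Module.length_eq_add_of_exact (LinearMap.range q).subtype (LinearMap.range q).mkQ
        (Submodule.subtype_injective _) (Submodule.mkQ_surjective _)
        (LinearMap.exact_subtype_mkQ _)
    _ ≤ _ := add_le_add h1 h2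

/-- Subadditivity of relative length along linear relations. -/
theorem relLen_le_add {V₁ V₂ V₃ : Type} [AddCommGroup V₁] [AddCommGroup V₂] [AddCommGroup V₃]
    [Module k V₁] [Module k V₂] [Module k V₃]
    (Z₁ B₁ : Submodule k V₁) (Z₂ B₂ : Submodule k V₂) (Z₃ B₃ : Submodule k V₃)
    (σ : Submodule k (V₂ × V₃)) (τ : Submodule k (V₁ × V₂))
    (ha : ∀ z ∈ Z₂, ∃ w ∈ Z₃, ∃ z' ∈ Z₂, (z', w) ∈ σ ∧ z - z' ∈ B₂)
    (hb : ∀ z w, (z, w) ∈ σ → z ∈ Z₂ → w ∈ Z₃ → w ∈ B₃ →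
      ∃ v₁ v₂, (v₁, v₂) ∈ τ ∧ v₁ ∈ Z₁ ∧ v₂ ∈ Z₂ ∧ v₂ - z ∈ B₂)
    (hc : ∀ v₁ v₂, (v₁, v₂) ∈ τ → v₁ ∈ Z₁ → v₁ ∈ B₁ → v₂ ∈ Z₂ → v₂ ∈ B₂) :
    relLen k Z₂ B₂ ≤ relLen k Z₁ B₁ + relLen k Z₃ B₃ := by
  let W : Submodule k (V₂ × V₃) := σ ⊓ Submodule.prod Z₂ Z₃
  let W' : Submodule k (V₁ × V₂) := τ ⊓ Submodule.prod Z₁ Z₂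
  let f₀ : W →ₗ[k] Z₂ := (LinearMap.fst k V₂ V₃ ∘ₗ W.subtype).codRestrict Z₂ (fun w => w.2.2.1)
  let g₀ : W →ₗ[k] Z₃ := (LinearMap.snd k V₂ V₃ ∘ₗ W.subtype).codRestrict Z₃ (fun w => w.2.2.2)
  let q₀ : W' →ₗ[k] Z₂ := (LinearMap.snd k V₁ V₂ ∘ₗ W'.subtype).codRestrict Z₂ (fun w => w.2.2.2)
  let r₀ : W' →ₗ[k] Z₁ := (LinearMap.fst k V₁ V₂ ∘ₗ W'.subtype).codRestrict Z₁ (fun w => w.2.2.1)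
  refine length_le_of_maps (Submodule.mkQ _ ∘ₗ f₀) (Submodule.mkQ _ ∘ₗ g₀) (Submodule.mkQ _ ∘ₗ q₀)
    (Submodule.mkQ _ ∘ₗ r₀) ?_ ?_ ?_
  · intro c
    obtain ⟨z, rfl⟩ := Submodule.mkQ_surjective _ c
    obtain ⟨w, hw, z', hz', hσ, hd⟩ := ha z z.2
    refine ⟨⟨(z', w), hσ, hz', hw⟩, ?_⟩
    exact ((Submodule.Quotient.eq (B₂.comap Z₂.subtype)).2 hd).symm
  · rintro ⟨⟨v₁, v₂⟩, hτ, h1, h2⟩ hr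
    have : v₁ ∈ B₁ := (Submodule.Quotient.mk_eq_zero (B₁.comap Z₁.subtype)).1 hr
    exact (Submodule.Quotient.mk_eq_zero _).2 (hc v₁ v₂ hτ h1 this h2)
  · rintro ⟨⟨z, w⟩, hσ, h1, h2⟩ hg
    have : w ∈ B₃ := (Submodule.Quotient.mk_eq_zero (B₃.comap Z₃.subtype)).1 hg
    obtain ⟨v₁, v₂, hτ, a1, a2, a3⟩ := hb z w hσ h1 h2 this
    exact ⟨⟨(v₁, v₂), hτ, a1, a2⟩, (Submodule.Quotient.eq _).2 a3⟩

theorem relLen_eq_zero {V : Type} [AddCommGroup V] [Module k V] {Z B : Submodule k V}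
    (h : Z ≤ B) : relLen k Z B = 0 := by
  rw [relLen, Module.length_eq_zero_iff, Submodule.Quotient.subsingleton_iff, eq_top_iff]
  exact fun z _ => h z.2

/-- Monotonicity of relative length along a linear relation. -/
theorem relLen_le {V₂ V₃ : Type} [AddCommGroup V₂] [AddCommGroup V₃] [Module k V₂] [Module k V₃]
    (Z₂ B₂ : Submodule k V₂) (Z₃ B₃ : Submodule k V₃) (σ : Submodule k (V₂ × V₃))
    (ha : ∀ z ∈ Z₂, ∃ w ∈ Z₃, ∃ z' ∈ Z₂, (z', w) ∈ σ ∧ z - z' ∈ B₂)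
    (hb : ∀ z w, (z, w) ∈ σ → z ∈ Z₂ → w ∈ Z₃ → w ∈ B₃ → z ∈ B₂) :
    relLen k Z₂ B₂ ≤ relLen k Z₃ B₃ := by
  have := relLen_le_add (⊥ : Submodule k k) ⊥ Z₂ B₂ Z₃ B₃ σ ⊥ ha
    (fun z w h h1 h2 h3 => ⟨0, 0, by simp, by simp, by simp, by simpa using hb z w h h1 h2 h3⟩)
    (fun v₁ v₂ h _ _ _ => by
      have : v₁ = 0 ∧ v₂ = 0 := by simpa using h
      simp [this.2])
  rwa [relLen_eq_zero (le_refl _), zero_add] at this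

end

/-- A differential `k`-module with commuting operators and a family of homogeneous parts. -/
structure DMod (k : Type) [Field k] where
  V : Type
  [grp : AddCommGroup V]
  [mod : Module k V]
  d : V →ₗ[k] V
  u : ℕ → V →ₗ[k] V
  gr : ℤ → Submodule k V
  dd : ∀ v, d (d v) = 0
  du : ∀ i v, d (u i v) = u i (d v)
  uu : ∀ i j v, u i (u j v) = u j (u i v)
  dgr : ∀ s v, v ∈ gr s → d v ∈ gr (s - 1)
  ugr : ∀ i s v, v ∈ gr s → u i v ∈ gr s

attribute [instance] DMod.grp DMod.mod

namespace DMod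
variable {k : Type} [Field k]

/-- Cycles of degree `s`. -/
def Z (X : DMod k) (s : ℤ) : Submodule k X.V := LinearMap.ker X.d ⊓ X.gr s

/-- Boundaries of elements of degree `s + 1`. -/
def B (X : DMod k) (s : ℤ) : Submodule k X.V := (X.gr (s + 1)).map X.d

theorem mem_Z {X : DMod k} {s : ℤ} {v : X.V} : v ∈ X.Z s ↔ X.d v = 0 ∧ v ∈ X.gr s := by
  simp [Z]

theorem mem_B {X : DMod k} {s : ℤ} {v : X.V} : v ∈ X.B s ↔ ∃ w ∈ X.gr (s + 1), X.d w = v := by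
  simp [B]

/-- Length of the homology in degree `s`. -/
noncomputable def h (X : DMod k) (s : ℤ) : ℕ∞ := relLen k (X.Z s) (X.B s)

/-- Forget the first operator. -/
abbrev tail (X : DMod k) : DMod k :=
  { X with u := fun i => X.u (i + 1), du := fun _ => X.du _, uu := fun _ _ => X.uu _ _,
           ugr := fun _ => X.ugr _ }

/-- Suspension. -/
abbrev susp (X : DMod k) : DMod k where
  V := X.V
  d := -X.d
  u := X.u
  gr := fun s => X.gr (s - 1)
  dd := fun v => by simp [X.dd]
  du := fun i v => by simp [X.du]
  uu := X.uu
  dgr := fun s v hv => by simpa using X.dgr _ v hv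
  ugr := fun i s v hv => X.ugr i _ v hv

/-- Mapping cone of a degree-preserving endomorphism. -/
abbrev coneF (X : DMod k) (f : X.V →ₗ[k] X.V) (hd : ∀ v, X.d (f v) = f (X.d v))
    (hu : ∀ i v, X.u i (f v) = f (X.u i v)) (hgr : ∀ s v, v ∈ X.gr s → f v ∈ X.gr s) :
    DMod k where
  V := X.V × X.V
  d := LinearMap.prod (X.d.coprod f) (-X.d ∘ₗ LinearMap.snd k _ _)
  u := fun i => (X.u i).prodMap (X.u i)
  gr := fun s => (X.gr s).prod (X.gr (s - 1))
  dd := fun v => by simp [X.dd, hd]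
  du := fun i v => by simp [X.du, hu]
  uu := fun i j v => by simp [X.uu i j]
  dgr := fun s v hv => by
    have h1 := Submodule.mem_prod.1 hv
    refine Submodule.mem_prod.2 ⟨?_, ?_⟩
    · simpa using add_mem (X.dgr _ _ h1.1) (hgr _ _ h1.2)
    · simpa using X.dgr _ _ h1.2
  ugr := fun i s v hv => by
    have h1 := Submodule.mem_prod.1 hv
    exact Submodule.mem_prod.2 ⟨X.ugr _ _ _ h1.1, X.ugr _ _ _ h1.2⟩

/-- The cone of the first operator, with the remaining operators. -/
abbrev cone (X : DMod k) : DMod k :=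
  X.tail.coneF (X.u 0) (X.du 0) (fun i v => X.uu (i + 1) 0 v) (X.ugr 0)

/-- The cone of the identity. -/
abbrev coneId (X : DMod k) : DMod k :=
  X.coneF LinearMap.id (fun _ => rfl) (fun _ _ => rfl) (fun _ _ h => h)

/-- Homology lengths of the Koszul complex on the first `m` operators. -/
noncomputable def hK : ℕ → DMod k → ℤ → ℕ∞
  | 0, X, s => X.h s
  | m + 1, X, s => hK m X.cone s

/-- Short exact sequences. -/
structure SES (X Y W : DMod k) where
  i : X.V →ₗ[k] Y.V
  p : Y.V →ₗ[k] W.V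
  inj : Function.Injective i
  surj : Function.Surjective p
  exact : ∀ y, p y = 0 → ∃ x, i x = y
  pi : ∀ x, p (i x) = 0
  id : ∀ x, i (X.d x) = Y.d (i x)
  pd : ∀ y, p (Y.d y) = W.d (p y)
  iu : ∀ n x, i (X.u n x) = Y.u n (i x)
  pu : ∀ n y, p (Y.u n y) = W.u n (p y)
  igr : ∀ s x, i x ∈ Y.gr s ↔ x ∈ X.gr s
  pgr : ∀ s y, y ∈ Y.gr s → p y ∈ W.gr s
  lift : ∀ s w, w ∈ W.gr s → ∃ y ∈ Y.gr s, p y = w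

theorem cone_d (X : DMod k) (a b : X.V) :
    X.cone.d (a, b) = ((X.d a + X.u 0 b, -X.d b) : X.V × X.V) := rfl

def SES.cone {X Y W : DMod k} (S : SES X Y W) : SES X.cone Y.cone W.cone where
  i := S.i.prodMap S.i
  p := S.p.prodMap S.p
  inj := S.inj.prodMap S.inj
  surj := S.surj.prodMap S.surj
  exact := fun y hy => by
    obtain ⟨a, ha⟩ := S.exact y.1 (congrArg Prod.fst hy)
    obtain ⟨b, hb⟩ := S.exact y.2 (congrArg Prod.snd hy)
    exact ⟨(a, b), Prod.ext ha hb⟩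
  pi := fun x => Prod.ext (S.pi _) (S.pi _)
  id := fun ⟨a, b⟩ => by
    refine Prod.ext ?_ ?_
    · exact (map_add S.i _ _).trans (congrArg₂ _ (S.id _) (S.iu _ _))
    · exact (map_neg S.i _).trans (congrArg _ (S.id _))
  pd := fun ⟨a, b⟩ => by
    refine Prod.ext ?_ ?_
    · exact (map_add S.p _ _).trans (congrArg₂ _ (S.pd _) (S.pu _ _))
    · exact (map_neg S.p _).trans (congrArg _ (S.pd _))
  iu := fun n x => Prod.ext (S.iu _ _) (S.iu _ _)
  pu := fun n x => Prod.ext (S.pu _ _) (S.pu _ _)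
  igr := fun s x => and_congr (S.igr _ _) (S.igr _ _)
  pgr := fun s y hy => ⟨S.pgr _ _ hy.1, S.pgr _ _ hy.2⟩
  lift := fun s w hw => by
    obtain ⟨a, ha, ha'⟩ := S.lift _ _ hw.1
    obtain ⟨b, hb, hb'⟩ := S.lift _ _ hw.2
    exact ⟨(a, b), ⟨ha, hb⟩, Prod.ext ha' hb'⟩

theorem SES.h_mid {X Y W : DMod k} (S : SES X Y W) (s : ℤ) : Y.h s ≤ X.h s + W.h s := by
  refine relLen_le_add _ _ _ _ _ _ S.p.graph S.i.graph ?_ ?_ ?_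
  · intro y hy
    rw [mem_Z] at hy
    refine ⟨S.p y, mem_Z.2 ⟨by rw [← S.pd, hy.1, map_zero], S.pgr _ _ hy.2⟩, y, mem_Z.2 hy, ?_, ?_⟩
    · simp
    · simp
  · intro y w h hy hw hw'
    obtain rfl : w = S.p y := by simpa using h
    obtain ⟨w₁, hw₁, e⟩ := mem_B.1 hw'
    obtain ⟨y₁, hy₁, rfl⟩ := S.lift _ _ hw₁
    rw [mem_Z] at hy
    obtain ⟨x, hx⟩ := S.exact (y - Y.d y₁) (by rw [map_sub, S.pd, e, sub_self])
    have h1 : Y.d y₁ ∈ Y.gr s := by simpa using Y.dgr _ _ hy₁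
    have h2 : S.i x ∈ Y.gr s := by rw [hx]; exact sub_mem hy.2 h1
    have h3 : Y.d (S.i x) = 0 := by rw [hx]; simp [Y.dd, hy.1]
    refine ⟨x, S.i x, by simp, mem_Z.2 ⟨S.inj ?_, (S.igr _ _).1 h2⟩, mem_Z.2 ⟨h3, h2⟩, ?_⟩
    · rw [S.id, h3, map_zero]
    · rw [hx]
      exact mem_B.2 ⟨-y₁, neg_mem hy₁, by simp⟩
  · intro x y h hx hx' _
    obtain rfl : y = S.i x := by simpa using h
    obtain ⟨x₁, h1, rfl⟩ := mem_B.1 hx'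
    exact mem_B.2 ⟨S.i x₁, (S.igr _ _).2 h1, (S.id _).symm⟩

theorem SES.h_right {X Y W : DMod k} (S : SES X Y W) (s : ℤ) : W.h s ≤ Y.h s + X.h (s - 1) := by
  let σ : Submodule k (W.V × X.V) :=
    { carrier := {q | ∃ y ∈ Y.gr s, S.p y = q.1 ∧ Y.d y = S.i q.2}
      add_mem' := by
        rintro a b ⟨y, h0, h1, h2⟩ ⟨y', h0', h1', h2'⟩
        exact ⟨y + y', add_mem h0 h0', by simp [h1, h1'], by simp [h2, h2']⟩
      zero_mem' := ⟨0, zero_mem _, by simp, by simp⟩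
      smul_mem' := by
        rintro c a ⟨y, h0, h1, h2⟩
        exact ⟨c • y, Submodule.smul_mem _ _ h0, by simp [h1], by simp [h2]⟩ }
  refine relLen_le_add _ _ _ _ _ _ σ S.p.graph ?_ ?_ ?_
  · intro w hw
    rw [mem_Z] at hw
    obtain ⟨y, hy, rfl⟩ := S.lift _ _ hw.2
    obtain ⟨x, hx⟩ := S.exact (Y.d y) (by rw [S.pd, hw.1])
    refine ⟨x, mem_Z.2 ⟨S.inj ?_, (S.igr _ _).1 ?_⟩, S.p y, mem_Z.2 hw, ⟨y, hy, rfl, hx.symm⟩, by simp⟩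
    · rw [S.id, hx, Y.dd, map_zero]
    · rw [hx]; exact Y.dgr _ _ hy
  · rintro w x ⟨y, hy, rfl, h2⟩ hw hx hx'
    obtain ⟨x₁, h1, rfl⟩ := mem_B.1 hx'
    rw [sub_add_cancel] at h1
    refine ⟨y - S.i x₁, S.p (y - S.i x₁), by simp, mem_Z.2 ⟨?_, ?_⟩, ?_, ?_⟩
    · dsimp only at h2
      rw [map_sub, h2, S.id, sub_self]
    · exact sub_mem hy ((S.igr _ _).2 h1)
    · rw [map_sub, S.pi, sub_zero]; exact hw
    · simp [S.pi]
  · intro y w h hy hy' _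
    obtain rfl : w = S.p y := by simpa using h
    obtain ⟨y₁, h1, rfl⟩ := mem_B.1 hy'
    exact mem_B.2 ⟨S.p y₁, S.pgr _ _ h1, (S.pd _).symm⟩

theorem SES.hK_mid {X Y W : DMod k} (S : SES X Y W) (m : ℕ) (s : ℤ) :
    hK m Y s ≤ hK m X s + hK m W s := by
  induction m generalizing X Y W with
  | zero => exact S.h_mid s
  | succ m ih => exact ih S.cone

theorem SES.hK_right {X Y W : DMod k} (S : SES X Y W) (m : ℕ) (s : ℤ) :
    hK m W s ≤ hK m Y s + hK m X (s - 1) := by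
  induction m generalizing X Y W with
  | zero => exact S.h_right s
  | succ m ih => exact ih S.cone

end DMod

namespace DMod
variable {k : Type} [Field k]

/-- `f` acts as zero on the homology of the Koszul complex on the first `m` operators. -/
def ZH : (m : ℕ) → (X : DMod k) → (X.V →ₗ[k] X.V) → Prop
  | 0, X, f => ∀ s, ∀ v ∈ X.Z s, f v ∈ X.B s
  | m + 1, X, f => ZH m X.cone (f.prodMap f)

/-- `f` is nullhomotopic by a homotopy commuting with the operators. -/
def NH (X : DMod k) (f : X.V →ₗ[k] X.V) : Prop :=
  ∃ σ : X.V →ₗ[k] X.V, (∀ s v, v ∈ X.gr s → σ v ∈ X.gr (s + 1)) ∧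
    (∀ v, X.d (σ v) + σ (X.d v) = f v) ∧ ∀ i v, σ (X.u i v) = X.u i (σ v)

theorem NH.cone {X : DMod k} {f : X.V →ₗ[k] X.V} (h : X.NH f) : X.cone.NH (f.prodMap f) := by
  obtain ⟨σ, h1, h2, h3⟩ := h
  refine ⟨σ.prodMap (-σ), ?_, ?_, ?_⟩
  · rintro s ⟨a, b⟩ ⟨ha, hb⟩
    refine ⟨h1 _ _ ha, neg_mem ?_⟩
    have := h1 _ _ hb
    rwa [sub_add_cancel, ← add_sub_cancel_right s 1] at this
  · rintro ⟨a, b⟩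
    refine Prod.ext ?_ ?_
    · change (X.d (σ a) + X.u 0 (-σ b)) + σ (X.d a + X.u 0 b) = f a
      rw [← h2 a, map_neg, map_add, h3]; abel
    · change (-X.d (-σ b)) + -σ (-X.d b) = f b
      rw [← h2 b, map_neg, map_neg]; abel
  · rintro i ⟨a, b⟩
    refine Prod.ext (h3 _ _) ?_
    change -σ (X.u (i + 1) b) = X.u (i + 1) (-σ b)
    rw [h3, map_neg]

theorem NH.zh {X : DMod k} {f : X.V →ₗ[k] X.V} (h : X.NH f) (m : ℕ) : ZH m X f := by
  induction m generalizing X with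
  | zero =>
    obtain ⟨σ, h1, h2, h3⟩ := h
    intro s v hv
    rw [mem_Z] at hv
    exact mem_B.2 ⟨σ v, h1 _ _ hv.2, by rw [← h2 v, hv.1, map_zero, add_zero]⟩
  | succ m ih => exact ih h.cone

theorem ZH.add {X : DMod k} {f g : X.V →ₗ[k] X.V} {m : ℕ} (hf : ZH m X f) (hg : ZH m X g) :
    ZH m X (f + g) := by
  induction m generalizing X with
  | zero => exact fun s v hv => add_mem (hf s v hv) (hg s v hv)
  | succ m ih =>
    have := ih (X := X.cone) hf hg
    exact this

theorem ZH.of_u {X : DMod k} {m i : ℕ} (hi : i < m) {g : X.V →ₗ[k] X.V}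
    (hd : ∀ v, X.d (g v) = g (X.d v)) (hu : ∀ i v, X.u i (g v) = g (X.u i v))
    (hgr : ∀ s v, v ∈ X.gr s → g v ∈ X.gr s) : ZH m X (g ∘ₗ X.u i) := by
  induction m generalizing X i with
  | zero => omega
  | succ m ih =>
    rcases i with _ | i
    · refine NH.zh (X := X.cone) ⟨LinearMap.prod 0 (g ∘ₗ LinearMap.fst k _ _), ?_, ?_, ?_⟩ m
      · rintro s ⟨a, b⟩ ⟨ha, hb⟩
        refine ⟨zero_mem _, ?_⟩
        have := hgr _ _ ha
        rwa [← add_sub_cancel_right s 1] at this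
      · rintro ⟨a, b⟩
        refine Prod.ext ?_ ?_
        · change (X.d 0 + X.u 0 (g a)) + 0 = g (X.u 0 a)
          rw [map_zero, hu]; abel
        · change (-X.d (g a)) + g (X.d a + X.u 0 b) = g (X.u 0 b)
          rw [hd, map_add]; abel
      · rintro i ⟨a, b⟩
        exact Prod.ext (map_zero (X.u (i + 1))).symm (hu _ _).symm
    · refine ih (X := X.cone) (g := g.prodMap g) (by omega) ?_ ?_ ?_
      · rintro ⟨a, b⟩
        refine Prod.ext ?_ ?_
        · change X.d (g a) + X.u 0 (g b) = g (X.d a + X.u 0 b)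
          rw [hd, hu, map_add]
        · change -X.d (g b) = g (-X.d b)
          rw [hd, map_neg]
      · rintro i ⟨a, b⟩
        exact Prod.ext (hu _ _) (hu _ _)
      · rintro s ⟨a, b⟩ ⟨ha, hb⟩
        exact ⟨hgr _ _ ha, hgr _ _ hb⟩

theorem hK_eq_zero {X : DMod k} {m : ℕ} (h : ZH m X LinearMap.id) (s : ℤ) : hK m X s = 0 := by
  induction m generalizing X with
  | zero => exact relLen_eq_zero fun v hv => h s v hv
  | succ m ih => exact ih (by rw [← LinearMap.prodMap_id]; exact h)

theorem SES.hK_le_of_zh {X W : DMod k} (S : SES X X W) {m : ℕ} (h : ZH m X S.i) (s : ℤ) :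
    hK m X s ≤ hK m W s := by
  induction m generalizing X W with
  | zero =>
    refine relLen_le _ _ _ _ S.p.graph ?_ ?_
    · intro y hy
      rw [mem_Z] at hy
      exact ⟨S.p y, mem_Z.2 ⟨by rw [← S.pd, hy.1, map_zero], S.pgr _ _ hy.2⟩, y, mem_Z.2 hy,
        by simp, by simp⟩
    · intro y w e hy hw hw'
      obtain rfl : w = S.p y := by simpa using e
      obtain ⟨w₁, hw₁, e⟩ := mem_B.1 hw'
      obtain ⟨y₁, hy₁, rfl⟩ := S.lift _ _ hw₁
      rw [mem_Z] at hy
      obtain ⟨x, hx⟩ := S.exact (y - X.d y₁) (by rw [map_sub, S.pd, e, sub_self])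
      have h1 : X.d y₁ ∈ X.gr s := by simpa using X.dgr _ _ hy₁
      have h2 : S.i x ∈ X.gr s := by rw [hx]; exact sub_mem hy.2 h1
      have h3 : X.d (S.i x) = 0 := by rw [hx]; simp [X.dd, hy.1]
      have h4 := h s x (mem_Z.2 ⟨S.inj (by rw [S.id, h3, map_zero]), (S.igr _ _).1 h2⟩)
      rw [hx] at h4
      have h5 := add_mem h4 (mem_B.2 ⟨y₁, hy₁, rfl⟩)
      rwa [sub_add_cancel] at h5
  | succ m ih => exact ih S.cone h

theorem hK_coneId (X : DMod k) (m : ℕ) (s : ℤ) : hK m X.coneId s = 0 := by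
  refine hK_eq_zero (NH.zh ⟨LinearMap.prod 0 (LinearMap.fst k X.V X.V), ?_, ?_, ?_⟩ m) s
  · rintro s ⟨a, b⟩ ⟨ha, hb⟩
    refine ⟨zero_mem _, ?_⟩
    rwa [← add_sub_cancel_right s 1] at ha
  · rintro ⟨a, b⟩
    refine Prod.ext ?_ ?_
    · change (X.d 0 + a) + 0 = a
      rw [map_zero]; abel
    · change (-X.d a) + (X.d a + b) = b
      abel
  · rintro i ⟨a, b⟩
    exact Prod.ext (map_zero (X.u i)).symm rfl

/-- The restriction to a stable submodule. -/
abbrev sub (X : DMod k) (W : Submodule k X.V) (hd : ∀ v ∈ W, X.d v ∈ W)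
    (hu : ∀ i, ∀ v ∈ W, X.u i v ∈ W) : DMod k where
  V := W
  d := X.d.restrict hd
  u := fun i => (X.u i).restrict (hu i)
  gr := fun s => (X.gr s).comap W.subtype
  dd := fun v => Subtype.ext (X.dd _)
  du := fun i v => Subtype.ext (X.du _ _)
  uu := fun i j v => Subtype.ext (X.uu _ _ _)
  dgr := fun s v hv => X.dgr s _ hv
  ugr := fun i s v hv => X.ugr i s _ hv

/-- The quotient by a stable submodule. -/
abbrev quo (X : DMod k) (W : Submodule k X.V) (hd : ∀ v ∈ W, X.d v ∈ W)
    (hu : ∀ i, ∀ v ∈ W, X.u i v ∈ W) : DMod k where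
  V := X.V ⧸ W
  d := W.mapQ W X.d hd
  u := fun i => W.mapQ W (X.u i) (hu i)
  gr := fun s => (X.gr s).map W.mkQ
  dd := fun v => by
    obtain ⟨v, rfl⟩ := W.mkQ_surjective v
    simp [X.dd]
  du := fun i v => by
    obtain ⟨v, rfl⟩ := W.mkQ_surjective v
    simp [X.du]
  uu := fun i j v => by
    obtain ⟨v, rfl⟩ := W.mkQ_surjective v
    simp [X.uu i j]
  dgr := by
    rintro s _ ⟨v, hv, rfl⟩
    exact ⟨X.d v, X.dgr _ _ hv, rfl⟩
  ugr := by
    rintro i s _ ⟨v, hv, rfl⟩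
    exact ⟨X.u i v, X.ugr _ _ _ hv, rfl⟩

def sesSubQuo (X : DMod k) (W : Submodule k X.V) (hd : ∀ v ∈ W, X.d v ∈ W)
    (hu : ∀ i, ∀ v ∈ W, X.u i v ∈ W) : SES (X.sub W hd hu) X (X.quo W hd hu) where
  i := W.subtype
  p := W.mkQ
  inj := W.subtype_injective
  surj := W.mkQ_surjective
  exact := fun y hy => ⟨⟨y, (Submodule.Quotient.mk_eq_zero _).1 hy⟩, rfl⟩
  pi := fun x => (Submodule.Quotient.mk_eq_zero _).2 x.2
  id := fun _ => rfl
  pd := fun _ => rfl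
  iu := fun _ _ => rfl
  pu := fun _ _ => rfl
  igr := fun _ _ => Iff.rfl
  pgr := fun _ y hy => ⟨y, hy, rfl⟩
  lift := fun _ _ hw => hw

def sesCone (X : DMod k) : SES X.tail X.cone X.tail.susp where
  i := LinearMap.inl k X.V X.V
  p := LinearMap.snd k X.V X.V
  inj := LinearMap.inl_injective
  surj := Prod.snd_surjective
  exact := fun ⟨a, b⟩ hb => ⟨a, Prod.ext rfl (Eq.symm hb)⟩
  pi := fun _ => rfl
  id := fun a => Prod.ext (by
    change X.d a = X.d a + X.u 0 0
    rw [map_zero, add_zero]) (by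
    change 0 = -X.d 0
    rw [map_zero, neg_zero])
  pd := fun _ => rfl
  iu := fun n a => Prod.ext rfl (map_zero (X.u (n + 1))).symm
  pu := fun _ _ => rfl
  igr := fun s a => ⟨fun h => h.1, fun h => ⟨h, zero_mem _⟩⟩
  pgr := fun s _ h => h.2
  lift := fun s b hb => ⟨(0, b), ⟨zero_mem _, hb⟩, rfl⟩

theorem h_susp_le (X : DMod k) (s : ℤ) : X.susp.h s ≤ X.h (s - 1) := by
  refine relLen_le _ _ _ _ (LinearMap.id : X.V →ₗ[k] X.V).graph ?_ ?_
  · intro z hz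
    rw [mem_Z] at hz
    exact ⟨z, mem_Z.2 ⟨neg_eq_zero.1 hz.1, hz.2⟩, z, mem_Z.2 hz, by simp, by simp⟩
  · intro z w e _ _ hw
    obtain rfl : w = z := by simpa using e
    obtain ⟨y, hy, rfl⟩ := mem_B.1 hw
    refine mem_B.2 ⟨-y, neg_mem ?_, ?_⟩
    · rwa [sub_add_cancel, ← add_sub_cancel_right s 1] at hy
    · change -X.d (-y) = X.d y
      rw [map_neg, neg_neg]

theorem hK_le_of_h_le {X : DMod k} {c : ℕ∞} (h : ∀ t, X.h t ≤ c) (m : ℕ) (s : ℤ) :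
    hK m X s ≤ 2 ^ m * c := by
  induction m generalizing X c with
  | zero => simpa [hK] using h s
  | succ m ih =>
    have := ih (X := X.cone) (c := 2 * c) (fun t => by
      refine (X.sesCone.h_mid t).trans ?_
      rw [two_mul]
      exact add_le_add (h t) ((h_susp_le _ _).trans (h _)))
    rwa [← mul_assoc, ← pow_succ] at this

/-- If the first operator vanishes on homology, homology embeds into that of the cone. -/
theorem h_le_h_cone {X : DMod k} (s : ℤ) (h : ∀ v ∈ X.Z s, X.u 0 v ∈ X.B s) :
    X.h s ≤ X.cone.h (s + 1) := by
  let σ : Submodule k (X.V × X.cone.V) :=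
    LinearMap.ker (LinearMap.fst k X.V (X.V × X.V) -
      LinearMap.snd k X.V X.V ∘ₗ LinearMap.snd k X.V (X.V × X.V))
  have hσ : ∀ b (w : X.V × X.V), (b, w) ∈ σ ↔ b = w.2 := fun b w => by
    simp [σ, sub_eq_zero]
  refine relLen_le _ _ _ _ σ ?_ ?_
  · intro b hb
    obtain ⟨a, ha, e⟩ := mem_B.1 (h b hb)
    rw [mem_Z] at hb
    refine ⟨((-a, b) : X.V × X.V), mem_Z.2 ⟨Prod.ext ?_ ?_, neg_mem ha, ?_⟩, b, mem_Z.2 hb,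
      (hσ _ _).2 rfl, by simp⟩
    · change X.d (-a) + X.u 0 b = 0
      rw [map_neg, e]; abel
    · change -X.d b = 0
      rw [hb.1, neg_zero]
    · change b ∈ X.gr (s + 1 - 1)
      rw [add_sub_cancel_right]; exact hb.2
  · rintro b ⟨a, b'⟩ e _ _ hw
    obtain rfl : b = b' := (hσ _ _).1 e
    obtain ⟨⟨a₁, b₁⟩, ⟨_, h1⟩, h2⟩ := mem_B.1 hw
    refine mem_B.2 ⟨-b₁, neg_mem ?_, ?_⟩
    · change b₁ ∈ X.gr (s + 1 + 1 - 1) at h1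
      rwa [add_sub_cancel_right] at h1
    · rw [map_neg]; exact congrArg Prod.snd h2

theorem h_le_hK {X : DMod k} {m : ℕ} (h : ∀ i < m, X.NH (X.u i)) (s : ℤ) :
    X.h s ≤ hK m X (s + m) := by
  induction m generalizing X s with
  | zero => simp [hK]
  | succ m ih =>
    refine (h_le_h_cone s ((h 0 (by omega)).zh 0 s)).trans ?_
    refine (ih (X := X.cone) (fun i hi => (h (i + 1) (by omega)).cone) (s + 1)).trans_eq ?_
    rw [hK]; congr 1; push_cast; ring

end DMod

section
open TensorProduct
namespace DMod
variable {k : Type} [Field k]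

/-- The tensor product over `k`; `ε` is the sign twist, and the operators are the differences. -/
abbrev tens (X Y : DMod k) (ε : X.V →ₗ[k] X.V) (hd : ∀ v, X.d (ε v) = -ε (X.d v))
    (hu : ∀ i v, X.u i (ε v) = ε (X.u i v)) : DMod k where
  V := X.V ⊗[k] Y.V
  d := map X.d LinearMap.id + map ε Y.d
  u := fun i => map LinearMap.id (Y.u i) - map (X.u i) LinearMap.id
  gr := fun _ => ⊤
  dd := fun v => by
    induction v using TensorProduct.induction_on with
    | zero => simp
    | tmul a b => simp [X.dd, Y.dd, hd, neg_tmul]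
    | add a b ha hb => rw [map_add, map_add, ha, hb, add_zero]
  du := fun i v => by
    induction v using TensorProduct.induction_on with
    | zero => simp
    | tmul a b => simp [X.du, Y.du, hu]; abel
    | add a b ha hb => simp only [map_add, ha, hb]
  uu := fun i j v => by
    induction v using TensorProduct.induction_on with
    | zero => simp
    | tmul a b => simp [X.uu i j, Y.uu i j]; abel
    | add a b ha hb => simp only [map_add, ha, hb]
  dgr := fun _ _ _ => trivial
  ugr := fun _ _ _ _ => trivial

/-- The tensor product with a module without differential. -/
abbrev tens₀ (X Y : DMod k) : DMod k :=
  X.tens Y 0 (fun _ => by simp) (fun _ _ => by simp)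

theorem tens_eq_tens₀ {X Y : DMod k} (h : Y.d = 0) (ε : X.V →ₗ[k] X.V)
    (hd : ∀ v, X.d (ε v) = -ε (X.d v)) (hu : ∀ i v, X.u i (ε v) = ε (X.u i v)) :
    X.tens Y ε hd hu = X.tens₀ Y := by
  have : map ε Y.d = map 0 Y.d := by rw [h]; simp
  simp only [tens₀, tens, this]

def SES.tensRight (X : DMod k) {Y Y' Y'' : DMod k} (S : SES Y Y' Y'') (ε : X.V →ₗ[k] X.V)
    (hd : ∀ v, X.d (ε v) = -ε (X.d v)) (hu : ∀ i v, X.u i (ε v) = ε (X.u i v)) :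
    SES (X.tens Y ε hd hu) (X.tens Y' ε hd hu) (X.tens Y'' ε hd hu) where
  i := S.i.lTensor X.V
  p := S.p.lTensor X.V
  inj := Module.Flat.lTensor_preserves_injective_linearMap _ S.inj
  surj := LinearMap.lTensor_surjective _ S.surj
  exact := fun y hy => (lTensor_exact X.V (f := S.i) (g := S.p)
    (fun y => ⟨S.exact y, by rintro ⟨x, rfl⟩; exact S.pi x⟩) S.surj y).1 hy
  pi := fun x => by
    induction x using TensorProduct.induction_on with
    | zero => simp
    | tmul a b => simp [S.pi]
    | add a b ha hb => simp only [map_add, ha, hb, add_zero]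
  id := fun x => by
    induction x using TensorProduct.induction_on with
    | zero => simp
    | tmul a b => simp [S.id]
    | add a b ha hb => simp only [map_add, ha, hb]
  pd := fun x => by
    induction x using TensorProduct.induction_on with
    | zero => simp
    | tmul a b => simp [S.pd]
    | add a b ha hb => simp only [map_add, ha, hb]
  iu := fun n x => by
    induction x using TensorProduct.induction_on with
    | zero => simp
    | tmul a b => simp [S.iu]
    | add a b ha hb => simp only [map_add, ha, hb]
  pu := fun n x => by
    induction x using TensorProduct.induction_on with
    | zero => simp
    | tmul a b => simp [S.pu]
    | add a b ha hb => simp only [map_add, ha, hb]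
  igr := fun _ _ => Iff.rfl
  pgr := fun _ _ _ => trivial
  lift := fun _ w _ => by
    obtain ⟨y, hy⟩ := LinearMap.lTensor_surjective X.V S.surj w
    exact ⟨y, trivial, hy⟩

def SES.tensLeft {X X' X'' : DMod k} (S : SES X X' X'') (Y : DMod k) :
    SES (X.tens₀ Y) (X'.tens₀ Y) (X''.tens₀ Y) where
  i := S.i.rTensor Y.V
  p := S.p.rTensor Y.V
  inj := Module.Flat.rTensor_preserves_injective_linearMap _ S.inj
  surj := LinearMap.rTensor_surjective _ S.surj
  exact := fun y hy => (rTensor_exact Y.V (f := S.i) (g := S.p)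
    (fun y => ⟨S.exact y, by rintro ⟨x, rfl⟩; exact S.pi x⟩) S.surj y).1 hy
  pi := fun x => by
    induction x using TensorProduct.induction_on with
    | zero => simp
    | tmul a b => simp [S.pi]
    | add a b ha hb => simp only [map_add, ha, hb, add_zero]
  id := fun x => by
    induction x using TensorProduct.induction_on with
    | zero => simp
    | tmul a b => simp [S.id]
    | add a b ha hb => simp only [map_add, ha, hb]
  pd := fun x => by
    induction x using TensorProduct.induction_on with
    | zero => simp
    | tmul a b => simp [S.pd]
    | add a b ha hb => simp only [map_add, ha, hb]
  iu := fun n x => by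
    induction x using TensorProduct.induction_on with
    | zero => simp
    | tmul a b => simp [S.iu]
    | add a b ha hb => simp only [map_add, ha, hb]
  pu := fun n x => by
    induction x using TensorProduct.induction_on with
    | zero => simp
    | tmul a b => simp [S.pu]
    | add a b ha hb => simp only [map_add, ha, hb]
  igr := fun _ _ => Iff.rfl
  pgr := fun _ _ _ => trivial
  lift := fun _ w _ => by
    obtain ⟨y, hy⟩ := LinearMap.rTensor_surjective Y.V S.surj w
    exact ⟨y, trivial, hy⟩

theorem NH.tens₀ {X : DMod k} {f : X.V →ₗ[k] X.V} (h : X.NH f) (Y : DMod k) :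
    (X.tens₀ Y).NH (map f LinearMap.id) := by
  obtain ⟨σ, -, h2, h3⟩ := h
  refine ⟨map σ LinearMap.id, fun _ _ _ => trivial, fun v => ?_, fun i v => ?_⟩
  · induction v using TensorProduct.induction_on with
    | zero => simp
    | tmul a b => simp [← h2, add_tmul]
    | add a b ha hb =>
      have := congrArg₂ (· + ·) ha hb
      simp only [map_add] at this ⊢
      rw [← this]; abel
  · induction v using TensorProduct.induction_on with
    | zero => simp
    | tmul a b => simp [h3]
    | add a b ha hb => simp only [map_add, ha, hb]

theorem _root_.exists_pow_sub_pow {E : Type} [Ring E] [Algebra k E] {a b : E} (hab : Commute b a)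
    (n : ℕ) : ∃ g ∈ Algebra.adjoin k {a, b}, b ^ n - a ^ n = g * (b - a) := by
  refine ⟨∑ i ∈ Finset.range n, b ^ i * a ^ (n - 1 - i), ?_, ?_⟩
  · refine sum_mem fun i _ => mul_mem (pow_mem (Algebra.subset_adjoin ?_) _)
      (pow_mem (Algebra.subset_adjoin ?_) _) <;> simp
  · rw [hab.geom_sum₂_mul n]

/-- If `u i ^ n` is nullhomotopic on the left factor, then it vanishes on the homology of the
Koszul complex of the tensor product when acting on the right factor. -/
theorem zh_map_pow {X Y : DMod k} {m i n : ℕ} (hi : i < m) (h : X.NH (X.u i ^ n)) :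
    ZH m (X.tens₀ Y) (map LinearMap.id (Y.u i ^ n)) := by
  let a : Module.End k (X.V ⊗[k] Y.V) := map (X.u i) LinearMap.id
  let b : Module.End k (X.V ⊗[k] Y.V) := map LinearMap.id (Y.u i)
  have hab : Commute b a := by
    ext x y
    simp [a, b]
  obtain ⟨g, hg, e⟩ := exists_pow_sub_pow (k := k) hab n
  have hcomm : ∀ f : Module.End k (X.V ⊗[k] Y.V), Commute f a → Commute f b → Commute f g := by
    intro f ha hb
    refine Algebra.adjoin_induction (p := fun x _ => Commute f x) ?_ ?_ ?_ ?_ hg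
    · rintro x (rfl | rfl)
      exacts [ha, hb]
    · exact fun r => (Algebra.commutes r f).symm
    · exact fun x y _ _ hx hy => hx.add_right hy
    · exact fun x y _ _ hx hy => hx.mul_right hy
  have key : (map LinearMap.id (Y.u i ^ n) : X.V ⊗[k] Y.V →ₗ[k] X.V ⊗[k] Y.V) =
      map (X.u i ^ n) LinearMap.id + g ∘ₗ (X.tens₀ Y).u i := by
    have h1 : b ^ n = map LinearMap.id (Y.u i ^ n) := by
      rw [TensorProduct.map_pow]; congr 1; exact one_pow n
    have h2 : a ^ n = map (X.u i ^ n) LinearMap.id := by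
      rw [TensorProduct.map_pow]; congr 1; exact one_pow n
    rw [← h1, ← h2]
    exact (eq_add_of_sub_eq' e)
  rw [key]
  refine (NH.zh (h.tens₀ Y) m).add (ZH.of_u hi ?_ ?_ (fun _ _ _ => trivial))
  · refine fun v => LinearMap.congr_fun (hcomm (X.tens₀ Y).d ?_ ?_).eq v
    · ext x y; simp [a, X.du]
    · ext x y; simp [b]
  · refine fun j v => LinearMap.congr_fun (hcomm ((X.tens₀ Y).u j) ?_ ?_).eq v
    · ext x y; simp [a, X.uu i j]
    · ext x y; simp [b, Y.uu i j]

end DMod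
end

section
open TensorProduct
namespace DMod
variable {k : Type} [Field k]

/-- Forget the homogeneous parts. -/
abbrev flat (X : DMod k) : DMod k :=
  { X with gr := fun _ => ⊤, dgr := fun _ _ _ => trivial, ugr := fun _ _ _ _ => trivial }

/-- The zero object. -/
def pt (k : Type) [Field k] : DMod k :=
  ⟨PUnit, 0, 0, fun _ => ⊤, fun _ => rfl, fun _ _ => rfl, fun _ _ _ => rfl,
      fun _ _ _ => trivial, fun _ _ _ _ => trivial⟩

def sesOfEquiv {X Y : DMod k} (e : X.V ≃ₗ[k] Y.V) (hd : ∀ x, e (X.d x) = Y.d (e x))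
    (hu : ∀ n x, e (X.u n x) = Y.u n (e x)) (hgr : ∀ s x, e x ∈ Y.gr s ↔ x ∈ X.gr s) :
    SES X Y (pt k) where
  i := e
  p := 0
  inj := e.injective
  surj := fun x => ⟨0, rfl⟩
  exact := fun y _ => ⟨e.symm y, e.apply_symm_apply y⟩
  pi := fun _ => rfl
  id := hd
  pd := fun _ => rfl
  iu := hu
  pu := fun _ _ => rfl
  igr := hgr
  pgr := fun _ _ _ => trivial
  lift := fun _ _ _ => ⟨0, zero_mem _, rfl⟩

theorem hK_eq_zero_of_subsingleton {X : DMod k} [Subsingleton X.V] (m : ℕ) (s : ℤ) :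
    hK m X s = 0 :=
  hK_eq_zero (NH.zh ⟨0, fun _ _ _ => zero_mem _, fun _ => Subsingleton.elim _ _,
    fun _ _ => Subsingleton.elim _ _⟩ m) s

theorem hK_le_of_equiv {X Y : DMod k} (e : X.V ≃ₗ[k] Y.V) (hd : ∀ x, e (X.d x) = Y.d (e x))
    (hu : ∀ n x, e (X.u n x) = Y.u n (e x)) (hgr : ∀ s x, e x ∈ Y.gr s ↔ x ∈ X.gr s)
    (m : ℕ) (s : ℤ) : hK m Y s ≤ hK m X s := by
  have h := (sesOfEquiv e hd hu hgr).hK_mid m s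
  have : Subsingleton (pt k).V := inferInstanceAs (Subsingleton PUnit)
  rwa [hK_eq_zero_of_subsingleton (X := pt k), add_zero] at h

/-- Total Koszul homology length of a tensor product. -/
noncomputable def phi (m : ℕ) (X Y : DMod k) : ℕ∞ := hK m (X.tens₀ Y) 0

theorem SES.phi_mid {X X' X'' : DMod k} (S : SES X X' X'') (m : ℕ) (Y : DMod k) :
    phi m X' Y ≤ phi m X Y + phi m X'' Y :=
  (S.tensLeft Y).hK_mid m 0

theorem phi_eq_zero {X : DMod k} (h : X.NH LinearMap.id) (m : ℕ) (Y : DMod k) : phi m X Y = 0 :=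
  hK_eq_zero (by simpa using (h.tens₀ Y).zh m) 0


section chain
variable (X : DMod k) (F : Submodule k X.V)

/-- The largest subcomplex of `F`. -/
def inn : Submodule k X.V := F ⊓ F.comap X.d

/-- The smallest subcomplex containing `F`. -/
def out : Submodule k X.V := F ⊔ F.map X.d

variable {X F}
theorem mem_out {v : X.V} : v ∈ X.out F ↔ ∃ a ∈ F, ∃ b ∈ F, a + X.d b = v := by
  simp [out, Submodule.mem_sup]

theorem inn_le : X.inn F ≤ F := inf_le_left

theorem inn_le_out : X.inn F ≤ X.out F := inf_le_left.trans le_sup_left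

theorem inn_d (v : X.V) (hv : v ∈ X.inn F) : X.d v ∈ X.inn F :=
  ⟨hv.2, by simp [X.dd]⟩

theorem inn_u (hF : ∀ i, ∀ v ∈ F, X.u i v ∈ F) (i : ℕ) (v : X.V) (hv : v ∈ X.inn F) :
    X.u i v ∈ X.inn F :=
  ⟨hF i v hv.1, by rw [SetLike.mem_coe, Submodule.mem_comap, X.du]; exact hF i _ hv.2⟩

theorem out_d (v : X.V) (hv : v ∈ X.out F) : X.d v ∈ X.out F := by
  obtain ⟨a, ha, b, hb, rfl⟩ := mem_out.1 hv
  exact mem_out.2 ⟨0, zero_mem _, a, ha, by simp [X.dd]⟩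

theorem out_u (hF : ∀ i, ∀ v ∈ F, X.u i v ∈ F) (i : ℕ) (v : X.V) (hv : v ∈ X.out F) :
    X.u i v ∈ X.out F := by
  obtain ⟨a, ha, b, hb, rfl⟩ := mem_out.1 hv
  exact mem_out.2 ⟨X.u i a, hF i a ha, X.u i b, hF i b hb, by simp [X.du]⟩

/-- The contractible complex `W → W`. -/
abbrev disk (W : Submodule k X.V) (hW : ∀ i, ∀ v ∈ W, X.u i v ∈ W) : DMod k where
  V := W × W
  d := LinearMap.inr k W W ∘ₗ LinearMap.fst k W W
  u := fun i => ((X.u i).restrict (hW i)).prodMap ((X.u i).restrict (hW i))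
  gr := fun _ => ⊤
  dd := fun v => by simp
  du := fun i v => by simp
  uu := fun i j v => by
    ext <;> simp [LinearMap.restrict_apply, X.uu i j]
  dgr := fun _ _ _ => trivial
  ugr := fun _ _ _ _ => trivial

theorem disk_nh (W : Submodule k X.V) (hW : ∀ i, ∀ v ∈ W, X.u i v ∈ W) :
    (disk W hW).NH LinearMap.id := by
  refine ⟨LinearMap.inl k W W ∘ₗ LinearMap.snd k W W, fun _ _ _ => trivial, ?_, ?_⟩
  · rintro ⟨a, b⟩
    simp
  · rintro i ⟨a, b⟩
    simp

end chain

/-- The subquotient `W' / W`. -/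
abbrev subQuo (X : DMod k) (W W' : Submodule k X.V) (hd : ∀ v ∈ W, X.d v ∈ W)
    (hu : ∀ i, ∀ v ∈ W, X.u i v ∈ W) (hd' : ∀ v ∈ W', X.d v ∈ W')
    (hu' : ∀ i, ∀ v ∈ W', X.u i v ∈ W') : DMod k :=
  (X.sub W' hd' hu').quo (W.comap W'.subtype) (fun v hv => hd _ hv) (fun i v hv => hu i _ hv)

def sesSub (X : DMod k) (W W' : Submodule k X.V) (h : W ≤ W') (hd : ∀ v ∈ W, X.d v ∈ W)
    (hu : ∀ i, ∀ v ∈ W, X.u i v ∈ W) (hd' : ∀ v ∈ W', X.d v ∈ W')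
    (hu' : ∀ i, ∀ v ∈ W', X.u i v ∈ W') :
    SES (X.sub W hd hu) (X.sub W' hd' hu') (X.subQuo W W' hd hu hd' hu') where
  i := Submodule.inclusion h
  p := (W.comap W'.subtype).mkQ
  inj := Submodule.inclusion_injective h
  surj := Submodule.mkQ_surjective _
  exact := fun y hy => by
    rw [Submodule.mkQ_apply, Submodule.Quotient.mk_eq_zero] at hy
    exact ⟨⟨y, hy⟩, rfl⟩
  pi := fun x => by
    rw [Submodule.mkQ_apply, Submodule.Quotient.mk_eq_zero]
    exact x.2
  id := fun _ => rfl
  pd := fun _ => rfl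
  iu := fun _ _ => rfl
  pu := fun _ _ => rfl
  igr := fun _ _ => Iff.rfl
  pgr := fun _ y hy => Submodule.mem_map_of_mem hy
  lift := fun _ w hw => hw

variable {X : DMod k} {F : Submodule k X.V}

abbrev outQuoInn (hF : ∀ i, ∀ v ∈ F, X.u i v ∈ F) : DMod k :=
  X.flat.subQuo (X.inn F) (X.out F) inn_d (inn_u hF) out_d (out_u hF)

def sesDisk (hF : ∀ i, ∀ v ∈ F, X.u i v ∈ F) :
    SES (disk (X.inn F) (inn_u hF)) (disk F hF) (outQuoInn hF) where
  i := (Submodule.inclusion inn_le).prodMap (Submodule.inclusion inn_le)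
  p := ((X.inn F).comap (X.out F).subtype).mkQ ∘ₗ
    LinearMap.codRestrict (X.out F) ((F.subtype).coprod (X.d ∘ₗ F.subtype))
      (fun v => mem_out.2 ⟨v.1, v.1.2, v.2, v.2.2, rfl⟩)
  inj := (Submodule.inclusion_injective inn_le).prodMap (Submodule.inclusion_injective inn_le)
  surj := fun q => by
    obtain ⟨⟨v, hv⟩, rfl⟩ := Submodule.mkQ_surjective _ q
    obtain ⟨a, ha, b, hb, rfl⟩ := mem_out.1 hv
    exact ⟨(⟨a, ha⟩, ⟨b, hb⟩), rfl⟩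
  exact := fun ⟨a, b⟩ hy => by
    simp only [LinearMap.comp_apply, Submodule.mkQ_apply, Submodule.Quotient.mk_eq_zero] at hy
    obtain ⟨h1, h2⟩ : (a : X.V) + X.d b ∈ F ∧ X.d ((a : X.V) + X.d b) ∈ F := hy
    have hb : X.d b ∈ F := by simpa using sub_mem h1 a.2
    exact ⟨(⟨a, a.2, by simpa [X.dd] using h2⟩, ⟨b, b.2, hb⟩), rfl⟩
  pi := fun ⟨a, b⟩ => by
    simp only [LinearMap.comp_apply, Submodule.mkQ_apply, Submodule.Quotient.mk_eq_zero]
    have : (a : X.V) + X.d b ∈ F ∧ X.d ((a : X.V) + X.d b) ∈ F :=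
      ⟨add_mem a.2.1 b.2.2, by simpa [X.dd] using a.2.2⟩
    exact this
  id := fun _ => rfl
  pd := fun ⟨a, b⟩ => by
    refine congrArg (Submodule.mkQ _) (Subtype.ext ?_)
    change (0 : X.V) + X.d a = X.d (a + X.d b)
    simp [X.dd]
  iu := fun _ _ => rfl
  pu := fun i ⟨a, b⟩ => by
    refine congrArg (Submodule.mkQ _) (Subtype.ext ?_)
    change X.u i a + X.d (X.u i b) = X.u i (a + X.d b)
    simp [X.du]
  igr := fun _ _ => Iff.rfl
  pgr := fun _ y _ => ⟨_, trivial, rfl⟩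
  lift := fun _ w _ => by
    obtain ⟨⟨v, hv⟩, rfl⟩ := Submodule.mkQ_surjective _ w
    obtain ⟨a, ha, b, hb, rfl⟩ := mem_out.1 hv
    exact ⟨(⟨a, ha⟩, ⟨b, hb⟩), trivial, rfl⟩

theorem phi_out_le (hF : ∀ i, ∀ v ∈ F, X.u i v ∈ F) (m : ℕ) (Y : DMod k) :
    phi m (X.flat.sub (X.out F) out_d (out_u hF)) Y ≤
      phi m (X.flat.sub (X.inn F) inn_d (inn_u hF)) Y := by
  have h1 := (sesSub X.flat (X.inn F) (X.out F) inn_le_out inn_d (inn_u hF) out_d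
    (out_u hF)).phi_mid m Y
  have h2 : phi m (outQuoInn hF) Y ≤ 0 := by
    have h3 : ∀ (W : Submodule k X.V) (hW : ∀ i, ∀ v ∈ W, X.u i v ∈ W) (s : ℤ),
        hK m ((disk W hW).tens₀ Y) s = 0 := fun W hW s =>
      hK_eq_zero (by simpa using ((disk_nh W hW).tens₀ Y).zh m) s
    have := ((sesDisk hF).tensLeft Y).hK_right m 0
    rwa [h3, h3, add_zero] at this
  exact h1.trans ((add_le_add_right h2 _).trans_eq (add_zero _))
end DMod
end

section
open TensorProduct
namespace DMod
variable {k : Type} [Field k]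

theorem exists_common_kernel {V : Type} [AddCommGroup V] [Module k V] [Nontrivial V]
    (u : ℕ → V →ₗ[k] V) (uu : ∀ i j v, u i (u j v) = u j (u i v))
    (hn : ∀ i, ∃ n, ∀ v, (u i ^ n) v = 0) (N : ℕ) : ∃ v ≠ 0, ∀ i < N, u i v = 0 := by
  classical
  induction N with
  | zero => simpa using exists_ne (0 : V)
  | succ N ih =>
    obtain ⟨v, hv, h⟩ := ih
    have hex : ∃ n, (u N ^ n) v = 0 := (hn N).imp fun n h => h v
    have hpos : Nat.find hex ≠ 0 := fun h0 => hv (by simpa [h0] using Nat.find_spec hex)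
    obtain ⟨n, hn'⟩ := Nat.exists_eq_succ_of_ne_zero hpos
    refine ⟨(u N ^ n) v, Nat.find_min hex (by omega), fun i hi => ?_⟩
    rcases Nat.lt_succ_iff_lt_or_eq.1 hi with hi | rfl
    · have hc : Commute (u i) (u N) := LinearMap.ext fun v => uu i N v
      have := LinearMap.congr_fun (hc.pow_right n).eq v
      simp only [Module.End.mul_apply] at this
      rw [this, h i hi, map_zero]
    · have := Nat.find_spec hex
      rwa [hn', pow_succ', Module.End.mul_apply] at this

theorem phi_eq_zero_of_subsingleton {X : DMod k} [Subsingleton X.V] (m : ℕ) (Y : DMod k) :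
    phi m X Y = 0 :=
  phi_eq_zero ⟨0, fun _ _ _ => zero_mem _, fun _ => Subsingleton.elim _ _,
    fun _ _ => Subsingleton.elim _ _⟩ m Y

theorem phi_le_of_nilpotent {W Y : DMod k} [FiniteDimensional k W.V] (hd : W.d = 0)
    (hn : ∀ i, ∃ n, ∀ v, (W.u i ^ n) v = 0) {L : ℕ} (hL : ∀ i ≥ L, W.u i = 0) (hY : Y.d = 0)
    (m : ℕ) : phi m W Y ≤ Module.finrank k W.V * hK m Y.flat 0 := by
  obtain ⟨n, hnn⟩ : ∃ n, Module.finrank k W.V = n := ⟨_, rfl⟩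
  induction n generalizing W with
  | zero =>
    have := Module.finrank_zero_iff.1 hnn
    rw [phi_eq_zero_of_subsingleton]
    exact zero_le
  | succ n ih =>
    have := Module.nontrivial_of_finrank_pos (R := k) (M := W.V) (by omega)
    obtain ⟨v, hv, hv'⟩ := exists_common_kernel W.u W.uu hn L
    have hv' : ∀ i, W.u i v = 0 := fun i => by
      by_cases hi : i < L
      · exact hv' i hi
      · simp [hL i (by omega)]
    have hdW : ∀ w ∈ k ∙ v, W.d w ∈ k ∙ v := fun w _ => by simp [hd]
    have huW0 : ∀ i, ∀ w ∈ k ∙ v, W.u i w = 0 := fun i w hw => by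
      obtain ⟨c, rfl⟩ := Submodule.mem_span_singleton.1 hw
      simp [hv']
    have huW : ∀ i, ∀ w ∈ k ∙ v, W.u i w ∈ k ∙ v := fun i w hw => by
      simp [huW0 i w hw]
    have h1 := (W.sesSubQuo (k ∙ v) hdW huW).phi_mid m Y
    have hfr := Submodule.finrank_quotient_add_finrank (k ∙ v)
    rw [finrank_span_singleton hv] at hfr
    have h2 := ih (W := W.quo (k ∙ v) hdW huW)
      (LinearMap.ext fun w => by
        obtain ⟨w, rfl⟩ := Submodule.mkQ_surjective _ w
        simp [hd])
      (fun i => by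
        obtain ⟨N, hN⟩ := hn i
        refine ⟨N, fun w => ?_⟩
        obtain ⟨w, rfl⟩ := Submodule.mkQ_surjective _ w
        have h := Submodule.mapQ_pow (p := k ∙ v) (f := W.u i) (h := huW i) N
        have h' := LinearMap.congr_fun h ((k ∙ v).mkQ w)
        rw [← h']
        simp [hN])
      (fun i hi => LinearMap.ext fun w => by
        obtain ⟨w, rfl⟩ := Submodule.mkQ_surjective _ w
        simp [hL i hi])
      (by change Module.finrank k (W.V ⧸ (k ∙ v)) = n; omega)
    have h3 : phi m (W.sub (k ∙ v) hdW huW) Y ≤ hK m Y.flat 0 := by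
      let e : Y.V ≃ₗ[k] (k ∙ v) ⊗[k] Y.V := (TensorProduct.lid k Y.V).symm ≪≫ₗ
        TensorProduct.congr (LinearEquiv.toSpanNonzeroSingleton k W.V v hv) (.refl k Y.V)
      have he : ∀ y, e y = (⟨v, Submodule.mem_span_singleton_self v⟩ : k ∙ v) ⊗ₜ[k] y := by
        intro y
        simp only [e, LinearEquiv.trans_apply, TensorProduct.lid_symm_apply,
          TensorProduct.congr_tmul, LinearEquiv.refl_apply]
        congr 1
        exact Subtype.ext (by simp)
      refine hK_le_of_equiv (X := Y.flat) (Y := (W.sub (k ∙ v) hdW huW).tens₀ Y) e ?_ ?_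
        (fun _ _ => Iff.rfl) m 0
      · intro y
        simp [hY]
        rw [he]
        simp only [TensorProduct.map_tmul]
        have : (W.d.restrict hdW) ⟨v, Submodule.mem_span_singleton_self v⟩ = 0 :=
          Subtype.ext (by simp [hd])
        rw [this, zero_tmul]
      · intro i y
        rw [he, he]
        have : ((W.u i).restrict (huW i)) ⟨v, Submodule.mem_span_singleton_self v⟩ = 0 :=
          Subtype.ext (by simp [hv'])
        simp [this]
    have h4 : Module.finrank k (W.quo (k ∙ v) hdW huW).V = n := by
      change Module.finrank k (W.V ⧸ (k ∙ v)) = n; omega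
    rw [h4] at h2
    rw [hnn]
    refine h1.trans ((add_le_add h3 h2).trans_eq ?_)
    push_cast
    ring

/-- A bounded grading by projections. -/
structure Grd (X : DMod k) (N : ℕ) where
  π : ℕ → X.V →ₗ[k] X.V
  pp : ∀ s t v, π s (π t v) = if s = t then π t v else 0
  sum : ∀ v, ∑ s ∈ Finset.range N, π s v = v
  d_succ : ∀ s v, X.d (π (s + 1) v) = π s (X.d v)
  d_zero : ∀ v, X.d (π 0 v) = 0
  pu : ∀ i s v, π s (X.u i v) = X.u i (π s v)
  gr : ∀ (s : ℕ) v, v ∈ X.gr s ↔ π s v = v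

namespace Grd
variable {X : DMod k} {N : ℕ} (P : Grd X N)

/-- Elements of degree at least `s`. -/
def F (s : ℕ) : Submodule k X.V := ⨅ t ∈ Finset.range s, LinearMap.ker (P.π t)

variable {P}
theorem mem_F {s : ℕ} {v : X.V} : v ∈ P.F s ↔ ∀ t < s, P.π t v = 0 := by simp [F]

theorem F_top : P.F N = ⊥ := by
  refine (Submodule.eq_bot_iff _).2 fun v hv => ?_
  rw [← P.sum v]
  exact Finset.sum_eq_zero fun t ht => mem_F.1 hv t (Finset.mem_range.1 ht)

theorem F_u (s : ℕ) (i : ℕ) (v : X.V) (hv : v ∈ P.F s) : X.u i v ∈ P.F s :=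
  mem_F.2 fun t ht => by rw [P.pu, mem_F.1 hv t ht, map_zero]

theorem F_succ_le (s : ℕ) : P.F (s + 1) ≤ P.F s := fun _ hv =>
  mem_F.2 fun t ht => mem_F.1 hv t (by omega)

theorem pi_mem_F {s t : ℕ} (h : s ≤ t) (v : X.V) : P.π t v ∈ P.F s :=
  mem_F.2 fun r hr => by rw [P.pp, if_neg (by omega)]

theorem sub_pi_mem {s : ℕ} {v : X.V} (hv : v ∈ P.F s) : v - P.π s v ∈ P.F (s + 1) :=
  mem_F.2 fun t ht => by
    rw [map_sub, P.pp]
    split_ifs with h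
    · rw [h, sub_self]
    · rw [mem_F.1 hv t (by omega), sub_zero]

theorem d_pi_eq_zero {s : ℕ} {v : X.V} (hv : X.d v ∈ P.F s) : X.d (P.π s v) = 0 := by
  cases s with
  | zero => exact P.d_zero v
  | succ s => rw [P.d_succ, mem_F.1 hv s (by omega)]

theorem d_mem_F {s : ℕ} {v : X.V} (hv : v ∈ P.F (s + 1)) : X.d v ∈ P.F s :=
  mem_F.2 fun t ht => by rw [← P.d_succ, mem_F.1 hv (t + 1) (by omega), map_zero]

theorem d_mem_out {s : ℕ} {v : X.V} (hv : v ∈ X.inn (P.F s)) : X.d v ∈ X.out (P.F (s + 1)) :=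
  mem_out.2 ⟨0, zero_mem _, v - P.π s v, sub_pi_mem hv.1, by
    rw [map_sub, d_pi_eq_zero hv.2, sub_zero, zero_add]⟩

theorem out_le_inn (s : ℕ) : X.out (P.F (s + 1)) ≤ X.inn (P.F s) := fun v hv => by
  obtain ⟨a, ha, b, hb, rfl⟩ := mem_out.1 hv
  exact ⟨add_mem (F_succ_le s ha) (d_mem_F hb), by
    simpa [X.dd] using d_mem_F ha⟩

/-- The graded pieces of the truncation filtration. -/
abbrev piece (P : Grd X N) (s : ℕ) : DMod k :=
  X.flat.subQuo (X.out (P.F (s + 1))) (X.inn (P.F s)) (out_d (X := X)) (out_u (X := X) (F_u (s + 1))) (inn_d (X := X))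
    (inn_u (X := X) (F_u s))

theorem piece_length (s : ℕ) : Module.length k (P.piece s).V ≤ X.h s := by
  have hz : ∀ z ∈ X.Z s, z ∈ X.inn (P.F s) := fun z hz => by
    rw [mem_Z, P.gr] at hz
    refine ⟨hz.2 ▸ pi_mem_F le_rfl z, ?_⟩
    simp [hz.1]
  let f : X.Z s →ₗ[k] (P.piece s).V :=
    ((X.out (P.F (s + 1))).comap (X.inn (P.F s)).subtype).mkQ ∘ₗ Submodule.inclusion hz
  have hf : (X.B s).comap (X.Z s).subtype ≤ LinearMap.ker f := by
    rintro ⟨z, hz⟩ hB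
    obtain ⟨w, hw, rfl⟩ := mem_B.1 hB
    rw [← Nat.cast_succ, P.gr] at hw
    refine (Submodule.Quotient.mk_eq_zero _).2 (mem_out.2 ⟨0, zero_mem _, w, ?_, by simp⟩)
    exact hw ▸ pi_mem_F le_rfl w
  refine Module.length_le_of_surjective (Submodule.liftQ _ f hf) ?_
  rw [← LinearMap.range_eq_top, Submodule.range_liftQ, LinearMap.range_eq_top]
  intro q
  obtain ⟨⟨v, hv⟩, rfl⟩ := Submodule.mkQ_surjective _ q
  refine ⟨⟨P.π s v, mem_Z.2 ⟨d_pi_eq_zero hv.2, by rw [P.gr, P.pp, if_pos rfl]⟩⟩, ?_⟩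
  refine (Submodule.Quotient.eq _).2 (mem_out.2 ⟨_, neg_mem (sub_pi_mem hv.1), 0, zero_mem _, ?_⟩)
  simp

theorem piece_nilpotent (s i : ℕ) {n : ℕ} (hn : X.NH (X.u i ^ n)) (q : (P.piece s).V) :
    ((P.piece s).u i ^ n) q = 0 := by
  obtain ⟨σ, h1, h2, h3⟩ := hn
  obtain ⟨⟨v, hv⟩, rfl⟩ := Submodule.mkQ_surjective _ q
  have e : ((P.piece s).u i ^ n) (Submodule.Quotient.mk ⟨v, hv⟩) =
      Submodule.Quotient.mk ((((X.u i).restrict (inn_u (X := X) (F_u s) i)) ^ n) ⟨v, hv⟩) := by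
    exact (LinearMap.congr_fun (Submodule.mapQ_pow
      (p := (X.out (P.F (s + 1))).comap (X.inn (P.F s)).subtype)
      (f := (X.u i).restrict (inn_u (F_u s) i)) (h := fun v hv => out_u (X := X) (F_u (s + 1)) i _ hv) (k := n)) _).symm
  rw [Submodule.mkQ_apply, e, Submodule.Quotient.mk_eq_zero]
  have e2 : (((((X.u i).restrict (inn_u (X := X) (F_u s) i)) ^ n) ⟨v, hv⟩ : X.inn (P.F s)) : X.V) =
      (X.u i ^ n) v := by
    rw [Module.End.pow_restrict]
    rfl
  refine mem_out.2 ⟨(X.u i ^ n) (v - P.π s v), ?_, σ (P.π s v), ?_, ?_⟩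
  · have : ∀ n, ∀ w ∈ P.F (s + 1), (X.u i ^ n) w ∈ P.F (s + 1) := by
      intro n w hw
      induction n with
      | zero => exact hw
      | succ n ih => rw [pow_succ', Module.End.mul_apply]; exact F_u _ _ _ ih
    exact this n _ (sub_pi_mem hv.1)
  · have := h1 s (P.π s v) (by rw [P.gr, P.pp, if_pos rfl])
    rw [← Nat.cast_succ, P.gr] at this
    exact this ▸ pi_mem_F le_rfl _
  · have := h2 (P.π s v)
    rw [d_pi_eq_zero hv.2, map_zero, add_zero] at this
    change _ = ((((X.u i).restrict (inn_u (X := X) (F_u s) i)) ^ n) ⟨v, hv⟩ : X.inn (P.F s)).1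
    rw [this, e2, ← map_add, sub_add_cancel]

theorem phi_le (P : Grd X N) {Y : DMod k} (hY : Y.d = 0) (hfin : ∀ s < N, X.h s ≠ ⊤)
    (hn : ∀ i, ∃ n, X.NH (X.u i ^ n)) {L : ℕ} (hL : ∀ i ≥ L, X.u i = 0) (m : ℕ) :
    phi m X Y ≤ (∑ s ∈ Finset.range N, X.h s) * hK m Y.flat 0 := by
  have hp : ∀ s < N, phi m (P.piece s) Y ≤ X.h s * hK m Y.flat 0 := by
    intro s hs
    have hlen := P.piece_length s
    have : FiniteDimensional k (P.piece s).V := by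
      have := Module.length_ne_top_iff.1 (ne_top_of_le_ne_top (hfin s hs) hlen)
      have := isFiniteLength_iff_isNoetherian_isArtinian.1 this
      have := this.1
      infer_instance
    refine (phi_le_of_nilpotent ?_ ?_ ?_ hY m (L := L)).trans (mul_le_mul_left ?_ _)
    · refine LinearMap.ext fun q => ?_
      obtain ⟨⟨v, hv⟩, rfl⟩ := Submodule.mkQ_surjective _ q
      exact (Submodule.Quotient.mk_eq_zero _).2 (d_mem_out hv)
    · exact fun i => (hn i).imp fun n h q => piece_nilpotent s i h q
    · refine fun i hi => LinearMap.ext fun q => ?_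
      obtain ⟨⟨v, hv⟩, rfl⟩ := Submodule.mkQ_surjective _ q
      refine (Submodule.Quotient.mk_eq_zero _).2 ?_
      change X.u i v ∈ X.out (P.F (s + 1))
      rw [hL i hi]
      exact zero_mem _
    · rwa [← Module.length_eq_finrank]
  have key : ∀ j ≤ N, phi m X Y ≤ (∑ s ∈ Finset.range j, X.h s) * hK m Y.flat 0 +
      phi m (X.flat.sub (X.inn (P.F j)) (inn_d (X := X)) (inn_u (X := X) (F_u j))) Y := by
    intro j hj
    induction j with
    | zero =>
      have h := (X.flat.sesSubQuo (X.inn (P.F 0)) (inn_d (X := X)) (inn_u (X := X) (F_u 0))).phi_mid m Y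
      have : Subsingleton (X.flat.quo (X.inn (P.F 0)) (inn_d (X := X)) (inn_u (X := X) (F_u 0))).V :=
        Submodule.Quotient.subsingleton_iff.2 (eq_top_iff.2 fun v _ => by simp [inn, F])
      rw [phi_eq_zero_of_subsingleton (X := X.flat.quo _ _ _), add_zero] at h
      rw [Finset.sum_range_zero, zero_mul, zero_add]
      exact h
    | succ j ih =>
      refine (ih (by omega)).trans ?_
      have h1 := (sesSub X.flat (X.out (P.F (j + 1))) (X.inn (P.F j)) (out_le_inn j) (out_d (X := X))
        (out_u (X := X) (F_u (j + 1))) (inn_d (X := X)) (inn_u (X := X) (F_u j))).phi_mid m Y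
      rw [Finset.sum_range_succ, add_mul, add_assoc]
      refine add_le_add_right (h1.trans ?_) _
      rw [add_comm]
      exact add_le_add (hp j (by omega)) (phi_out_le (F_u _) m Y)
  refine (key N le_rfl).trans_eq ?_
  have : Subsingleton (X.flat.sub (X.inn (P.F N)) (inn_d (X := X)) (inn_u (X := X) (F_u N))).V := by
    have : X.inn (P.F N) = ⊥ := by simp [inn, F_top]
    exact Submodule.subsingleton_iff_eq_bot.2 this
  rw [phi_eq_zero_of_subsingleton (X := X.flat.sub _ _ _), add_zero]

end Grd
end DMod
end

section
open TensorProduct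

section relLen
variable {k : Type} [Field k] {V W : Type} [AddCommGroup V] [Module k V] [AddCommGroup W]
  [Module k W]

theorem relLen_add {Y Z B : Submodule k V} (h : Y ≤ Z) :
    relLen k Z B = relLen k Y B + relLen k Z (B ⊔ Y) := by
  let f : (Y ⧸ B.comap Y.subtype) →ₗ[k] (Z ⧸ B.comap Z.subtype) :=
    Submodule.mapQ _ _ (Submodule.inclusion h) (fun _ hv => hv)
  let g : (Z ⧸ B.comap Z.subtype) →ₗ[k] (Z ⧸ (B ⊔ Y).comap Z.subtype) :=
    Submodule.factor (Submodule.comap_mono le_sup_left)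
  have hf : ∀ y : Y, f (Submodule.Quotient.mk y) =
      Submodule.Quotient.mk (Submodule.inclusion h y) := fun _ => rfl
  have hg : ∀ z : Z, g (Submodule.Quotient.mk z) = Submodule.Quotient.mk z := fun _ => rfl
  refine Module.length_eq_add_of_exact f g ?_ ?_ ?_
  · rw [← LinearMap.ker_eq_bot, LinearMap.ker_eq_bot']
    intro q hq
    induction q using Submodule.Quotient.induction_on with | _ y
    rw [hf, Submodule.Quotient.mk_eq_zero] at hq
    rw [Submodule.Quotient.mk_eq_zero]
    exact hq
  · exact Submodule.factor_surjective _
  · intro q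
    induction q using Submodule.Quotient.induction_on with | _ z
    rw [hg, Submodule.Quotient.mk_eq_zero, Submodule.mem_comap, Submodule.mem_sup]
    constructor
    · rintro ⟨b, hb, y, hy, e⟩
      refine ⟨Submodule.Quotient.mk ⟨y, hy⟩, ?_⟩
      rw [hf, Submodule.Quotient.eq, Submodule.mem_comap]
      have : y - (z : V) = -b := by rw [← Z.subtype_apply z, ← e]; abel
      change y - (z : V) ∈ B
      rw [this]
      exact neg_mem hb
    · rintro ⟨q, hq⟩
      induction q using Submodule.Quotient.induction_on with | _ y
      rw [hf, Submodule.Quotient.eq, Submodule.mem_comap] at hq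
      refine ⟨(z : V) - y, ?_, y, y.2, by simp⟩
      rw [← neg_mem_iff, neg_sub]
      exact hq

theorem relLen_congr {Z B : Submodule k V} {Z' B' : Submodule k W} (f : V →ₗ[k] W)
    (h1 : ∀ z ∈ Z, f z ∈ Z') (h2 : ∀ w ∈ Z', ∃ z ∈ Z, w - f z ∈ B')
    (h3 : ∀ z ∈ Z, z ∈ B ↔ f z ∈ B') : relLen k Z B = relLen k Z' B' := by
  refine le_antisymm (relLen_le _ _ _ _ f.graph ?_ ?_)
    (relLen_le _ _ _ _ (f.graph.map (LinearEquiv.prodComm k V W).toLinearMap) ?_ ?_)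
  · exact fun z hz => ⟨f z, h1 z hz, z, hz, by simp, by simp⟩
  · intro z w e hz hw hB
    simp only [LinearMap.mem_graph_iff] at e
    exact (h3 z hz).2 (e ▸ hB)
  · intro w hw
    obtain ⟨z, hz, hB⟩ := h2 w hw
    exact ⟨z, hz, f z, h1 z hz, ⟨(z, f z), by simp, rfl⟩, hB⟩
  · rintro w z ⟨⟨z', w'⟩, e, e'⟩ hw hz hB
    simp only [SetLike.mem_coe, LinearMap.mem_graph_iff] at e
    obtain ⟨rfl, rfl⟩ : w' = w ∧ z' = z := by simpa using e'
    exact e ▸ (h3 _ hz).1 hB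

end relLen

namespace DMod
variable {k : Type} [Field k]

/-- Homology of the part `P` of a `ℤ/2`-graded differential module with parts `P` and `Q`. -/
noncomputable def half (X : DMod k) (P Q : Submodule k X.V) : ℕ∞ :=
  relLen k (LinearMap.ker X.d ⊓ P) (Q.map X.d)

/-- Length of the image of the first operator on the homology of the part `P`. -/
noncomputable def halfIm (X : DMod k) (P : Submodule k X.V) : ℕ∞ :=
  relLen k ((LinearMap.ker X.d ⊓ P).map (X.u 0)) (P.map X.d)

theorem half_cone (X : DMod k) {P Q : Submodule k X.V} (hdQ : ∀ v ∈ Q, X.d v ∈ P)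
    (huQ : ∀ v ∈ Q, X.u 0 v ∈ P) (huP : ∀ v ∈ P, X.u 0 v ∈ Q) :
    X.cone.half (P.prod P) (Q.prod Q) + X.halfIm P + X.halfIm Q = 2 * X.half P Q := by
  have hd : ∀ v : X.V, X.d (X.u 0 v) = X.u 0 (X.d v) := X.du 0
  have e1 : X.half P Q = X.halfIm Q + relLen k (LinearMap.ker X.d ⊓ P)
      (Q.map X.d ⊔ (LinearMap.ker X.d ⊓ Q).map (X.u 0)) := by
    refine relLen_add ?_
    rintro _ ⟨z, ⟨hz, hzQ⟩, rfl⟩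
    exact ⟨by simp [hd, LinearMap.mem_ker.1 hz], huQ z hzQ⟩
  let K : Submodule k X.V := (LinearMap.ker X.d ⊓ P) ⊓ (P.map X.d).comap (X.u 0)
  have e2 : X.half P Q = relLen k K (Q.map X.d) + X.halfIm P := by
    have h := relLen_add (k := k) (Y := K) (Z := LinearMap.ker X.d ⊓ P) (B := Q.map X.d)
      inf_le_left
    refine h.trans (congrArg₂ _ rfl (relLen_congr (X.u 0) ?_ ?_ ?_))
    · exact fun z hz => Submodule.mem_map_of_mem hz
    · rintro _ ⟨z, hz, rfl⟩
      exact ⟨z, hz, by simp⟩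
    · intro z hz
      constructor
      · intro h
        obtain ⟨_, ⟨q, hq, rfl⟩, y, hy, rfl⟩ := Submodule.mem_sup.1 h
        rw [map_add, ← hd]
        exact add_mem (Submodule.mem_map_of_mem (huQ q hq)) hy.2
      · exact fun h => Submodule.mem_sup_right ⟨hz, h⟩
  let Y : Submodule k (X.V × X.V) := (LinearMap.ker X.d ⊓ P).map (LinearMap.inl k X.V X.V)
  have hZ' : ∀ a b : X.V, ((a, b) : X.V × X.V) ∈ LinearMap.ker X.cone.d ⊓ P.prod P ↔
      X.d a + X.u 0 b = 0 ∧ X.d b = 0 ∧ a ∈ P ∧ b ∈ P := by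
    intro a b
    have : ((a, b) : X.V × X.V) ∈ LinearMap.ker X.cone.d ↔ X.d a + X.u 0 b = 0 ∧ X.d b = 0 := by
      rw [LinearMap.mem_ker, cone_d]
      change ((X.d a + X.u 0 b, -X.d b) : X.V × X.V) = (0, 0) ↔ _
      rw [Prod.mk.injEq, neg_eq_zero]
    rw [Submodule.mem_inf, this, Submodule.mem_prod, and_assoc]
  have hB' : ∀ a b : X.V, ((a, b) : X.V × X.V) ∈ (Q.prod Q).map X.cone.d ↔
      ∃ x ∈ Q, ∃ y ∈ Q, X.d x + X.u 0 y = a ∧ -X.d y = b := by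
    intro a b
    constructor
    · rintro ⟨⟨x, y⟩, ⟨hx, hy⟩, e⟩
      rw [cone_d] at e
      exact ⟨x, hx, y, hy, congrArg Prod.fst e, congrArg Prod.snd e⟩
    · rintro ⟨x, hx, y, hy, rfl, rfl⟩
      exact ⟨(x, y), ⟨hx, hy⟩, cone_d X x y⟩
  have hY : ∀ a b : X.V, ((a, b) : X.V × X.V) ∈ Y ↔ X.d a = 0 ∧ a ∈ P ∧ b = 0 := by
    intro a b
    constructor
    · rintro ⟨z, ⟨hz, hzP⟩, e⟩
      obtain ⟨rfl, rfl⟩ : z = a ∧ 0 = b := by simpa using e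
      exact ⟨hz, hzP, rfl⟩
    · rintro ⟨h1, h2, rfl⟩
      exact ⟨a, ⟨h1, h2⟩, rfl⟩
  have e3 : X.cone.half (P.prod P) (Q.prod Q) =
      relLen k (LinearMap.ker X.d ⊓ P) (Q.map X.d ⊔ (LinearMap.ker X.d ⊓ Q).map (X.u 0)) +
        relLen k K (Q.map X.d) := by
    have h := relLen_add (k := k) (V := X.V × X.V) (Y := Y)
      (Z := LinearMap.ker X.cone.d ⊓ P.prod P) (B := (Q.prod Q).map X.cone.d) (by
        rintro ⟨a, b⟩ h
        obtain ⟨h1, h2, rfl⟩ := (hY a b).1 h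
        exact (hZ' _ _).2 ⟨by simp [h1], by simp, h2, zero_mem _⟩)
    refine h.trans (congrArg₂ _ ?_ ?_)
    · refine (relLen_congr (LinearMap.inl k X.V X.V) ?_ ?_ ?_).symm
      · exact fun z hz => Submodule.mem_map_of_mem hz
      · rintro _ ⟨z, hz, rfl⟩
        exact ⟨z, hz, by simp⟩
      · intro z hz
        refine Iff.trans ?_ (hB' z 0).symm
        constructor
        · intro h
          obtain ⟨_, ⟨x, hx, rfl⟩, _, ⟨y, ⟨hy, hyQ⟩, rfl⟩, rfl⟩ := Submodule.mem_sup.1 h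
          exact ⟨x, hx, y, hyQ, rfl, by rw [LinearMap.mem_ker.1 hy, neg_zero]⟩
        · rintro ⟨x, hx, y, hy, rfl, e⟩
          exact Submodule.add_mem_sup (Submodule.mem_map_of_mem hx)
            (Submodule.mem_map_of_mem ⟨neg_eq_zero.1 e, hy⟩)
    · refine relLen_congr (LinearMap.snd k X.V X.V) ?_ ?_ ?_
      · rintro ⟨a, b⟩ hz
        obtain ⟨h1, h2, h3, h4⟩ := (hZ' a b).1 hz
        exact ⟨⟨h2, h4⟩, -a, neg_mem h3, by rw [map_neg]; exact neg_eq_of_add_eq_zero_right h1⟩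
      · rintro b ⟨⟨h1, h2⟩, a, ha, e⟩
        exact ⟨(-a, b), (hZ' _ _).2 ⟨by rw [map_neg, e, neg_add_cancel], h1, neg_mem ha, h2⟩,
          by simp⟩
      · rintro ⟨a, b⟩ hz
        obtain ⟨h1, h2, h3, h4⟩ := (hZ' a b).1 hz
        constructor
        · intro h
          obtain ⟨⟨a', b'⟩, hc, ⟨a'', b''⟩, hy, e⟩ := Submodule.mem_sup.1 h
          obtain ⟨x, hx, y, hy', e1, e2⟩ := (hB' _ _).1 hc
          obtain ⟨-, -, rfl⟩ := (hY _ _).1 hy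
          refine ⟨-y, neg_mem hy', ?_⟩
          rw [map_neg, e2]
          simpa using congrArg Prod.snd e
        · rintro ⟨y, hy, e⟩
          change X.d y = b at e
          refine Submodule.mem_sup.2 ⟨(X.u 0 (-y), b), (hB' _ _).2 ⟨0, zero_mem _, -y, neg_mem hy,
            by simp, by simp [e]⟩, (a - X.u 0 (-y), 0), (hY _ _).2 ⟨?_, ?_, rfl⟩, by simp⟩
          · rw [map_sub, hd, map_neg, e, map_neg, sub_neg_eq_add, h1]
          · exact sub_mem h3 (huQ _ (neg_mem hy))
  rw [two_mul]
  nth_rw 1 [e1]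
  rw [e2, e3]
  ring

theorem half_le_hK {X : DMod k} (hgr : ∀ s v, v ∈ X.gr s) {P Q : Submodule k X.V}
    (hc : IsCompl P Q) (hdP : ∀ v ∈ P, X.d v ∈ Q) (hdQ : ∀ v ∈ Q, X.d v ∈ P)
    (huP : ∀ i, ∀ v ∈ P, X.u i v ∈ Q) (huQ : ∀ i, ∀ v ∈ Q, X.u i v ∈ P) (m : ℕ) (s : ℤ) :
    2 ^ m * X.half P Q ≤ hK m X s + 2 ^ m * X.half Q P := by
  induction m generalizing X with
  | zero =>
    rw [pow_zero, one_mul]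
    refine le_trans ?_ le_self_add
    refine relLen_le _ _ _ _ (LinearMap.id : X.V →ₗ[k] X.V).graph ?_ ?_
    · exact fun z hz => ⟨z, mem_Z.2 ⟨hz.1, hgr _ _⟩, z, hz, by simp, by simp⟩
    · intro z w e hz _ hB
      obtain rfl : w = z := by simpa using e
      obtain ⟨v, -, rfl⟩ := mem_B.1 hB
      obtain ⟨p, hp, q, hq, rfl⟩ := Submodule.mem_sup.1 (hc.sup_eq_top ▸ Submodule.mem_top (x := v))
      have : X.d p ∈ P ⊓ Q := ⟨by
        have := sub_mem hz.2 (hdQ q hq)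
        rwa [map_add, add_sub_cancel_right] at this, hdP p hp⟩
      rw [hc.inf_eq_bot, Submodule.mem_bot] at this
      exact ⟨q, hq, by simp [this]⟩
  | succ m ih =>
    have h1 := X.half_cone hdQ (huQ 0) (huP 0)
    have h2 := X.half_cone hdP (huP 0) (huQ 0)
    have h3 := ih (X := X.cone) (fun s v => ⟨hgr _ _, hgr _ _⟩) (P := P.prod P) (Q := Q.prod Q)
      ⟨disjoint_iff.2 (by rw [Submodule.prod_inf_prod, hc.inf_eq_bot, Submodule.prod_bot]),
        codisjoint_iff.2 (by
          rw [Submodule.prod_sup_prod, hc.sup_eq_top, Submodule.prod_top])⟩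
      (fun v hv => ⟨add_mem (hdP _ hv.1) (huP 0 _ hv.2), neg_mem (hdP _ hv.2)⟩)
      (fun v hv => ⟨add_mem (hdQ _ hv.1) (huQ 0 _ hv.2), neg_mem (hdQ _ hv.2)⟩)
      (fun i v hv => ⟨huP _ _ hv.1, huP _ _ hv.2⟩)
      (fun i v hv => ⟨huQ _ _ hv.1, huQ _ _ hv.2⟩)
    rw [pow_succ, mul_assoc, ← h1, mul_assoc, ← h2, mul_add, mul_add, mul_add, mul_add]
    calc _ ≤ hK m X.cone s + 2 ^ m * X.cone.half (Q.prod Q) (P.prod P) +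
          2 ^ m * X.halfIm P + 2 ^ m * X.halfIm Q := by gcongr
      _ = _ := by simp only [hK]; ring

theorem two_pow_mul_half_le_of_zh {X : DMod k} (hgr : ∀ s v, v ∈ X.gr s) {m : ℕ}
    (h : ∀ i < m, X.NH (X.u i)) (s : ℤ) : 2 ^ m * X.half ⊤ ⊤ ≤ hK m X s := by
  induction m generalizing X with
  | zero =>
    rw [pow_zero, one_mul]
    refine (relLen_congr LinearMap.id ?_ ?_ ?_).le
    · exact fun z hz => mem_Z.2 ⟨hz.1, hgr _ _⟩
    · exact fun z hz => ⟨z, ⟨(mem_Z.1 hz).1, trivial⟩, by simp⟩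
    · exact fun z hz => ⟨fun ⟨w, _, e⟩ => mem_B.2 ⟨w, hgr _ _, e⟩,
        fun h => by obtain ⟨w, -, e⟩ := mem_B.1 h; exact ⟨w, trivial, e⟩⟩
  | succ m ih =>
    have h1 := X.half_cone (P := ⊤) (Q := ⊤) (fun _ _ => trivial) (fun _ _ => trivial)
      (fun _ _ => trivial)
    have h2 := ih (X := X.cone) (fun s v => ⟨hgr _ _, hgr _ _⟩)
      (fun i hi => (h (i + 1) (by omega)).cone)
    have h3 : X.halfIm ⊤ = 0 := by
      refine relLen_eq_zero ?_
      rintro _ ⟨z, ⟨hz, -⟩, rfl⟩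
      obtain ⟨σ, -, h4, -⟩ := h 0 (by omega)
      exact ⟨σ z, trivial, by rw [← h4, LinearMap.mem_ker.1 hz, map_zero, add_zero]⟩
    rw [h3, add_zero, add_zero, Submodule.prod_top] at h1
    rw [pow_succ, mul_assoc, ← h1]
    exact h2

end DMod
end

section
open TensorProduct

section
variable {k : Type} [Field k] {V : Type} [AddCommGroup V] [Module k V]

theorem relLen_top_bot : relLen k (⊤ : Submodule k V) ⊥ = Module.length k V := by
  refine ((Submodule.quotEquivOfEqBot _ ?_).trans Submodule.topEquiv).length_eq
  rw [Submodule.comap_bot, Submodule.ker_subtype]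

theorem card_le_relLen {Z B : Submodule k V} {ι : Type} [Fintype ι] [DecidableEq ι] (z : ι → V)
    (f : ι → V →ₗ[k] k) (hz : ∀ i, z i ∈ Z) (hf : ∀ i, ∀ v ∈ B, f i v = 0)
    (h : ∀ i j, f i (z j) = if i = j then 1 else 0) : (Fintype.card ι : ℕ∞) ≤ relLen k Z B := by
  have h1 : Module.length k (ι → k) = Fintype.card ι := by
    rw [Module.length_eq_finrank, Module.finrank_fintype_fun_eq_card]
  rw [← h1]
  let g : (ι → k) →ₗ[k] Z := ∑ i, (LinearMap.proj i).smulRight ⟨z i, hz i⟩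
  refine Module.length_le_of_injective ((B.comap Z.subtype).mkQ ∘ₗ g) ?_
  rw [← LinearMap.ker_eq_bot, LinearMap.ker_eq_bot']
  intro c hc
  have hc' : g c ∈ B.comap Z.subtype := (Submodule.Quotient.mk_eq_zero _).1 hc
  have e : (g c : V) = ∑ i, c i • z i := by simp [g]
  funext j
  have := hf j _ hc'
  rw [Submodule.subtype_apply, e, map_sum] at this
  simpa [h] using this

theorem relLen_le_card {Z B : Submodule k V} {ι : Type} [Fintype ι]
    (f : ι → V →ₗ[k] k) (h : ∀ v ∈ Z, (∀ i, f i v = 0) → v ∈ B) :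
    relLen k Z B ≤ Fintype.card ι := by
  have h1 : Module.length k (ι → k) = Fintype.card ι := by
    rw [Module.length_eq_finrank, Module.finrank_fintype_fun_eq_card]
  rw [← h1, ← relLen_top_bot]
  refine relLen_le _ _ _ _ (LinearMap.pi f).graph ?_ ?_
  · exact fun z hz => ⟨LinearMap.pi f z, trivial, z, hz, by simp [LinearMap.mem_graph_iff], by simp⟩
  · intro z w e hz _ hw
    refine h z hz fun i => ?_
    rw [Submodule.mem_bot] at hw
    rw [hw, LinearMap.mem_graph_iff] at e
    exact (congrFun e i).symm

end

namespace DMod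
variable {k : Type} [Field k]

/-- A strong deformation retraction of a differential module onto a finite dimensional one with
zero differential, compatible with the sign automorphism `ε`. -/
structure Base (X : DMod k) (ε : X.V →ₗ[k] X.V) (ι : Type) [Fintype ι] [DecidableEq ι] where
  sgn : ι → ℤˣ
  el : ι → X.V
  φ : ι → X.V →ₗ[k] k
  σ : X.V →ₗ[k] X.V
  d_el : ∀ i, X.d (el i) = 0
  φ_d : ∀ i v, φ i (X.d v) = 0
  φ_el : ∀ i j, φ i (el j) = if i = j then 1 else 0
  hom : ∀ v, v - ∑ i, φ i v • el i = X.d (σ v) + σ (X.d v)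
  ε_el : ∀ i, ε (el i) = sgn i • el i
  φ_ε : ∀ i v, φ i (ε v) = sgn i • φ i v
  ε_σ : ∀ v, ε (σ v) = -σ (ε v)

namespace Grd
variable {X : DMod k} {N : ℕ} (P : Grd X N)

/-- The sign automorphism of a graded differential module. -/
def ε : X.V →ₗ[k] X.V := ∑ s ∈ Finset.range N, (-1 : ℤˣ) ^ s • P.π s

theorem pi_eq_zero {s : ℕ} (hs : N ≤ s) (v : X.V) : P.π s v = 0 := by
  conv_lhs => rw [← P.sum v]
  rw [map_sum]
  refine Finset.sum_eq_zero fun t ht => ?_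
  rw [P.pp, if_neg]
  have := Finset.mem_range.1 ht
  omega

theorem ext_pi {v w : X.V} (h : ∀ s, P.π s v = P.π s w) : v = w := by
  rw [← P.sum v, ← P.sum w]
  exact Finset.sum_congr rfl fun s _ => h s

theorem pi_ε (s : ℕ) (v : X.V) : P.π s (P.ε v) = (-1 : ℤˣ) ^ s • P.π s v := by
  rcases le_or_gt N s with h | h
  · rw [P.pi_eq_zero h, P.pi_eq_zero h, smul_zero]
  · simp only [ε, LinearMap.sum_apply, LinearMap.smul_apply, map_sum, Units.smul_def, map_zsmul,
      P.pp]
    rw [Finset.sum_eq_single_of_mem s (Finset.mem_range.2 h)]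
    · simp
    · intro t _ ht
      rw [if_neg (Ne.symm ht), smul_zero]

theorem ε_pi (s : ℕ) (v : X.V) : P.ε (P.π s v) = (-1 : ℤˣ) ^ s • P.π s v := by
  refine P.ext_pi fun t => ?_
  rw [pi_ε, Units.smul_def, Units.smul_def, map_zsmul, P.pp]
  split_ifs with h
  · rw [h]
  · simp

theorem ε_ε (v : X.V) : P.ε (P.ε v) = v := P.ext_pi fun s => by
  rw [pi_ε, pi_ε, smul_smul, ← mul_pow]; simp

theorem d_ε (v : X.V) : X.d (P.ε v) = -P.ε (X.d v) := P.ext_pi fun s => by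
  rw [← P.d_succ, pi_ε, Units.smul_def, map_zsmul, P.d_succ, map_neg, pi_ε, ← Units.smul_def,
    pow_succ, mul_neg_one, Units.neg_smul]

theorem u_ε (i : ℕ) (v : X.V) : X.u i (P.ε v) = P.ε (X.u i v) := P.ext_pi fun s => by
  rw [P.pu, pi_ε, pi_ε, P.pu, Units.smul_def, Units.smul_def, map_zsmul]

theorem exists_contraction : ∃ σ : X.V →ₗ[k] X.V, (∀ v, X.d (σ (X.d v)) = X.d v) ∧
    (∀ s v, P.π (s + 1) (σ v) = σ (P.π s v)) ∧ ∀ v, P.π 0 (σ v) = 0 := by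
  obtain ⟨g, hg⟩ := X.d.rangeRestrict.exists_rightInverse_of_surjective
    (LinearMap.range_rangeRestrict _)
  obtain ⟨r, hr⟩ := (LinearMap.range X.d).subtype.exists_leftInverse_of_injective
    (Submodule.ker_subtype _)
  let σ₀ := g ∘ₗ r
  have h0 : ∀ v, X.d (σ₀ (X.d v)) = X.d v := fun v => by
    have h1 : r (X.d v) = X.d.rangeRestrict v := LinearMap.congr_fun hr (X.d.rangeRestrict v)
    have h2 := LinearMap.congr_fun hg (X.d.rangeRestrict v)
    have h3 := congrArg Subtype.val h2
    change X.d (g (r (X.d v))) = _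
    rw [h1]
    exact h3
  let σ : X.V →ₗ[k] X.V := ∑ s ∈ Finset.range N, P.π (s + 1) ∘ₗ σ₀ ∘ₗ P.π s
  have hσ : ∀ s v, P.π (s + 1) (σ v) = P.π (s + 1) (σ₀ (P.π s v)) := fun s v => by
    rcases le_or_gt N s with h | h
    · rw [P.pi_eq_zero (by omega), P.pi_eq_zero (by omega)]
    · simp only [σ, LinearMap.sum_apply, LinearMap.comp_apply, map_sum, P.pp]
      rw [Finset.sum_eq_single_of_mem s (Finset.mem_range.2 h)]
      · simp
      · intro t _ ht
        rw [if_neg (by omega)]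
  have hσ' : ∀ s v, σ (P.π s v) = P.π (s + 1) (σ₀ (P.π s v)) := fun s v => by
    rcases le_or_gt N s with h | h
    · rw [P.pi_eq_zero (by omega : N ≤ s), P.pi_eq_zero (by omega), map_zero]
    · simp only [σ, LinearMap.sum_apply, LinearMap.comp_apply]
      rw [Finset.sum_eq_single_of_mem s (Finset.mem_range.2 h)]
      · rw [P.pp, if_pos rfl]
      · intro t _ ht
        rw [P.pp, if_neg ht, map_zero, map_zero]
  refine ⟨σ, fun v => ?_, fun s v => by rw [hσ, hσ'], fun v => ?_⟩
  · refine P.ext_pi fun s => ?_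
    rw [← P.d_succ, hσ, P.d_succ, ← P.d_succ s v, h0]
    rw [P.d_succ, P.pp, if_pos rfl]
  · simp [σ, P.pp]

theorem exists_base (h : ∀ s < N, X.h s ≠ ⊤) : ∃ n : ℕ → ℕ,
    (∀ s < N, X.h s = n s) ∧ ∃ b : Base X P.ε (Σ s : Fin N, Fin (n s)),
      ∀ i, b.sgn i = (-1) ^ (i.1 : ℕ) := by
  obtain ⟨σ₀, h0, hσ, hσ0⟩ := P.exists_contraction
  have hdd := X.dd
  let p : X.V →ₗ[k] X.V := LinearMap.id - X.d ∘ₗ σ₀ - σ₀ ∘ₗ X.d + X.d ∘ₗ σ₀ ∘ₗ σ₀ ∘ₗ X.d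
  have p_def : ∀ v, p v = v - X.d (σ₀ v) - σ₀ (X.d v) + X.d (σ₀ (σ₀ (X.d v))) := fun _ => rfl
  let σ : X.V →ₗ[k] X.V := σ₀ - σ₀ ∘ₗ σ₀ ∘ₗ X.d
  have σ_def : ∀ v, σ v = σ₀ v - σ₀ (σ₀ (X.d v)) := fun _ => rfl
  have pd : ∀ v, p (X.d v) = 0 := fun v => by simp [p_def, h0, hdd]
  have dp : ∀ v, X.d (p v) = 0 := fun v => by simp [p_def, h0, hdd]
  have hom : ∀ v, v - p v = X.d (σ v) + σ (X.d v) := fun v => by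
    simp [p_def, σ_def, hdd]; abel
  have pσd : ∀ v, p (σ (X.d v)) = 0 := fun v => by
    simp [p_def, σ_def, hdd, h0]
  have pp : ∀ v, p (p v) = p v := fun v => by
    have := congrArg p (hom v)
    rw [map_sub, map_add, pd, pσd, zero_add, sub_eq_zero] at this
    exact this.symm
  have hπd : ∀ s v, P.π s (X.d (σ₀ v)) = X.d (σ₀ (P.π s v)) := fun s v => by
    rw [← P.d_succ, hσ]
  have hπd' : ∀ s v, P.π s (σ₀ (X.d v)) = σ₀ (X.d (P.π s v)) := fun s v => by
    cases s with
    | zero => rw [hσ0, P.d_zero, map_zero]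
    | succ s => rw [hσ, P.d_succ]
  have hπp : ∀ s v, P.π s (p v) = p (P.π s v) := fun s v => by
    simp only [p_def, map_add, map_sub, hπd, hπd']
  have hπσ : ∀ s v, P.π (s + 1) (σ v) = σ (P.π s v) := fun s v => by
    simp only [σ_def, map_sub, hσ, hπd']
  have hπσ0 : ∀ v, P.π 0 (σ v) = 0 := fun v => by simp only [σ_def, map_sub, hσ0, sub_zero]
  let W : ℕ → Submodule k X.V := fun s => LinearMap.range (p ∘ₗ P.π s)
  have hW : ∀ s, ∀ w ∈ W s, p w = w ∧ P.π s w = w ∧ X.d w = 0 := by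
    rintro s _ ⟨v, rfl⟩
    refine ⟨pp _, ?_, dp _⟩
    rw [LinearMap.comp_apply, hπp, P.pp, if_pos rfl]
  have hlen : ∀ s, Module.length k (W s) = X.h s := fun s => by
    rw [← relLen_top_bot]
    refine relLen_congr (W s).subtype ?_ ?_ ?_
    · exact fun w _ => mem_Z.2 ⟨(hW s w w.2).2.2, (P.gr s _).2 (hW s w w.2).2.1⟩
    · intro v hv
      obtain ⟨h1, h2⟩ := mem_Z.1 hv
      rw [P.gr] at h2
      refine ⟨⟨p v, v, by rw [LinearMap.comp_apply, h2]⟩, trivial, mem_B.2 ⟨σ v, ?_, ?_⟩⟩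
      · have := hπσ s v
        rw [h2] at this
        exact (P.gr (s + 1) _).2 this
      · have := hom v
        rw [h1, map_zero, add_zero] at this
        exact this.symm
    · intro w _
      constructor
      · intro hw
        rw [(Submodule.mem_bot k).1 hw]
        exact zero_mem _
      · intro hw
        obtain ⟨v, -, hv⟩ := mem_B.1 hw
        refine (Submodule.mem_bot k).2 (Subtype.ext ?_)
        change (w : X.V) = 0
        rw [← (hW s w w.2).1]
        change p ((W s).subtype w) = 0
        rw [← hv, pd]
  have hfin : ∀ s < N, Module.Finite k (W s) := fun s hs => by
    have h1 : Module.length k (W s) ≠ ⊤ := hlen s ▸ h s hs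
    rw [Module.length_ne_top_iff] at h1
    have := (isFiniteLength_iff_isNoetherian_isArtinian.1 h1).1
    infer_instance
  let n : ℕ → ℕ := fun s => Module.finrank k (W s)
  have hn : ∀ s < N, X.h s = n s := fun s hs => by
    have := hfin s hs
    rw [← hlen, Module.length_eq_finrank]
  let bs : ∀ s : Fin N, Module.Basis (Fin (n s)) k (W s) := fun s =>
    have := hfin s s.2
    Module.finBasis k (W s)
  let φ : (Σ s : Fin N, Fin (n s)) → X.V →ₗ[k] k := fun i =>
    (bs i.1).coord i.2 ∘ₗ (p ∘ₗ P.π i.1).rangeRestrict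
  have hπel : ∀ (s : ℕ) (i : Σ s : Fin N, Fin (n s)),
      P.π s (bs i.1 i.2 : X.V) = if s = i.1 then (bs i.1 i.2 : X.V) else 0 := fun s i => by
    have := (hW i.1 _ (bs i.1 i.2).2).2.1
    rw [← this, P.pp]
  have hφ : ∀ s v, ∑ j, φ ⟨s, j⟩ v • (bs s j : X.V) = p (P.π s v) := fun s v => by
    have := (bs s).sum_repr ((p ∘ₗ P.π s).rangeRestrict v)
    have := congrArg Subtype.val this
    rw [Submodule.coe_sum] at this
    exact this
  have hφ0 : ∀ (i : Σ s : Fin N, Fin (n s)) v, p (P.π i.1 v) = 0 → φ i v = 0 := fun i v hv => by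
    have : (p ∘ₗ P.π i.1).rangeRestrict v = 0 := Subtype.ext hv
    simp only [φ, LinearMap.comp_apply, this, map_zero]
  refine ⟨n, hn, ⟨fun i => (-1) ^ (i.1 : ℕ), fun i => bs i.1 i.2, φ, σ, ?_, ?_, ?_, ?_, ?_, ?_, ?_⟩,
    fun _ => rfl⟩
  · exact fun i => (hW i.1 _ (bs i.1 i.2).2).2.2
  · intro i v
    refine hφ0 i _ ?_
    rw [← P.d_succ, pd]
  · intro i j
    by_cases hij : i.1 = j.1
    · obtain ⟨s, i⟩ := i
      obtain ⟨t, j⟩ := j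
      obtain rfl : s = t := hij
      have : (p ∘ₗ P.π s).rangeRestrict (bs s j : X.V) = bs s j := Subtype.ext (by
        have := hW s _ (bs s j).2
        change p (P.π s _) = _
        rw [this.2.1, this.1])
      simp only [φ, LinearMap.comp_apply, this, Module.Basis.coord_apply, Module.Basis.repr_self,
        Finsupp.single_apply, Sigma.mk.injEq, heq_eq_eq, true_and]
      simp only [eq_comm]
    · rw [if_neg (fun h => hij (congrArg Sigma.fst h))]
      refine hφ0 i _ ?_
      rw [hπel, if_neg (fun h => hij (Fin.ext h)), map_zero]
  · intro v
    rw [← hom, Fintype.sum_sigma]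
    simp only [hφ]
    rw [← map_sum, Fin.sum_univ_eq_sum_range (fun s => P.π s v), P.sum]
  · intro i
    have := (hW i.1 _ (bs i.1 i.2).2).2.1
    rw [← this, P.ε_pi]
  · intro i v
    have : (p ∘ₗ P.π i.1).rangeRestrict (P.ε v) =
        (-1 : ℤˣ) ^ (i.1 : ℕ) • (p ∘ₗ P.π i.1).rangeRestrict v := Subtype.ext (by
      change p (P.π _ _) = _
      rw [P.pi_ε, Units.smul_def, map_zsmul, Units.smul_def]
      rfl)
    change (bs i.1).coord i.2 _ = _
    rw [this, Units.smul_def, map_zsmul, Units.smul_def]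
    rfl
  · intro v
    refine P.ext_pi fun s => ?_
    rw [P.pi_ε, map_neg]
    cases s with
    | zero => simp [hπσ0]
    | succ s =>
      rw [hπσ, hπσ, P.pi_ε, pow_succ, mul_neg_one, Units.neg_smul, Units.smul_def,
        Units.smul_def, map_zsmul]

end Grd
end DMod
end

section
open TensorProduct

namespace DMod
namespace Base
variable {k : Type} [Field k] {X : DMod k} {ε : X.V →ₗ[k] X.V} {ι : Type} [Fintype ι]
  [DecidableEq ι] (b : Base X ε ι)

/-- The sign of a basis element as a scalar. -/
def sg (i : ι) : k := ((b.sgn i : ℤ) : k)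

theorem ε_el' (i : ι) : ε (b.el i) = b.sg i • b.el i := by
  rw [b.ε_el, Units.smul_def, sg, Int.cast_smul_eq_zsmul]

theorem φ_ε' (i : ι) (v : X.V) : b.φ i (ε v) = b.sg i * b.φ i v := by
  rw [b.φ_ε, Units.smul_def, sg, zsmul_eq_mul]

theorem sg_mul_self (i : ι) : b.sg i * b.sg i = 1 := by
  rw [sg, ← Int.cast_mul, ← Units.val_mul, Int.units_mul_self, Units.val_one, Int.cast_one]

/-- Tensor products of the functionals. -/
noncomputable def φφ (i j : ι) : X.V ⊗[k] X.V →ₗ[k] k := LinearMap.mul' k k ∘ₗ map (b.φ i) (b.φ j)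

@[simp] theorem φφ_tmul (i j : ι) (v w : X.V) : b.φφ i j (v ⊗ₜ w) = b.φ i v * b.φ j w := rfl

theorem φφ_d (hd : ∀ v, X.d (ε v) = -ε (X.d v)) (hu : ∀ i v, X.u i (ε v) = ε (X.u i v))
    (i j : ι) (v) : b.φφ i j ((X.tens X ε hd hu).d v) = 0 := by
  induction v using TensorProduct.induction_on with
  | zero => simp
  | tmul v w => simp [b.φ_d]
  | add v w h1 h2 => rw [map_add, map_add, h1, h2, add_zero]

/-- The projection onto the span of the basis elements. -/
noncomputable def p : X.V →ₗ[k] X.V := ∑ i, (b.φ i).smulRight (b.el i)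

theorem hom' (v : X.V) : b.p v = v - (X.d (b.σ v) + b.σ (X.d v)) := by
  rw [← b.hom]; simp [p]

theorem p_d (v : X.V) : b.p (X.d v) = 0 := by simp [p, b.φ_d]

theorem d_p (v : X.V) : X.d (b.p v) = 0 := by simp [p, b.d_el]

theorem p_ε (v : X.V) : b.p (ε v) = ε (b.p v) := by
  simp [p, b.ε_el', b.φ_ε', smul_smul, mul_comm]

theorem exists_tens_hom (hd : ∀ v, X.d (ε v) = -ε (X.d v)) (hu : ∀ i v, X.u i (ε v) = ε (X.u i v))
    (hε : ∀ v, ε (ε v) = v) : ∃ S : X.V ⊗[k] X.V →ₗ[k] X.V ⊗[k] X.V, ∀ v,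
      v - ∑ i, ∑ j, b.φφ i j v • b.el i ⊗ₜ b.el j =
        (X.tens X ε hd hu).d (S v) + S ((X.tens X ε hd hu).d v) := by
  refine ⟨map b.σ LinearMap.id + map (b.p ∘ₗ ε) b.σ, fun v => ?_⟩
  have hp : ∀ v, ∑ i, ∑ j, b.φφ i j v • b.el i ⊗ₜ[k] b.el j = map b.p b.p v := by
    intro v
    induction v using TensorProduct.induction_on with
    | zero => simp
    | tmul v w =>
      simp only [map_tmul, p, LinearMap.sum_apply, LinearMap.smulRight_apply, sum_tmul, tmul_sum,
        φφ_tmul, smul_tmul_smul]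
      exact Finset.sum_comm
    | add v w h1 h2 => simp only [map_add, add_smul, Finset.sum_add_distrib, h1, h2]
  rw [hp]
  induction v using TensorProduct.induction_on with
  | zero => simp
  | tmul v w =>
    have e1 : ε (b.σ v) ⊗ₜ[k] X.d w = -(b.σ (ε v) ⊗ₜ[k] X.d w) := by rw [b.ε_σ, neg_tmul]
    simp only [map_tmul, LinearMap.add_apply, map_add, LinearMap.id_apply, LinearMap.comp_apply,
      b.d_p, b.p_d, b.p_ε, hε, zero_tmul, map_zero, hd, map_neg, e1, neg_zero]
    rw [b.hom' w, b.hom' v]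
    simp only [tmul_sub, tmul_add, sub_tmul, add_tmul]
    abel
  | add v w h1 h2 =>
    simp only [map_add] at h1 h2 ⊢
    rw [add_sub_add_comm, h1, h2]
    abel

variable (ε) in
/-- The swap twisted by signs. -/
noncomputable def γ : X.V ⊗[k] X.V →ₗ[k] X.V ⊗[k] X.V :=
  (2⁻¹ : k) • (map ε ε + map ε LinearMap.id + map LinearMap.id ε - LinearMap.id) ∘ₗ
    (TensorProduct.comm k X.V X.V).toLinearMap

theorem γ_tmul (v w : X.V) : γ ε (v ⊗ₜ w) = (2⁻¹ : k) •
    (ε w ⊗ₜ ε v + ε w ⊗ₜ v + w ⊗ₜ ε v - w ⊗ₜ v) := rfl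

theorem γ_γ (h2 : (2 : k) ≠ 0) (hε : ∀ v, ε (ε v) = v) (v : X.V ⊗[k] X.V) : γ ε (γ ε v) = v := by
  have h4 : (2⁻¹ : k) * 2⁻¹ * 4 = 1 := by
    rw [show (4 : k) = 2 * 2 by norm_num]; field_simp
  induction v using TensorProduct.induction_on with
  | zero => simp
  | tmul v w =>
    simp only [γ_tmul, map_smul, map_add, map_sub, hε, smul_smul]
    conv_rhs => rw [← one_smul k (v ⊗ₜ[k] w), ← h4]
    module
  | add v w h1 h2 => rw [map_add, map_add, h1, h2]

theorem γ_d (hd : ∀ v, X.d (ε v) = -ε (X.d v)) (hu : ∀ i v, X.u i (ε v) = ε (X.u i v))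
    (hε : ∀ v, ε (ε v) = v) (v) :
    γ ε ((X.tens X ε hd hu).d v) = -(X.tens X ε hd hu).d (γ ε v) := by
  induction v using TensorProduct.induction_on with
  | zero => simp
  | tmul v w =>
    simp only [γ_tmul, map_smul, map_add, map_sub, hε, LinearMap.add_apply, map_tmul,
      LinearMap.id_apply, hd, neg_tmul, tmul_neg]
    module
  | add v w h1 h2 => simp only [map_add, h1, h2]; abel

theorem γ_u (hd : ∀ v, X.d (ε v) = -ε (X.d v)) (hu : ∀ i v, X.u i (ε v) = ε (X.u i v)) (i : ℕ) (v) :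
    γ ε ((X.tens X ε hd hu).u i v) = -(X.tens X ε hd hu).u i (γ ε v) := by
  induction v using TensorProduct.induction_on with
  | zero => simp
  | tmul v w =>
    simp only [γ_tmul, map_smul, map_add, map_sub, LinearMap.sub_apply, map_tmul,
      LinearMap.id_apply, hu]
    module
  | add v w h1 h2 => simp only [map_add, h1, h2]; abel

/-- The sign of the twisted swap on tensor products of basis elements. -/
def cc (i j : ι) : k := 2⁻¹ * (b.sg i * b.sg j + b.sg j + b.sg i - 1)

theorem γ_el (i j : ι) : γ ε (b.el i ⊗ₜ b.el j) = b.cc i j • b.el j ⊗ₜ[k] b.el i := by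
  simp only [γ_tmul, b.ε_el', cc, tmul_smul, ← smul_tmul']
  module

theorem φφ_γ (i j : ι) (v : X.V ⊗[k] X.V) : b.φφ i j (γ ε v) = b.cc i j * b.φφ j i v := by
  induction v using TensorProduct.induction_on with
  | zero => simp
  | tmul v w =>
    simp only [γ_tmul, map_smul, map_add, map_sub, φφ_tmul, b.φ_ε', cc, smul_eq_mul]
    ring
  | add v w h1 h2 => simp only [map_add, h1, h2]; ring

theorem cc_self (h2 : (2 : k) ≠ 0) (i : ι) : b.cc i i = b.sg i := by
  rw [cc, b.sg_mul_self]; field_simp; ring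

theorem card_aux [LinearOrder ι] (q : ι → Prop) [DecidablePred q] :
    Fintype.card {x : ι × ι // x.1 < x.2 ∨ x.1 = x.2 ∧ q x.1} =
      Fintype.card {x : ι × ι // x.1 < x.2} + Fintype.card {i // q i} := by
  rw [Fintype.card_subtype_or_disjoint]
  · congr 1
    refine Fintype.card_congr ⟨fun x => ⟨x.1.1, x.2.2⟩, fun i => ⟨(i.1, i.1), rfl, i.2⟩, ?_, ?_⟩
    · rintro ⟨⟨i, j⟩, h, h'⟩
      exact Subtype.ext (Prod.ext rfl h)
    · exact fun _ => rfl
  · rw [disjoint_iff]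
    ext x
    simp only [Pi.inf_apply, Pi.bot_apply, inf_Prop_eq, Prop.bot_eq_false, iff_false, not_and]
    exact fun h h' => absurd h' h.ne

/-- The Euler characteristic bound in characteristic different from two. -/
theorem le_of_two_ne_zero [LinearOrder ι] (h2 : (2 : k) ≠ 0) (hd : ∀ v, X.d (ε v) = -ε (X.d v))
    (hu : ∀ i v, X.u i (ε v) = ε (X.u i v)) (hε : ∀ v, ε (ε v) = v) (L : ℕ) :
    (2 ^ L * Fintype.card {i // b.sgn i = 1} : ℕ∞) ≤ hK L (X.tens X ε hd hu) 0 +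
      2 ^ L * Fintype.card {i // b.sgn i = -1} := by
  set T := X.tens X ε hd hu with hT
  let P : Submodule k T.V := LinearMap.ker (γ ε - LinearMap.id)
  let Q : Submodule k T.V := LinearMap.ker (γ ε + LinearMap.id)
  have hP : ∀ v : T.V, v ∈ P ↔ γ ε v = v := fun v => by
    rw [LinearMap.mem_ker, LinearMap.sub_apply, LinearMap.id_apply, sub_eq_zero]
  have hQ : ∀ v : T.V, v ∈ Q ↔ γ ε v = -v := fun v => by
    rw [LinearMap.mem_ker, LinearMap.add_apply, LinearMap.id_apply, add_eq_zero_iff_eq_neg]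
  have hPQ : IsCompl P Q := by
    constructor
    · rw [Submodule.disjoint_def]
      intro v h1 h3
      rw [hP] at h1
      rw [hQ, h1] at h3
      have : (2 : k) • v = 0 := by rw [two_smul]; nth_rw 1 [h3]; exact neg_add_cancel v
      exact (smul_eq_zero.1 this).resolve_left h2
    · rw [codisjoint_iff, eq_top_iff]
      intro v _
      refine Submodule.mem_sup.2 ⟨(2⁻¹ : k) • (v + γ ε v), ?_, (2⁻¹ : k) • (v - γ ε v), ?_, ?_⟩
      · rw [hP, map_smul, map_add, γ_γ h2 hε, add_comm]
      · rw [hQ, map_smul, map_sub, γ_γ h2 hε, ← smul_neg, neg_sub]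
      · rw [← smul_add, add_add_sub_cancel, ← two_smul k, smul_smul, inv_mul_cancel₀ h2, one_smul]
  have hdP : ∀ v ∈ P, T.d v ∈ Q := fun v hv => by
    rw [hQ]
    exact (γ_d hd hu hε v).trans (by rw [(hP v).1 hv])
  have hdQ : ∀ v ∈ Q, T.d v ∈ P := fun v hv => by
    rw [hP]
    exact (γ_d hd hu hε v).trans (by rw [(hQ v).1 hv, map_neg, neg_neg])
  have huP : ∀ i, ∀ v ∈ P, T.u i v ∈ Q := fun i v hv => by
    rw [hQ]
    exact (γ_u hd hu i v).trans (by rw [(hP v).1 hv])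
  have huQ : ∀ i, ∀ v ∈ Q, T.u i v ∈ P := fun i v hv => by
    rw [hP]
    exact (γ_u hd hu i v).trans (by rw [(hQ v).1 hv, map_neg, neg_neg])
  have hs1 : ∀ i, b.sgn i = 1 → b.sg i = 1 := fun i h => by rw [sg, h]; simp
  have hsn : ∀ i, b.sgn i = -1 → b.sg i = -1 := fun i h => by rw [sg, h]; simp
  have key := half_le_hK (X := T) (fun _ _ => trivial) hPQ hdP hdQ huP huQ L 0
  have low : (Fintype.card {x : ι × ι // x.1 < x.2 ∨ x.1 = x.2 ∧ b.sgn x.1 = 1} : ℕ∞) ≤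
      T.half P Q := by
    refine card_le_relLen (fun x => b.el x.1.1 ⊗ₜ[k] b.el x.1.2 + γ ε (b.el x.1.1 ⊗ₜ b.el x.1.2))
      (fun x => (if x.1.1 = x.1.2 then (2⁻¹ : k) else 1) • b.φφ x.1.1 x.1.2) ?_ ?_ ?_
    · intro x
      refine ⟨?_, ?_⟩
      · have : ∀ i j, T.d (b.el i ⊗ₜ[k] b.el j) = 0 := fun i j => by
          change map X.d LinearMap.id _ + map ε X.d _ = _
          simp [b.d_el]
        change T.d _ = 0
        rw [map_add, b.γ_el, map_smul, this, this, smul_zero, add_zero]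
      · change _ ∈ P
        rw [hP, map_add, γ_γ h2 hε, add_comm]
    · rintro x _ ⟨v, -, rfl⟩
      rw [LinearMap.smul_apply, b.φφ_d, smul_zero]
    · rintro ⟨⟨i, j⟩, hij⟩ ⟨⟨i', j'⟩, hij'⟩
      have e : b.φφ i j (b.el i' ⊗ₜ[k] b.el j' + γ ε (b.el i' ⊗ₜ b.el j')) =
          (if i = i' then 1 else 0) * (if j = j' then 1 else 0) +
            b.cc i' j' * ((if i = j' then 1 else 0) * (if j = i' then 1 else 0)) := by
        rw [map_add, b.γ_el, map_smul, φφ_tmul, φφ_tmul, b.φ_el, b.φ_el, b.φ_el, b.φ_el,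
          smul_eq_mul]
      change (if i = j then (2⁻¹ : k) else 1) * b.φφ i j _ = _
      rw [e]
      simp only [Subtype.mk.injEq, Prod.mk.injEq]
      by_cases h1 : i = i' ∧ j = j'
      · obtain ⟨rfl, rfl⟩ := h1
        by_cases h3 : i = j
        · subst h3
          have h4 := (hij.resolve_left (lt_irrefl _)).2
          simp [b.cc_self h2, hs1 _ h4, one_add_one_eq_two, h2]
        · simp [h3]
      · have h3 : ¬(i = j' ∧ j = i') := fun ⟨e1, e2⟩ => by
          subst e1 e2
          have h3 : i ≤ j := by rcases hij with h | h; exacts [h.le, h.1.le]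
          have h4 : j ≤ i := by rcases hij' with h | h; exacts [h.le, h.1.le]
          exact h1 ⟨le_antisymm h3 h4, le_antisymm h4 h3⟩
        have h4 : ∀ a b c d : ι, ¬(a = c ∧ b = d) →
            (if a = c then (1 : k) else 0) * (if b = d then 1 else 0) = 0 := fun a b c d h => by
          rcases not_and_or.1 h with h | h <;> simp [h]
        rw [if_neg h1, h4 _ _ _ _ h1, h4 _ _ _ _ h3]
        simp
  have up : T.half Q P ≤
      Fintype.card {x : ι × ι // x.1 < x.2 ∨ x.1 = x.2 ∧ b.sgn x.1 = -1} := by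
    refine relLen_le_card (fun x => b.φφ x.1.1 x.1.2) fun v hv h => ?_
    obtain ⟨hv1, hv2⟩ := hv
    have hv3 := (hQ v).1 hv2
    have hsym : ∀ i j, b.φφ j i v = 0 → b.φφ i j v = 0 := fun i j h0 => by
      have := b.φφ_γ i j v
      rw [hv3, map_neg, h0, mul_zero, neg_eq_zero] at this
      exact this
    have h0 : ∀ i j, b.φφ i j v = 0 := fun i j => by
      rcases lt_trichotomy i j with hij | rfl | hij
      · exact h ⟨(i, j), Or.inl hij⟩
      · rcases Int.units_eq_one_or (b.sgn i) with h3 | h3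
        · have := b.φφ_γ i i v
          rw [hv3, map_neg, b.cc_self h2, hs1 i h3, one_mul, neg_eq_iff_add_eq_zero,
            ← two_mul] at this
          exact (mul_eq_zero.1 this).resolve_left h2
        · exact h ⟨(i, i), Or.inr ⟨rfl, h3⟩⟩
      · exact hsym i j (h ⟨(j, i), Or.inl hij⟩)
    obtain ⟨S, hS⟩ := b.exists_tens_hom hd hu hε
    have := hS v
    simp only [h0, zero_smul, Finset.sum_const_zero, sub_zero] at this
    have h3 : T.d (S v) = v := by
      refine Eq.trans ?_ this.symm
      have h4 : T.d v = 0 := hv1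
      have h5 : S ((X.tens X ε hd hu).d v) = 0 := (congrArg S h4).trans (map_zero S)
      rw [h5, add_zero]
    obtain ⟨x, hx, y, hy, hxy⟩ := Submodule.mem_sup.1
      (hPQ.sup_eq_top ▸ Submodule.mem_top (x := S v))
    refine ⟨x, hx, ?_⟩
    rw [← hxy, map_add] at h3
    have h4 : T.d y ∈ P ⊓ Q := ⟨hdQ y hy, by
      rw [← h3] at hv2
      have := sub_mem hv2 (hdP x hx)
      rwa [add_sub_cancel_left] at this⟩
    rw [hPQ.inf_eq_bot, Submodule.mem_bot] at h4
    rw [h4, add_zero] at h3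
    exact h3
  rw [card_aux (fun i => b.sgn i = 1), Nat.cast_add] at low
  rw [card_aux (fun i => b.sgn i = -1), Nat.cast_add] at up
  have h3 := (mul_le_mul_right low (2 ^ L)).trans (key.trans
    (add_le_add le_rfl (mul_le_mul_right up (2 ^ L))))
  rw [mul_add, mul_add, add_left_comm] at h3
  refine (ENat.add_le_add_iff_left ?_).1 h3
  exact_mod_cast ENat.natCast_ne_top (2 ^ L * Fintype.card {x : ι × ι // x.1 < x.2})

end Base
end DMod
end

section
open TensorProduct

namespace DMod
variable {k : Type} [Field k]

/-- A bounded grading of a differential module (not recorded by `gr`). -/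
structure Gra (X : DMod k) (N : ℕ) where
  π : ℕ → X.V →ₗ[k] X.V
  pp : ∀ s t v, π s (π t v) = if s = t then π t v else 0
  sum : ∀ v, ∑ s ∈ Finset.range N, π s v = v
  d_succ : ∀ s v, X.d (π (s + 1) v) = π s (X.d v)
  d_zero : ∀ v, X.d (π 0 v) = 0
  pu : ∀ i s v, π s (X.u i v) = X.u i (π s v)

/-- A perturbation of the differential by an operator of degree zero. -/
structure Pert (X : DMod k) where
  θ : X.V →ₗ[k] X.V
  sq : ∀ v, θ (θ v) = 0
  anti : ∀ v, X.d (θ v) + θ (X.d v) = 0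
  comm : ∀ i v, X.u i (θ v) = θ (X.u i v)

/-- The perturbed differential module. -/
abbrev Pert.mod {X : DMod k} (T : X.Pert) : DMod k where
  V := X.V
  d := X.d + T.θ
  u := X.u
  gr := fun _ => ⊤
  dd := fun v => by
    have := T.anti v
    simp only [LinearMap.add_apply, map_add, X.dd, T.sq]
    rw [zero_add, add_zero, add_comm, this]
  du := fun i v => by simp only [LinearMap.add_apply, map_add, X.du, T.comm]
  uu := X.uu
  dgr := fun _ _ _ => trivial
  ugr := fun _ _ _ _ => trivial

/-- The induced perturbation of the cone. -/
def Pert.cone {X : DMod k} (T : X.Pert) : X.cone.Pert where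
  θ := (T.θ.prodMap (-T.θ) : X.V × X.V →ₗ[k] X.V × X.V)
  sq := fun (v : X.V × X.V) => Prod.ext (T.sq _) (by
    change -T.θ (-T.θ v.2) = 0
    rw [map_neg, T.sq, neg_zero, neg_zero])
  anti := fun (v : X.V × X.V) => by
    have h1 := T.anti v.1
    have h2 := T.anti v.2
    have h3 := T.comm 0 v.2
    refine Prod.ext ?_ ?_
    · change X.d (T.θ v.1) + X.u 0 (-T.θ v.2) + T.θ (X.d v.1 + X.u 0 v.2) = 0
      rw [map_neg, map_add, h3]
      rw [← h1]
      abel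
    · change -X.d (-T.θ v.2) + -T.θ (-X.d v.2) = 0
      rw [map_neg, map_neg, neg_neg, neg_neg, h2]
  comm := fun i (v : X.V × X.V) => Prod.ext (T.comm _ _) (by
    change X.u (i + 1) (-T.θ v.2) = -T.θ (X.u (i + 1) v.2)
    rw [map_neg, T.comm])

namespace Gra
variable {X : DMod k} {N : ℕ} (P : Gra X N)

/-- The induced grading of the cone. -/
def cone : Gra X.cone (N + 1) where
  π s := (P.π s).prodMap (match s with | 0 => 0 | s + 1 => P.π s)
  pp s t v := by
    obtain ⟨a, b⟩ : X.V × X.V := v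
    cases s <;> cases t
    all_goals
      simp only [LinearMap.prodMap_apply, P.pp, LinearMap.zero_apply, map_zero,
        Nat.add_right_cancel_iff]
      split_ifs
      all_goals first
        | rfl
        | (simp_all; done)
  sum v := by
    obtain ⟨a, b⟩ : X.V × X.V := v
    have h0 : P.π N a = 0 := by
      conv_lhs => rw [← P.sum a]
      rw [map_sum]
      refine Finset.sum_eq_zero fun t ht => ?_
      rw [P.pp, if_neg]
      have := Finset.mem_range.1 ht
      omega
    refine Prod.ext ?_ ?_
    · refine (map_sum (LinearMap.fst k X.V X.V) _ _).trans ?_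
      change ∑ s ∈ Finset.range (N + 1), P.π s a = a
      rw [Finset.sum_range_succ, h0, add_zero, P.sum]
    · refine (map_sum (LinearMap.snd k X.V X.V) _ _).trans ?_
      rw [Finset.sum_range_succ']
      change ∑ s ∈ Finset.range N, P.π s b + 0 = b
      rw [add_zero, P.sum]
  d_succ s v := by
    obtain ⟨a, b⟩ : X.V × X.V := v
    cases s with
    | zero =>
      refine Prod.ext ?_ ?_
      · change X.d (P.π 1 a) + X.u 0 (P.π 0 b) = P.π 0 (X.d a + X.u 0 b)
        rw [P.d_succ, map_add, P.pu]
      · change -X.d (P.π 0 b) = 0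
        rw [P.d_zero, neg_zero]
    | succ s =>
      refine Prod.ext ?_ ?_
      · change X.d (P.π (s + 1 + 1) a) + X.u 0 (P.π (s + 1) b) = P.π (s + 1) (X.d a + X.u 0 b)
        rw [P.d_succ, map_add, P.pu]
      · change -X.d (P.π (s + 1) b) = P.π s (-X.d b)
        rw [P.d_succ, map_neg]
  d_zero v := by
    obtain ⟨a, b⟩ : X.V × X.V := v
    refine Prod.ext ?_ ?_
    · change X.d (P.π 0 a) + X.u 0 0 = 0
      rw [P.d_zero, map_zero, add_zero]
    · change -X.d 0 = 0
      rw [map_zero, neg_zero]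
  pu i s v := by
    obtain ⟨a, b⟩ : X.V × X.V := v
    refine Prod.ext (P.pu _ _ _) ?_
    cases s with
    | zero => exact (map_zero (X.u (i + 1))).symm
    | succ s => exact P.pu _ _ _

/-- Elements of degree at least `s`. -/
def F (s : ℕ) : Submodule k X.V := ⨅ t ∈ Finset.range s, LinearMap.ker (P.π t)

variable {P}
theorem mem_F {s : ℕ} {v : X.V} : v ∈ P.F s ↔ ∀ t < s, P.π t v = 0 := by simp [F]

theorem relLen_pert_le (T : X.Pert) (hT : ∀ s v, P.π s (T.θ v) = T.θ (P.π s v)) (r : ℕ) : ∀ s,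
    N ≤ s + r → relLen k (LinearMap.ker T.mod.d ⊓ P.F s) (LinearMap.range T.mod.d) ≤
      relLen k (LinearMap.ker X.d ⊓ P.F s) (LinearMap.range X.d) := by
  induction r with
  | zero =>
    intro s hs
    refine (relLen_eq_zero ?_).trans_le zero_le
    rintro v ⟨-, hv⟩
    have : v = 0 := by
      rw [← P.sum v]
      refine Finset.sum_eq_zero fun t ht => mem_F.1 hv t ?_
      have := Finset.mem_range.1 ht
      omega
    rw [this]
    exact zero_mem _
  | succ r ih =>
    intro s hs
    have hle : LinearMap.ker X.d ⊓ P.F (s + 1) ≤ LinearMap.ker X.d ⊓ P.F s := fun v hv =>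
      ⟨hv.1, mem_F.2 fun t ht => mem_F.1 hv.2 t (by omega)⟩
    rw [relLen_add hle]
    refine le_trans ?_ (add_le_add (ih (s + 1) (by omega)) le_rfl)
    refine relLen_le_add _ _ _ _ _ _ (P.π s).graph (LinearMap.id : X.V →ₗ[k] X.V).graph ?_ ?_ ?_
    · rintro z ⟨hz1, hz2⟩
      refine ⟨P.π s z, ⟨?_, mem_F.2 fun t ht => by rw [P.pp, if_neg (by omega)]⟩, z, ⟨hz1, hz2⟩,
        by simp [LinearMap.mem_graph_iff], by simp⟩
      cases s with
      | zero => exact P.d_zero z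
      | succ s =>
        have h1 : X.d z + T.θ z = 0 := hz1
        have := congrArg (P.π s) h1
        rw [map_add, hT, mem_F.1 hz2 s (by omega), map_zero, map_zero, add_zero] at this
        exact (P.d_succ s z).trans this
    · intro z w e hz hw hB
      obtain rfl : w = P.π s z := by simpa using e
      obtain ⟨_, ⟨y, rfl⟩, j, hj, hyj⟩ := Submodule.mem_sup.1 hB
      have h1 : P.π s z = X.d (P.π (s + 1) y) := by
        have := congrArg (P.π s) hyj
        rw [map_add, mem_F.1 hj.2 s (by omega), add_zero, P.pp, if_pos rfl] at this
        rw [← this, P.d_succ]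
      have hx : T.mod.d (z - T.mod.d (P.π (s + 1) y)) = 0 := by
        rw [map_sub, T.mod.dd, sub_zero]
        exact hz.1
      refine ⟨z - T.mod.d (P.π (s + 1) y), z - T.mod.d (P.π (s + 1) y),
        by simp [LinearMap.mem_graph_iff], ⟨hx, mem_F.2 fun t ht => ?_⟩,
        ⟨hx, mem_F.2 fun t ht => ?_⟩, ?_⟩
      · change P.π t (z - (X.d _ + T.θ _)) = 0
        rw [map_sub, map_add, hT, P.pp, if_neg (by omega), map_zero, add_zero, ← P.d_succ]
        rcases (Nat.lt_succ_iff.1 ht).lt_or_eq with h | rfl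
        · rw [P.pp, if_neg (by omega), mem_F.1 hz.2 t h, map_zero, sub_zero]
        · rw [P.pp, if_pos rfl, h1, sub_self]
      · change P.π t (z - (X.d _ + T.θ _)) = 0
        rw [map_sub, map_add, hT, P.pp, if_neg (by omega), map_zero, add_zero, ← P.d_succ,
          P.pp, if_neg (by omega), mem_F.1 hz.2 t ht, map_zero, sub_zero]
      · rw [sub_sub_cancel_left]
        exact neg_mem ⟨_, rfl⟩
    · intro v₁ v₂ e _ h _
      obtain rfl : v₂ = v₁ := by simpa using e
      exact h

theorem hK_pert_le (m : ℕ) : ∀ {X : DMod k} {N : ℕ} (P : Gra X N), (∀ s v, v ∈ X.gr s) →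
    ∀ (T : X.Pert), (∀ s v, P.π s (T.θ v) = T.θ (P.π s v)) → ∀ s, hK m T.mod s ≤ hK m X s := by
  induction m with
  | zero =>
    intro X N P hgr T hT s
    have h1 := relLen_pert_le (P := P) T hT N 0 (by omega)
    have h2 : ∀ Y : DMod k, (∀ s v, v ∈ Y.gr s) → ∀ F : Submodule k Y.V, F = ⊤ →
        Y.h s = relLen k (LinearMap.ker Y.d ⊓ F) (LinearMap.range Y.d) := by
      rintro Y hY _ rfl
      refine relLen_congr LinearMap.id ?_ ?_ ?_
      · exact fun z hz => ⟨(mem_Z.1 hz).1, trivial⟩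
      · exact fun w hw => ⟨w, mem_Z.2 ⟨hw.1, hY _ _⟩, by simp⟩
      · exact fun z _ => ⟨fun h => by obtain ⟨y, -, hy⟩ := mem_B.1 h; exact ⟨y, hy⟩,
          fun ⟨y, hy⟩ => mem_B.2 ⟨y, hY _ _, hy⟩⟩
    have hF : P.F 0 = ⊤ := eq_top_iff.2 fun v _ => mem_F.2 fun t ht => by omega
    exact (h2 T.mod (fun _ _ => trivial) (P.F 0) hF).trans_le (h1.trans_eq (h2 X hgr _ hF).symm)
  | succ m ih =>
    intro X N P hgr T hT s
    refine le_trans ?_ (ih P.cone (fun s v => ⟨hgr _ _, hgr _ _⟩) T.cone ?_ s)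
    · refine hK_le_of_equiv (X := T.cone.mod) (Y := T.mod.cone)
        (LinearEquiv.refl k (X.V × X.V)) ?_ ?_ ?_ m s
      · intro (v : X.V × X.V)
        refine Prod.ext ?_ ?_
        · change X.d v.1 + X.u 0 v.2 + T.θ v.1 = X.d v.1 + T.θ v.1 + X.u 0 v.2
          abel
        · change -X.d v.2 + -T.θ v.2 = -(X.d v.2 + T.θ v.2)
          abel
      · exact fun _ _ => rfl
      · exact fun _ _ => ⟨fun _ => trivial, fun _ => ⟨trivial, trivial⟩⟩
    · intro s (v : X.V × X.V)
      refine Prod.ext (hT _ _) ?_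
      cases s with
      | zero => exact neg_zero.symm.trans (congrArg _ (map_zero T.θ).symm)
      | succ s => exact (map_neg (P.π s) _).trans (congrArg _ (hT _ _))

end Gra

section tens
variable {X : DMod k} {ε : X.V →ₗ[k] X.V}

theorem tens_induction {N : ℕ} (P : Grd X N) {W : Type} [AddCommGroup W] [Module k W]
    {f g : X.V ⊗[k] X.V →ₗ[k] W}
    (h : ∀ a b v w, f (P.π a v ⊗ₜ P.π b w) = g (P.π a v ⊗ₜ P.π b w)) (v) : f v = g v := by
  induction v using TensorProduct.induction_on with
  | zero => simp
  | tmul v w =>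
    rw [← P.sum v, ← P.sum w]
    simp only [sum_tmul, tmul_sum, map_sum, h]
  | add v w h1 h2 => rw [map_add, map_add, h1, h2]

/-- The component of degree `s` of the tensor square. -/
noncomputable def tensπ {N : ℕ} (P : Grd X N) (s : ℕ) : X.V ⊗[k] X.V →ₗ[k] X.V ⊗[k] X.V :=
  ∑ x ∈ Finset.HasAntidiagonal.antidiagonal s, map (P.π x.1) (P.π x.2)

theorem tensπ_tmul {N : ℕ} (P : Grd X N) (s a b : ℕ) (v w : X.V) :
    tensπ P s (P.π a v ⊗ₜ P.π b w) = if s = a + b then P.π a v ⊗ₜ P.π b w else 0 := by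
  simp only [tensπ, LinearMap.sum_apply, map_tmul, P.pp]
  split_ifs with h
  · rw [Finset.sum_eq_single_of_mem (a, b) (by simp [h])]
    · simp
    · rintro ⟨a', b'⟩ _ h'
      rw [Ne, Prod.mk.injEq, not_and_or] at h'
      rcases h' with h' | h' <;> simp [h']
  · refine Finset.sum_eq_zero fun x hx => ?_
    rw [Finset.HasAntidiagonal.mem_antidiagonal] at hx
    by_cases h1 : x.1 = a
    · rw [if_neg (show ¬ x.2 = b by omega), tmul_zero]
    · rw [if_neg h1, zero_tmul]

/-- The total grading of the tensor square. -/
noncomputable def tensGra {N : ℕ} (P : Grd X N) (hd : ∀ v, X.d (ε v) = -ε (X.d v))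
    (hu : ∀ i v, X.u i (ε v) = ε (X.u i v)) (hε : ∀ v, ε v = v) :
    Gra (X.tens X ε hd hu) (2 * N) where
  π := tensπ P
  pp s t v := by
    refine tens_induction P (f := tensπ P s ∘ₗ tensπ P t)
      (g := if s = t then tensπ P t else 0) (fun a b v w => ?_) v |>.trans ?_
    · rw [LinearMap.comp_apply, tensπ_tmul]
      split_ifs with h1 h2 h2
      · rw [h2]
      · rw [tensπ_tmul, if_neg (by omega)]; rfl
      · rw [map_zero, tensπ_tmul, if_neg h1]
      · simp
    · split_ifs <;> rfl
  sum v := by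
    refine (LinearMap.sum_apply _ _ _).symm.trans
      (tens_induction P (g := LinearMap.id) (fun a b v w => ?_) v)
    simp only [LinearMap.sum_apply, tensπ_tmul, LinearMap.id_apply]
    rw [Finset.sum_ite_eq']
    split_ifs with h
    · rfl
    · rw [Finset.mem_range] at h
      rcases le_or_gt N a with ha | ha
      · rw [P.pi_eq_zero ha, zero_tmul]
      · rw [P.pi_eq_zero (show N ≤ b by omega), tmul_zero]
  d_succ s v := by
    refine tens_induction P (f := (X.tens X ε hd hu).d ∘ₗ tensπ P (s + 1))
      (g := tensπ P s ∘ₗ (X.tens X ε hd hu).d) (fun a b v w => ?_) v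
    have h1 : ∀ c v, (c = 0 ∧ X.d (P.π c v) = 0) ∨ ∃ c', c = c' + 1 ∧
        X.d (P.π c v) = P.π c' (X.d v) := fun c v => by
      cases c with
      | zero => exact Or.inl ⟨rfl, P.d_zero v⟩
      | succ c => exact Or.inr ⟨c, rfl, P.d_succ c v⟩
    rw [LinearMap.comp_apply, LinearMap.comp_apply, tensπ_tmul, apply_ite (X.tens X ε hd hu).d,
      map_zero]
    change (if _ then map X.d LinearMap.id _ + map ε X.d _ else _) =
      tensπ P s (map X.d LinearMap.id _ + map ε X.d _)
    simp only [map_tmul, LinearMap.id_apply, hε, map_add]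
    have h2 : tensπ P s (X.d (P.π a v) ⊗ₜ P.π b w) =
        if s + 1 = a + b then X.d (P.π a v) ⊗ₜ P.π b w else 0 := by
      rcases h1 a v with ⟨-, h⟩ | ⟨c, rfl, h⟩
      · simp [h]
      · rw [h, tensπ_tmul]
        exact if_congr (by omega) rfl rfl
    have h3 : tensπ P s (P.π a v ⊗ₜ X.d (P.π b w)) =
        if s + 1 = a + b then P.π a v ⊗ₜ X.d (P.π b w) else 0 := by
      rcases h1 b w with ⟨-, h⟩ | ⟨c, rfl, h⟩
      · simp [h]
      · rw [h, tensπ_tmul]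
        exact if_congr (by omega) rfl rfl
    rw [h2, h3]
    split_ifs
    · rfl
    · rw [add_zero]
  d_zero v := by
    change map X.d LinearMap.id _ + map ε X.d _ = 0
    simp only [tensπ, Finset.Nat.antidiagonal_zero, Finset.sum_singleton]
    induction v using TensorProduct.induction_on with
    | zero => simp
    | tmul v w => simp [P.d_zero]
    | add v w h1 h2 => simp only [map_add] at h1 h2 ⊢; rw [add_add_add_comm, h1, h2, add_zero]
  pu i s v := by
    refine tens_induction P (f := tensπ P s ∘ₗ (X.tens X ε hd hu).u i)
      (g := (X.tens X ε hd hu).u i ∘ₗ tensπ P s) (fun a b v w => ?_) v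
    rw [LinearMap.comp_apply, LinearMap.comp_apply, tensπ_tmul, apply_ite ((X.tens X ε hd hu).u i),
      map_zero]
    change tensπ P s (map LinearMap.id _ _ - map _ LinearMap.id _) =
      if _ then map LinearMap.id _ _ - map _ LinearMap.id _ else _
    simp only [map_tmul, LinearMap.id_apply, map_sub, ← P.pu, tensπ_tmul]
    split_ifs
    · rfl
    · rw [sub_zero]

theorem Base.le_of_two_eq_zero {N : ℕ} (P : Grd X N) {ι : Type} [Fintype ι] [DecidableEq ι]
    (b : Base X ε ι) (h2 : (2 : k) = 0) (hd : ∀ v, X.d (ε v) = -ε (X.d v))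
    (hu : ∀ i v, X.u i (ε v) = ε (X.u i v)) (hε : ∀ v, ε v = v) (L : ℕ) :
    (2 ^ L * Fintype.card ι : ℕ∞) ≤ hK L (X.tens X ε hd hu) 0 := by
  have two : ∀ {W : Type} [AddCommGroup W] [Module k W] (w : W), w + w = 0 := fun w => by
    rw [← two_smul k, h2, zero_smul]
  have neg : ∀ {W : Type} [AddCommGroup W] [Module k W] (w : W), -w = w := fun w =>
    neg_eq_of_add_eq_zero_left (two w)
  let sw : X.V ⊗[k] X.V →ₗ[k] X.V ⊗[k] X.V := (TensorProduct.comm k X.V X.V).toLinearMap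
  have sw_tmul : ∀ v w : X.V, sw (v ⊗ₜ w) = w ⊗ₜ v := fun _ _ => rfl
  have sw_sw : ∀ v, sw (sw v) = v := (TensorProduct.comm k X.V X.V).symm_apply_apply
  set T := X.tens X ε hd hu
  have sw_d : ∀ v, T.d (sw v) = sw (T.d v) := fun v => by
    change (map X.d LinearMap.id + map ε X.d : _ →ₗ[k] _) (sw v) =
      sw ((map X.d LinearMap.id + map ε X.d : _ →ₗ[k] _) v)
    induction v using TensorProduct.induction_on with
    | zero => simp
    | tmul v w =>
      simp only [LinearMap.add_apply, map_tmul, LinearMap.id_apply, map_add, sw_tmul, hε]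
      rw [add_comm]
    | add v w h1 h2 => rw [map_add, map_add, map_add, map_add, h1, h2]
  have sw_u : ∀ i v, T.u i (sw v) = sw (T.u i v) := fun i v => by
    change (map LinearMap.id (X.u i) - map (X.u i) LinearMap.id : _ →ₗ[k] _) (sw v) =
      sw ((map LinearMap.id (X.u i) - map (X.u i) LinearMap.id : _ →ₗ[k] _) v)
    induction v using TensorProduct.induction_on with
    | zero => simp
    | tmul v w =>
      simp only [LinearMap.sub_apply, map_tmul, LinearMap.id_apply, map_sub, sw_tmul]
      rw [← neg_sub, neg]
    | add v w h1 h2 => rw [map_add, map_add, map_add, map_add, h1, h2]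
  let Θ : T.Pert :=
    { θ := (LinearMap.id + sw : X.V ⊗[k] X.V →ₗ[k] X.V ⊗[k] X.V)
      sq := fun v => by
        change (v + sw v) + sw (v + sw v) = 0
        rw [map_add, sw_sw, add_comm (sw v) v]
        exact two _
      anti := fun v => by
        change T.d (v + sw v) + (T.d v + sw (T.d v)) = 0
        rw [map_add, sw_d]
        exact two _
      comm := fun i v => by
        change T.u i (v + sw v) = T.u i v + sw (T.u i v)
        rw [map_add, sw_u] }
  refine le_trans ?_ (Gra.hK_pert_le L (tensGra P hd hu hε) (fun _ _ => trivial) Θ ?_ 0)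
  · refine le_trans ?_ (two_pow_mul_half_le_of_zh (X := Θ.mod) (fun _ _ => trivial) (m := L) ?_ 0)
    · refine mul_le_mul_right (card_le_relLen (fun i => b.el i ⊗ₜ[k] b.el i)
        (fun i => b.φφ i i) ?_ ?_ ?_) _
      · intro i
        refine ⟨?_, trivial⟩
        change (map X.d LinearMap.id _ + map ε X.d _) +
          (b.el i ⊗ₜ[k] b.el i + b.el i ⊗ₜ[k] b.el i) = 0
        rw [two]
        simp [b.d_el]
      · rintro i _ ⟨v, -, rfl⟩
        change b.φφ i i (T.d v + (v + sw v)) = 0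
        rw [map_add, b.φφ_d, zero_add]
        induction v using TensorProduct.induction_on with
        | zero => simp
        | tmul v w =>
          rw [sw_tmul, map_add, b.φφ_tmul, b.φφ_tmul, mul_comm]
          exact two _
        | add v w h1 h2 =>
          rw [map_add sw, add_add_add_comm, map_add, h1, h2, add_zero]
      · intro i j
        rw [b.φφ_tmul, b.φ_el]
        split_ifs <;> simp
    · intro i _
      let g : X.V ⊗[k] X.V →ₗ[k] X.V ⊗[k] X.V := map (X.u i) LinearMap.id
      have g_d : ∀ v, T.d (g v) = g (T.d v) := fun v => by
        change (map X.d LinearMap.id + map ε X.d : _ →ₗ[k] _) (g v) =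
          g ((map X.d LinearMap.id + map ε X.d : _ →ₗ[k] _) v)
        induction v using TensorProduct.induction_on with
        | zero => simp
        | tmul v w => simp [g, X.du, hε]
        | add v w h1 h2 => rw [map_add, map_add, map_add, map_add, h1, h2]
      have g_u : ∀ j v, T.u j (g v) = g (T.u j v) := fun j v => by
        change (map LinearMap.id (X.u j) - map (X.u j) LinearMap.id : _ →ₗ[k] _) (g v) =
          g ((map LinearMap.id (X.u j) - map (X.u j) LinearMap.id : _ →ₗ[k] _) v)
        induction v using TensorProduct.induction_on with
        | zero => simp
        | tmul v w => simp [g, X.uu i j]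
        | add v w h1 h2 => rw [map_add, map_add, map_add, map_add, h1, h2]
      have g_sw : ∀ v, g v + sw (g (sw v)) = T.u i v := fun v => by
        change _ = (map LinearMap.id (X.u i) - map (X.u i) LinearMap.id : _ →ₗ[k] _) v
        induction v using TensorProduct.induction_on with
        | zero => simp
        | tmul v w =>
          simp only [g, sw_tmul, map_tmul, LinearMap.id_apply, LinearMap.sub_apply]
          rw [sub_eq_add_neg, neg, add_comm]
        | add v w h1 h2 =>
          rw [map_add, map_add, map_add, map_add, map_add, add_add_add_comm, h1, h2]
      refine ⟨sw ∘ₗ g, fun _ _ _ => trivial, fun v => ?_, fun j v => ?_⟩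
      · change T.d (sw (g v)) + (sw (g v) + sw (sw (g v))) + sw (g (T.d v + (v + sw v))) = T.u i v
        rw [sw_d, g_d, map_add, map_add, map_add, map_add, sw_sw, ← g_sw v, ← sub_eq_zero]
        refine Eq.trans ?_ ((congrArg₂ (· + ·) (two (sw (g (T.d v)))) (two (sw (g v)))).trans
          (add_zero 0))
        abel
      · change sw (g (T.u j v)) = T.u j (sw (g v))
        rw [sw_u, g_u]
  · intro s v
    change tensπ P s (v + sw v) = tensπ P s v + sw (tensπ P s v)
    rw [map_add]
    congr 1
    refine tens_induction P (f := tensπ P s ∘ₗ sw) (g := sw ∘ₗ tensπ P s) (fun a b v w => ?_) v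
    rw [LinearMap.comp_apply, LinearMap.comp_apply, sw_tmul, tensπ_tmul, tensπ_tmul,
      apply_ite sw, sw_tmul, map_zero]
    exact if_congr (by omega) rfl rfl

end tens
end DMod
end

section
open TensorProduct

namespace DMod
variable {k : Type} [Field k]

theorem Grd.two_pow_mul_le {X : DMod k} {M : ℕ} (P : Grd X (M + 1))
    (h : ∀ s < M + 1, X.h s ≠ ⊤) (L : ℕ) :
    2 ^ L * X.h 0 ≤ hK L (X.tens X P.ε P.d_ε P.u_ε) 0 +
      2 ^ L * ∑ s ∈ Finset.range M, X.h (s + 1 : ℕ) := by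
  obtain ⟨n, hn, b, hb⟩ := P.exists_base h
  have e0 : X.h 0 = n 0 := hn 0 (by omega)
  have e1 : ∑ s ∈ Finset.range M, X.h (s + 1 : ℕ) =
      ((∑ s ∈ Finset.range M, n (s + 1) : ℕ) : ℕ∞) := by
    rw [Nat.cast_sum]
    exact Finset.sum_congr rfl fun s hs => hn (s + 1) (by
      have := Finset.mem_range.1 hs
      omega)
  rw [e0, e1]
  have c0 : Function.Injective (fun j : Fin (n 0) =>
      (⟨0, j⟩ : Σ s : Fin (M + 1), Fin (n s))) := fun i j hij => eq_of_heq (Sigma.mk.inj_iff.1 hij).2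
  have c1 : Fintype.card (Σ s : Fin (M + 1), Fin (n s)) =
      ∑ s ∈ Finset.range M, n (s + 1) + n 0 := by
    rw [Fintype.card_sigma]
    simp only [Fintype.card_fin]
    rw [Fin.sum_univ_eq_sum_range n, Finset.sum_range_succ']
  by_cases h2 : (2 : k) = 0
  · refine le_trans ?_ ((b.le_of_two_eq_zero P h2 P.d_ε P.u_ε (fun v => ?_) L).trans le_self_add)
    · refine mul_le_mul_right (Nat.cast_le.2 ?_) _
      rw [c1]
      omega
    · refine P.ext_pi fun s => ?_
      rw [P.pi_ε]
      have : -P.π s v = P.π s v := by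
        refine neg_eq_of_add_eq_zero_left ?_
        rw [← two_smul k, h2, zero_smul]
      rcases neg_one_pow_eq_or ℤˣ s with h | h <;> simp [h, this]
  · let _ : LinearOrder (Σ s : Fin (M + 1), Fin (n s)) :=
      LinearOrder.lift' (Fintype.equivFin _) (Equiv.injective _)
    refine le_trans ?_ ((b.le_of_two_ne_zero h2 P.d_ε P.u_ε P.ε_ε L).trans
      (add_le_add le_rfl ?_))
    · refine mul_le_mul_right (Nat.cast_le.2 ?_) _
      rw [← Fintype.card_fin (n 0)]
      exact Fintype.card_le_of_injective (fun j => ⟨⟨0, j⟩, by rw [hb]; rfl⟩)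
        fun i j hij => c0 (congrArg Subtype.val hij)
    · refine mul_le_mul_right (Nat.cast_le.2 ?_) _
      have : Fintype.card {i // b.sgn i = -1} + Fintype.card (Fin (n 0)) ≤
          Fintype.card (Σ s : Fin (M + 1), Fin (n s)) := by
        rw [← Fintype.card_sum]
        refine Fintype.card_le_of_injective _ (Subtype.val_injective.sumElim c0 ?_)
        rintro ⟨i, hi⟩ j hij
        change i = _ at hij
        rw [hb, hij] at hi
        exact absurd hi (by simp)
      rw [c1, Fintype.card_fin] at this
      omega

end DMod
end

section Devissage
variable {S : Type} [CommRing S]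

/-- Every chain of primes starting at the prime `Q` has fewer than `r` strict steps plus one. -/
def DimLT : ℕ → Ideal S → Prop
  | 0, _ => False
  | r + 1, Q => ∀ p : Ideal S, p.IsPrime → Q < p → DimLT r p

/-- Length-like functions on modules, controlled by the elements `x i ^ n`. -/
structure Dev {ι : Type} (x : ι → S) (n : ℕ) (C₀ : ℕ∞)
    (ψ : ∀ (M : Type) [AddCommGroup M] [Module S M], ℕ∞) : Prop where
  zero : ∀ (M : Type) [AddCommGroup M] [Module S M] [Subsingleton M], ψ M = 0
  mid : ∀ (M₁ M₂ M₃ : Type) [AddCommGroup M₁] [AddCommGroup M₂] [AddCommGroup M₃]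
    [Module S M₁] [Module S M₂] [Module S M₃] (f : M₁ →ₗ[S] M₂) (g : M₂ →ₗ[S] M₃),
    Function.Injective f → Function.Surjective g → Function.Exact f g → ψ M₂ ≤ ψ M₁ + ψ M₃
  quo : ∀ (i : ι) (M M' : Type) [AddCommGroup M] [AddCommGroup M'] [Module S M] [Module S M']
    (p : M →ₗ[S] M'), (∀ v : M, x i ^ n • v = 0 → v = 0) → Function.Surjective p →
    (∀ v, p v = 0 ↔ ∃ w, x i ^ n • w = v) → ψ M ≤ ψ M'
  base : ∀ Q : Ideal S, Q.IsPrime → (∀ i, x i ∈ Q) → ψ (S ⧸ Q) ≤ C₀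

theorem Dev.le_of_equiv {ι : Type} {x : ι → S} {n : ℕ} {C₀ : ℕ∞}
    {ψ : ∀ (M : Type) [AddCommGroup M] [Module S M], ℕ∞} (h : Dev x n C₀ ψ)
    {M M' : Type} [AddCommGroup M] [AddCommGroup M'] [Module S M] [Module S M']
    (e : M ≃ₗ[S] M') : ψ M ≤ ψ M' := by
  have := h.mid M' M PUnit e.symm.toLinearMap 0 e.symm.injective (fun x => ⟨0, rfl⟩)
    (fun y => ⟨fun _ => e.symm.surjective y, fun _ => rfl⟩)
  rwa [h.zero PUnit, add_zero] at this

/-- Polynomial growth of order `r`, uniformly in the length-like function. -/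
def Growth {ι : Type} (x : ι → S) (r : ℕ) (M : Type) [AddCommGroup M] [Module S M] : Prop :=
  ∃ C : ℕ, ∀ (n : ℕ) (C₀ : ℕ∞) (ψ : ∀ (M : Type) [AddCommGroup M] [Module S M], ℕ∞),
    1 ≤ n → Dev x n C₀ ψ → n * ψ M ≤ C * C₀ * n ^ r

variable {ι : Type} {x : ι → S} {r : ℕ}

theorem Growth.of_equiv {M M' : Type} [AddCommGroup M] [AddCommGroup M'] [Module S M]
    [Module S M'] (e : M ≃ₗ[S] M') (h : Growth x r M') : Growth x r M := by
  obtain ⟨C, hC⟩ := h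
  exact ⟨C, fun n C₀ ψ hn hψ => (by gcongr; exact hψ.le_of_equiv e : _ ≤ n * ψ M').trans
    (hC n C₀ ψ hn hψ)⟩

theorem growth_of_subsingleton (M : Type) [AddCommGroup M] [Module S M] [Subsingleton M] :
    Growth x r M :=
  ⟨0, fun n C₀ ψ _ hψ => by rw [hψ.zero]; simp⟩

theorem Growth.mid {M₁ M₂ M₃ : Type} [AddCommGroup M₁] [AddCommGroup M₂] [AddCommGroup M₃]
    [Module S M₁] [Module S M₂] [Module S M₃] (f : M₁ →ₗ[S] M₂) (g : M₂ →ₗ[S] M₃)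
    (hf : Function.Injective f) (hg : Function.Surjective g) (hfg : Function.Exact f g)
    (h₁ : Growth x r M₁) (h₃ : Growth x r M₃) : Growth x r M₂ := by
  obtain ⟨C, hC⟩ := h₁
  obtain ⟨C', hC'⟩ := h₃
  refine ⟨C + C', fun n C₀ ψ hn hψ => ?_⟩
  calc n * ψ M₂ ≤ n * (ψ M₁ + ψ M₃) := by gcongr; exact hψ.mid _ _ _ f g hf hg hfg
    _ = n * ψ M₁ + n * ψ M₃ := mul_add _ _ _
    _ ≤ C * C₀ * n ^ r + C' * C₀ * n ^ r := add_le_add (hC n C₀ ψ hn hψ) (hC' n C₀ ψ hn hψ)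
    _ = _ := by push_cast; ring

theorem Growth.of_finite [IsNoetherianRing S] (J : Ideal S)
    (h : ∀ Q : Ideal S, Q.IsPrime → J ≤ Q → Growth x r (S ⧸ Q))
    (M : Type) [AddCommGroup M] [Module S M] (hM : Module.Finite S M)
    (hJ : J ≤ Module.annihilator S M) : Growth x r M := by
  revert hJ
  refine IsNoetherianRing.induction_on_isQuotientEquivQuotientPrime S hM
    (motive := fun N _ _ _ => J ≤ Module.annihilator S N → Growth x r N) ?_ ?_ ?_
  · intro N _ _ _ _ _
    exact growth_of_subsingleton N
  · intro N _ _ _ p e hJ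
    refine (h p.1 p.2 fun a ha => ?_).of_equiv e
    rw [e.annihilator_eq, Ideal.annihilator_quotient] at hJ
    exact hJ ha
  · intro N₁ _ _ _ N₂ _ _ _ N₃ _ _ _ f g hf hg hfg h₁ h₃ hJ
    exact Growth.mid f g hf hg hfg (h₁ (hJ.trans (f.annihilator_le_of_injective hf)))
      (h₃ (hJ.trans (g.annihilator_le_of_surjective hg)))

/-- The submodule `a ^ j M`. -/
def powSub (a : S) (M : Type) [AddCommGroup M] [Module S M] (j : ℕ) : Submodule S M :=
  LinearMap.range (LinearMap.lsmul S M (a ^ j))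

theorem mem_powSub {a : S} {M : Type} [AddCommGroup M] [Module S M] {j : ℕ} {v : M} :
    v ∈ powSub a M j ↔ ∃ w, a ^ j • w = v := Iff.rfl

theorem Dev.powSub_le {n : ℕ} {C₀ : ℕ∞}
    {ψ : ∀ (M : Type) [AddCommGroup M] [Module S M], ℕ∞} (h : Dev x n C₀ ψ)
    (a : S) {M : Type} [AddCommGroup M] [Module S M] (ha : ∀ v : M, a • v = 0 → v = 0) (j : ℕ) :
    ψ (M ⧸ powSub a M j) ≤ j * ψ (M ⧸ powSub a M 1) := by
  induction j with
  | zero =>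
    have : Subsingleton (M ⧸ powSub a M 0) :=
      Submodule.Quotient.subsingleton_iff.2 (eq_top_iff.2 fun v _ => ⟨v, by simp⟩)
    rw [h.zero]; exact zero_le
  | succ j ih =>
    have hf : powSub a M j ≤ (powSub a M (j + 1)).comap (LinearMap.lsmul S M a) := by
      rintro _ ⟨w, rfl⟩
      exact ⟨w, by simp [pow_succ', mul_smul, smul_comm a]⟩
    have hg : powSub a M (j + 1) ≤ powSub a M 1 := by
      rintro _ ⟨w, rfl⟩
      exact ⟨a ^ j • w, by simp [pow_succ', mul_smul, smul_comm a]⟩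
    refine (h.mid _ _ _ ((powSub a M j).mapQ (powSub a M (j + 1)) _ hf)
      (Submodule.factor hg) ?_ (Submodule.factor_surjective hg) ?_).trans
      ((add_le_add_left ih _).trans_eq (by push_cast; ring))
    · rw [← LinearMap.ker_eq_bot, Submodule.eq_bot_iff]
      intro y
      induction y using Submodule.Quotient.induction_on with | _ y
      intro hy
      have hy' : a • y ∈ powSub a M (j + 1) := (Submodule.Quotient.mk_eq_zero _).1 hy
      obtain ⟨w, hw⟩ := mem_powSub.1 hy'
      refine (Submodule.Quotient.mk_eq_zero _).2 ⟨w, ?_⟩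
      refine sub_eq_zero.1 (ha _ ?_)
      simp only [LinearMap.lsmul_apply, smul_sub]
      rw [← hw, pow_succ', mul_smul, sub_self]
    · intro y
      induction y using Submodule.Quotient.induction_on with | _ y
      constructor
      · intro hy
        have hy' : y ∈ powSub a M 1 := (Submodule.Quotient.mk_eq_zero _).1 hy
        obtain ⟨w, hw⟩ := mem_powSub.1 hy'
        refine ⟨Submodule.Quotient.mk w, ?_⟩
        rw [← hw, pow_one]; rfl
      · rintro ⟨z, hz⟩
        induction z using Submodule.Quotient.induction_on with | _ z
        rw [← hz]
        exact (Submodule.Quotient.mk_eq_zero _).2 ⟨z, by simp⟩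

theorem growth_quotient [IsNoetherianRing S] (r : ℕ) (Q : Ideal S) (hQ : Q.IsPrime)
    (hr : DimLT r Q) : Growth x r (S ⧸ Q) := by
  induction r generalizing Q with
  | zero => exact hr.elim
  | succ r ih =>
    by_cases hx : ∀ i, x i ∈ Q
    · refine ⟨1, fun n C₀ ψ hn hψ => ?_⟩
      calc n * ψ (S ⧸ Q) ≤ n * C₀ := by gcongr; exact hψ.base Q hQ hx
        _ ≤ n ^ (r + 1) * C₀ := by
          gcongr
          exact_mod_cast Nat.le_self_pow (by omega) n
        _ = _ := by rw [Nat.cast_one, one_mul, mul_comm]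
    · push Not at hx
      obtain ⟨i, hi⟩ := hx
      have hreg : ∀ v : S ⧸ Q, x i • v = 0 → v = 0 := by
        intro v hv
        induction v using Submodule.Quotient.induction_on with | _ v
        have : x i * v ∈ Q := (Submodule.Quotient.mk_eq_zero _).1 hv
        exact (Submodule.Quotient.mk_eq_zero _).2 ((hQ.mem_or_mem this).resolve_left hi)
      have hgr : Growth x r ((S ⧸ Q) ⧸ powSub (x i) (S ⧸ Q) 1) := by
        refine Growth.of_finite (Q ⊔ Ideal.span {x i}) (fun p hp hle => ih p hp ?_) _
          inferInstance ?_
        · refine hr p hp (lt_of_le_of_ne (le_sup_left.trans hle) fun h => hi ?_)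
          rw [h]
          exact hle (Ideal.mem_sup_right (Ideal.mem_span_singleton_self _))
        · refine sup_le (fun a ha => ?_) ((Ideal.span_singleton_le_iff_mem _).2 ?_)
          · refine Module.mem_annihilator.2 fun v => ?_
            induction v using Submodule.Quotient.induction_on with | _ v
            induction v using Submodule.Quotient.induction_on with | _ v
            refine congrArg Submodule.Quotient.mk ((Submodule.Quotient.mk_eq_zero _).2 ?_)
            exact Q.mul_mem_right _ ha
          · refine Module.mem_annihilator.2 fun v => ?_
            induction v using Submodule.Quotient.induction_on with | _ v
            exact (Submodule.Quotient.mk_eq_zero _).2 ⟨v, by simp⟩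
      obtain ⟨C, hC⟩ := hgr
      refine ⟨C, fun n C₀ ψ hn hψ => ?_⟩
      have h1 : ψ (S ⧸ Q) ≤ n * ψ ((S ⧸ Q) ⧸ powSub (x i) (S ⧸ Q) 1) := by
        refine (hψ.quo i _ _ (powSub (x i) (S ⧸ Q) n).mkQ ?_ (Submodule.mkQ_surjective _)
          (fun v => ?_)).trans (hψ.powSub_le (x i) hreg n)
        · intro v
          intro hv
          have : ∀ (j : ℕ) (v : S ⧸ Q), x i ^ j • v = 0 → v = 0 := by
            intro j
            induction j with
            | zero => simp
            | succ j ihj =>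
              intro v hv
              exact hreg v (ihj _ (by rwa [← mul_smul, ← pow_succ]))
          exact this _ v hv
        · exact (Submodule.Quotient.mk_eq_zero _).trans mem_powSub
      calc n * ψ (S ⧸ Q) ≤ n * (n * ψ ((S ⧸ Q) ⧸ powSub (x i) (S ⧸ Q) 1)) := by gcongr
        _ ≤ n * (C * C₀ * n ^ r) := mul_le_mul_right (hC n C₀ ψ hn hψ) _
        _ = _ := by ring

theorem DimLT.succ {r : ℕ} {Q : Ideal S} (h : DimLT r Q) : DimLT (r + 1) Q := by
  induction r generalizing Q with
  | zero => exact h.elim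
  | succ r ih => exact fun p hp hlt => ih (h p hp hlt)

/-- Growth of modules killed by a nonzero element of a domain. -/
theorem growth_of_smul_eq_zero [IsNoetherianRing S] [IsDomain S] {r : ℕ}
    (hr : DimLT (r + 1) (⊥ : Ideal S)) {c : S} (hc : c ≠ 0) (M : Type) [AddCommGroup M]
    [Module S M] [Module.Finite S M] (hM : ∀ v : M, c • v = 0) : Growth x r M := by
  refine Growth.of_finite (Ideal.span {c}) (fun Q hQ hle => growth_quotient r Q hQ
    (hr Q hQ (bot_lt_iff_ne_bot.2 fun h => hc ?_))) M inferInstance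
    ((Ideal.span_singleton_le_iff_mem _).2 (Module.mem_annihilator.2 hM))
  have := hle (Ideal.mem_span_singleton_self c)
  rwa [h, Ideal.mem_bot] at this

/-- Growth of arbitrary finite modules. -/
theorem growth_of_dimLT [IsNoetherianRing S] {r : ℕ}
    (hr : DimLT (r + 1) (⊥ : Ideal S)) (M : Type) [AddCommGroup M]
    [Module S M] [Module.Finite S M] : Growth x (r + 1) M :=
  Growth.of_finite ⊥ (fun Q hQ _ => growth_quotient _ Q hQ (by
    rcases eq_or_ne Q ⊥ with rfl | h
    · exact hr
    · exact (hr Q hQ (bot_lt_iff_ne_bot.2 h)).succ)) M inferInstance bot_le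

end Devissage

section
open TensorProduct

section scalars
variable (k : Type) [Field k] {S : Type} [CommRing S] [Algebra k S]

/-- The `k`-module structure of an `S`-module. -/
abbrev kMod (S : Type) [CommRing S] [Algebra k S] (V : Type) [AddCommGroup V] [Module S V] :
    Module k V :=
  Module.compHom V (algebraMap k S)

/-- Restriction of scalars of a linear map. -/
abbrev kLin {V W : Type} [AddCommGroup V] [AddCommGroup W] [Module S V] [Module S W]
    (f : V →ₗ[S] W) : @LinearMap k k _ _ (RingHom.id k) V W _ _ (kMod k S V) (kMod k S W) :=
  letI := kMod k S V
  letI := kMod k S W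
  { toFun := f, map_add' := f.map_add, map_smul' := fun c v => f.map_smul (algebraMap k S c) v }

/-- Restriction of scalars of a submodule. -/
abbrev kSub {V : Type} [AddCommGroup V] [Module S V] (W : Submodule S V) :
    @Submodule k V _ _ (kMod k S V) :=
  letI := kMod k S V
  { carrier := W, add_mem' := W.add_mem, zero_mem' := W.zero_mem,
    smul_mem' := fun c _ hv => W.smul_mem (algebraMap k S c) hv }

/-- The length over `k` of an `S`-module. -/
noncomputable def kLen (S : Type) [CommRing S] [Algebra k S] (V : Type) [AddCommGroup V]
    [Module S V] : ℕ∞ :=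
  @Module.length k V _ _ (kMod k S V)

/-- The submodule that is everything or nothing according to a proposition. -/
def propSub (S V : Type) [CommRing S] [AddCommGroup V] [Module S V] (P : Prop) :
    Submodule S V where
  carrier := {v | P ∨ v = 0}
  add_mem' := by
    rintro a b (h | rfl) (h' | rfl)
    exacts [Or.inl h, Or.inl h, Or.inl h', Or.inr (add_zero 0)]
  zero_mem' := Or.inr rfl
  smul_mem' := by
    rintro c a (h | rfl)
    exacts [Or.inl h, Or.inr (smul_zero c)]

end scalars

namespace DMod
variable {k : Type} [Field k] {S : Type} [CommRing S] [Algebra k S]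

/-- A complex of `S`-modules, with operators given by elements of `S`. -/
abbrev dm (w : ℕ → S) (V : Type) [AddCommGroup V] [Module S V] (d : V →ₗ[S] V)
    (dd : ∀ v, d (d v) = 0) (gr : ℤ → Submodule S V)
    (dgr : ∀ s v, v ∈ gr s → d v ∈ gr (s - 1)) : DMod k where
  V := V
  mod := kMod k S V
  d := kLin k d
  u := fun i => kLin k (LinearMap.lsmul S V (w i))
  gr := fun s => kSub k (gr s)
  dd := dd
  du := fun i v => d.map_smul (w i) v
  uu := fun i j v => smul_comm (w i) (w j) v
  dgr := dgr
  ugr := fun i s v hv => (gr s).smul_mem (w i) hv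

/-- Short exact sequences from linear data. -/
def SES.ofDm {w : ℕ → S} {V₁ V₂ V₃ : Type} [AddCommGroup V₁] [AddCommGroup V₂] [AddCommGroup V₃]
    [Module S V₁] [Module S V₂] [Module S V₃]
    {d₁ : V₁ →ₗ[S] V₁} {d₂ : V₂ →ₗ[S] V₂} {d₃ : V₃ →ₗ[S] V₃} {dd₁ dd₂ dd₃}
    {gr₁ : ℤ → Submodule S V₁} {gr₂ : ℤ → Submodule S V₂} {gr₃ : ℤ → Submodule S V₃}
    {dgr₁ dgr₂ dgr₃} (f : V₁ →ₗ[S] V₂) (g : V₂ →ₗ[S] V₃) (inj : Function.Injective f)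
    (surj : Function.Surjective g) (hfg : Function.Exact f g)
    (hf : ∀ v, f (d₁ v) = d₂ (f v)) (hg : ∀ v, g (d₂ v) = d₃ (g v))
    (hgf : ∀ s v, f v ∈ gr₂ s ↔ v ∈ gr₁ s) (hgg : ∀ s v, v ∈ gr₂ s → g v ∈ gr₃ s)
    (hl : ∀ s v, v ∈ gr₃ s → ∃ y ∈ gr₂ s, g y = v) :
    SES (k := k) (DMod.dm w V₁ d₁ dd₁ gr₁ dgr₁) (DMod.dm w V₂ d₂ dd₂ gr₂ dgr₂)
      (DMod.dm w V₃ d₃ dd₃ gr₃ dgr₃) where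
  i := kLin k f
  p := kLin k g
  inj := inj
  surj := surj
  exact := fun y hy => (hfg y).1 hy
  pi := fun x => hfg.apply_apply_eq_zero x
  id := hf
  pd := hg
  iu := fun n x => f.map_smul (w n) x
  pu := fun n x => g.map_smul (w n) x
  igr := hgf
  pgr := hgg
  lift := hl

/-- A module with zero differential, homogeneous in the degrees satisfying `A`. -/
abbrev mo (w : ℕ → S) (A : ℤ → Prop) (V : Type) [AddCommGroup V] [Module S V] : DMod k :=
  dm w V 0 (fun _ => rfl) (fun s => propSub S V (A s)) (fun _ _ _ => zero_mem _)

def SES.ofMo (w : ℕ → S) (A : ℤ → Prop) {V₁ V₂ V₃ : Type} [AddCommGroup V₁] [AddCommGroup V₂]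
    [AddCommGroup V₃] [Module S V₁] [Module S V₂] [Module S V₃] (f : V₁ →ₗ[S] V₂)
    (g : V₂ →ₗ[S] V₃) (inj : Function.Injective f)
    (surj : Function.Surjective g) (hfg : Function.Exact f g) :
    SES (k := k) (mo w A V₁) (mo w A V₂) (mo w A V₃) :=
  SES.ofDm f g inj surj hfg (fun _ => map_zero f) (fun _ => map_zero g)
    (fun s v => or_congr_right (map_eq_zero_iff f inj))
    (fun s v hv => hv.imp_right fun h => by rw [h, map_zero])
    (fun s v hv => by
      rcases hv with h | rfl
      · obtain ⟨y, hy⟩ := surj v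
        exact ⟨y, Or.inl h, hy⟩
      · exact ⟨0, zero_mem _, map_zero g⟩)

theorem h_mo_le (w : ℕ → S) (A : ℤ → Prop) (V : Type) [AddCommGroup V] [Module S V] (s : ℤ) :
    (mo (k := k) w A V).h s ≤ kLen k S V := by
  let _ := kMod k S V
  exact (Module.length_le_of_surjective _ (Submodule.mkQ_surjective _)).trans
    (Module.length_le_of_injective _ (Submodule.subtype_injective _))

theorem h_mo_eq_zero {w : ℕ → S} {A : ℤ → Prop} {V : Type} [AddCommGroup V] [Module S V] {s : ℤ}
    (hs : ¬ A s) : (mo (k := k) w A V).h s = 0 :=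
  @relLen_eq_zero k _ V _ (kMod k S V) _ _ fun v hv => by
    have : v = 0 := (hv.2 : A s ∨ v = 0).resolve_left hs
    rw [this]; exact zero_mem _

/-- Dropping the first operator, when it is injective, in favour of a model of its quotient. -/
theorem SES.hK_succ_le {X Y : DMod k} (T : SES X X Y) (h : T.i = X.u 0) (m : ℕ) (s : ℤ) :
    hK (m + 1) X s ≤ hK m Y.tail s := by
  have hX : ∀ x, X.u 0 x = T.i x := fun x => by rw [h]
  let S' : SES X.tail.coneId X.cone Y.tail :=
    { i := (X.u 0).prodMap LinearMap.id
      p := T.p ∘ₗ LinearMap.fst k _ _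
      inj := (h ▸ T.inj : Function.Injective (X.u 0)).prodMap Function.injective_id
      surj := T.surj.comp Prod.fst_surjective
      exact := fun ⟨a, b⟩ hy => by
        obtain ⟨c, hc⟩ := T.exact a hy
        exact ⟨(c, b), Prod.ext (h ▸ hc) rfl⟩
      pi := fun ⟨a, b⟩ => by
        change T.p (X.u 0 a) = 0
        rw [hX, T.pi]
      id := fun ⟨a, b⟩ => Prod.ext (by
        change X.u 0 (X.d a + b) = X.d (X.u 0 a) + X.u 0 b
        rw [map_add, X.du]) rfl
      pd := fun ⟨a, b⟩ => by
        change T.p (X.d a + X.u 0 b) = Y.d (T.p a)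
        rw [map_add, hX, T.pi, add_zero, T.pd]
      iu := fun n ⟨a, b⟩ => Prod.ext (X.uu _ _ _) rfl
      pu := fun n ⟨a, b⟩ => T.pu _ a
      igr := fun s ⟨a, b⟩ => and_congr (by
        change X.u 0 a ∈ X.gr s ↔ a ∈ X.gr s
        rw [hX]; exact T.igr s a) Iff.rfl
      pgr := fun s ⟨a, b⟩ hab => T.pgr s a hab.1
      lift := fun s v hv => by
        obtain ⟨y, hy, rfl⟩ := T.lift s v hv
        exact ⟨(y, 0), ⟨hy, zero_mem _⟩, rfl⟩ }
  exact (S'.hK_mid m s).trans_eq (by rw [hK_coneId, zero_add])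

open RingTheory.Sequence Pointwise in
/-- Koszul homology of a weakly regular sequence. -/
theorem hK_mo_eq_zero {A : ℤ → Prop} {s : ℤ} (hs : ¬ A s) (rs : List S) (w : ℕ → S) (V : Type)
    [AddCommGroup V] [Module S V] (hw : ∀ i (h : i < rs.length), w i = rs[i])
    (hr : IsWeaklyRegular V rs) : hK rs.length (mo (k := k) w A V) s = 0 := by
  induction rs generalizing w V with
  | nil => exact h_mo_eq_zero hs
  | cons r rs ih =>
    rw [isWeaklyRegular_cons_iff] at hr
    have h0 : w 0 = r := hw 0 (by simp)
    have hi := ih (fun i => w (i + 1)) (QuotSMulTop r V) (fun i h => by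
      exact hw (i + 1) (by simpa using h)) hr.2
    refine le_antisymm (le_trans (SES.hK_succ_le (SES.ofMo w A (LinearMap.lsmul S V r)
      (r • (⊤ : Submodule S V)).mkQ hr.1 (Submodule.mkQ_surjective _) fun v => ?_) ?_ _ _)
      hi.le) bot_le
    · rw [Submodule.mkQ_apply, Submodule.Quotient.mk_eq_zero, Submodule.mem_smul_pointwise_iff_exists]
      simp
    · subst h0; rfl

end DMod
end

section
open TensorProduct
open TensorProduct (map)

namespace DMod
variable {k : Type} [Field k] {S : Type} [CommRing S] [Algebra k S]

/-- The exact sequence of multiplication by a regular element. -/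
def SES.moMul (w : ℕ → S) (A : ℤ → Prop) (a : S) {M M' : Type} [AddCommGroup M] [AddCommGroup M']
    [Module S M] [Module S M'] (p : M →ₗ[S] M') (h : ∀ v : M, a • v = 0 → v = 0)
    (hp : Function.Surjective p) (he : ∀ v, p v = 0 ↔ ∃ w, a • w = v) :
    SES (k := k) (mo w A M) (mo w A M) (mo w A M') :=
  SES.ofMo w A (LinearMap.lsmul S M a) p
    ((injective_iff_map_eq_zero _).2 h) hp (fun v => he v)

section
variable {ι : Type} {x : ι → S} {w : ℕ → S} {A : ℤ → Prop}

theorem kLin_lsmul_pow (M : Type) [AddCommGroup M] [Module S M] (i n : ℕ) :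
    kLin k (LinearMap.lsmul S M (w i ^ n)) = (mo (k := k) w A M).u i ^ n := by
  let _ := kMod k S M
  induction n with
  | zero => ext v; exact (congrArg (· • v) (pow_zero _)).trans (one_smul S v)
  | succ n ih =>
    refine LinearMap.ext fun v => ?_
    change w i ^ (n + 1) • v = ((mo (k := k) w A M).u i ^ (n + 1)) v
    rw [pow_succ' ((mo (k := k) w A M).u i), Module.End.mul_apply, ← ih]
    exact (congrArg (· • v) (pow_succ' (w i) n)).trans (mul_smul _ _ _)

theorem ZH.self_u {X : DMod k} {m i : ℕ} (hi : i < m) : ZH m X (X.u i) :=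
  ZH.of_u hi (g := LinearMap.id) (fun _ => rfl) (fun _ _ => rfl) (fun _ _ h => h)

theorem zh_map_left {X Y : DMod k} {m i : ℕ} (hi : i < m) (hY : Y.u i = 0) :
    ZH m (X.tens₀ Y) (map (X.u i) LinearMap.id) := by
  have := ZH.of_u (X := X.tens₀ Y) hi (g := -LinearMap.id)
    (fun v => map_neg _ v) (fun _ v => map_neg _ v) (fun _ _ h => trivial)
  have e : (X.tens₀ Y).u i = -map (X.u i) LinearMap.id := by
    change map LinearMap.id (Y.u i) - map (X.u i) LinearMap.id = _
    rw [hY, map_zero_right, zero_sub]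
  rw [e, LinearMap.neg_comp, LinearMap.id_comp, neg_neg] at this
  exact this

theorem subsingleton_tens₀ (X Y : DMod k) [Subsingleton Y.V] : Subsingleton (X.tens₀ Y).V :=
  inferInstanceAs (Subsingleton (X.V ⊗[k] Y.V))

theorem dev_phi {X : DMod k} {L n : ℕ} {ix : ι → ℕ} (hx : ∀ j, x j = w (ix j))
    (hL : ∀ j, ix j < L) (hn : ∀ j, X.NH (X.u (ix j) ^ n)) {C₀ : ℕ∞}
    (hb : ∀ Q : Ideal S, Q.IsPrime → (∀ i, x i ∈ Q) → phi L X (mo w A (S ⧸ Q)) ≤ C₀) :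
    Dev x n C₀ fun M _ _ => phi L X (mo w A M) where
  zero M _ _ _ := by
    have : Subsingleton (mo (k := k) w A M).V := inferInstanceAs (Subsingleton M)
    have := subsingleton_tens₀ X (mo (k := k) w A M)
    exact hK_eq_zero_of_subsingleton _ _
  mid M₁ M₂ M₃ _ _ _ _ _ _ f g hf hg hfg :=
    ((SES.ofMo w A f g hf hg hfg).tensRight X 0 (by simp) (by simp)).hK_mid L 0
  quo i M M' _ _ _ _ p h hp he := by
    refine ((SES.moMul w A _ p h hp he).tensRight X 0 (by simp) (by simp)).hK_le_of_zh ?_ 0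
    have := zh_map_pow (hL i) (hn i) (Y := mo w A M)
    rw [← kLin_lsmul_pow, ← hx] at this
    exact this
  base := hb

theorem dev_hK {d n : ℕ} {x : Fin d → S} {y : ℕ → S} (hy : ∀ j : Fin d, y j = x j ^ n) (s : ℤ)
    {ℓ : ℕ∞} (hb : ∀ Q : Ideal S, Q.IsPrime → (∀ i, x i ∈ Q) → kLen k S (S ⧸ Q) ≤ ℓ) :
    Dev x n (2 ^ d * ℓ) fun M _ _ => hK d (mo (k := k) y A M) s where
  zero M _ _ _ := by
    have : Subsingleton (mo (k := k) y A M).V := inferInstanceAs (Subsingleton M)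
    exact hK_eq_zero_of_subsingleton _ _
  mid M₁ M₂ M₃ _ _ _ _ _ _ f g hf hg hfg := (SES.ofMo y A f g hf hg hfg).hK_mid d s
  quo i M M' _ _ _ _ p h hp he := by
    refine (SES.moMul y A _ p h hp he).hK_le_of_zh ?_ s
    have := ZH.self_u (X := mo (k := k) y A M) i.2
    change ZH d (mo y A M) (kLin k (LinearMap.lsmul S M (x i ^ n)))
    rw [← hy]
    exact this
  base Q hQ hx := hK_le_of_h_le (fun t => (h_mo_le _ _ _ _).trans (hb Q hQ hx)) _ _

theorem dev_phi_left {Y : DMod k} {L : ℕ} {ix : ι → ℕ} (hx : ∀ j, x j = w (ix j))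
    (hL : ∀ j, ix j < L) (hn : ∀ j, Y.u (ix j) = 0) {C₀ : ℕ∞}
    (hb : ∀ Q : Ideal S, Q.IsPrime → (∀ i, x i ∈ Q) → phi L (mo w A (S ⧸ Q)) Y ≤ C₀) :
    Dev x 1 C₀ fun M _ _ => phi L (mo w A M) Y where
  zero M _ _ _ := by
    have : Subsingleton (mo (k := k) w A M).V := inferInstanceAs (Subsingleton M)
    exact phi_eq_zero_of_subsingleton _ _
  mid M₁ M₂ M₃ _ _ _ _ _ _ f g hf hg hfg := (SES.ofMo w A f g hf hg hfg).phi_mid L Y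
  quo i M M' _ _ _ _ p h hp he := by
    refine ((SES.moMul w A _ p h hp he).tensLeft Y).hK_le_of_zh ?_ 0
    have := zh_map_left (X := mo (k := k) w A M) (hL i) (hn i)
    have e : x i ^ 1 = w (ix i) := by rw [pow_one, hx]
    rw [← show kLin k (LinearMap.lsmul S M (x i ^ 1)) = (mo (k := k) w A M).u (ix i) by rw [e]] at this
    exact this
  base := hb

theorem phi_mo_mo_le (w : ℕ → S) (A : ℤ → Prop) (M M' : Type) [AddCommGroup M] [AddCommGroup M']
    [Module S M] [Module S M'] (L : ℕ) (hM : kLen k S M ≠ ⊤) (hM' : kLen k S M' ≠ ⊤) :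
    ∃ c : ℕ, phi L (mo (k := k) w A M) (mo (k := k) w A M') ≤ c := by
  let _ := kMod k S M
  let _ := kMod k S M'
  have h1 : Module.length k M ≠ ⊤ := hM
  have h2 : Module.length k M' ≠ ⊤ := hM'
  have f1 : FiniteDimensional k M := by
    rw [Module.length_ne_top_iff, isFiniteLength_iff_isNoetherian_isArtinian] at h1
    have := h1.1; infer_instance
  have f2 : FiniteDimensional k M' := by
    rw [Module.length_ne_top_iff, isFiniteLength_iff_isNoetherian_isArtinian] at h2
    have := h2.1; infer_instance
  have h3 : Module.length k (M ⊗[k] M') = Module.finrank k (M ⊗[k] M') := Module.length_eq_finrank ..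
  refine ⟨2 ^ L * Module.finrank k (M ⊗[k] M'), ?_⟩
  push_cast
  refine hK_le_of_h_le (fun t => ?_) _ _
  rw [← h3]
  exact (Module.length_le_of_surjective _ (Submodule.mkQ_surjective _)).trans
    (Module.length_le_of_injective _ (Submodule.subtype_injective _))

end

section
variable (k)

/-- The length of `M / JM`. -/
noncomputable def qLen (J : Ideal S) (M : Type) [AddCommGroup M] [Module S M] : ℕ∞ :=
  kLen k S (M ⧸ (J • ⊤ : Submodule S M))

theorem kLen_le_of_injective {M M' : Type} [AddCommGroup M] [AddCommGroup M'] [Module S M]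
    [Module S M'] (f : M →ₗ[S] M') (hf : Function.Injective f) : kLen k S M ≤ kLen k S M' := by
  let _ := kMod k S M
  let _ := kMod k S M'
  exact Module.length_le_of_injective (kLin k f) hf

theorem kLen_le_of_surjective {M M' : Type} [AddCommGroup M] [AddCommGroup M'] [Module S M]
    [Module S M'] (f : M →ₗ[S] M') (hf : Function.Surjective f) : kLen k S M' ≤ kLen k S M := by
  let _ := kMod k S M
  let _ := kMod k S M'
  exact Module.length_le_of_surjective (kLin k f) hf

theorem kLen_le_add {M₁ M M₃ : Type} [AddCommGroup M₁] [AddCommGroup M] [AddCommGroup M₃]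
    [Module S M₁] [Module S M] [Module S M₃] (f : M₁ →ₗ[S] M) (g : M →ₗ[S] M₃)
    (h : ∀ v, g v = 0 → ∃ u, f u = v) : kLen k S M ≤ kLen k S M₁ + kLen k S M₃ := by
  let _ := kMod k S M₁
  let _ := kMod k S M
  let _ := kMod k S M₃
  let f' : M₁ →ₗ[k] M := kLin k f
  let g' : M →ₗ[k] M₃ := kLin k g
  have := Module.length_eq_add_of_exact (LinearMap.ker g').subtype g'.rangeRestrict
    (Submodule.subtype_injective _) g'.surjective_rangeRestrict (fun y => by
      constructor
      · intro hy
        exact ⟨⟨y, congrArg Subtype.val hy⟩, rfl⟩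
      · rintro ⟨z, rfl⟩
        exact Subtype.ext z.2)
  change Module.length k M ≤ Module.length k M₁ + Module.length k M₃
  rw [this]
  refine add_le_add ?_ (Module.length_le_of_injective _ (Submodule.subtype_injective _))
  refine le_trans (Module.length_le_of_injective (Submodule.inclusion
    (show LinearMap.ker g' ≤ LinearMap.range f' from fun v hv => h v hv))
    (Submodule.inclusion_injective _)) ?_
  exact Module.length_le_of_surjective _ f'.surjective_rangeRestrict

theorem smul_top_le_comap (J : Ideal S) {M M' : Type} [AddCommGroup M] [AddCommGroup M']
    [Module S M] [Module S M'] (f : M →ₗ[S] M') :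
    (J • ⊤ : Submodule S M) ≤ (J • ⊤ : Submodule S M').comap f := by
  rw [← Submodule.map_le_iff_le_comap, Submodule.map_smul'']
  exact Submodule.smul_mono le_rfl le_top

theorem qLen_mid (J : Ideal S) {M₁ M M₃ : Type} [AddCommGroup M₁] [AddCommGroup M]
    [AddCommGroup M₃] [Module S M₁] [Module S M] [Module S M₃] (f : M₁ →ₗ[S] M) (g : M →ₗ[S] M₃)
    (hg : Function.Surjective g) (h : ∀ v, g v = 0 → ∃ u, f u = v) :
    qLen k J M ≤ qLen k J M₁ + qLen k J M₃ := by
  refine kLen_le_add k (Submodule.mapQ _ _ f (smul_top_le_comap J f))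
    (Submodule.mapQ _ _ g (smul_top_le_comap J g)) fun y hy => ?_
  induction y using Submodule.Quotient.induction_on with | _ y
  have hy' : g y ∈ (J • ⊤ : Submodule S M₃) := (Submodule.Quotient.mk_eq_zero _).1 hy
  have : (J • ⊤ : Submodule S M₃) = (J • ⊤ : Submodule S M).map g := by
    rw [Submodule.map_smul'', Submodule.map_top, LinearMap.range_eq_top.2 hg]
  rw [this] at hy'
  obtain ⟨z, hz, hzy⟩ := hy'
  obtain ⟨u, hu⟩ := h (y - z) (by rw [map_sub, hzy, sub_self])
  refine ⟨Submodule.Quotient.mk u, ?_⟩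
  change Submodule.Quotient.mk (f u) = _
  rw [Submodule.Quotient.eq, hu, sub_sub_cancel_left]
  exact neg_mem hz

theorem dev_qLen {ι : Type} {x : ι → S} {n : ℕ} {J : Ideal S} (hJ : ∀ i, x i ^ n ∈ J) {ℓ : ℕ∞}
    (hb : ∀ Q : Ideal S, Q.IsPrime → (∀ i, x i ∈ Q) → kLen k S (S ⧸ Q) ≤ ℓ) :
    Dev x n ℓ fun M _ _ => qLen k J M where
  zero M _ _ _ := by
    refine le_antisymm ?_ bot_le
    refine (kLen_le_of_surjective k (Submodule.mkQ _) (Submodule.mkQ_surjective _)).trans ?_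
    let _ := kMod k S M
    exact (Module.length_eq_zero : Module.length k M = 0).le
  mid M₁ M₂ M₃ _ _ _ _ _ _ f g hf hg hfg := qLen_mid k J f g hg fun v hv => (hfg v).1 hv
  quo i M M' _ _ _ _ p h hp he := by
    refine kLen_le_of_injective k (Submodule.mapQ _ _ p (smul_top_le_comap J p)) ?_
    rw [← LinearMap.ker_eq_bot, Submodule.eq_bot_iff]
    intro y hy
    induction y using Submodule.Quotient.induction_on with | _ y
    have hy' : p y ∈ (J • ⊤ : Submodule S M') := (Submodule.Quotient.mk_eq_zero _).1 hy
    have : (J • ⊤ : Submodule S M') = (J • ⊤ : Submodule S M).map p := by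
      rw [Submodule.map_smul'', Submodule.map_top, LinearMap.range_eq_top.2 hp]
    rw [this] at hy'
    obtain ⟨z, hz, hzy⟩ := hy'
    obtain ⟨u, hu⟩ := (he (y - z)).1 (by rw [map_sub, hzy, sub_self])
    refine (Submodule.Quotient.mk_eq_zero _).2 ?_
    rw [← sub_add_cancel y z, ← hu]
    exact add_mem (Submodule.smul_mem_smul (hJ i) trivial) hz
  base Q hQ hx :=
    (kLen_le_of_surjective k (Submodule.mkQ _) (Submodule.mkQ_surjective _)).trans (hb Q hQ hx)

end

end DMod
end

section
open DMod

/-- A bounded complex of free modules with a chosen homogeneous basis, ordered by degree. -/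
structure MC (D : Type) [CommRing D] (n d : ℕ) where
  deg : Fin n → ℕ
  mono : Monotone deg
  le : ∀ j, deg j ≤ d
  mat : Matrix (Fin n) (Fin n) D
  hmat : ∀ i j, mat i j ≠ 0 → deg i + 1 = deg j
  sq : mat * mat = 0

namespace MC
variable {D : Type} [CommRing D] {n d : ℕ}

/-- Base change. -/
def map {D' : Type} [CommRing D'] (F : MC D n d) (f : D →+* D') : MC D' n d where
  deg := F.deg
  mono := F.mono
  le := F.le
  mat := F.mat.map f
  hmat i j h := F.hmat i j fun h' => h (by rw [Matrix.map_apply, h', map_zero])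
  sq := by rw [← Matrix.map_mul, F.sq]; ext; simp

/-- The scalars that act by zero up to homotopy. -/
def Null (F : MC D n d) (c : D) : Prop :=
  ∃ σ : Matrix (Fin n) (Fin n) D, (∀ i j, σ i j ≠ 0 → F.deg i = F.deg j + 1) ∧
    F.mat * σ + σ * F.mat = c • 1

theorem Null.map {D' : Type} [CommRing D'] {F : MC D n d} {c : D} (h : F.Null c) (f : D →+* D') :
    (F.map f).Null (f c) := by
  obtain ⟨σ, h1, h2⟩ := h
  refine ⟨σ.map f, fun i j h => h1 i j fun h' => h (by rw [Matrix.map_apply, h', map_zero]), ?_⟩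
  have := congrArg (fun M => Matrix.map M f) h2
  simp only [Matrix.map_add f (map_add f), Matrix.map_mul] at this
  refine this.trans ?_
  ext i j
  simp [Matrix.one_apply, apply_ite f]

theorem Null.mul {F : MC D n d} {c : D} (h : F.Null c) (a : D) : F.Null (a * c) := by
  obtain ⟨σ, h1, h2⟩ := h
  refine ⟨a • σ, fun i j h => h1 i j fun h' => h (by simp [h']), ?_⟩
  rw [Matrix.mul_smul, Matrix.smul_mul, ← smul_add, h2, smul_smul]

theorem Null.add {F : MC D n d} {c c' : D} (h : F.Null c) (h' : F.Null c') : F.Null (c + c') := by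
  obtain ⟨σ, h1, h2⟩ := h
  obtain ⟨τ, h3, h4⟩ := h'
  refine ⟨σ + τ, fun i j h => ?_, ?_⟩
  · by_cases h' : σ i j = 0
    · exact h3 i j fun h'' => h (by simp [h', h''])
    · exact h1 i j h'
  · rw [mul_add, add_mul, add_add_add_comm, h2, h4, add_smul]

theorem Null.zero (F : MC D n d) : F.Null 0 := ⟨0, fun _ _ h => absurd rfl h, by simp⟩

/-- The ideal of scalars acting by zero up to homotopy. -/
def nullIdeal (F : MC D n d) : Ideal D where
  carrier := {c | F.Null c}
  add_mem' := Null.add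
  zero_mem' := Null.zero F
  smul_mem' a _ h := h.mul a

/-- Remove the last basis vector. -/
def init (F : MC D (n + 1) d) : MC D n d where
  deg j := F.deg j.castSucc
  mono i j h := F.mono (Fin.castSucc_le_castSucc_iff.2 h)
  le j := F.le _
  mat := F.mat.submatrix Fin.castSucc Fin.castSucc
  hmat i j h := F.hmat _ _ h
  sq := by
    ext i j
    have := congrFun (congrFun F.sq i.castSucc) j.castSucc
    rw [Matrix.mul_apply, Fin.sum_univ_castSucc] at this
    have h0 : F.mat (Fin.last n) j.castSucc = 0 := by
      by_contra h
      have := F.hmat _ _ h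
      have := F.mono (Fin.le_last j.castSucc)
      omega
    rw [h0, mul_zero, add_zero] at this
    exact this

theorem mat_last (F : MC D (n + 1) d) (j : Fin (n + 1)) : F.mat (Fin.last n) j = 0 := by
  by_contra h
  have := F.hmat _ _ h
  have := F.mono (Fin.le_last j)
  omega

variable {k : Type} [Field k] {S : Type} [CommRing S] [Algebra k S] [Algebra S D]

variable (S) in
/-- The differential. -/
abbrev dl (F : MC D n d) : (Fin n → D) →ₗ[S] (Fin n → D) := F.mat.mulVecLin.restrictScalars S

theorem dl_apply (F : MC D n d) (v : Fin n → D) (i : Fin n) :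
    F.dl S v i = ∑ j, F.mat i j * v j := rfl

/-- The associated differential module. -/
abbrev cplx (k : Type) [Field k] {S : Type} [CommRing S] [Algebra k S] [Algebra S D]
    (F : MC D n d) (w : ℕ → S) : DMod k :=
  DMod.dm w (Fin n → D) (F.dl S)
    (fun v => by
      change F.mat.mulVec (F.mat.mulVec v) = 0
      rw [Matrix.mulVec_mulVec, F.sq, Matrix.zero_mulVec])
    (fun s => { carrier := {v | ∀ j, (F.deg j : ℤ) ≠ s → v j = 0}
                add_mem' := fun {a b} ha hb j hj => by
                  rw [Pi.add_apply, ha j hj, hb j hj, add_zero]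
                zero_mem' := fun _ _ => rfl
                smul_mem' := fun c a ha j hj => by rw [Pi.smul_apply, ha j hj, smul_zero] })
    (fun s v hv i hi => by
      rw [dl_apply]
      refine Finset.sum_eq_zero fun j _ => ?_
      by_cases h : F.mat i j = 0
      · rw [h, zero_mul]
      · rw [hv j (by have := F.hmat i j h; omega), mul_zero])

/-- Homotopies given by matrices. -/
theorem Null.nh {F : MC D n d} {w : ℕ → S} {i N : ℕ} (h : F.Null (algebraMap S D (w i ^ N))) :
    (F.cplx k w).NH ((F.cplx k w).u i ^ N) := by
  obtain ⟨σ, h1, h2⟩ := h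
  have e : ∀ v : Fin n → D, ((F.cplx k w).u i ^ N) v = w i ^ N • v := fun v =>
    letI := kMod k S (Fin n → D)
    (LinearMap.congr_fun
      (DMod.kLin_lsmul_pow (k := k) (w := w) (A := fun _ => True) (Fin n → D) i N) v).symm
  refine ⟨kLin k (σ.mulVecLin.restrictScalars S), fun s v hv i hi => ?_, fun v => ?_,
    fun i v => (σ.mulVecLin.restrictScalars S).map_smul (w i) v⟩
  · change ∑ j, σ i j * v j = 0
    refine Finset.sum_eq_zero fun j _ => ?_
    by_cases h : σ i j = 0
    · rw [h, zero_mul]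
    · rw [hv j (by have := h1 i j h; omega), mul_zero]
  · rw [e]
    change F.mat.mulVec (σ.mulVec v) + σ.mulVec (F.mat.mulVec v) = _
    rw [Matrix.mulVec_mulVec, Matrix.mulVec_mulVec, ← Matrix.add_mulVec, h2, Matrix.smul_mulVec,
      Matrix.one_mulVec]
    exact algebraMap_smul D _ v

/-- Split off the last basis vector. -/
def sesLast (F : MC D (n + 1) d) (w : ℕ → S) :
    SES (F.init.cplx k w) (F.cplx k w)
      (mo w (fun s => (F.deg (Fin.last n) : ℤ) = s) D) :=
  SES.ofDm
    { toFun := fun v => Fin.snoc (α := fun _ => D) v 0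
      map_add' := fun v v' => by
        ext j; refine Fin.lastCases ?_ (fun j => ?_) j <;> simp
      map_smul' := fun c v => by
        ext j; refine Fin.lastCases ?_ (fun j => ?_) j <;> simp }
    (LinearMap.proj (Fin.last n))
    (fun v v' h => by
      ext j
      simpa using congrFun h j.castSucc)
    (fun b => ⟨fun _ => b, rfl⟩)
    (fun v => by
      constructor
      · intro h
        refine ⟨fun j => v j.castSucc, ?_⟩
        ext j; refine Fin.lastCases ?_ (fun j => ?_) j
        · simpa using h.symm
        · simp
      · rintro ⟨v, rfl⟩
        simp)
    (fun v => by
      funext j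
      change Fin.snoc (α := fun _ => D) (F.init.dl S v) 0 j =
        F.dl S (Fin.snoc (α := fun _ => D) v 0) j
      rw [dl_apply, Fin.sum_univ_castSucc]
      refine Fin.lastCases ?_ (fun j => ?_) j
      · simp [mat_last]
      · rw [Fin.snoc_castSucc, dl_apply]
        simp [init])
    (fun v => by
      change F.dl S v (Fin.last n) = 0
      rw [dl_apply]
      simp [mat_last])
    (fun s v => by
      constructor
      · intro h j hj
        simpa using h j.castSucc hj
      · intro h j
        refine Fin.lastCases ?_ (fun j => ?_) j
        · simp
        · intro hj
          simpa using h j hj)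
    (fun s v hv => by
      by_cases h : (F.deg (Fin.last n) : ℤ) = s
      · exact Or.inl h
      · exact Or.inr (hv _ h))
    (fun s b hb => by
      refine ⟨Pi.single (Fin.last n) b, fun j hj => ?_, by simp⟩
      by_cases h : j = Fin.last n
      · subst h
        simpa using hb.resolve_left hj
      · simp [h])

/-- Subadditive invariants of a complex are bounded by those of its basis vectors. -/
theorem le_sum (ψ : DMod k → ℕ∞) (hz : ∀ X, Subsingleton X.V → ψ X = 0)
    (hm : ∀ X Y W, SES X Y W → ψ Y ≤ ψ X + ψ W) (F : MC D n d) (w : ℕ → S) :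
    ψ (F.cplx k w) ≤ ∑ j, ψ (mo w (fun s => (F.deg j : ℤ) = s) D) := by
  induction n with
  | zero => exact (hz _ (inferInstanceAs (Subsingleton (Fin 0 → D)))).le.trans bot_le
  | succ n ih =>
    rw [Fin.sum_univ_castSucc]
    exact (hm _ _ _ (F.sesLast w)).trans (add_le_add_left (ih F.init) _)

variable (S) in
/-- The projections on the homogeneous components. -/
def pr (F : MC D n d) (s : ℕ) : (Fin n → D) →ₗ[S] (Fin n → D) where
  toFun v j := if F.deg j = s then v j else 0
  map_add' v v' := by ext j; simp only [Pi.add_apply]; split_ifs <;> simp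
  map_smul' c v := by ext j; simp

theorem pr_apply (F : MC D n d) (s : ℕ) (v : Fin n → D) (j : Fin n) :
    F.pr S s v j = if F.deg j = s then v j else 0 := rfl

theorem dl_pr (F : MC D n d) (s : ℕ) (v : Fin n → D) :
    F.dl S (F.pr S (s + 1) v) = F.pr S s (F.dl S v) := by
  ext i
  rw [pr_apply, dl_apply, dl_apply]
  split_ifs with h
  · refine Finset.sum_congr rfl fun j _ => ?_
    by_cases hm : F.mat i j = 0
    · rw [hm, zero_mul, zero_mul]
    · rw [pr_apply, if_pos (by have := F.hmat i j hm; omega)]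
  · refine Finset.sum_eq_zero fun j _ => ?_
    by_cases hm : F.mat i j = 0
    · rw [hm, zero_mul]
    · rw [pr_apply, if_neg (by have := F.hmat i j hm; omega), mul_zero]

theorem dl_pr_zero (F : MC D n d) (v : Fin n → D) : F.dl S (F.pr S 0 v) = 0 := by
  ext i
  rw [dl_apply]
  refine Finset.sum_eq_zero fun j _ => ?_
  by_cases hm : F.mat i j = 0
  · rw [hm, zero_mul]
  · rw [pr_apply, if_neg (by have := F.hmat i j hm; omega), mul_zero]

/-- The grading of the complex. -/
def grd (F : MC D n d) (w : ℕ → S) : Grd (F.cplx k w) (d + 1) where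
  π s := kLin k (F.pr S s)
  pp s t v := by
    funext j
    change F.pr S s (F.pr S t v) j = _
    rw [pr_apply, pr_apply]
    by_cases h : s = t
    · subst h
      rw [if_pos rfl]
      change _ = F.pr S s v j
      rw [pr_apply]
      split_ifs <;> rfl
    · rw [if_neg h]
      by_cases h1 : F.deg j = s
      · rw [if_pos h1, if_neg (by omega)]; rfl
      · rw [if_neg h1]; rfl
  sum v := by
    funext j
    refine (Finset.sum_apply j _ _).trans ?_
    change ∑ s ∈ Finset.range (d + 1), F.pr S s v j = v j
    simp only [pr_apply]
    rw [Finset.sum_ite_eq, if_pos (Finset.mem_range.2 (Nat.lt_succ_of_le (F.le j)))]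
  d_succ s v := F.dl_pr (S := S) s v
  d_zero v := F.dl_pr_zero (S := S) v
  pu i s v := (F.pr S s).map_smul (w i) v
  gr s v := by
    change (∀ j, (F.deg j : ℤ) ≠ s → v j = 0) ↔ F.pr S s v = v
    rw [funext_iff]
    refine forall_congr' fun j => ?_
    rw [pr_apply]
    by_cases h : F.deg j = s
    · simp [h]
    · rw [if_neg h]
      exact ⟨fun hh => (hh (by exact_mod_cast h)).symm, fun hh _ => hh.symm⟩

end MC
end

section
open DMod

namespace MC
variable {D : Type} [CommRing D] {n d : ℕ}
variable {k : Type} [Field k] {S : Type} [CommRing S] [Algebra k S] [Algebra S D]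

theorem two_pow_mul_h_le (G : MC D n d) (w : ℕ → S) (A : ℤ → Prop) (L : ℕ)
    (hfin : ∀ s < d + 1, (G.cplx k w).h s ≠ ⊤) :
    2 ^ L * (G.cplx k w).h 0 ≤ n * phi L (G.cplx k w) (mo w A D) +
      2 ^ L * ∑ s ∈ Finset.range d, (G.cplx k w).h (s + 1 : ℕ) := by
  refine ((G.grd w).two_pow_mul_le hfin L).trans (add_le_add_left ?_ _)
  set X := G.cplx k w with hX
  have := le_sum (fun Y => hK L (X.tens Y (G.grd w).ε (G.grd w).d_ε (G.grd w).u_ε) 0)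
    (fun Y hY => ?_) (fun Y Y' Y'' T => (T.tensRight X _ _ _).hK_mid L 0) G w
  · refine this.trans ?_
    refine (Finset.sum_le_card_nsmul _ _ (phi L X (mo w A D)) fun j _ => ?_).trans ?_
    · rw [tens_eq_tens₀ rfl]
      exact le_rfl
    · rw [Finset.card_univ, Fintype.card_fin, nsmul_eq_mul]
  · have : Subsingleton (X.tens Y (G.grd w).ε (G.grd w).d_ε (G.grd w).u_ε).V :=
      subsingleton_tens₀ X Y
    exact hK_eq_zero_of_subsingleton _ _

/-- The cokernel of the structure map. -/
abbrev Cok (S D : Type) [CommRing S] [CommRing D] [Algebra S D] : Type :=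
  D ⧸ LinearMap.range (Algebra.linearMap S D)

/-- The sequence `0 → S → D → D / S → 0`. -/
def sesCok (hinj : Function.Injective (algebraMap S D)) (w : ℕ → S) (A : ℤ → Prop) :
    SES (k := k) (mo w A S) (mo w A D) (mo w A (Cok S D)) :=
  SES.ofMo w A (Algebra.linearMap S D) (Submodule.mkQ _) hinj (Submodule.mkQ_surjective _)
    (LinearMap.exact_map_mkQ_range _)

theorem phi_le_add (hinj : Function.Injective (algebraMap S D)) (X : DMod k) (L : ℕ) (w : ℕ → S)
    (A : ℤ → Prop) :
    phi L X (mo w A D) ≤ phi L X (mo w A S) + phi L X (mo w A (Cok S D)) :=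
  ((sesCok hinj w A).tensRight X 0 (by simp) (by simp)).hK_mid L 0

theorem hK_le_add (hinj : Function.Injective (algebraMap S D)) (L : ℕ) (w : ℕ → S)
    (A : ℤ → Prop) (s : ℤ) :
    hK L (mo (k := k) w A D) s ≤ hK L (mo (k := k) w A S) s + hK L (mo (k := k) w A (Cok S D)) s :=
  (sesCok hinj w A).hK_mid L s

/-- Homology is bounded by the Koszul homology of the terms. -/
theorem h_le_sum (G : MC D n d) (w y : ℕ → S) (hy : ∀ i < d, G.Null (algebraMap S D (y i)))
    (s : ℤ) :
    (G.cplx k w).h s ≤ ∑ j, hK d (mo (k := k) y (fun t => (G.deg j : ℤ) = t) D) (s + d) := by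
  refine le_trans ?_ (le_sum (fun Y => hK d Y (s + d))
    (fun Y hY => hK_eq_zero_of_subsingleton _ _) (fun Y Y' Y'' T => T.hK_mid d _) G y)
  refine le_trans (le_of_eq rfl) (h_le_hK (X := G.cplx k y) (fun i hi => ?_) s)
  have := Null.nh (k := k) (w := y) (i := i) (N := 1) (F := G) (by simpa using hy i hi)
  rwa [pow_one] at this

theorem qLen_le_h (G : MC D (n + 1) d) (h0 : G.deg 0 = 0) (w : ℕ → S) (J : Ideal S)
    (hJ : ∀ i j, G.mat i j ∈ J.map (algebraMap S D)) : qLen k J D ≤ (G.cplx k w).h 0 := by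
  let _ := kMod k S D
  let _ := kMod k S (Fin (n + 1) → D)
  let _ := kMod k S (D ⧸ (J • ⊤ : Submodule S D))
  let f : (Fin (n + 1) → D) →ₗ[k] D ⧸ (J • ⊤ : Submodule S D) :=
    kLin k ((J • ⊤ : Submodule S D).mkQ ∘ₗ LinearMap.proj 0)
  let X := G.cplx k w
  change Module.length k (D ⧸ (J • ⊤ : Submodule S D)) ≤
    Module.length k (X.Z 0 ⧸ (X.B 0).submoduleOf (X.Z 0))
  refine Module.length_le_of_surjective (Submodule.liftQ ((X.B 0).submoduleOf (X.Z 0))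
    (f ∘ₗ (X.Z 0).subtype) ?_) ?_
  · rintro ⟨v, hv⟩ ⟨u, hu, rfl⟩
    refine (Submodule.Quotient.mk_eq_zero _).2 ?_
    rw [Ideal.smul_top_eq_map]
    change ∑ j, G.mat 0 j * u j ∈ J.map (algebraMap S D)
    exact sum_mem fun j _ => Ideal.mul_mem_right _ _ (hJ 0 j)
  · intro y
    induction y using Submodule.Quotient.induction_on with | _ y
    have hz : (Pi.single 0 y : Fin (n + 1) → D) ∈ X.Z 0 := by
      refine ⟨?_, fun j hj => ?_⟩
      · have : G.pr S 0 (Pi.single 0 y) = Pi.single 0 y := by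
          ext j
          rw [pr_apply]
          split_ifs with h
          · rfl
          · rw [Pi.single_eq_of_ne]
            rintro rfl
            exact h h0
        have h2 := G.dl_pr_zero (S := S) (Pi.single 0 y)
        rw [this] at h2
        exact h2
      · exact Pi.single_eq_of_ne (fun h => hj (by rw [h, h0]; rfl)) _
    refine ⟨Submodule.Quotient.mk ⟨_, hz⟩, ?_⟩
    change Submodule.Quotient.mk ((Pi.single 0 y : Fin (n + 1) → D) 0) = _
    rw [Pi.single_eq_same]

theorem qLen_le_add [IsDomain S] (hinj : Function.Injective (algebraMap S D)) (J : Ideal S)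
    (μ : D →ₗ[S] S) :
    qLen k J S ≤ qLen k J D + qLen k J (S ⧸ LinearMap.range μ) :=
  qLen_mid k J μ (LinearMap.range μ).mkQ (Submodule.mkQ_surjective _) fun v hv =>
    (Submodule.Quotient.mk_eq_zero _).1 hv

end MC
end

section
open DMod

/-- A finite torsion-free extension `S ⊆ D` of rank one with good Koszul homology. -/
structure Model (k : Type) [Field k] {S D : Type} [CommRing S] [CommRing D] [Algebra k S]
    [Algebra S D] (d m : ℕ) (x : Fin d → S) (w : ℕ → S) (ix : Fin d → ℕ) (𝔪 : Ideal S)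
    (c : S) (μ : D →ₗ[S] S) : Prop where
  hx : ∀ j, x j = w (ix j)
  hL : ∀ j, ix j < m + d
  hw : ∀ i, w i ∈ (Ideal.span (Set.range x)).radical
  hw0 : ∀ i ≥ m + d, w i = 0
  xm : ∀ i, x i ∈ 𝔪
  prime : ∀ Q : Ideal S, Q.IsPrime → (∀ i, x i ∈ Q) → Q = 𝔪
  fin : kLen k S (S ⧸ 𝔪) ≠ ⊤
  dim : DimLT (d + 1) (⊥ : Ideal S)
  c_ne : c ≠ 0
  inj : Function.Injective (algebraMap S D)
  hμ : ∀ v, algebraMap S D (μ v) = c • v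
  len : ∀ q : ℕ, 1 ≤ q → ((q ^ d : ℕ) : ℕ∞) ≤
    DMod.qLen k (Ideal.span (Set.range fun i => x i ^ q)) S
  reg : ∀ n, 1 ≤ n → RingTheory.Sequence.IsWeaklyRegular S (List.ofFn fun i => x i ^ n)
  kos : hK (m + d) (mo (k := k) w (fun _ => True) S).flat 0 ≤ 2 ^ m

theorem DMod.dm_u_eq_zero {k : Type} [Field k] {S : Type} [CommRing S] [Algebra k S] {w : ℕ → S}
    {V : Type} [AddCommGroup V] [Module S V] {f : V →ₗ[S] V} {dd gr dgr} {i : ℕ}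
    (h : ∀ v : V, w i • v = 0) : (dm (k := k) w V f dd gr dgr).u i = 0 := by
  let _ := kMod k S V
  exact LinearMap.ext h

namespace Model
variable {k : Type} [Field k] {S D : Type} [CommRing S] [CommRing D] [Algebra k S]
    [Algebra S D] {d m : ℕ} {x : Fin d → S} {w : ℕ → S} {ix : Fin d → ℕ} {𝔪 : Ideal S}
    {c : S} {μ : D →ₗ[S] S}

/-- The operators `x_i ^ n`. -/
def yop (x : Fin d → S) (n : ℕ) (i : ℕ) : S := if h : i < d then x ⟨i, h⟩ ^ n else 0

theorem yop_coe (x : Fin d → S) (n : ℕ) (i : Fin d) : yop x n i = x i ^ n := by simp [yop]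

theorem smul_cok (M : Model k d m x w ix 𝔪 c μ) (v : MC.Cok S D) : c • v = 0 := by
  induction v using Submodule.Quotient.induction_on with | _ v
  refine (Submodule.Quotient.mk_eq_zero _).2 ⟨μ v, M.hμ v⟩

theorem mu_algebraMap (M : Model k d m x w ix 𝔪 c μ) (a : S) : μ (algebraMap S D a) = c * a := by
  apply M.inj
  rw [M.hμ, Algebra.smul_def, map_mul]

theorem smul_range (M : Model k d m x w ix 𝔪 c μ) (v : S ⧸ LinearMap.range μ) : c • v = 0 := by
  induction v using Submodule.Quotient.induction_on with | _ v
  exact (Submodule.Quotient.mk_eq_zero _).2 ⟨algebraMap S D v, M.mu_algebraMap v⟩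

theorem base_le (M : Model k d m x w ix 𝔪 c μ) (Q : Ideal S) (hQ : Q.IsPrime) (hx : ∀ i, x i ∈ Q) :
    kLen k S (S ⧸ Q) ≤ kLen k S (S ⧸ 𝔪) := by
  rw [M.prime Q hQ hx]

theorem nh_exists (M : Model k d m x w ix 𝔪 c μ)
    {n : ℕ} (G : MC D n d) {N : ℕ} (hG : ∀ i, G.Null (algebraMap S D (x i ^ N)))
    (i : ℕ) : ∃ r, (G.cplx k w).NH ((G.cplx k w).u i ^ r) := by
  have h1 : Ideal.span (Set.range x) ≤ (G.nullIdeal.comap (algebraMap S D)).radical := by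
    rw [Ideal.span_le]
    rintro _ ⟨j, rfl⟩
    exact ⟨N, hG j⟩
  obtain ⟨r, hr⟩ := Ideal.radical_le_radical_iff.2 h1 (M.hw i)
  exact ⟨r, MC.Null.nh hr⟩

theorem nh_pow (M : Model k d m x w ix 𝔪 c μ)
    {n : ℕ} (G : MC D n d) {N : ℕ} (hG : ∀ i, G.Null (algebraMap S D (x i ^ N)))
    (j : Fin d) : (G.cplx k w).NH ((G.cplx k w).u (ix j) ^ N) :=
  MC.Null.nh (by rw [← M.hx]; exact hG j)

theorem u_eq_zero (M : Model k d m x w ix 𝔪 c μ)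
    {n : ℕ} (G : MC D n d) : ∀ i ≥ m + d, (G.cplx k w).u i = 0 := fun i hi =>
  dm_u_eq_zero fun v => by rw [M.hw0 i hi, zero_smul]

/-- The estimate of `Φ_G (S)`. -/
theorem phi_base_le (M : Model k d m x w ix 𝔪 c μ)
    {n : ℕ} (G : MC D n d) {N : ℕ} (hG : ∀ i, G.Null (algebraMap S D (x i ^ N)))
    (hfin : ∀ s < d + 1, (G.cplx k w).h s ≠ ⊤) :
    phi (m + d) (G.cplx k w) (mo w (fun _ => True) S) ≤
      (∑ s ∈ Finset.range (d + 1), (G.cplx k w).h s) * 2 ^ m :=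
  ((G.grd w).phi_le rfl hfin (M.nh_exists G hG) (M.u_eq_zero G) _).trans
    (mul_le_mul_right M.kos _)

variable [IsNoetherianRing S] [IsDomain S] [Module.Finite S D]

/-- Growth of the higher homology. -/
theorem exists_h_le (M : Model k d m x w ix 𝔪 c μ)
    : ∃ C : ℕ, ∀ (n : ℕ) (G : MC D n d) (N : ℕ), 1 ≤ N →
    (∀ i, G.Null (algebraMap S D (x i ^ N))) → ∀ s : ℕ,
    (G.cplx k w).h s ≠ ⊤ ∧ N * (G.cplx k w).h (s + 1 : ℕ) ≤ n * C * N ^ d := by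
  lift kLen k S (S ⧸ 𝔪) to ℕ using M.fin with ℓ hℓ
  have hb : ∀ Q : Ideal S, Q.IsPrime → (∀ i, x i ∈ Q) → kLen k S (S ⧸ Q) ≤ ℓ := fun Q hQ hx =>
    (M.base_le Q hQ hx).trans hℓ.ge
  obtain ⟨C₁, hC₁⟩ := growth_of_dimLT (x := x) M.dim D
  obtain ⟨C₂, hC₂⟩ := growth_of_smul_eq_zero (x := x) M.dim M.c_ne (MC.Cok S D) M.smul_cok
  refine ⟨C₂ * (2 ^ d * ℓ), fun n G N hN hG s => ?_⟩
  have hy : ∀ j : Fin d, yop x N j = x j ^ N := yop_coe x N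
  have hsum := fun s : ℤ => G.h_le_sum (k := k) w (yop x N) (fun i hi => by
    rw [show yop x N i = x ⟨i, hi⟩ ^ N from dif_pos hi]; exact hG _) s
  constructor
  · refine ne_top_of_le_ne_top ?_ (hsum s)
    refine ENat.sum_ne_top.2 fun j _ => ?_
    have := hC₁ N (2 ^ d * ℓ) _ hN (dev_hK (k := k) (A := fun t => (G.deg j : ℤ) = t) hy (s + d) hb)
    intro ht
    rw [ht, ENat.mul_top (Nat.cast_ne_zero.2 (by omega : N ≠ 0)), top_le_iff] at this
    exact ENat.natCast_ne_top (C₁ * (2 ^ d * ℓ) * N ^ (d + 1)) (by push_cast; exact this)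
  · refine (mul_le_mul_right (hsum _) _).trans ?_
    rw [Finset.mul_sum]
    refine (Finset.sum_le_card_nsmul _ _ (((C₂ * (2 ^ d * ℓ) : ℕ) : ℕ∞) * N ^ d) fun j _ => ?_).trans ?_
    · refine (mul_le_mul_right (MC.hK_le_add M.inj _ _ _ _) _).trans ?_
      have hreg := hK_mo_eq_zero (k := k) (A := fun t => (G.deg j : ℤ) = t)
        (s := ((s + 1 : ℕ) : ℤ) + d)
        (by have := G.le j; push_cast; omega) (List.ofFn fun i => x i ^ N) (yop x N) S
        (fun i hi => by
          rw [List.getElem_ofFn, ← hy]) (M.reg N hN)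
      rw [List.length_ofFn] at hreg
      rw [hreg, zero_add]
      push_cast
      exact hC₂ N _ _ hN (dev_hK hy _ hb)
    · rw [Finset.card_univ, Fintype.card_fin, nsmul_eq_mul, mul_assoc]

/-- Growth of `Φ_G (D / S)`. -/
theorem exists_phi_le (M : Model k d m x w ix 𝔪 c μ)
    (n : ℕ) : ∃ C : ℕ, ∀ (G : MC D n d) (N : ℕ), 1 ≤ N →
    (∀ i, G.Null (algebraMap S D (x i ^ N))) →
    N * phi (m + d) (G.cplx k w) (mo w (fun _ => True) (MC.Cok S D)) ≤ C * N ^ d := by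
  obtain ⟨C₁, hC₁⟩ := growth_of_dimLT (x := x) M.dim D
  obtain ⟨C₂, hC₂⟩ := growth_of_smul_eq_zero (x := x) M.dim M.c_ne (MC.Cok S D) M.smul_cok
  have hxm : ∀ i, ∀ v : S ⧸ 𝔪, x i • v = 0 := fun i v => by
    induction v using Submodule.Quotient.induction_on with | _ v
    exact (Submodule.Quotient.mk_eq_zero _).2 (𝔪.mul_mem_right v (M.xm i))
  obtain ⟨c₀, hc₀⟩ := phi_mo_mo_le (k := k) w (fun _ => True) (S ⧸ 𝔪) (S ⧸ 𝔪) (m + d) M.fin M.fin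
  have hd : Dev x 1 c₀ fun M' _ _ => phi (m + d) (mo (k := k) w (fun _ => True) M')
      (mo w (fun _ => True) (S ⧸ 𝔪)) :=
    dev_phi_left M.hx M.hL (fun j => dm_u_eq_zero fun v => by rw [← M.hx, hxm]) (fun Q hQ hx => by rw [M.prime Q hQ hx]; exact hc₀)
  have h1 := hC₁ 1 c₀ _ le_rfl hd
  simp only [Nat.cast_one, one_mul, one_pow, mul_one] at h1
  refine ⟨C₂ * (n * (C₁ * c₀)), fun G N hN hG => ?_⟩
  have hd : Dev x N (n * (C₁ * c₀)) fun M' _ _ => phi (m + d) (G.cplx k w)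
      (mo w (fun _ => True) M') :=
    dev_phi M.hx M.hL (fun j => M.nh_pow G hG j) fun Q hQ hx => ?_
  · push_cast; exact hC₂ N (n * (C₁ * c₀)) _ hN hd
  · rw [M.prime Q hQ hx]
    refine (MC.le_sum (fun X => phi (m + d) X (mo w (fun _ => True) (S ⧸ 𝔪)))
      (fun X hX => phi_eq_zero_of_subsingleton _ _) (fun _ _ _ T => T.phi_mid _ _) G w).trans ?_
    refine (Finset.sum_le_card_nsmul _ _ (C₁ * c₀ : ℕ∞) fun j _ => h1).trans ?_
    rw [Finset.card_univ, Fintype.card_fin, nsmul_eq_mul]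

/-- Growth of the lowest homology. -/
theorem exists_le_h (M : Model k d m x w ix 𝔪 c μ)
    : ∃ C : ℕ, ∀ (n : ℕ) (G : MC D (n + 1) d) (q : ℕ), 1 ≤ q → G.deg 0 = 0 →
    (∀ i j, G.mat i j ∈ (Ideal.span (Set.range fun i => x i ^ q)).map (algebraMap S D)) →
    (q * q ^ d : ℕ∞) ≤ q * (G.cplx k w).h 0 + C * q ^ d := by
  lift kLen k S (S ⧸ 𝔪) to ℕ using M.fin with ℓ hℓ
  obtain ⟨C, hC⟩ := growth_of_smul_eq_zero (x := x) M.dim M.c_ne (S ⧸ LinearMap.range μ)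
    M.smul_range
  refine ⟨C * ℓ, fun n G q hq h0 hG => ?_⟩
  have h1 := hC q ℓ _ hq (dev_qLen k (x := x) (J := Ideal.span (Set.range fun i => x i ^ q))
    (fun i => Ideal.subset_span ⟨i, rfl⟩) fun Q hQ hx => (M.base_le Q hQ hx).trans hℓ.ge)
  have h2 := G.qLen_le_h (k := k) h0 w _ hG
  have h3 := MC.qLen_le_add (k := k) M.inj (Ideal.span (Set.range fun i => x i ^ q)) μ
  refine (mul_le_mul_right (((by exact_mod_cast M.len q hq :
    (q ^ d : ℕ∞) ≤ _)).trans (h3.trans (add_le_add_left h2 _))) _).trans ?_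
  rw [mul_add]
  push_cast
  exact add_le_add_right h1 _

end Model
end

section
open DMod

theorem le_of_growth {q d m n C₁ C₂ C₃ h R E : ℕ} (hq : 1 ≤ q) (hn : n < 2 ^ d)
    (h1 : 2 ^ (m + d) * h ≤ n * ((R + h) * 2 ^ m + E) + 2 ^ (m + d) * R)
    (hR : q * R ≤ C₁ * q ^ d) (hE : q * E ≤ C₂ * q ^ d) (hh : q * q ^ d ≤ q * h + C₃ * q ^ d) :
    q ≤ (n * 2 ^ m + 2 ^ (m + d)) * C₁ + n * C₂ + C₃ := by
  have h2 : 2 ^ m * ((n + 1) * h) ≤ 2 ^ m * (2 ^ d * h) :=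
    Nat.mul_le_mul_left _ (Nat.mul_le_mul_right _ hn)
  have h3 : 1 ≤ 2 ^ m := Nat.one_le_two_pow
  have h4 : h ≤ (n * 2 ^ m + 2 ^ (m + d)) * R + n * E := by
    have := Nat.mul_le_mul_right h h3
    rw [pow_add] at *
    nlinarith
  have h5 : 0 < q ^ d := pow_pos hq d
  refine Nat.le_of_mul_le_mul_right (c := q ^ d) ?_ h5
  have h6 := Nat.mul_le_mul_left q h4
  have h7 := Nat.mul_le_mul_left (n * 2 ^ m + 2 ^ (m + d)) hR
  have h8 := Nat.mul_le_mul_left n hE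
  nlinarith

namespace Model
variable {k : Type} [Field k] {S D : Type} [CommRing S] [CommRing D] [Algebra k S]
    [Algebra S D] {d m : ℕ} {x : Fin d → S} {w : ℕ → S} {ix : Fin d → ℕ} {𝔪 : Ideal S}
    {c : S} {μ : D →ₗ[S] S}

/-- The rank inequality over a model in positive characteristic. -/
theorem two_pow_le (M : Model k d m x w ix 𝔪 c μ) [IsNoetherianRing S] [IsDomain S]
    [Module.Finite S D] (p : ℕ) [hp : Fact p.Prime] [CharP D p] {n : ℕ} (F : MC D (n + 1) d)
    (h0 : F.deg 0 = 0) {N : ℕ} (hN : ∀ i, F.Null (algebraMap S D (x i ^ N)))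
    (hF : ∀ i j, F.mat i j ∈ ((Ideal.span (Set.range x)).map (algebraMap S D)).radical) :
    2 ^ d ≤ n + 1 := by
  obtain ⟨C₁, hC₁⟩ := M.exists_h_le
  obtain ⟨C₂, hC₂⟩ := M.exists_phi_le (n + 1)
  obtain ⟨C₃, hC₃⟩ := M.exists_le_h
  choose K hK using hF
  obtain ⟨e₀, he₀⟩ : ∃ e₀, ∀ i j, K i j ≤ p ^ e₀ := by
    obtain ⟨B, hB⟩ := Finite.exists_le (fun ij : Fin (n + 1) × Fin (n + 1) => K ij.1 ij.2)
    exact ⟨B, fun i j => (hB (i, j)).trans (Nat.lt_pow_self hp.out.one_lt).le⟩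
  by_contra! hlt
  set a := (N + 1) * p ^ e₀ with ha
  have hp0 := hp.out.pos
  have ha1 : 1 ≤ a := Nat.mul_pos (Nat.succ_pos N) (pow_pos hp0 _)
  obtain ⟨e, he⟩ : ∃ e, ((n + 1) * 2 ^ m + 2 ^ (m + d)) * (d * ((n + 1) * C₁ * a ^ d)) +
      (n + 1) * (C₂ * a ^ d) + C₃ < p ^ e := ⟨_, Nat.lt_pow_self hp.out.one_lt⟩
  refine absurd he (not_lt.2 ?_)
  set q := p ^ e with hq
  have hq1 : 1 ≤ q := pow_pos hp0 _
  set G := F.map (iterateFrobenius D p (e₀ + e)) with hG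
  have hnull : ∀ i, G.Null (algebraMap S D (x i ^ (a * q))) := fun i => by
    have h := ((hN i).mul (algebraMap S D (x i))).map (iterateFrobenius D p (e₀ + e))
    rw [← map_mul, ← pow_succ', iterateFrobenius_def, ← map_pow, ← pow_mul] at h
    rwa [ha, hq, mul_assoc, ← pow_add]
  have hmat : ∀ i j, G.mat i j ∈
      (Ideal.span (Set.range fun i => x i ^ q)).map (algebraMap S D) := fun i j => by
    change iterateFrobenius D p (e₀ + e) (F.mat i j) ∈
      (Ideal.span (Set.range fun i => x i ^ q)).map (algebraMap S D)
    rw [iterateFrobenius_def, pow_add, pow_mul, ← iterateFrobenius_def (p := p) (n := e)]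
    have h1 : F.mat i j ^ p ^ e₀ ∈ (Ideal.span (Set.range x)).map (algebraMap S D) :=
      Ideal.pow_mem_of_pow_mem _ (hK i j) (he₀ i j)
    have h2 := Ideal.mem_map_of_mem (iterateFrobenius D p e) h1
    suffices h3 : ((Ideal.span (Set.range x)).map (algebraMap S D)).map (iterateFrobenius D p e) ≤
        (Ideal.span (Set.range fun i => x i ^ q)).map (algebraMap S D) from h3 h2
    rw [Ideal.map_map, Ideal.map_le_iff_le_comap, Ideal.span_le]
    rintro _ ⟨l, rfl⟩
    change iterateFrobenius D p e (algebraMap S D (x l)) ∈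
      (Ideal.span (Set.range fun i => x i ^ q)).map (algebraMap S D)
    rw [iterateFrobenius_def, ← map_pow]
    exact Ideal.mem_map_of_mem _ (Ideal.subset_span ⟨l, rfl⟩)
  have haq : 1 ≤ a * q := Nat.mul_pos ha1 hq1
  have hh := hC₁ (n + 1) G (a * q) haq hnull
  have hfin : ∀ s < d + 1, (G.cplx k w).h s ≠ ⊤ := fun s _ => (hh s).1
  have e1 := G.two_pow_mul_h_le w (fun _ => True) (m + d) hfin
  have e2 := MC.phi_le_add M.inj (G.cplx k w) (m + d) w (fun _ => True)
  have e3 := M.phi_base_le G hnull hfin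
  have e4 := hC₂ G (a * q) haq hnull
  have e5 := hC₃ n G q hq1 h0 hmat
  have hE : phi (m + d) (G.cplx k w) (mo w (fun _ => True) (MC.Cok S D)) ≠ ⊤ := fun ht => by
    rw [ht, ENat.mul_top (Nat.cast_ne_zero.2 (by omega)), top_le_iff] at e4
    exact ENat.natCast_ne_top (C₂ * (a * q) ^ d) (by push_cast; push_cast at e4; exact e4)
  lift phi (m + d) (G.cplx k w) (mo w (fun _ => True) (MC.Cok S D)) to ℕ using hE with E
  choose h hh' using fun s : ℕ => ENat.ne_top_iff_exists.1 (hh s).1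
  have h00 : (G.cplx k w).h 0 = h 0 := (hh' 0).symm
  simp only [← hh'] at hh e1 e3
  rw [h00] at e1 e5
  have e1' := e1.trans (add_le_add_left (mul_le_mul_right (e2.trans (add_le_add_left e3 _)) _) _)
  rw [Finset.sum_range_succ'] at e1'
  have haq' : q ≤ a * q := Nat.le_mul_of_pos_left _ ha1
  refine le_of_growth (h := h 0) (R := ∑ s ∈ Finset.range d, h (s + 1)) (E := E) hq1 hlt
    (by exact_mod_cast e1') ?_ ?_ (by exact_mod_cast e5)
  · refine (Nat.mul_le_mul_right _ haq').trans ?_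
    rw [Finset.mul_sum]
    refine (Finset.sum_le_card_nsmul _ _ ((n + 1) * C₁ * (a * q) ^ d) fun s _ => ?_).trans ?_
    · exact_mod_cast (hh s).2
    · rw [Finset.card_range, smul_eq_mul, mul_pow]
      exact le_of_eq (by ring)
  · refine (Nat.mul_le_mul_right _ haq').trans ?_
    have : a * q * E ≤ C₂ * (a * q) ^ d := by exact_mod_cast e4
    refine this.trans (le_of_eq (by ring))

end Model
end

section
open DMod RingTheory.Sequence

/-- Killing the first operator, with a change of rings. -/
theorem DMod.hK_mo_succ_le {k S S' V : Type} [Field k] [CommRing S] [Algebra k S] [CommRing S']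
    [Algebra k S'] [AddCommGroup V] [Module S' V] (w : ℕ → S) (y : ℕ → S') (π : S →+ V)
    (hk : ∀ (c : k) v, π (algebraMap k S c * v) = algebraMap k S' c • π v)
    (hy : ∀ i v, π (w (i + 1) * v) = y i • π v) (hs : Function.Surjective π)
    (h0 : ∀ v, w 0 * v = 0 → v = 0) (he : ∀ v, π v = 0 ↔ ∃ u, w 0 * u = v) (m : ℕ) (s : ℤ) :
    hK (m + 1) (mo (k := k) w (fun _ => True) S) s ≤ hK m (mo (k := k) y (fun _ => True) V) s := by
  let _ := kMod k S S
  let _ := kMod k S' V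
  let z : ℕ → S' := fun i => if i = 0 then 0 else y (i - 1)
  refine SES.hK_succ_le (X := mo (k := k) w (fun _ => True) S)
    (Y := mo (k := k) z (fun _ => True) V)
    { i := (mo (k := k) w (fun _ => True) S).u 0
      p := { toFun := π, map_add' := map_add π, map_smul' := hk }
      inj := (injective_iff_map_eq_zero _).2 h0
      surj := hs
      exact := fun v hv => (he v).1 hv
      pi := fun v => (he _).2 ⟨v, rfl⟩
      id := fun v => mul_zero (w 0)
      pd := fun v => map_zero π
      iu := fun n v => mul_left_comm _ _ _
      pu := fun n v => ?_
      igr := fun _ _ => iff_of_true (Or.inl trivial) (Or.inl trivial)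
      pgr := fun _ _ _ => Or.inl trivial
      lift := fun _ v _ => ?_ } rfl m s
  · change π (w n * v) = z n • π v
    rcases n with _ | n
    · rw [(he _).2 ⟨v, rfl⟩]
      exact (zero_smul S' (π v)).symm
    · exact hy n v
  · obtain ⟨v, rfl⟩ := hs v
    exact ⟨v, Or.inl trivial, rfl⟩

/-- Properties of power series rings used for Noether normalization. -/
structure PSB (k A : Type) [Field k] [CommRing A] [Algebra k A] (d : ℕ) (x : Fin d → A) :
    Prop where
  reg : ∀ n, 1 ≤ n → IsWeaklyRegular A (List.ofFn fun i => x i ^ n)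
  len : ∀ q : ℕ, 1 ≤ q → ((q ^ d : ℕ) : ℕ∞) ≤
    kLen k A (A ⧸ Ideal.span (Set.range fun i => x i ^ q))
  kos : ∀ s, hK d (mo (k := k) (Model.yop x 1) (fun _ => True) A) s ≤ 1
  res : ∀ a, ∃ c : k, a - algebraMap k A c ∈ Ideal.span (Set.range x)
  unit : ∀ a ∈ Ideal.span (Set.range x), IsUnit (1 + a)

namespace PSB
variable {k : Type} [Field k]

theorem mem_maximal {A : Type} [CommRing A] [Algebra k A] {d : ℕ} {x : Fin d → A}
    (h : PSB k A d x) (Q : Ideal A) [hQ : Q.IsMaximal] (i : Fin d) : x i ∈ Q := by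
  by_contra hx
  obtain ⟨y, z, hz, e⟩ := hQ.exists_inv hx
  have : IsUnit (1 + -(y * x i)) := h.unit _ (neg_mem (Ideal.mul_mem_left _ _
    (Ideal.subset_span ⟨i, rfl⟩)))
  refine hQ.ne_top (Ideal.eq_top_of_isUnit_mem _ hz ?_)
  rwa [← e, show y * x i + z + -(y * x i) = z by ring] at this

theorem field : PSB k k 0 (Fin.elim0 : Fin 0 → k) where
  reg n _ := by simp
  len q _ := by
    have : IsEmpty (Set.range fun i : Fin 0 => (Fin.elim0 i : k) ^ q) := by
      simp
    rw [Set.range_eq_empty, Ideal.span_empty]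
    have := kLen_le_of_surjective k (S := k) (M := k ⧸ (⊥ : Ideal k)) (M' := k)
      (AlgEquiv.quotientBot k k).toLinearMap (AlgEquiv.quotientBot k k).surjective
    refine le_trans ?_ this
    have h1 : kLen k k k = 1 := by
      have : kMod k k k = Semiring.toModule := by
        refine Module.ext' _ _ fun r m => rfl
      unfold kLen
      rw [this]
      exact Module.length_eq_one k k
    simp [h1]
  kos s := by
    refine (h_mo_le _ _ _ _).trans ?_
    have : kMod k k k = Semiring.toModule := by
      refine Module.ext' _ _ fun r m => rfl
    unfold kLen
    rw [this]
    exact (Module.length_eq_one k k).le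
  res a := ⟨a, by simp⟩
  unit a ha := by
    have : a = 0 := by simpa using ha
    simp [this]

theorem congr {A B : Type} [CommRing A] [Algebra k A] [CommRing B] [Algebra k B] (e : A ≃ₐ[k] B)
    {d : ℕ} {x : Fin d → A} {y : Fin d → B} (hxy : ∀ i, e (x i) = y i) (h : PSB k A d x) :
    PSB k B d y := by
  have hmap : ∀ n : ℕ, (Ideal.span (Set.range fun i => x i ^ n)).map (e : A →+* B) =
      Ideal.span (Set.range fun i => y i ^ n) := by
    intro n
    rw [Ideal.map_span, ← Set.range_comp]
    congr 2
    ext i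
    simp [hxy]
  have hmap1 : (Ideal.span (Set.range x)).map (e : A →+* B) = Ideal.span (Set.range y) := by
    simpa using hmap 1
  constructor
  · intro n hn
    refine (AddEquiv.isWeaklyRegular_congr (e := e.toAddEquiv) ?_).1 (h.reg n hn)
    rw [List.forall₂_iff_get]
    simp [hxy]
  · intro q hq
    refine (h.len q hq).trans ?_
    let _ := kMod k A (A ⧸ Ideal.span (Set.range fun i => x i ^ q))
    let _ := kMod k B (B ⧸ Ideal.span (Set.range fun i => y i ^ q))
    let f := Ideal.quotientEquiv _ _ e.toRingEquiv (hmap q).symm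
    let g : (A ⧸ Ideal.span (Set.range fun i => x i ^ q)) →ₗ[k]
        (B ⧸ Ideal.span (Set.range fun i => y i ^ q)) :=
      { toFun := f, map_add' := map_add f, map_smul' := fun c v => by
          change f (algebraMap k A c • v) = algebraMap k B c • f v
          rw [Algebra.smul_def, Algebra.smul_def, map_mul]
          congr 1
          change Ideal.Quotient.mk _ (e (algebraMap k A c)) = _
          rw [e.commutes]; rfl }
    exact Module.length_le_of_injective g f.injective
  · intro s
    refine le_trans ?_ (h.kos s)
    let _ := kMod k A A
    let _ := kMod k B B
    let g : A ≃ₗ[k] B := { e.toAddEquiv with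
        map_smul' := fun c v => by
          change e (algebraMap k A c * v) = algebraMap k B c * e v
          rw [map_mul, e.commutes] }
    refine hK_le_of_equiv (X := mo (k := k) (Model.yop x 1) (fun _ => True) A)
      (Y := mo (k := k) (Model.yop y 1) (fun _ => True) B) g (fun _ => map_zero g) ?_ ?_ d s
    · intro n v
      change e (Model.yop x 1 n * v) = Model.yop y 1 n * e v
      rw [map_mul]
      congr 1
      unfold Model.yop
      split_ifs <;> simp [hxy]
    · intro s v
      exact ⟨fun _ => Or.inl trivial, fun _ => Or.inl trivial⟩
  · intro a
    obtain ⟨c, hc⟩ := h.res (e.symm a)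
    refine ⟨c, ?_⟩
    rw [← hmap1]
    have := Ideal.mem_map_of_mem (e : A →+* B) hc
    simpa using this
  · intro a ha
    rw [← hmap1] at ha
    obtain ⟨a', ha', rfl⟩ := (Ideal.mem_map_iff_of_surjective (e : A →+* B) e.surjective).1 ha
    simpa using (h.unit a' ha').map (e : A →+* B)

open PowerSeries

open Pointwise in
theorem _root_.PowerSeries.X_pow_dvd_of_coeff {B : Type} [CommRing B] {n : ℕ} {f : B⟦X⟧} :
    f ∈ (X ^ n : B⟦X⟧) • (⊤ : Submodule B⟦X⟧ B⟦X⟧) ↔ ∀ i : Fin n, coeff i f = 0 := by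
  rw [Submodule.mem_smul_pointwise_iff_exists]
  constructor
  · rintro ⟨g, -, rfl⟩ i
    exact (X_pow_dvd_iff.1 (Dvd.intro g rfl)) i i.2
  · intro h
    obtain ⟨g, rfl⟩ := X_pow_dvd_iff.2 fun m hm => h ⟨m, hm⟩
    exact ⟨g, trivial, rfl⟩

open Pointwise in
theorem isWeaklyRegular_powerSeries {B : Type} [CommRing B] {rs : List B}
    (h : IsWeaklyRegular B rs) (n : ℕ) :
    IsWeaklyRegular B⟦X⟧ ((X ^ n : B⟦X⟧) :: rs.map (algebraMap B B⟦X⟧)) := by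
  rw [isWeaklyRegular_cons_iff]
  constructor
  · intro f g hfg
    ext i
    have := congrArg (coeff (i + n)) (hfg : X ^ n * f = X ^ n * g)
    simpa [coeff_X_pow_mul] using this
  · rw [isWeaklyRegular_map_algebraMap_iff]
    let φ : B⟦X⟧ →ₗ[B] (Fin n → B) := LinearMap.pi fun i => coeff (i : ℕ)
    have hφ : Function.Surjective φ := by
      intro v
      refine ⟨PowerSeries.mk fun i => if h : i < n then v ⟨i, h⟩ else 0, ?_⟩
      ext i
      simp [φ]
    have hk : LinearMap.ker φ =
        ((X ^ n : B⟦X⟧) • (⊤ : Submodule B⟦X⟧ B⟦X⟧)).restrictScalars B := by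
      ext f
      rw [LinearMap.mem_ker, Submodule.restrictScalars_mem, X_pow_dvd_of_coeff, funext_iff]
      rfl
    let e : QuotSMulTop (X ^ n : B⟦X⟧) B⟦X⟧ ≃ₗ[B] (Fin n → B) :=
      (Submodule.Quotient.restrictScalarsEquiv B _).symm ≪≫ₗ
        Submodule.quotEquivOfEq _ _ hk.symm ≪≫ₗ φ.quotKerEquivOfSurjective hφ
    rw [e.isWeaklyRegular_congr]
    exact ((TensorProduct.rid B (Fin n → B)).isWeaklyRegular_congr rs).1
      (h.isWeaklyRegular_lTensor (M₂ := Fin n → B))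

theorem powerSeries {B : Type} [CommRing B] [Algebra k B] {d : ℕ} {x : Fin d → B}
    (h : PSB k B d x) :
    PSB k B⟦X⟧ (d + 1) (Fin.cons X fun i => C (x i) : Fin (d + 1) → B⟦X⟧) where
  reg n hn := by
    have := isWeaklyRegular_powerSeries (h.reg n hn) n
    rw [List.map_ofFn] at this
    rw [List.ofFn_succ]
    have e : (fun i : Fin d => (Fin.cons X fun i => C (x i) : Fin (d + 1) → B⟦X⟧) i.succ ^ n) =
        algebraMap B B⟦X⟧ ∘ fun i => x i ^ n := funext fun i => (map_pow C (x i) n).symm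
    rw [e]
    exact this
  len q hq := by
    have e1 : ((q ^ (d + 1) : ℕ) : ℕ∞) = q * ((q ^ d : ℕ) : ℕ∞) := by
      rw [pow_succ']; push_cast; rfl
    rw [e1]
    refine (mul_le_mul_right (h.len q hq) _).trans ?_
    set J := Ideal.span (Set.range fun i => x i ^ q)
    set I := Ideal.span (Set.range fun i => (Fin.cons X fun i => C (x i) : Fin (d + 1) → B⟦X⟧) i ^ q)
    let _ := kMod k B (B ⧸ J)
    let _ := kMod k B⟦X⟧ (B⟦X⟧ ⧸ I)
    have hl : Module.length k (Fin q → B ⧸ J) = q * kLen k B (B ⧸ J) := by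
      rw [Module.length_pi_of_fintype]
      simp [kLen]
    rw [← hl]
    let φ : B⟦X⟧ →ₗ[B] (Fin q → B ⧸ J) :=
      LinearMap.pi fun i => (Submodule.mkQ J) ∘ₗ coeff (i : ℕ)
    have hφ : ∀ f ∈ I, φ f = 0 := by
      suffices ∀ f ∈ I, ∀ i < q, coeff i f ∈ J by
        intro f hf
        ext i
        exact (Submodule.Quotient.mk_eq_zero _).2 (this f hf i i.2)
      intro f hf
      induction hf using Submodule.span_induction with
      | mem f hf =>
        obtain ⟨i, rfl⟩ := hf
        intro j hj
        refine Fin.cases ?_ (fun i => ?_) i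
        · simp [coeff_X_pow, hj.ne]
        · simp only [Fin.cons_succ, ← map_pow, coeff_C]
          split_ifs
          · exact Ideal.subset_span ⟨i, rfl⟩
          · exact zero_mem _
      | zero => simp
      | add f g _ _ hf hg => exact fun i hi => by simpa using add_mem (hf i hi) (hg i hi)
      | smul a f _ hf =>
        intro i hi
        rw [smul_eq_mul, coeff_mul]
        refine sum_mem fun p hp => Ideal.mul_mem_left _ _ (hf _ ?_)
        have := Finset.HasAntidiagonal.mem_antidiagonal.1 hp
        omega
    let ψ : (B⟦X⟧ ⧸ I) →+ (Fin q → B ⧸ J) := QuotientAddGroup.lift I.toAddSubgroup φ.toAddMonoidHom hφ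
    let ψ' : (B⟦X⟧ ⧸ I) →ₗ[k] (Fin q → B ⧸ J) :=
      { toFun := ψ
        map_add' := map_add ψ
        map_smul' := fun c v => by
          obtain ⟨f, rfl⟩ := Submodule.Quotient.mk_surjective _ v
          have : algebraMap k B⟦X⟧ c * f = algebraMap k B c • f := by
            rw [Algebra.smul_def, PowerSeries.algebraMap_apply]; rfl
          change φ (algebraMap k B⟦X⟧ c * f) = fun i => algebraMap k B c • φ f i
          rw [this, map_smul]
          rfl }
    refine Module.length_le_of_surjective ψ' fun v => ?_
    choose g hg using fun i => Submodule.Quotient.mk_surjective _ (v i)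
    refine ⟨Submodule.Quotient.mk (PowerSeries.mk fun i => if h : i < q then g ⟨i, h⟩ else 0), ?_⟩
    change φ _ = v
    ext i
    simpa [φ] using hg i
  kos s := by
    refine (hK_mo_succ_le _ (Model.yop x 1) (constantCoeff (R := B)).toAddMonoidHom ?_ ?_
      constantCoeff_surj ?_ ?_ d s).trans (h.kos s)
    · intro c v
      change constantCoeff (algebraMap k B⟦X⟧ c * v) = _ * constantCoeff v
      simp [PowerSeries.algebraMap_apply]
    · intro i v
      change constantCoeff (_ * v) = _ * constantCoeff v
      rw [map_mul]
      congr 1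
      unfold Model.yop
      by_cases hi : i < d
      · rw [dif_pos hi, dif_pos (by omega)]
        change constantCoeff (C (x ⟨i, hi⟩) ^ 1) = _
        simp
      · rw [dif_neg hi, dif_neg (by omega), map_zero]
    · intro v hv
      have hv' : X ^ 1 * v = 0 := hv
      ext i
      simpa using congrArg (coeff (i + 1)) hv'
    · intro v
      change constantCoeff v = 0 ↔ _
      rw [← X_dvd_iff]
      simp only [Model.yop, Nat.zero_lt_succ, dif_pos, pow_one]
      exact ⟨fun ⟨u, h⟩ => ⟨u, h.symm⟩, fun ⟨u, h⟩ => ⟨u, h.symm⟩⟩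
  res f := by
    obtain ⟨c, hc⟩ := h.res (constantCoeff f)
    refine ⟨c, ?_⟩
    have h1 := f.eq_X_mul_shift_add_const
    have h2 : f - algebraMap k B⟦X⟧ c = X * (PowerSeries.mk fun p => coeff (p + 1) f) +
        C (constantCoeff f - algebraMap k B c) := by
      conv_lhs => rw [h1]
      rw [map_sub, add_sub_assoc, PowerSeries.algebraMap_apply]
    rw [h2]
    refine add_mem (Ideal.mul_mem_right _ _ (Ideal.subset_span ⟨0, rfl⟩)) ?_
    have := Ideal.mem_map_of_mem (C (R := B)) hc
    rw [Ideal.map_span, ← Set.range_comp] at this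
    refine Ideal.span_mono ?_ this
    rintro _ ⟨i, rfl⟩
    exact ⟨Fin.succ i, rfl⟩
  unit f hf := by
    rw [PowerSeries.isUnit_iff_constantCoeff, map_add, map_one]
    refine h.unit _ ?_
    have : (Ideal.span (Set.range (Fin.cons X fun i => C (x i) : Fin (d + 1) → B⟦X⟧))).map
        (constantCoeff (R := B)) ≤ Ideal.span (Set.range x) := by
      rw [Ideal.map_span, Ideal.span_le]
      rintro _ ⟨_, ⟨i, rfl⟩, rfl⟩
      refine Fin.cases ?_ (fun i => ?_) i
      · simp
      · simpa using Ideal.subset_span (Set.mem_range_self i)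
    exact this (Ideal.mem_map_of_mem _ hf)

theorem mvPowerSeries (d : ℕ) : PSB k (MvPowerSeries (Fin d) k) d MvPowerSeries.X := by
  induction d with
  | zero => exact field.congr (MvPowerSeries.isEmptyEquiv (Fin 0) k).symm fun i => i.elim0
  | succ d ih =>
    refine ih.powerSeries.congr (MvPowerSeries.finSuccEquiv k d).symm fun i => ?_
    rw [AlgEquiv.symm_apply_eq]
    refine Fin.cases ?_ (fun i => ?_) i <;> simp

end PSB
end

section
open DMod RingTheory.Sequence

/-- Finite free extensions with controlled Koszul homology. -/
structure Tw (k A S : Type) [Field k] [CommRing A] [CommRing S] [Algebra k A] [Algebra k S]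
    [Algebra A S] {d : ℕ} (x : Fin d → A) (m : ℕ) (w : ℕ → S) : Prop where
  free : Module.Free A S
  fin : Module.Finite A S
  tower : IsScalarTower k A S
  wx : ∀ j : Fin d, w (m + j) = algebraMap A S (x j)
  w0 : ∀ i ≥ m + d, w i = 0
  wrad : ∀ i, w i ∈ (Ideal.span (Set.range fun j => algebraMap A S (x j))).radical
  res : ∀ v, ∃ c : k, v - algebraMap k S c ∈
    (Ideal.span (Set.range fun j => algebraMap A S (x j))).radical
  kos : ∀ s, hK (m + d) (mo (k := k) w (fun _ => True) S) s ≤ 2 ^ m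

namespace Tw
variable {k A : Type} [Field k] [CommRing A] [Algebra k A] {d : ℕ} {x : Fin d → A}

theorem base (h : PSB k A d x) : Tw k A A x 0 (Model.yop x 1) where
  free := inferInstance
  fin := inferInstance
  tower := inferInstance
  wx j := by rw [zero_add, Model.yop_coe]; simp
  w0 i hi := dif_neg (by omega)
  wrad i := by
    unfold Model.yop
    split_ifs with hi
    · exact Ideal.le_radical (Ideal.subset_span ⟨⟨i, hi⟩, by simp⟩)
    · exact zero_mem _
  res v := by
    obtain ⟨c, hc⟩ := h.res v
    exact ⟨c, Ideal.le_radical hc⟩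
  kos s := by simpa using h.kos s

open Polynomial

theorem adjoinRoot {S : Type} [CommRing S] [IsDomain S] [Algebra k S] [Algebra A S] {m : ℕ}
    {w : ℕ → S} (h : Tw k A S x m w) {g : S[X]} (hg : g.Monic) [IsDomain (AdjoinRoot g)]
    (hr : AdjoinRoot.root g ≠ 0) (hd : g.natDegree ≠ 0) (j : Fin d)
    (hc : ∀ i < g.natDegree, g.coeff i ∈ Ideal.span {algebraMap A S (x j)}) :
    Tw k A (AdjoinRoot g) x (m + 1)
      (fun i => if i = 0 then AdjoinRoot.root g else AdjoinRoot.of g (w (i - 1))) := by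
  have := h.free
  have := h.fin
  have := h.tower
  have hA : ∀ a, algebraMap A (AdjoinRoot g) a = AdjoinRoot.of g (algebraMap A S a) := fun a => rfl
  have hk : ∀ a, algebraMap k (AdjoinRoot g) a = AdjoinRoot.of g (algebraMap k S a) := fun a => rfl
  have hmap : (Ideal.span (Set.range fun j => algebraMap A S (x j))).map (AdjoinRoot.of g) =
      Ideal.span (Set.range fun j => algebraMap A (AdjoinRoot g) (x j)) := by
    rw [Ideal.map_span, ← Set.range_comp]; rfl
  set I := Ideal.span (Set.range fun j => algebraMap A S (x j))
  set I' := Ideal.span (Set.range fun j => algebraMap A (AdjoinRoot g) (x j))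
  have hrad : ∀ v ∈ I.radical, AdjoinRoot.of g v ∈ I'.radical := by
    intro v hv
    rw [← hmap]
    exact Ideal.map_radical_le _ (Ideal.mem_map_of_mem _ hv)
  have hroot : AdjoinRoot.root g ∈ I'.radical := by
    refine ⟨g.natDegree, ?_⟩
    have h1 : aeval (AdjoinRoot.root g) g = 0 := by rw [AdjoinRoot.aeval_eq, AdjoinRoot.mk_self]
    rw [aeval_eq_sum_range, Finset.sum_range_succ, hg.coeff_natDegree, one_smul] at h1
    rw [eq_neg_of_add_eq_zero_right h1]
    refine neg_mem (sum_mem fun i hi => ?_)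
    rw [Algebra.smul_def]
    refine Ideal.mul_mem_right _ _ ?_
    rw [← hmap]
    refine Ideal.mem_map_of_mem _ ?_
    refine Ideal.span_mono ?_ (hc i (Finset.mem_range.1 hi))
    rintro _ rfl
    exact ⟨j, rfl⟩
  have hg0 : g.coeff 0 ≠ 0 := by
    intro h0
    obtain ⟨q, hq⟩ := X_dvd_iff.2 h0
    have h1 : AdjoinRoot.root g * AdjoinRoot.mk g q = 0 := by
      rw [← AdjoinRoot.mk_X, ← map_mul, ← hq, AdjoinRoot.mk_self]
    have h2 := (mul_eq_zero.1 h1).resolve_left hr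
    rw [AdjoinRoot.mk_eq_zero] at h2
    have hq0 : q ≠ 0 := by
      rintro rfl
      exact hg.ne_zero (by simpa using hq)
    have h3 := natDegree_le_of_dvd h2 hq0
    have h4 := congrArg natDegree hq
    rw [natDegree_X_mul hq0] at h4
    omega
  have := (AdjoinRoot.powerBasis' hg).finite
  have := Module.Free.of_basis (AdjoinRoot.powerBasis' hg).basis
  refine ⟨Module.Free.trans (S := S), Module.Finite.trans S _, ?_, ?_, ?_, ?_, ?_, ?_⟩
  · refine IsScalarTower.of_algebraMap_eq fun c => ?_
    rw [hk, hA, ← IsScalarTower.algebraMap_apply]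
  · intro i
    rw [if_neg (by omega), show m + 1 + (i : ℕ) - 1 = m + i by omega, h.wx, hA]
  · intro i hi
    rw [if_neg (by omega), h.w0 _ (by omega), map_zero]
  · intro i
    split_ifs
    · exact hroot
    · exact hrad _ (h.wrad _)
  · intro v
    induction v using AdjoinRoot.induction_on with | _ f
    obtain ⟨c, hc⟩ := h.res (f.coeff 0)
    refine ⟨c, ?_⟩
    obtain ⟨q, hq⟩ := X_dvd_sub_C (p := f)
    have : AdjoinRoot.mk g f - algebraMap k _ c = AdjoinRoot.root g * AdjoinRoot.mk g q +
        AdjoinRoot.of g (f.coeff 0 - algebraMap k S c) := by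
      rw [← AdjoinRoot.mk_X, ← map_mul, ← hq, hk, ← AdjoinRoot.mk_C, ← AdjoinRoot.mk_C]
      simp
    rw [this]
    exact add_mem (Ideal.mul_mem_right _ _ hroot) (hrad _ hc)
  · intro s
    let G := Ideal.span {g.coeff 0}
    let π : AdjoinRoot g →+* S ⧸ G := AdjoinRoot.lift (Ideal.Quotient.mk G) 0 (by
      rw [eval₂_at_zero, Ideal.Quotient.eq_zero_iff_mem]
      exact Ideal.mem_span_singleton_self _)
    have hπ : ∀ f, π (AdjoinRoot.mk g f) = Ideal.Quotient.mk G (f.coeff 0) := by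
      intro f
      rw [AdjoinRoot.lift_mk, eval₂_at_zero]
    have hof : ∀ a, π (AdjoinRoot.of g a) = Ideal.Quotient.mk G a := by
      intro a
      rw [← AdjoinRoot.mk_C, hπ, coeff_C_zero]
    have h1 := hK_mo_succ_le (k := k)
      (fun i => if i = 0 then AdjoinRoot.root g else AdjoinRoot.of g (w (i - 1))) w
      (V := S ⧸ G) π.toAddMonoidHom (fun c v => by
        change π (_ * v) = _ • π v
        rw [map_mul, hk, hof]; rfl) (fun i v => by
        change π (AdjoinRoot.of g (w i) * v) = _ • π v
        rw [map_mul, hof]; rfl) (fun v => by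
        obtain ⟨v, rfl⟩ := Ideal.Quotient.mk_surjective v
        exact ⟨AdjoinRoot.of g v, hof v⟩)
      (fun v hv => (mul_eq_zero.1 hv).resolve_left hr) (fun v => by
        change π v = 0 ↔ ∃ u, AdjoinRoot.root g * u = v
        constructor
        · intro hv
          induction v using AdjoinRoot.induction_on with | _ f
          rw [hπ, Ideal.Quotient.eq_zero_iff_mem, Ideal.mem_span_singleton'] at hv
          obtain ⟨a, ha⟩ := hv
          obtain ⟨q, hq⟩ : X ∣ f - C a * g := X_dvd_iff.2 (by simp [ha])
          refine ⟨AdjoinRoot.mk g q, ?_⟩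
          rw [← AdjoinRoot.mk_X, ← map_mul, ← hq]
          simp
        · rintro ⟨u, rfl⟩
          rw [map_mul, ← AdjoinRoot.mk_X, hπ]
          simp) (m + d) s
    rw [show m + 1 + d = m + d + 1 by ring]
    refine h1.trans (((SES.moMul w (fun _ => True) (g.coeff 0) (Submodule.mkQ G)
      (fun v hv => (mul_eq_zero.1 hv).resolve_left hg0) (Submodule.mkQ_surjective _)
      fun v => ?_).hK_right _ _).trans ((add_le_add (h.kos _) (h.kos _)).trans_eq ?_))
    · rw [Submodule.mkQ_apply, Submodule.Quotient.mk_eq_zero, Ideal.mem_span_singleton]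
      exact ⟨fun ⟨u, h⟩ => ⟨u, h.symm⟩, fun ⟨u, h⟩ => ⟨u, h.symm⟩⟩
    · rw [pow_succ, mul_two]

end Tw
end

section
open DMod RingTheory.Sequence

namespace Tw
open Polynomial
variable {k A : Type} [Field k] [CommRing A] [Algebra k A] {d : ℕ} {x : Fin d → A}

theorem extend {S D : Type} [CommRing S] [Algebra k S] [Algebra A S] [CommRing D] [IsDomain D]
    [Algebra A D] {m : ℕ} {w : ℕ → S} (h : Tw k A S x m w) (φ : S →ₐ[A] D)
    (hφ : Function.Injective φ) {t : D} (ht : IsIntegral A t)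
    (hn : ∀ c : S, c ≠ 0 → φ c * t ∉ φ.range) {j : Fin d} (hj : algebraMap A S (x j) ≠ 0) :
    ∃ (S' : Type) (_ : CommRing S') (_ : Algebra k S') (_ : Algebra A S') (w' : ℕ → S')
      (_ : Tw k A S' x (m + 1) w') (φ' : S' →ₐ[A] D), Function.Injective φ' ∧
      φ.range < φ'.range := by
  have hS : IsDomain S := hφ.isDomain φ.toRingHom
  have hex : ∃ e, ∃ P : S[X], P ≠ 0 ∧ eval₂ φ.toRingHom t P = 0 ∧ P.natDegree = e := by
    obtain ⟨P, hP, hP0⟩ := ht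
    refine ⟨_, P.map (algebraMap A S), (hP.map _).ne_zero, ?_, rfl⟩
    have h1 : φ.toRingHom.comp (algebraMap A S) = algebraMap A D := φ.comp_algebraMap
    rw [eval₂_map, h1]
    exact hP0
  classical
  obtain ⟨P, hP, hP0, hPe⟩ := Nat.find_spec hex
  have hmin : ∀ Q : S[X], eval₂ φ.toRingHom t Q = 0 → Q.natDegree < P.natDegree → Q = 0 := by
    intro Q hQ hlt
    by_contra hne
    exact Nat.find_min hex (hPe ▸ hlt) ⟨Q, hne, hQ, rfl⟩
  set b := algebraMap A S (x j)
  set a := P.leadingCoeff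
  have ha : a ≠ 0 := leadingCoeff_ne_zero.2 hP
  have hd : P.natDegree ≠ 0 := by
    intro h0
    rw [eq_C_of_natDegree_eq_zero h0, eval₂_C] at hP0
    have := (map_eq_zero_iff φ.toRingHom hφ).1 hP0
    rw [eq_C_of_natDegree_eq_zero h0, this] at hP
    simp at hP
  set T := φ (a * b) * t
  have hT : T ∉ φ.range := hn _ (mul_ne_zero ha hj)
  set g := scaleRoots (integralNormalization P) b
  have hg : g.Monic := (monic_scaleRoots_iff _).2 (monic_integralNormalization hP)
  have hgd : g.natDegree = P.natDegree := by
    rw [natDegree_scaleRoots, natDegree_integralNormalization]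
  have hgT : eval₂ φ.toRingHom T g = 0 := by
    have h1 := integralNormalization_eval₂_eq_zero φ.toRingHom hP0
      (fun y hy => (map_eq_zero_iff φ.toRingHom hφ).1 hy)
    have h2 := scaleRoots_eval₂_eq_zero φ.toRingHom (s := b) h1
    have h3 : T = φ.toRingHom b * (φ.toRingHom P.leadingCoeff * t) := by
      change φ (a * b) * t = φ b * (φ a * t)
      rw [map_mul]; ring
    rwa [h3]
  let φ' : AdjoinRoot g →ₐ[A] D :=
    { AdjoinRoot.lift φ.toRingHom T hgT with
      commutes' := fun r => by
        change AdjoinRoot.lift φ.toRingHom T hgT (AdjoinRoot.of g (algebraMap A S r)) = _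
        rw [AdjoinRoot.lift_of]
        exact φ.commutes r }
  have hmk : ∀ f, φ' (AdjoinRoot.mk g f) = eval₂ φ.toRingHom T f := fun f =>
    AdjoinRoot.lift_mk hgT f
  have hinj : Function.Injective φ' := by
    rw [injective_iff_map_eq_zero]
    intro v hv
    induction v using AdjoinRoot.induction_on with | _ f
    have hdiv := modByMonic_add_div f g
    have hmod : AdjoinRoot.mk g f = AdjoinRoot.mk g (f %ₘ g) := by
      conv_lhs => rw [← hdiv]
      rw [map_add, map_mul, AdjoinRoot.mk_self, zero_mul, add_zero]
    rw [hmod] at hv ⊢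
    rw [hmk] at hv
    have hr : (f %ₘ g).natDegree < P.natDegree := by
      rw [← hgd]
      exact natDegree_modByMonic_lt _ hg (fun h1 => by rw [h1, natDegree_one] at hgd; omega)
    set r := f %ₘ g
    have h1 : r.comp (C (a * b) * X) = 0 := by
      refine hmin _ ?_ ?_
      · rw [eval₂_comp, eval₂_mul, eval₂_C, eval₂_X]
        exact hv
      · refine lt_of_le_of_lt natDegree_comp_le ?_
        refine lt_of_le_of_lt (Nat.mul_le_mul_left _ (natDegree_C_mul_le _ _)) ?_
        simpa using hr
    have h2 : r = 0 := by
      ext i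
      have := congrArg (fun q => coeff q i) h1
      simp only [comp_C_mul_X_coeff, coeff_zero] at this
      exact (mul_eq_zero.1 this).resolve_right (pow_ne_zero _ (mul_ne_zero ha hj))
    rw [h2, map_zero]
  have hroot : φ' (AdjoinRoot.root g) = T := AdjoinRoot.lift_root hgT
  have : IsDomain (AdjoinRoot g) := hinj.isDomain φ'.toRingHom
  refine ⟨AdjoinRoot g, inferInstance, inferInstance, inferInstance, _,
    h.adjoinRoot hg ?_ (by omega) j ?_, φ', hinj, ?_⟩
  · intro h0
    rw [h0, map_zero] at hroot
    exact hT (hroot ▸ zero_mem _)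
  · intro i hi
    rw [coeff_scaleRoots, Ideal.mem_span_singleton]
    refine Dvd.dvd.mul_left (dvd_pow_self _ ?_) _
    rw [natDegree_scaleRoots] at hi
    omega
  · refine lt_of_le_of_ne ?_ fun he => hT (he ▸ ⟨_, hroot⟩)
    rintro _ ⟨s, rfl⟩
    exact ⟨AdjoinRoot.of g s, AdjoinRoot.lift_of hgT⟩

/-- Inside a finite domain extension there is a tower over which everything is torsion. -/
theorem exists_torsion (h : PSB k A d x) {D : Type} [CommRing D] [IsDomain D] [Algebra A D]
    [IsNoetherianRing A] [Module.Finite A D] (hinj : Function.Injective (algebraMap A D))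
    {j : Fin d} (hj : x j ≠ 0) :
    ∃ (m : ℕ) (S : Type) (_ : CommRing S) (_ : Algebra k S) (_ : Algebra A S) (w : ℕ → S)
      (_ : Tw k A S x m w) (φ : S →ₐ[A] D), Function.Injective φ ∧
      ∀ t : D, ∃ c : S, c ≠ 0 ∧ φ c * t ∈ φ.range := by
  let Pr : Submodule A D → Prop := fun N =>
    ∃ (m : ℕ) (S : Type) (_ : CommRing S) (_ : Algebra k S) (_ : Algebra A S) (w : ℕ → S)
      (_ : Tw k A S x m w) (φ : S →ₐ[A] D), Function.Injective φ ∧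
      Subalgebra.toSubmodule φ.range = N
  have : IsNoetherian A D := isNoetherian_of_isNoetherianRing_of_finite A D
  obtain ⟨N, ⟨m, S, i1, i2, i3, w, hw, φ, hφ, rfl⟩, hN⟩ :=
    (wellFounded_gt (α := Submodule A D)).has_min {N | Pr N}
      ⟨_, 0, A, inferInstance, inferInstance, inferInstance, _, base h, Algebra.ofId A D,
        hinj, rfl⟩
  refine ⟨m, S, i1, i2, i3, w, hw, φ, hφ, ?_⟩
  by_contra! hcon
  obtain ⟨t, ht⟩ := hcon
  have hj' : algebraMap A S (x j) ≠ 0 := by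
    intro h0
    have := congrArg φ h0
    rw [φ.commutes, map_zero] at this
    exact hj (hinj (by rw [this, map_zero]))
  obtain ⟨S', j1, j2, j3, w', hw', φ', hφ', hlt⟩ :=
    hw.extend φ hφ (Algebra.IsIntegral.isIntegral t) ht hj'
  exact hN _ ⟨m + 1, S', j1, j2, j3, w', hw', φ', hφ', rfl⟩ hlt

end Tw
end

section
open DMod RingTheory.Sequence

theorem dimLT_of_height_le {S : Type} [CommRing S] {d : ℕ}
    (h : ∀ M : Ideal S, M.IsMaximal → M.height ≤ d) :
    ∀ (r : ℕ) (p : Ideal S), p.IsPrime → (d + 1 : ℕ∞) ≤ p.height + r → DimLT r p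
  | 0, p, hp, hr => by
    obtain ⟨M, hM, hpM⟩ := p.exists_le_maximal hp.ne_top
    have := (Ideal.height_mono hpM).trans (h M hM)
    simp only [Nat.cast_zero, add_zero] at hr
    have := hr.trans this
    norm_cast at this
    omega
  | r + 1, p, hp, hr => fun q hq hlt => by
    refine dimLT_of_height_le h r q hq (hr.trans ?_)
    have := Ideal.height_add_one_le_of_lt_of_isPrime hlt
    push_cast
    rw [add_comm (r : ℕ∞), ← add_assoc]
    gcongr

namespace Tw
variable {k A : Type} [Field k] [CommRing A] [Algebra k A] {d : ℕ} {x : Fin d → A}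
  {S : Type} [CommRing S] [Algebra k S] [Algebra A S] {m : ℕ} {w : ℕ → S}

theorem eq_radical (h : Tw k A S x m w) {Q : Ideal S} (hQ : Q.IsPrime)
    (hx : ∀ i, algebraMap A S (x i) ∈ Q) :
    Q = (Ideal.span (Set.range fun j => algebraMap A S (x j))).radical := by
  have h1 : (Ideal.span (Set.range fun j => algebraMap A S (x j))).radical ≤ Q := by
    rw [hQ.radical_le_iff, Ideal.span_le]
    rintro _ ⟨j, rfl⟩
    exact hx j
  refine le_antisymm (fun v hv => ?_) h1
  obtain ⟨c, hc⟩ := h.res v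
  have hcQ : algebraMap k S c ∈ Q := by
    have := Q.sub_mem hv (h1 hc)
    simpa using this
  have : c = 0 := by
    by_contra hne
    exact hQ.ne_top (Q.eq_top_of_isUnit_mem hcQ ((isUnit_iff_ne_zero.2 hne).map _))
  simpa [this] using hc

theorem height_le (h : Tw k A S x m w) (hA : PSB k A d x) [IsNoetherianRing S] (M : Ideal S)
    (hM : M.IsMaximal) : M.height ≤ d := by
  have := h.fin
  have hx : ∀ i, algebraMap A S (x i) ∈ M := by
    have : (M.comap (algebraMap A S)).IsMaximal :=
      Ideal.isMaximal_comap_of_isIntegral_of_isMaximal M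
    exact fun i => hA.mem_maximal (M.comap (algebraMap A S)) i
  have h1 : M ∈ (Ideal.span (Set.range fun j => algebraMap A S (x j))).minimalPrimes := by
    refine ⟨⟨hM.isPrime, ?_⟩, fun Q hQ _ => ?_⟩
    · rw [Ideal.span_le]
      rintro _ ⟨j, rfl⟩
      exact hx j
    · rw [h.eq_radical hM.isPrime hx, h.eq_radical hQ.1 fun i => hQ.2 (Ideal.subset_span ⟨i, rfl⟩)]
  refine (Ideal.height_le_card_of_mem_minimalPrimes_span (Set.finite_range _) h1).trans ?_
  rw [← Set.image_univ]
  exact_mod_cast (Set.ncard_image_le Set.finite_univ).trans (by simp)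

theorem len_le (h : Tw k A S x m w) (hA : PSB k A d x) [Nontrivial S] (q : ℕ) (hq : 1 ≤ q) :
    ((q ^ d : ℕ) : ℕ∞) ≤
      DMod.qLen k (Ideal.span (Set.range fun i => algebraMap A S (x i) ^ q)) S := by
  have := h.free
  have := h.tower
  refine (hA.len q hq).trans ?_
  let b := Module.Free.chooseBasis A S
  obtain ⟨i₀⟩ := b.index_nonempty
  let f := b.coord i₀
  set I := Ideal.span (Set.range fun i => x i ^ q)
  set J := Ideal.span (Set.range fun i => algebraMap A S (x i) ^ q)
  have hJ : ∀ v ∈ J, ∀ a, f (a * v) ∈ I := by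
    intro v hv
    refine Submodule.span_induction ?_ ?_ ?_ ?_ hv
    · rintro _ ⟨i, rfl⟩ a
      change f (a * algebraMap A S (x i) ^ q) ∈ I
      rw [mul_comm, ← map_pow, ← Algebra.smul_def, map_smul, smul_eq_mul]
      exact I.mul_mem_right _ (Ideal.subset_span ⟨i, rfl⟩)
    · intro a; simp
    · intro u v _ _ hu hv a
      rw [mul_add, map_add]
      exact add_mem (hu a) (hv a)
    · intro a v _ hv b
      rw [smul_eq_mul, ← mul_assoc]
      exact hv _
  have hle : (J • ⊤ : Submodule S S).restrictScalars A ≤ LinearMap.ker ((Submodule.mkQ I) ∘ₗ f) := by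
    intro v hv
    have hv' : v ∈ J := by
      have : v ∈ (J • ⊤ : Submodule S S) := hv
      rwa [smul_eq_mul, Ideal.mul_top] at this
    rw [LinearMap.mem_ker, LinearMap.comp_apply, Submodule.mkQ_apply,
      Submodule.Quotient.mk_eq_zero]
    simpa using hJ v hv' 1
  let g := Submodule.liftQ _ _ hle
  let _ := kMod k S (S ⧸ (J • ⊤ : Submodule S S))
  let _ := kMod k A (A ⧸ I)
  let g' : (S ⧸ (J • ⊤ : Submodule S S)) →ₗ[k] (A ⧸ I) :=
    { toFun := g
      map_add' := g.map_add
      map_smul' := fun c v => by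
        induction v using Submodule.Quotient.induction_on with | _ v
        change Submodule.mkQ I (f (algebraMap k S c * v)) =
          algebraMap k A c • Submodule.mkQ I (f v)
        rw [IsScalarTower.algebraMap_apply k A S, ← Algebra.smul_def, map_smul, map_smul] }
  refine Module.length_le_of_surjective g' ?_
  intro v
  obtain ⟨v, rfl⟩ := Submodule.mkQ_surjective I v
  refine ⟨Submodule.Quotient.mk (v • b i₀), ?_⟩
  change Submodule.mkQ I (f (v • b i₀)) = _
  simp [f]

theorem model [IsNoetherianRing S] [IsDomain S] (h : Tw k A S x m w) (hA : PSB k A d x)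
    {D : Type} [CommRing D] [Algebra S D] (hinj : Function.Injective (algebraMap S D)) {c : S}
    (hc : c ≠ 0) {μ : D →ₗ[S] S} (hμ : ∀ v, algebraMap S D (μ v) = c • v) :
    Model k d m (fun j => algebraMap A S (x j)) w (fun j => m + j)
      (Ideal.span (Set.range fun j => algebraMap A S (x j))).radical c μ where
  hx j := (h.wx j).symm
  hL j := by omega
  hw := h.wrad
  hw0 := h.w0
  xm i := Ideal.le_radical (Ideal.subset_span ⟨i, rfl⟩)
  prime Q hQ hx := h.eq_radical hQ hx
  fin := by
    set 𝔪 := (Ideal.span (Set.range fun j => algebraMap A S (x j))).radical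
    let _ := kMod k S (S ⧸ 𝔪)
    let g : k →ₗ[k] (S ⧸ 𝔪) :=
      { toFun := fun c => Submodule.Quotient.mk (algebraMap k S c)
        map_add' := fun a b => by rw [map_add]; rfl
        map_smul' := fun a b => by rw [smul_eq_mul, map_mul]; rfl }
    refine ne_top_of_le_ne_top ?_ (Module.length_le_of_surjective g ?_)
    · rw [Module.length_eq_one]
      simp
    · intro v
      induction v using Submodule.Quotient.induction_on with | _ v
      obtain ⟨c, hc⟩ := h.res v
      exact ⟨c, ((Submodule.Quotient.eq _).2 hc).symm⟩
  dim := dimLT_of_height_le (h.height_le hA) _ _ Ideal.isPrime_bot (by simp)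
  c_ne := hc
  inj := hinj
  hμ := hμ
  len := h.len_le hA
  reg n hn := by
    have := h.free
    have := (hA.reg n hn).of_flat (S := S)
    rw [List.map_ofFn] at this
    convert this using 2
    ext i
    simp
  kos := by
    refine le_trans ?_ (h.kos 0)
    let _ := kMod k S S
    refine hK_le_of_equiv (X := mo (k := k) w (fun _ => True) S)
      (Y := (mo (k := k) w (fun _ => True) S).flat) (LinearEquiv.refl k S) (fun _ => rfl)
      (fun _ _ => rfl) ?_ _ _
    exact fun s v => ⟨fun _ => Or.inl trivial, fun _ => trivial⟩

end Tw
end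

section
open DMod RingTheory.Sequence

theorem MC.mem_radical_map {D D' : Type} [CommRing D] [CommRing D'] (f : D →+* D') {I : Ideal D}
    {v : D} (hv : v ∈ I.radical) : f v ∈ (I.map f).radical :=
  Ideal.map_radical_le _ (Ideal.mem_map_of_mem _ hv)

namespace PSB
variable {k A : Type} [Field k] [CommRing A] [Algebra k A] {d : ℕ} {x : Fin d → A}

theorem two_pow_le_of_isDomain (h : PSB k A d x) [IsNoetherianRing A] {D : Type} [CommRing D]
    [IsDomain D] [Algebra A D] [Module.Finite A D] (hinj : Function.Injective (algebraMap A D))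
    {j : Fin d} (hj : x j ≠ 0) (p : ℕ) [Fact p.Prime] [CharP D p] {n : ℕ} (F : MC D (n + 1) d)
    (h0 : F.deg 0 = 0) {N : ℕ} (hN : ∀ i, F.Null (algebraMap A D (x i ^ N)))
    (hF : ∀ i j, F.mat i j ∈ ((Ideal.span (Set.range x)).map (algebraMap A D)).radical) :
    2 ^ d ≤ n + 1 := by
  obtain ⟨m, S, i1, i2, i3, w, hw, φ, hφ, ht⟩ := Tw.exists_torsion h hinj hj
  have hS : IsDomain S := hφ.isDomain φ.toRingHom
  have hfin := hw.fin
  have hno : IsNoetherianRing S := IsNoetherianRing.of_finite A S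
  let _ : Algebra S D := φ.toRingHom.toAlgebra
  have hsm : ∀ (s : S) (v : D), s • v = φ s * v := fun _ _ => rfl
  have : IsScalarTower A S D := IsScalarTower.of_algebraMap_eq fun a => (φ.commutes a).symm
  have : Module.Finite S D := Module.Finite.of_restrictScalars_finite A S D
  obtain ⟨c, hc0, hc⟩ : ∃ c : S, c ≠ 0 ∧ ∀ v : D, φ c * v ∈ φ.range := by
    obtain ⟨T, hT⟩ := Module.finite_def.1 (inferInstance : Module.Finite S D)
    choose c hc0 hc using ht
    refine ⟨∏ t ∈ T, c t, Finset.prod_ne_zero_iff.2 fun t _ => hc0 t, fun v => ?_⟩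
    have hv : v ∈ Submodule.span S (T : Set D) := hT ▸ Submodule.mem_top
    refine Submodule.span_induction ?_ ?_ ?_ ?_ hv
    · intro t hmem
      obtain ⟨u, hu⟩ := Finset.dvd_prod_of_mem c (Finset.mem_coe.1 hmem)
      rw [hu, map_mul, mul_right_comm]
      exact mul_mem (hc t) ⟨u, rfl⟩
    · rw [mul_zero]; exact zero_mem _
    · intro a b _ _ ha hb
      rw [mul_add]; exact add_mem ha hb
    · intro s a _ ha
      rw [hsm, mul_left_comm]
      exact mul_mem ⟨s, rfl⟩ ha
  choose μ hμ using hc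
  have hμ' : ∀ v, φ (μ v) = φ c * v := hμ
  let μ' : D →ₗ[S] S :=
    { toFun := μ
      map_add' := fun a b => hφ (by rw [map_add, hμ', hμ', hμ', mul_add])
      map_smul' := fun s a => hφ (by
        rw [RingHom.id_apply, smul_eq_mul, map_mul, hμ', hμ', hsm]; ring) }
  have hx : ∀ a, algebraMap S D (algebraMap A S a) = algebraMap A D a := fun a => φ.commutes a
  refine (hw.model h (D := D) hφ hc0 (μ := μ') fun v => hμ' v).two_pow_le p F h0 (N := N) ?_ ?_
  · intro i
    rw [← map_pow, hx]
    exact hN i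
  · intro i j
    convert hF i j using 2
    rw [Ideal.map_span, Ideal.map_span, ← Set.range_comp, ← Set.range_comp]
    congr 2
    ext i
    exact hx _

end PSB

/-- The rank inequality for finite extensions of a power series ring, positive characteristic. -/
theorem MC.two_pow_le_of_charP (k : Type) [Field k] (p : ℕ) [Fact p.Prime] [CharP k p] {d : ℕ}
    {D : Type} [CommRing D] [Algebra (MvPowerSeries (Fin d) k) D]
    [Module.Finite (MvPowerSeries (Fin d) k) D]
    (hinj : Function.Injective (algebraMap (MvPowerSeries (Fin d) k) D))
    {n : ℕ} (F : MC D (n + 1) d) (h0 : F.deg 0 = 0) {N : ℕ}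
    (hN : ∀ i, F.Null (algebraMap (MvPowerSeries (Fin d) k) D (MvPowerSeries.X i ^ N)))
    (hF : ∀ i j, F.mat i j ∈ ((Ideal.span (Set.range MvPowerSeries.X)).map
      (algebraMap (MvPowerSeries (Fin d) k) D)).radical) :
    2 ^ d ≤ n + 1 := by
  obtain rfl | hd := Nat.eq_zero_or_pos d
  · simp
  obtain ⟨P, -, hP, hP0⟩ := Ideal.exists_ideal_over_prime_of_isIntegral
    (⊥ : Ideal (MvPowerSeries (Fin d) k)) (⊥ : Ideal D)
    (by rw [← RingHom.ker_eq_comap_bot, (RingHom.injective_iff_ker_eq_bot _).1 hinj])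
  have hinj' : Function.Injective (algebraMap (MvPowerSeries (Fin d) k) (D ⧸ P)) := by
    rw [injective_iff_map_eq_zero]
    intro a ha
    have : a ∈ P.comap (algebraMap (MvPowerSeries (Fin d) k) D) :=
      Ideal.Quotient.eq_zero_iff_mem (I := P).1 ha
    rwa [hP0] at this
  have : CharP (D ⧸ P) p := charP_of_injective_ringHom
    (f := (algebraMap (MvPowerSeries (Fin d) k) (D ⧸ P)).comp MvPowerSeries.C)
    (RingHom.injective _) p
  have hX : (MvPowerSeries.X ⟨0, hd⟩ : MvPowerSeries (Fin d) k) ≠ 0 := fun h0 => by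
    simpa using congrArg (MvPowerSeries.coeff (Finsupp.single ⟨0, hd⟩ 1)) h0
  refine (PSB.mvPowerSeries (k := k) d).two_pow_le_of_isDomain hinj' (j := ⟨0, hd⟩)
    hX p (F.map (Ideal.Quotient.mk P)) h0 (N := N)
    (fun i => (hN i).map (Ideal.Quotient.mk P)) fun i j => ?_
  have := MC.mem_radical_map (Ideal.Quotient.mk P) (hF i j)
  rwa [Ideal.map_map] at this
end

open IntermediateField in
theorem exists_integral_primitive {T B : Type} [CommRing T] [IsDomain T] [CharZero T] [CommRing B]
    [IsDomain B] [Algebra T B] [FaithfulSMul T B] [Algebra.IsAlgebraic T B] (S : Finset B) :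
    ∃ z : B, IsIntegral T z ∧ ∃ a : T, a ≠ 0 ∧ ∃ g : S → Polynomial T,
      ∀ b : S, algebraMap T B a * b = Polynomial.aeval z (g b) := by
  classical
  let E := FractionRing T
  let F := FractionRing B
  let : Algebra E F := FractionRing.liftAlgebra T F
  have : IsScalarTower T E F := inferInstance
  have halg : Algebra.IsAlgebraic E F := 
    IsFractionRing.comap_isAlgebraic_iff.mp ((IsFractionRing.isAlgebraic_iff' T B F).mp inferInstance)
  have hcz : CharZero E := charZero_of_injective_algebraMap (IsFractionRing.injective T E)
  let S' : Set F := (algebraMap B F) '' S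
  have hfin : S'.Finite := S.finite_toSet.image _
  have : FiniteDimensional E (adjoin E S') :=
    finiteDimensional_adjoin fun x _ => (Algebra.IsAlgebraic.isAlgebraic x).isIntegral
  obtain ⟨α, hα⟩ := Field.exists_primitive_element E (adjoin E S')
  have hα' : E⟮(α : F)⟯ = adjoin E S' := by
    have := congrArg IntermediateField.lift hα
    simpa [IntermediateField.lift_adjoin, IntermediateField.lift_top] using this
  obtain ⟨u, v, hv, huv⟩ := IsFractionRing.div_surjective (A := B) (α : F)
  obtain ⟨c, hc, w, hw⟩ := (Algebra.IsAlgebraic.isAlgebraic (R := T) v).exists_nonzero_dvd hv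
  obtain ⟨e, he, hintegral⟩ := (Algebra.IsAlgebraic.isAlgebraic (R := T) (u * w)).exists_integral_multiple
  set z := e • (u * w) with hz
  have hce : algebraMap T E (e * c) ≠ 0 := by
    rw [Ne, FaithfulSMul.algebraMap_eq_zero_iff]; exact mul_ne_zero he hc
  have hzα : algebraMap B F z = algebraMap T E (e * c) • (α : F) := by
    have hv0 : algebraMap B F v ≠ 0 := by
      rw [Ne, FaithfulSMul.algebraMap_eq_zero_iff]; exact nonZeroDivisors.ne_zero hv
    rw [Algebra.smul_def, ← IsScalarTower.algebraMap_apply T E F, ← huv, hz, Algebra.smul_def,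
      map_mul, map_mul, map_mul (algebraMap T F), IsScalarTower.algebraMap_apply T B F,
      IsScalarTower.algebraMap_apply T B F c, hw]
    rw [map_mul, mul_assoc]
    rw [mul_div_left_comm, mul_div_cancel_left₀ _ hv0]
  have hmem : ∀ b : S, ∃ a : T, a ≠ 0 ∧ ∃ g : Polynomial T,
      algebraMap T B a * b = Polynomial.aeval z g := by
    intro b
    have hb : algebraMap B F b ∈ E⟮algebraMap B F z⟯ := by
      have h1 : algebraMap B F b ∈ E⟮(α : F)⟯ := by
        rw [hα']; exact subset_adjoin E S' ⟨b, b.2, rfl⟩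
      have h2 : E⟮(α : F)⟯ ≤ E⟮algebraMap B F z⟯ := by
        rw [adjoin_simple_le_iff]
        have : (α : F) = (algebraMap T E (e * c))⁻¹ • algebraMap B F z := by
          rw [hzα, inv_smul_smul₀ hce]
        rw [this]
        exact IntermediateField.smul_mem _ (mem_adjoin_simple_self E _)
      exact h2 h1
    rw [← IntermediateField.mem_toSubalgebra, adjoin_simple_toSubalgebra_of_isAlgebraic
      (Algebra.IsAlgebraic.isAlgebraic _), Algebra.adjoin_singleton_eq_range_aeval] at hb
    obtain ⟨p, hp⟩ := hb
    obtain ⟨a, ha, hg⟩ := IsLocalization.integerNormalization_spec (nonZeroDivisors T) p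
    refine ⟨a, nonZeroDivisors.ne_zero ha, IsLocalization.integerNormalization (nonZeroDivisors T) p,
      IsFractionRing.injective B F ?_⟩
    have hp' : Polynomial.aeval (algebraMap B F z) p = algebraMap B F b := hp
    rw [← Polynomial.aeval_algebraMap_apply, ← Polynomial.aeval_map_algebraMap E, hg,
      ← IsScalarTower.algebraMap_smul E a p, map_smul, hp', map_mul,
      ← IsScalarTower.algebraMap_apply, Algebra.smul_def, ← IsScalarTower.algebraMap_apply]
  choose a ha g hg using hmem
  refine ⟨z, hintegral, ∏ b, a b, Finset.prod_ne_zero_iff.mpr fun b _ => ha b,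
    fun b => Polynomial.C (∏ b' ∈ Finset.univ.erase b, a b') * g b, fun b => ?_⟩
  rw [map_mul, ← hg, Polynomial.aeval_C, ← Finset.prod_erase_mul _ _ (Finset.mem_univ b), map_mul]
  ring

theorem minpoly_derivative_ne_zero {T B : Type} [CommRing T] [IsDomain T] [CharZero T]
    [IsIntegrallyClosed T] [CommRing B] [IsDomain B] [Algebra T B] [FaithfulSMul T B] {z : B}
    (hz : IsIntegral T z) : Polynomial.aeval z (minpoly T z).derivative ≠ 0 := by
  intro h
  have h1 := minpoly.isIntegrallyClosed_dvd hz h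
  have hpos := minpoly.natDegree_pos hz
  have h3 : (minpoly T z).derivative ≠ 0 := by
    intro h0
    have := Polynomial.natDegree_eq_zero_of_derivative_eq_zero h0
    omega
  exact (Polynomial.degree_derivative_lt (minpoly.ne_zero hz)).not_ge
    (Polynomial.degree_le_of_dvd h1 h3)

/-- A generically étale presentation of a finitely generated domain of characteristic zero,
together with its universal property for points in domains. -/
theorem exists_etale_presentation {B : Type} [CommRing B] [IsDomain B] [CharZero B]
    [Algebra.FiniteType ℤ B] {m : ℕ} (x : Fin m → B) (hx : AlgebraicIndependent ℤ x) :
    ∃ (ι S : Type) (_ : Finite ι) (_ : Finite S) (t : ι → B) (j : Fin m → ι) (z : B) (s : S → B)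
      (a : MvPolynomial ι ℤ) (f : Polynomial (MvPolynomial ι ℤ))
      (g : S → Polynomial (MvPolynomial ι ℤ)),
      (∀ i, t (j i) = x i) ∧ Function.Injective j ∧
      f.eval₂ (MvPolynomial.aeval t : _ →ₐ[ℤ] B).toRingHom z = 0 ∧
      f.derivative.eval₂ (MvPolynomial.aeval t : _ →ₐ[ℤ] B).toRingHom z ≠ 0 ∧
      MvPolynomial.aeval t a ≠ 0 ∧
      (∀ b, MvPolynomial.aeval t a * s b =
        (g b).eval₂ (MvPolynomial.aeval t : _ →ₐ[ℤ] B).toRingHom z) ∧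
      ∀ (Ω : Type) [CommRing Ω] [IsDomain Ω] (τ : ι → Ω) (ζ : Ω),
        f.eval₂ (MvPolynomial.aeval τ : _ →ₐ[ℤ] Ω).toRingHom ζ = 0 →
        MvPolynomial.aeval τ a ≠ 0 →
        (∀ b, MvPolynomial.aeval τ a ∣
          (g b).eval₂ (MvPolynomial.aeval τ : _ →ₐ[ℤ] Ω).toRingHom ζ) →
        ∃ ψ : B →+* Ω, ∀ i, ψ (t i) = τ i := by
  classical
  obtain ⟨S, hS⟩ := (Algebra.FiniteType.out : (⊤ : Subalgebra ℤ B).FG)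
  have halg0 : Algebra.IsAlgebraic (Algebra.adjoin ℤ ((S : Set B) ∪ Set.range x)) B := by
    constructor
    intro b
    have hb : b ∈ Algebra.adjoin ℤ ((S : Set B) ∪ Set.range x) :=
      Algebra.adjoin_mono Set.subset_union_left (hS ▸ Algebra.mem_top)
    exact isAlgebraic_algebraMap (A := B)
      (⟨b, hb⟩ : Algebra.adjoin ℤ ((S : Set B) ∪ Set.range x))
  obtain ⟨ι, h1, h2, h3⟩ := exists_isTranscendenceBasis_between (R := ℤ) (Set.range x)
    ((S : Set B) ∪ Set.range x) Set.subset_union_right hx.to_subtype_range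
  have hfin : Finite ι := ((S.finite_toSet.union (Set.finite_range x)).subset h2).to_subtype
  let t : ι → B := (↑)
  let alg : Algebra (MvPolynomial ι ℤ) B := (MvPolynomial.aeval t : _ →ₐ[ℤ] B).toRingHom.toAlgebra
  have hinj : Function.Injective (algebraMap (MvPolynomial ι ℤ) B) := h3.1
  have : FaithfulSMul (MvPolynomial ι ℤ) B := (faithfulSMul_iff_algebraMap_injective _ _).mpr hinj
  have halg : Algebra.IsAlgebraic (MvPolynomial ι ℤ) B := by
    have := h3.isAlgebraic
    refine Algebra.IsAlgebraic.of_ringHom_of_comp_eq h3.1.aevalEquiv.toRingEquiv.toRingHom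
      (RingHom.id B) h3.1.aevalEquiv.surjective Function.injective_id ?_
    ext i <;> simp [alg, t, RingHom.algebraMap_toAlgebra]
  obtain ⟨z, hz, a, ha, g, hg⟩ := exists_integral_primitive (T := MvPolynomial ι ℤ) S
  refine ⟨ι, S, hfin, inferInstance, t, fun i => ⟨x i, h1 ⟨i, rfl⟩⟩, z, (↑), a,
    minpoly (MvPolynomial ι ℤ) z, g, fun i => rfl, fun i i' h => ?_, minpoly.aeval _ z,
    minpoly_derivative_ne_zero hz, ?_, hg, ?_⟩
  · exact hx.injective (by simpa using h)
  · exact fun h => ha (hinj (h.trans (map_zero _).symm))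
  intro Ω _ _ τ ζ hf ha' hdvd
  choose y hy using hdvd
  let ev : Polynomial (MvPolynomial ι ℤ) →+* Ω :=
    Polynomial.eval₂RingHom (MvPolynomial.aeval τ : _ →ₐ[ℤ] Ω).toRingHom ζ
  have hevC : ∀ q, ev (Polynomial.C q) = MvPolynomial.aeval τ q := fun q => by simp [ev]
  have hkey : ∀ Q : Polynomial (MvPolynomial ι ℤ), Polynomial.aeval z Q = 0 → ev Q = 0 := by
    intro Q hQ
    obtain ⟨Q', rfl⟩ := minpoly.isIntegrallyClosed_dvd hz hQ
    rw [map_mul, show ev (minpoly _ z) = 0 from hf, zero_mul]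
  let π : MvPolynomial S ℤ →ₐ[ℤ] B := MvPolynomial.aeval (fun b : S => (b : B))
  let ρ : MvPolynomial S ℤ →ₐ[ℤ] Ω := MvPolynomial.aeval y
  have hnum : ∀ q : MvPolynomial S ℤ, ∃ (N : ℕ) (Q : Polynomial (MvPolynomial ι ℤ)),
      algebraMap _ B a ^ N * π q = Polynomial.aeval z Q ∧ MvPolynomial.aeval τ a ^ N * ρ q = ev Q := by
    intro q
    induction q using MvPolynomial.induction_on with
    | C r => exact ⟨0, Polynomial.C (MvPolynomial.C r), by simp, by simp [hevC]⟩
    | add p q hp hq =>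
      obtain ⟨N, Q, e1, e2⟩ := hp
      obtain ⟨N', Q', e3, e4⟩ := hq
      refine ⟨N + N', Polynomial.C (a ^ N') * Q + Polynomial.C (a ^ N) * Q', ?_, ?_⟩
      · rw [map_add, map_add, map_mul, map_mul, ← e1, ← e3, Polynomial.aeval_C, Polynomial.aeval_C,
          map_pow, map_pow]; ring
      · rw [map_add, map_add, map_mul, map_mul, ← e2, ← e4, hevC, hevC, map_pow, map_pow]; ring
    | mul_X p b hp =>
      obtain ⟨N, Q, e1, e2⟩ := hp
      refine ⟨N + 1, Q * g b, ?_, ?_⟩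
      · rw [map_mul, map_mul, ← e1, ← hg]
        simp only [π, MvPolynomial.aeval_X]; ring
      · rw [map_mul, map_mul, ← e2, show ev (g b) = _ from hy b]
        simp only [ρ, MvPolynomial.aeval_X]; ring
  have hπ : Function.Surjective π := by
    rw [← AlgHom.range_eq_top, ← Algebra.adjoin_range_eq_range_aeval]
    simpa using hS
  have hker : ∀ q, π q = 0 → ρ q = 0 := by
    intro q hq
    obtain ⟨N, Q, e1, e2⟩ := hnum q
    rw [hq, mul_zero] at e1
    rw [hkey Q e1.symm] at e2
    exact (mul_eq_zero.mp e2).resolve_left (pow_ne_zero _ ha')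
  let ψ : B →+* Ω := RingHom.liftOfSurjective π.toRingHom hπ
    ⟨ρ.toRingHom, fun q hq => hker q hq⟩
  have hψ : ∀ q, ψ (π q) = ρ q := fun q =>
    RingHom.liftOfRightInverse_comp_apply π.toRingHom _ _ ⟨ρ.toRingHom, fun q hq => hker q hq⟩ q
  refine ⟨ψ, fun i => ?_⟩
  obtain ⟨q, hq⟩ := hπ (t i)
  obtain ⟨N, Q, e1, e2⟩ := hnum q
  rw [← hq, hψ]
  have h0 : Polynomial.aeval z (Q - Polynomial.C (a ^ N * MvPolynomial.X i)) = 0 := by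
    rw [map_sub, ← e1, hq, Polynomial.aeval_C, map_mul, map_pow]
    simp [alg, RingHom.algebraMap_toAlgebra, t]
  have h4 := hkey _ h0
  rw [map_sub, hevC, map_mul, map_pow, MvPolynomial.aeval_X, ← e2, ← mul_sub] at h4
  exact sub_eq_zero.mp ((mul_eq_zero.mp h4).resolve_left (pow_ne_zero _ ha'))

theorem MvPowerSeries.mem_span_range_X_of_constantCoeff {K : Type} [Field K] :
    ∀ {d : ℕ} {f : MvPowerSeries (Fin d) K}, MvPowerSeries.constantCoeff f = 0 →
      f ∈ Ideal.span (Set.range (MvPowerSeries.X : Fin d → MvPowerSeries (Fin d) K))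
  | 0, f, hf => by
    have : f = 0 := by
      ext m
      rw [Subsingleton.elim m 0]
      simpa using hf
    rw [this]; exact zero_mem _
  | d + 1, f, hf => by
    let e := MvPowerSeries.finSuccEquiv K d
    have h0 : MvPowerSeries.constantCoeff (PowerSeries.constantCoeff (e f)) = 0 := by
      rw [← hf, ← MvPowerSeries.coeff_zero_eq_constantCoeff_apply,
        ← MvPowerSeries.coeff_zero_eq_constantCoeff_apply,
        ← PowerSeries.coeff_zero_eq_constantCoeff_apply, MvPowerSeries.coeff_coeff_finSuccEquiv]
      congr 2
      ext i
      refine Fin.cases ?_ (fun j => ?_) i <;> simp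
    have h1 := mem_span_range_X_of_constantCoeff h0
    have h2 : e f ∈ (Ideal.span (Set.range (MvPowerSeries.X : Fin (d+1) → _))).map e := by
      have hX : ∀ i, e (MvPowerSeries.X i) ∈
          (Ideal.span (Set.range (MvPowerSeries.X : Fin (d+1) → MvPowerSeries _ K))).map e :=
        fun i => Ideal.mem_map_of_mem _ (Ideal.subset_span ⟨i, rfl⟩)
      obtain ⟨g, hg⟩ := PowerSeries.X_dvd_iff.mpr (show PowerSeries.constantCoeff
        (e f - PowerSeries.C (PowerSeries.constantCoeff (e f))) = 0 by simp)
      rw [sub_eq_iff_eq_add.mp hg]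
      refine add_mem (Ideal.mul_mem_right _ _ ?_) ?_
      · have := hX 0
        rwa [MvPowerSeries.finSuccEquiv_X_zero] at this
      · have : (Ideal.span (Set.range (MvPowerSeries.X : Fin d → MvPowerSeries (Fin d) K))).map
            (PowerSeries.C) ≤ (Ideal.span (Set.range (MvPowerSeries.X :
              Fin (d+1) → MvPowerSeries _ K))).map e := by
          rw [Ideal.map_span, Ideal.span_le]
          rintro _ ⟨_, ⟨i, rfl⟩, rfl⟩
          have := hX i.succ
          rwa [MvPowerSeries.finSuccEquiv_X_succ] at this
        exact this (Ideal.mem_map_of_mem _ h1)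
    obtain ⟨y, hy, hye⟩ := (Ideal.mem_map_iff_of_surjective e e.surjective).mp h2
    exact e.injective hye ▸ hy

theorem MvPowerSeries.maximalIdeal_eq_span_range_X {K : Type} [Field K] {d : ℕ} :
    IsLocalRing.maximalIdeal (MvPowerSeries (Fin d) K) = Ideal.span (Set.range MvPowerSeries.X) := by
  apply le_antisymm
  · intro f hf
    apply MvPowerSeries.mem_span_range_X_of_constantCoeff
    by_contra h
    exact (IsLocalRing.mem_maximalIdeal f).mp hf
      (MvPowerSeries.isUnit_iff_constantCoeff.mpr (Ne.isUnit h))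
  · rw [Ideal.span_le]
    rintro _ ⟨i, rfl⟩
    exact (IsLocalRing.mem_maximalIdeal _).mpr fun h => by
      simpa using MvPowerSeries.isUnit_iff_constantCoeff.mp h

theorem MvPowerSeries.isAdicComplete_maximalIdeal {K : Type} [Field K] {d : ℕ} :
    IsAdicComplete (IsLocalRing.maximalIdeal (MvPowerSeries (Fin d) K))
      (MvPowerSeries (Fin d) K) := by
  rw [MvPowerSeries.maximalIdeal_eq_span_range_X]; infer_instance

namespace Polynomial.IsDistinguishedAt
variable {A : Type} [CommRing A] {I : Ideal A} [IsAdicComplete I A] {g : Polynomial A}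

theorem exists_polynomial (H : g.IsDistinguishedAt I) (f : PowerSeries A) :
    ∃ r : Polynomial A, (g : PowerSeries A) ∣ f - r := by
  obtain ⟨y, hy⟩ := H.algEquivQuotient.surjective (Ideal.Quotient.mk _ f)
  obtain ⟨r, rfl⟩ := Ideal.Quotient.mk_surjective y
  exact ⟨r, Ideal.mem_span_singleton.mp (Ideal.Quotient.eq.mp hy.symm)⟩

theorem dvd_of_coe_dvd (H : g.IsDistinguishedAt I) {r : Polynomial A}
    (h : (g : PowerSeries A) ∣ r) : g ∣ r := by
  have : Ideal.Quotient.mk (Ideal.span {g}) r = 0 := by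
    apply H.algEquivQuotient.injective
    rw [map_zero]
    exact Ideal.Quotient.eq_zero_iff_mem.mpr (Ideal.mem_span_singleton.mpr h)
  exact Ideal.mem_span_singleton.mp (Ideal.Quotient.eq_zero_iff_mem.mp this)

end Polynomial.IsDistinguishedAt

namespace PowerSeries
variable {A : Type} [CommRing A]

theorem exists_fixed_of_contracting (Φ : PowerSeries A → PowerSeries A)
    (h : ∀ n f g, (X : PowerSeries A) ^ n ∣ f - g → (X : PowerSeries A) ^ (n + 1) ∣ Φ f - Φ g) :
    ∃ η, Φ η = η := by
  have h1 : ∀ n, (X : PowerSeries A) ^ n ∣ Φ^[n + 1] 0 - Φ^[n] 0 := by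
    intro n
    induction n with
    | zero => simp
    | succ n ih =>
      have := h n _ _ ih
      simpa only [Function.iterate_succ_apply'] using this
  have h2 : ∀ m n, n ≤ m → (X : PowerSeries A) ^ n ∣ Φ^[m] 0 - Φ^[n] 0 := by
    intro m n hmn
    induction m, hmn using Nat.le_induction with
    | base => simp
    | succ m hm ih =>
      rw [← sub_add_sub_cancel _ (Φ^[m] 0)]
      exact dvd_add ((pow_dvd_pow _ hm).trans (h1 m)) ih
  let η : PowerSeries A := mk fun n => coeff n (Φ^[n + 1] 0)
  have h3 : ∀ n, (X : PowerSeries A) ^ n ∣ η - Φ^[n] 0 := by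
    intro n
    rw [X_pow_dvd_iff]
    intro m hm
    have := X_pow_dvd_iff.mp (h2 n (m + 1) hm) m (Nat.lt_succ_self m)
    rw [map_sub] at this ⊢
    rw [coeff_mk, ← neg_sub, this, neg_zero]
  refine ⟨η, ?_⟩
  rw [← sub_eq_zero]
  ext n
  have h4 := h n _ _ (h3 n)
  have h5 := h3 (n + 1)
  rw [Function.iterate_succ_apply'] at h5
  have := X_pow_dvd_iff.mp (dvd_sub h4 h5) n (Nat.lt_succ_self n)
  simpa using this

end PowerSeries

namespace PowerSeries
variable {A : Type} [CommRing A]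

/-- A strong form of Hensel's lemma for the ideal generated by the variable. -/
theorem exists_root_of_approx (F : Polynomial (PowerSeries A)) (z α β e v : PowerSeries A)
    (h0 : F.eval z = α * β ^ 2 * X * e) (h1 : F.derivative.eval z = β * v) (hv : IsUnit v) :
    ∃ η, F.eval (z + α * β * X * η) = 0 := by
  obtain ⟨u, hu⟩ := hv.exists_right_inv
  let Q := (Polynomial.taylor z F).divX.divX
  have hT : ∀ y, F.eval (z + y) = F.eval z + F.derivative.eval z * y + y ^ 2 * Q.eval y := by
    intro y
    rw [add_comm z y, ← Polynomial.taylor_eval, ← Polynomial.divX_mul_X_add (Polynomial.taylor z F),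
      ← Polynomial.divX_mul_X_add (Polynomial.taylor z F).divX]
    simp only [Polynomial.eval_add, Polynomial.eval_mul, Polynomial.eval_X, Polynomial.eval_C,
      Polynomial.coeff_divX, Polynomial.taylor_coeff_zero, zero_add, Polynomial.taylor_coeff_one, Q]
    ring
  let P : Polynomial (PowerSeries A) :=
    Polynomial.X ^ 2 * Q.comp (Polynomial.C (α * β * X) * Polynomial.X)
  have hP : ∀ η, P.eval η = η ^ 2 * Q.eval (α * β * X * η) := fun η => by simp [P]
  obtain ⟨η, hη⟩ := exists_fixed_of_contracting (fun η => -u * (e + α * X * P.eval η)) (by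
    intro n f g hfg
    have h2 : X ^ n * X ∣ (P.eval f - P.eval g) * X :=
      mul_dvd_mul_right (hfg.trans (Polynomial.sub_dvd_eval_sub f g P)) X
    rw [pow_succ]
    convert h2.mul_left (-u * α) using 1
    ring)
  refine ⟨η, ?_⟩
  rw [hT, h0, h1]
  rw [hP] at hη
  have h3 : v * η = -(e + α * X * (η ^ 2 * Q.eval (α * β * X * η))) := by
    rw [← neg_mul_eq_neg_mul] at hη
    conv_lhs => rw [← hη]
    linear_combination (-(e + α * X * (η ^ 2 * Q.eval (α * β * X * η)))) * hu
  linear_combination α * β ^ 2 * X * h3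
end PowerSeries

/-- Evaluation of an integral polynomial in several variables. -/
noncomputable def evHom {ι Ω : Type} [CommRing Ω] (t : ι → Ω) : MvPolynomial ι ℤ →+* Ω :=
  (MvPolynomial.aeval t : _ →ₐ[ℤ] Ω).toRingHom

/-- Simultaneous evaluation of a polynomial over `MvPolynomial ι ℤ`. -/
noncomputable def evT {ι Ω : Type} [CommRing Ω] (t : ι → Ω) (z : Ω) :
    Polynomial (MvPolynomial ι ℤ) →+* Ω :=
  Polynomial.eval₂RingHom (evHom t) z

section evT
variable {ι Ω Ω' : Type} [CommRing Ω] [CommRing Ω']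

theorem evT_map (φ : Ω →+* Ω') (t : ι → Ω) (z : Ω) (f : Polynomial (MvPolynomial ι ℤ)) :
    φ (evT t z f) = evT (fun i => φ (t i)) (φ z) f := by
  have : φ.comp (evT t z) = evT (fun i => φ (t i)) (φ z) := by
    ext i <;> simp [evT, evHom]
  exact congrArg (fun h => h f) this

theorem evT_sub_mem {t t' : ι → Ω} {z z' : Ω} {G : Ω} (ht : ∀ i, G ∣ t i - t' i) (hz : G ∣ z - z')
    (f : Polynomial (MvPolynomial ι ℤ)) : G ∣ evT t z f - evT t' z' f := by
  rw [← Ideal.mem_span_singleton, ← Ideal.Quotient.eq, evT_map, evT_map]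
  congr 2
  · ext i
    exact Ideal.Quotient.eq.mpr (Ideal.mem_span_singleton.mpr (ht i))
  · exact Ideal.Quotient.eq.mpr (Ideal.mem_span_singleton.mpr hz)

theorem evT_eq_eval (t : ι → Ω) (z : Ω) (f : Polynomial (MvPolynomial ι ℤ)) :
    evT t z f = (f.map (evHom t)).eval z := by
  rw [Polynomial.eval_map]; rfl

end evT

theorem Polynomial.isDistinguishedAt_X {A : Type} [CommRing A] [Nontrivial A] (I : Ideal A) :
    (Polynomial.X : Polynomial A).IsDistinguishedAt I := by
  refine ⟨⟨fun {n} hn => ?_⟩, Polynomial.monic_X⟩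
  rw [Polynomial.natDegree_X, Nat.lt_one_iff] at hn
  simp [hn]

section approx
variable {A : Type} [CommRing A] [IsDomain A] [IsLocalRing A]
  [IsAdicComplete (IsLocalRing.maximalIdeal A) A]

theorem exists_eq_mul_of_coe_eq {P r : Polynomial A}
    (hP : P.IsDistinguishedAt (IsLocalRing.maximalIdeal A)) {h k : PowerSeries A} (hh : IsUnit h)
    (e : (r : PowerSeries A) = (P : PowerSeries A) * (h + PowerSeries.X * k)) :
    ∃ v, r = P * v ∧ IsUnit (v.coeff 0) := by
  obtain ⟨v, rfl⟩ := hP.dvd_of_coe_dvd ⟨_, e⟩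
  refine ⟨v, rfl, ?_⟩
  rw [Polynomial.coe_mul] at e
  have h0 : (P : PowerSeries A) ≠ 0 := by
    rw [Ne, Polynomial.coe_eq_zero_iff]; exact hP.monic.ne_zero
  have h1 := congrArg PowerSeries.constantCoeff (mul_left_cancel₀ h0 e)
  rw [map_add, map_mul, PowerSeries.constantCoeff_X, zero_mul, add_zero] at h1
  have h2 : PowerSeries.constantCoeff (v : PowerSeries A) = v.coeff 0 := by
    rw [← PowerSeries.coeff_zero_eq_constantCoeff_apply, Polynomial.coeff_coe]
  rw [← h2, h1]
  exact hh.map _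

/-- Polynomial approximations of a power series point of a generically étale presentation. -/
theorem exists_polynomial_approx {ι S : Type} (t : ι → PowerSeries A) (z : PowerSeries A)
    (a : MvPolynomial ι ℤ) (f : Polynomial (MvPolynomial ι ℤ))
    (g : S → Polynomial (MvPolynomial ι ℤ)) (hf : evT t z f = 0)
    (ha : (evT t z (Polynomial.C a)).map (IsLocalRing.residue A) ≠ 0)
    (hf' : (evT t z f.derivative).map (IsLocalRing.residue A) ≠ 0)
    (hg : ∀ b, evT t z (Polynomial.C a) ∣ evT t z (g b)) :
    ∃ (α β z' v w e : Polynomial A) (t' : ι → Polynomial A) (l : S → Polynomial A),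
      α.Monic ∧ IsUnit (v.coeff 0) ∧ IsUnit (w.coeff 0) ∧
      evT t' z' f = α * β ^ 2 * Polynomial.X * e ∧ evT t' z' (Polynomial.C a) = α * v ∧
      evT t' z' f.derivative = β * w ∧ (∀ b, evT t' z' (g b) = α * l b) ∧
      ∀ i q, t i = (q : Polynomial A) → t' i = q := by
  obtain ⟨α, h, H⟩ := PowerSeries.exists_isWeierstrassFactorization ha
  obtain ⟨β, h', H'⟩ := PowerSeries.exists_isWeierstrassFactorization hf'
  have hG := ((H.isDistinguishedAt.mul (H'.isDistinguishedAt.mul H'.isDistinguishedAt)).mul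
    (Polynomial.isDistinguishedAt_X _))
  set G := α * (β * β) * Polynomial.X with hGdef
  have ht : ∀ i, ∃ r : Polynomial A, (G : PowerSeries A) ∣ t i - r ∧
      ∀ q : Polynomial A, t i = q → r = q := by
    intro i
    by_cases hq : ∃ q : Polynomial A, t i = q
    · obtain ⟨q, hq⟩ := hq
      refine ⟨q, by simp [hq], fun q' hq' => Polynomial.coe_injective _ (hq.symm.trans hq')⟩
    · obtain ⟨r, hr⟩ := hG.exists_polynomial (t i)
      exact ⟨r, hr, fun q hq' => (hq ⟨q, hq'⟩).elim⟩
  choose t' ht' htq using ht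
  obtain ⟨z', hz'⟩ := hG.exists_polynomial z
  have hcoe : ∀ q, ((evT t' z' q : Polynomial A) : PowerSeries A) =
      evT (fun i => (t' i : PowerSeries A)) z' q := fun q =>
    evT_map (Polynomial.coeToPowerSeries.ringHom) t' z' q
  have hsub : ∀ q, (G : PowerSeries A) ∣ evT t z q - (evT t' z' q : Polynomial A) := by
    intro q
    rw [hcoe]
    exact evT_sub_mem ht' hz' q
  have hGc : (G : PowerSeries A) = (α : PowerSeries A) * ((β : PowerSeries A) * (β : PowerSeries A)) *
      PowerSeries.X := by
    rw [hGdef, Polynomial.coe_mul, Polynomial.coe_mul, Polynomial.coe_mul, Polynomial.coe_X]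
  have hfe : G ∣ evT t' z' f := by
    apply hG.dvd_of_coe_dvd
    have := hsub f
    rwa [hf, zero_sub, dvd_neg] at this
  obtain ⟨e, he⟩ := hfe
  obtain ⟨k, hk⟩ := hsub (Polynomial.C a)
  obtain ⟨k', hk'⟩ := hsub f.derivative
  obtain ⟨v, hv, hv0⟩ := exists_eq_mul_of_coe_eq (r := evT t' z' (Polynomial.C a))
    H.isDistinguishedAt H.isUnit (k := -(β * β * k)) (by
      rw [hGc] at hk
      linear_combination H.eq_mul - hk)
  obtain ⟨w, hw, hw0⟩ := exists_eq_mul_of_coe_eq (r := evT t' z' f.derivative)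
    H'.isDistinguishedAt H'.isUnit (k := -(α * β * k')) (by
      rw [hGc] at hk'
      linear_combination H'.eq_mul - hk')
  have hl : ∀ b, α ∣ evT t' z' (g b) := by
    intro b
    apply H.isDistinguishedAt.dvd_of_coe_dvd
    have h1 : (α : PowerSeries A) ∣ evT t z (g b) := (Dvd.intro _ H.eq_mul.symm).trans (hg b)
    have h2 : (α : PowerSeries A) ∣ G := by
      rw [hGc, mul_assoc]; exact Dvd.intro _ rfl
    have := dvd_sub h1 (h2.trans (hsub (g b)))
    rwa [sub_sub_cancel] at this
  choose l hl using hl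
  exact ⟨α, β, z', v, w, e, t', l, H.isDistinguishedAt.monic, hv0, hw0, by
    rw [he, hGdef]; ring, hv, hw, hl, htq⟩

end approx

/-- Polynomial approximations lift to power series solutions. -/
theorem exists_point_of_approx {A : Type} [CommRing A] [IsDomain A] {ι S : Type}
    (a : MvPolynomial ι ℤ) (f : Polynomial (MvPolynomial ι ℤ))
    (g : S → Polynomial (MvPolynomial ι ℤ)) {α β z v w e : Polynomial A} {t : ι → Polynomial A}
    {l : S → Polynomial A} (hα : α.Monic) (hv : IsUnit (v.coeff 0)) (hw : IsUnit (w.coeff 0))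
    (hf : evT t z f = α * β ^ 2 * Polynomial.X * e) (ha : evT t z (Polynomial.C a) = α * v)
    (hf' : evT t z f.derivative = β * w) (hg : ∀ b, evT t z (g b) = α * l b) :
    ∃ ζ : PowerSeries A, evT (fun i => (t i : PowerSeries A)) ζ f = 0 ∧
      evT (fun i => (t i : PowerSeries A)) ζ (Polynomial.C a) ≠ 0 ∧
      ∀ b, evT (fun i => (t i : PowerSeries A)) ζ (Polynomial.C a) ∣
        evT (fun i => (t i : PowerSeries A)) ζ (g b) := by
  have hu : ∀ u : Polynomial A, IsUnit (u.coeff 0) → IsUnit (u : PowerSeries A) := fun u hu => by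
    rw [PowerSeries.isUnit_iff_constantCoeff, ← PowerSeries.coeff_zero_eq_constantCoeff_apply,
      Polynomial.coeff_coe]
    exact hu
  set t' : ι → PowerSeries A := fun i => (t i : PowerSeries A) with ht'
  have hcoe : ∀ q, ((evT t z q : Polynomial A) : PowerSeries A) = evT t' z q := fun q =>
    evT_map (Polynomial.coeToPowerSeries.ringHom) t z q
  obtain ⟨η, hη⟩ := PowerSeries.exists_root_of_approx
    (f.map (evHom t')) z α β e w
    (by rw [← evT_eq_eval, ← hcoe, hf]; simp)
    (by rw [Polynomial.derivative_map, ← evT_eq_eval, ← hcoe, hf']; simp) (hu w hw)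
  rw [← evT_eq_eval] at hη
  have hac : ∀ ζ, evT t' ζ (Polynomial.C a) = α * v := by
    intro ζ
    rw [← Polynomial.coe_mul, ← ha, hcoe]
    simp [evT, evHom]
  refine ⟨_, hη, ?_, fun b => ?_⟩
  · rw [hac]
    refine mul_ne_zero ?_ (hu v hv).ne_zero
    rw [Ne, Polynomial.coe_eq_zero_iff]; exact hα.ne_zero
  · rw [hac, (hu v hv).mul_right_dvd]
    have h1 : (α : PowerSeries A) ∣ evT t'
        ((z : PowerSeries A) + (α : PowerSeries A) * (β : PowerSeries A) * PowerSeries.X * η) (g b) -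
          evT t' z (g b) :=
      evT_sub_mem (fun i => by simp) ⟨(β : PowerSeries A) * PowerSeries.X * η, by ring⟩ (g b)
    have h2 : (α : PowerSeries A) ∣ evT t' z (g b) := by
      rw [← hcoe, hg, Polynomial.coe_mul]; exact Dvd.intro _ rfl
    simpa using dvd_add h1 h2

/-- Every nonempty set of exponents has a unique minimizer for suitable positive weights. -/
theorem exists_weight_unique_min : ∀ (n : ℕ) (S : Set (Fin n → ℕ)), S.Nonempty →
    ∃ w : Fin n → ℕ, (∀ i, 0 < w i) ∧ (∀ i : Fin n, (i : ℕ) = 0 → w i = 1) ∧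
      ∃ s ∈ S, ∀ t ∈ S, t ≠ s → ∑ i, w i * s i < ∑ i, w i * t i
  | 0, S, hS => ⟨fun _ => 1, fun _ => one_pos, fun _ _ => rfl, hS.some, hS.some_mem,
      fun t _ h => absurd (Subsingleton.elim _ _) h⟩
  | n + 1, S, hS => by
    classical
    obtain ⟨w, hw, -, s, ⟨u, hu, rfl⟩, hs⟩ :=
      exists_weight_unique_min n (Fin.tail '' S) (hS.image _)
    have hex : ∃ b, Fin.cons b (Fin.tail u) ∈ S := ⟨u 0, by rwa [Fin.cons_self_tail]⟩
    refine ⟨Fin.cons 1 (fun i => (Nat.find hex + 1) * w i), Fin.cases (by simp) fun i => by simp [hw],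
      Fin.cases (by simp) fun i h => by simp at h, _, Nat.find_spec hex, fun t ht hne => ?_⟩
    simp only [Fin.sum_univ_succ, Fin.cons_zero, Fin.cons_succ, one_mul, mul_assoc,
      ← Finset.mul_sum]
    by_cases h : Fin.tail t = Fin.tail u
    · have e : t = Fin.cons (t 0) (Fin.tail u) := by rw [← h, Fin.cons_self_tail]
      have h1 : Nat.find hex ≤ t 0 := Nat.find_min' hex (e ▸ ht)
      have h2 : Nat.find hex ≠ t 0 := fun h' => hne (by rw [h']; exact e)
      have h3 : ∀ i : Fin n, t i.succ = Fin.tail u i := fun i => congrFun h i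
      simp only [h3]
      omega
    · have h1 := hs _ ⟨t, ht, rfl⟩ h
      have h2 := Nat.mul_le_mul_left (Nat.find hex + 1) (Nat.succ_le_of_lt h1)
      have h3 : ∀ i : Fin n, t i.succ = Fin.tail t i := fun i => rfl
      simp only [h3]
      rw [Nat.succ_eq_add_one, mul_add] at h2
      omega

namespace MvPowerSeries
variable {K : Type} [Field K] {d : ℕ}

/-- The images of the variables under a triangular substitution. -/
noncomputable def twistX (c : K) (e : Fin d → ℕ) : Fin (d + 1) → MvPowerSeries (Fin (d + 1)) K :=
  Fin.cons (X 0) fun i => X i.succ + C c * X 0 ^ e i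

theorem hasSubst_twistX (c : K) {e : Fin d → ℕ} (he : ∀ i, 0 < e i) : HasSubst (twistX c e) :=
  hasSubst_of_constantCoeff_zero <| Fin.cases (by simp [twistX])
    fun i => by simp [twistX, (he i).ne']

/-- The substitution `X₀ ↦ X₀`, `Xᵢ ↦ Xᵢ + c X₀ ^ eᵢ`. -/
noncomputable def twist (c : K) {e : Fin d → ℕ} (he : ∀ i, 0 < e i) :
    MvPowerSeries (Fin (d + 1)) K →+* MvPowerSeries (Fin (d + 1)) K :=
  (substAlgHom (hasSubst_twistX c he)).toRingHom

theorem twist_X (c : K) {e : Fin d → ℕ} (he : ∀ i, 0 < e i) (i : Fin (d + 1)) :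
    twist c he (X i) = twistX c e i :=
  substAlgHom_X (hasSubst_twistX c he) i

/-- Restriction of a power series to the axis of the first variable. -/
noncomputable def axis : MvPowerSeries (Fin (d + 1)) K →+* PowerSeries K :=
  (PowerSeries.map constantCoeff).comp (finSuccEquiv K d).toRingEquiv.toRingHom

theorem coeff_axis (k : ℕ) (f : MvPowerSeries (Fin (d + 1)) K) :
    PowerSeries.coeff k (axis f) = coeff (Finsupp.single 0 k) f := by
  have : (Finsupp.single 0 k : Fin (d + 1) →₀ ℕ) = Finsupp.cons k 0 := by
    ext i; refine Fin.cases ?_ (fun i => ?_) i <;> simp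
  rw [this, ← coeff_coeff_finSuccEquiv]
  simp [axis]

theorem axis_X_zero : axis (X 0 : MvPowerSeries (Fin (d + 1)) K) = PowerSeries.X := by
  simp [axis]

theorem axis_X_succ (i : Fin d) : axis (X i.succ : MvPowerSeries (Fin (d + 1)) K) = 0 := by
  simp [axis]

theorem exists_axis_twist_ne_zero {h : MvPowerSeries (Fin (d + 1)) K} (hh : h ≠ 0) :
    ∃ (e : Fin d → ℕ) (he : ∀ i, 0 < e i), axis (twist 1 he h) ≠ 0 := by
  obtain ⟨s₀, hs₀⟩ : ∃ s, coeff s h ≠ 0 := by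
    by_contra! H; exact hh (MvPowerSeries.ext H)
  obtain ⟨w, hw, hw0, s, hs, hmin⟩ := exists_weight_unique_min (d + 1)
    {s | coeff (Finsupp.equivFunOnFinite.symm s) h ≠ 0} ⟨s₀, by simpa using hs₀⟩
  have he : ∀ i : Fin d, 0 < w i.succ := fun i => hw _
  refine ⟨fun i => w i.succ, he, fun H => hs ?_⟩
  have H1 := congrArg (PowerSeries.coeff (∑ i, w i * s i)) H
  rw [coeff_axis, map_zero, twist, AlgHom.toRingHom_eq_coe, RingHom.coe_coe, coe_substAlgHom,
    coeff_subst (hasSubst_twistX _ he)] at H1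
  have key : ∀ t : Fin (d + 1) →₀ ℕ, coeff (Finsupp.single 0 (∑ i, w i * s i))
      (t.prod fun i m => twistX (1 : K) (fun i => w i.succ) i ^ m) =
        if ∑ i, w i * s i = ∑ i, w i * t i then 1 else 0 := by
    intro t
    rw [← coeff_axis, Finsupp.prod_fintype _ _ (by simp), map_prod]
    have : ∀ i, axis (twistX (1 : K) (fun i => w i.succ) i ^ t i) =
        PowerSeries.X ^ (w i * t i) := by
      refine Fin.cases ?_ fun i => ?_
      · simp [twistX, axis_X_zero, hw0 0 rfl]
      · simp [twistX, axis_X_zero, axis_X_succ, pow_mul]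
    rw [Finset.prod_congr rfl fun i _ => this i, Finset.prod_pow_eq_pow_sum,
      PowerSeries.coeff_X_pow]
  rw [finsum_eq_single _ (Finsupp.equivFunOnFinite.symm s)] at H1
  · rw [key] at H1
    simpa using H1
  · intro t ht
    rw [key]
    by_cases h0 : coeff t h = 0
    · rw [h0, zero_smul]
    · have := hmin t (by simpa using h0) fun h' => ht (by rw [← h']; simp)
      rw [if_neg this.ne, smul_zero]

end MvPowerSeries

/-- Points of finitely generated rings in power series rings of characteristic zero specialize
to points in power series rings of positive characteristic. -/
def HasPoints (d : ℕ) : Prop :=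
  ∀ (K : Type) [Field K] [CharZero K] (C : Type) [CommRing C] [Algebra.FiniteType ℤ C]
    (φ : C →+* MvPowerSeries (Fin d) K) (ξ : Fin d → C), (∀ i, φ (ξ i) = MvPowerSeries.X i) →
    ∃ (p : ℕ) (_ : Fact p.Prime) (k : Type) (_ : Field k) (_ : CharP k p)
      (ψ : C →+* MvPowerSeries (Fin d) k), ∀ i, ψ (ξ i) = MvPowerSeries.X i

theorem Int.isJacobsonRing : IsJacobsonRing ℤ := by
  refine isJacobsonRing_iff_prime_eq.mpr fun P hP => ?_
  by_cases h : P = ⊥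
  · subst h
    refine le_antisymm (fun x hx => ?_) Ideal.le_jacobson
    have h1 := Int.isUnit_iff.mp (Ideal.mem_jacobson_bot.mp hx (3 * x))
    rw [Ideal.mem_bot]
    by_contra h0
    have : 0 < x * x := mul_self_pos.mpr h0
    rcases h1 with h1 | h1 <;> nlinarith
  · exact Ideal.jacobson_eq_self_of_isMaximal (H := hP.isMaximal h)

theorem HasPoints.zero : HasPoints 0 := by
  intro K _ _ C _ _ φ ξ _
  have : Nontrivial C := φ.domain_nontrivial
  obtain ⟨M, hM⟩ := Ideal.exists_maximal C
  let := Ideal.Quotient.field M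
  have hfin : Module.Finite ℤ (C ⧸ M) := by
    have : Algebra.FiniteType ℤ (C ⧸ M) :=
      Algebra.FiniteType.of_surjective (Ideal.Quotient.mkₐ ℤ M) Ideal.Quotient.mk_surjective
    have := Int.isJacobsonRing
    exact finite_of_finite_type_of_isJacobsonRing ℤ (C ⧸ M)
  obtain ⟨p, hp⟩ := CharP.exists (C ⧸ M)
  rcases CharP.char_is_prime_or_zero (C ⧸ M) p with h | rfl
  · exact ⟨p, ⟨h⟩, C ⧸ M, inferInstance, hp,
      MvPowerSeries.C.comp (Ideal.Quotient.mk M), fun i => i.elim0⟩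
  · exfalso
    have : CharZero (C ⧸ M) := CharP.charP_to_charZero _
    have hintegral : Algebra.IsIntegral ℤ (C ⧸ M) := inferInstance
    have h2 := isField_of_isIntegral_of_isField (R := ℤ) (S := C ⧸ M)
      (FaithfulSMul.algebraMap_injective ℤ (C ⧸ M)) (Field.toIsField _)
    exact Int.not_isField h2

theorem HasPoints.exists_subring {d : ℕ} (H : HasPoints d) (K : Type) [Field K] [CharZero K]
    {E : Set (MvPowerSeries (Fin d) K)} (hE : E.Finite) :
    ∃ (C : Subring (MvPowerSeries (Fin d) K)) (hX : ∀ i, MvPowerSeries.X i ∈ C) (p : ℕ)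
      (_ : Fact p.Prime) (k : Type) (_ : Field k) (_ : CharP k p)
      (ψ : C →+* MvPowerSeries (Fin d) k),
      E ⊆ C ∧ ∀ i, ψ ⟨MvPowerSeries.X i, hX i⟩ = MvPowerSeries.X i := by
  have hfin : (E ∪ Set.range (MvPowerSeries.X (R := K))).Finite := hE.union (Set.finite_range _)
  let C := Algebra.adjoin ℤ (E ∪ Set.range (MvPowerSeries.X (R := K)))
  have hX : ∀ i, MvPowerSeries.X i ∈ C := fun i =>
    Algebra.subset_adjoin (Or.inr ⟨i, rfl⟩)
  have hft := (Subalgebra.fg_iff_finiteType C).mp (Subalgebra.fg_def.mpr ⟨_, hfin, rfl⟩)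
  rw [Subsingleton.elim C.algebra (Ring.toIntAlgebra C)] at hft
  obtain ⟨p, hp, k, hk, hc, ψ, hψ⟩ := H K C C.val.toRingHom (fun i => ⟨_, hX i⟩) fun i => rfl
  exact ⟨C.toSubring, hX, p, hp, k, hk, hc, ψ, fun x hx => Algebra.subset_adjoin (Or.inl hx), hψ⟩

theorem Subring.exists_map_eq {A : Type} [CommRing A] (C : Subring A) {q : Polynomial A}
    (hq : (q.coeffs : Set A) ⊆ C) : ∃ r : Polynomial C, r.map C.subtype = q :=
  ⟨q.toSubring C hq, Polynomial.map_toSubring _ _ _⟩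

section specialize
open Polynomial MvPowerSeries

/-- Polynomial approximations specialize to positive characteristic. -/
theorem HasPoints.exists_approx {d : ℕ} (H : HasPoints d) (K : Type) [Field K] [CharZero K]
    {ι S : Type} [Finite ι] [Finite S] (a : MvPolynomial ι ℤ) (f : Polynomial (MvPolynomial ι ℤ))
    (g : S → Polynomial (MvPolynomial ι ℤ)) {α β z v w e : (MvPowerSeries (Fin d) K)[X]}
    {t : ι → (MvPowerSeries (Fin d) K)[X]} {l : S → (MvPowerSeries (Fin d) K)[X]}
    (hα : α.Monic) (hv : IsUnit (v.coeff 0)) (hw : IsUnit (w.coeff 0))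
    (hf : evT t z f = α * β ^ 2 * Polynomial.X * e) (ha : evT t z (Polynomial.C a) = α * v)
    (hf' : evT t z f.derivative = β * w) (hg : ∀ b, evT t z (g b) = α * l b)
    (i₀ : ι) (j : Fin d → ι) (E : Fin d → ℕ) (h₀ : t i₀ = Polynomial.X)
    (hj : ∀ i, t (j i) = Polynomial.C (MvPowerSeries.X i) + Polynomial.X ^ E i) :
    ∃ (p : ℕ) (_ : Fact p.Prime) (k : Type) (_ : Field k) (_ : CharP k p)
      (t' : ι → (MvPowerSeries (Fin d) k)[X]) (ζ : PowerSeries (MvPowerSeries (Fin d) k)),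
      evT (fun i => (t' i : PowerSeries (MvPowerSeries (Fin d) k))) ζ f = 0 ∧
      evT (fun i => (t' i : PowerSeries (MvPowerSeries (Fin d) k))) ζ (Polynomial.C a) ≠ 0 ∧
      (∀ b, evT (fun i => (t' i : PowerSeries (MvPowerSeries (Fin d) k))) ζ (Polynomial.C a) ∣
        evT (fun i => (t' i : PowerSeries (MvPowerSeries (Fin d) k))) ζ (g b)) ∧
      t' i₀ = Polynomial.X ∧
      ∀ i, t' (j i) = Polynomial.C (MvPowerSeries.X i) + Polynomial.X ^ E i := by
  classical
  obtain ⟨v', hv'⟩ := hv.exists_right_inv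
  obtain ⟨w', hw'⟩ := hw.exists_right_inv
  have hfin : (((α.coeffs : Set (MvPowerSeries (Fin d) K)) ∪ β.coeffs ∪ z.coeffs ∪ v.coeffs ∪
      w.coeffs ∪ e.coeffs) ∪ (⋃ i, ((t i).coeffs : Set (MvPowerSeries (Fin d) K))) ∪
      (⋃ b, ((l b).coeffs : Set (MvPowerSeries (Fin d) K))) ∪ {v', w'}).Finite := by
    refine Set.Finite.union (Set.Finite.union (Set.Finite.union ?_ ?_) ?_) (by simp)
    · simp only [Set.finite_union, Finset.finite_toSet, and_true]
    · exact Set.finite_iUnion fun i => Finset.finite_toSet _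
    · exact Set.finite_iUnion fun i => Finset.finite_toSet _
  obtain ⟨C, hX, p, hp, k, hk, hc, ψ, hC, hψ⟩ := H.exists_subring K hfin
  simp only [Set.union_subset_iff, Set.iUnion_subset_iff, Set.insert_subset_iff,
    Set.singleton_subset_iff] at hC
  obtain ⟨⟨⟨⟨⟨⟨⟨⟨cα, cβ⟩, cz⟩, cv⟩, cw⟩, ce⟩, ct⟩, cl⟩, cv', cw'⟩ := hC
  obtain ⟨α, rfl⟩ := C.exists_map_eq cα
  obtain ⟨β, rfl⟩ := C.exists_map_eq cβ
  obtain ⟨z, rfl⟩ := C.exists_map_eq cz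
  obtain ⟨v, rfl⟩ := C.exists_map_eq cv
  obtain ⟨w, rfl⟩ := C.exists_map_eq cw
  obtain ⟨e, rfl⟩ := C.exists_map_eq ce
  choose t₁ ht using fun i => C.exists_map_eq (ct i)
  choose l₁ hl using fun b => C.exists_map_eq (cl b)
  obtain rfl : (fun i => (t₁ i).map C.subtype) = t := funext ht
  obtain rfl : (fun b => (l₁ b).map C.subtype) = l := funext hl
  have hinj : Function.Injective C.subtype := Subtype.val_injective
  have hpinj := Polynomial.map_injective C.subtype hinj
  have hev : ∀ q, (evT t₁ z q).map C.subtype =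
      evT (fun i => (t₁ i).map C.subtype) (z.map C.subtype) q :=
    fun q => evT_map (Polynomial.mapRingHom C.subtype) t₁ z q
  have hev' : ∀ q, (evT t₁ z q).map ψ = evT (fun i => (t₁ i).map ψ) (z.map ψ) q :=
    fun q => evT_map (Polynomial.mapRingHom ψ) t₁ z q
  have hu : ∀ (u : C[X]) (u' : MvPowerSeries (Fin d) K) (hu' : u' ∈ C),
      (u.map C.subtype).coeff 0 * u' = 1 → IsUnit ((u.map ψ).coeff 0) := by
    intro u u' hu' h
    rw [Polynomial.coeff_map] at h ⊢
    refine IsUnit.map ψ (IsUnit.of_mul_eq_one ⟨u', hu'⟩ (Subtype.ext h))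
  have : IsDomain (MvPowerSeries (Fin d) k) := NoZeroDivisors.to_isDomain _
  obtain ⟨ζ, h1, h2, h3⟩ := exists_point_of_approx a f g (α := α.map ψ) (β := β.map ψ)
    (z := z.map ψ) (v := v.map ψ) (w := w.map ψ) (e := e.map ψ) (t := fun i => (t₁ i).map ψ)
    (l := fun b => (l₁ b).map ψ) ((Polynomial.monic_of_injective hinj hα).map ψ)
    (hu v v' cv' hv') (hu w w' cw' hw')
    (by
      rw [← hev', show evT t₁ z f = α * β ^ 2 * Polynomial.X * e from
        hpinj (by rw [hev, hf]; simp)]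
      simp)
    (by
      rw [← hev', show evT t₁ z (Polynomial.C a) = α * v from hpinj (by rw [hev, ha]; simp)]
      simp)
    (by
      rw [← hev', show evT t₁ z f.derivative = β * w from hpinj (by rw [hev, hf']; simp)]
      simp)
    (fun b => by
      rw [← hev', show evT t₁ z (g b) = α * l₁ b from hpinj (by rw [hev, hg]; simp)]
      simp)
  refine ⟨p, hp, k, hk, hc, fun i => (t₁ i).map ψ, ζ, h1, h2, h3, ?_, fun i => ?_⟩
  · have : t₁ i₀ = Polynomial.X := hpinj (h₀.trans (by simp))
    simp [this]
  · have : t₁ (j i) = Polynomial.C ⟨MvPowerSeries.X i, hX i⟩ + Polynomial.X ^ E i :=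
      hpinj ((hj i).trans (by simp))
    simp [this, hψ]

theorem MvPowerSeries.map_residue_ne_zero {K : Type} [Field K] {d : ℕ}
    {F : PowerSeries (MvPowerSeries (Fin d) K)}
    (h : F.map (MvPowerSeries.constantCoeff (σ := Fin d) (R := K)) ≠ 0) :
    F.map (IsLocalRing.residue (MvPowerSeries (Fin d) K)) ≠ 0 := by
  intro h0
  refine h (PowerSeries.ext fun n => ?_)
  have h1 := congrArg (PowerSeries.coeff n) h0
  rw [PowerSeries.coeff_map, map_zero, IsLocalRing.residue_eq_zero_iff,
    IsLocalRing.mem_maximalIdeal, mem_nonunits_iff, MvPowerSeries.isUnit_iff_constantCoeff,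
    isUnit_iff_ne_zero, not_not] at h1
  rw [PowerSeries.coeff_map, h1, map_zero]

theorem MvPowerSeries.evHom_X_injective (K : Type) [Field K] [CharZero K] (σ : Type) :
    Function.Injective (evHom (MvPowerSeries.X : σ → MvPowerSeries σ K)) := by
  have : evHom (MvPowerSeries.X : σ → MvPowerSeries σ K) =
      (MvPolynomial.coeToMvPowerSeries.ringHom (R := K)).comp
        (MvPolynomial.map (Int.castRingHom K)) := by
    ext i <;> simp [evHom]
  rw [this]
  exact (MvPolynomial.coe_injective σ K).comp
    (MvPolynomial.map_injective (Int.castRingHom K) Int.cast_injective)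

theorem HasPoints.succ {d : ℕ} (H : HasPoints d) : HasPoints (d + 1) := by
  intro K _ _ C _ _ φ ξ hξ
  have hft : Algebra.FiniteType ℤ φ.range :=
    Algebra.FiniteType.of_surjective φ.rangeRestrict.toIntAlgHom φ.rangeRestrict_surjective
  have : CharZero (MvPowerSeries (Fin (d + 1)) K) :=
    charZero_of_injective_ringHom (f := MvPowerSeries.C) MvPowerSeries.C_injective
  have : CharZero φ.range :=
    ⟨fun m n h => by simpa using congrArg (φ.range.subtype) h⟩
  have hx : AlgebraicIndependent ℤ fun i => φ.rangeRestrict (ξ i) := by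
    have hcomp : φ.range.subtype.comp (evHom fun i => φ.rangeRestrict (ξ i)) =
        evHom MvPowerSeries.X := by
      ext i <;> simp [evHom, hξ]
    refine Function.Injective.of_comp (f := φ.range.subtype) ?_
    have := MvPowerSeries.evHom_X_injective K (Fin (d + 1))
    rw [← hcomp] at this
    exact this
  have : IsDomain (MvPowerSeries (Fin (d + 1)) K) := NoZeroDivisors.to_isDomain _
  have : IsDomain (MvPowerSeries (Fin d) K) := NoZeroDivisors.to_isDomain _
  obtain ⟨ι, S, _, _, t, j, z, s, a, f, g, htj, -, hf, hf', ha, hg, hψ⟩ :=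
    exists_etale_presentation _ hx
  have hA := MvPowerSeries.isAdicComplete_maximalIdeal (d := d) (K := K)
  change evT t z f = 0 at hf
  change evT t z f.derivative ≠ 0 at hf'
  have ha' : evT t z (Polynomial.C a) ≠ 0 := by simpa [evT, evHom] using ha
  have hg' : ∀ b, evT t z (Polynomial.C a) ∣ evT t z (g b) := fun b => ⟨s b, by
    rw [show evT t z (g b) = _ from (hg b).symm]; simp [evT, evHom]⟩
  obtain ⟨E, hE, haxis⟩ := MvPowerSeries.exists_axis_twist_ne_zero (K := K) (d := d)
    (h := φ.range.subtype (evT t z (Polynomial.C a) * evT t z f.derivative))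
    (fun h => mul_ne_zero ha' hf' (Subtype.val_injective h))
  rw [map_mul, map_mul, map_mul] at haxis
  let θ : φ.range →+* PowerSeries (MvPowerSeries (Fin d) K) :=
    ((finSuccEquiv K d).toRingEquiv.toRingHom.comp (twist 1 hE)).comp φ.range.subtype
  obtain ⟨α, β, z', v, w, e, t', l, hα, hv, hw, h1, h2, h3, h4, hq⟩ :=
    exists_polynomial_approx (fun i => θ (t i)) (θ z) a f g
      (by rw [← evT_map, hf, map_zero])
      (by rw [← evT_map]; exact MvPowerSeries.map_residue_ne_zero (left_ne_zero_of_mul haxis))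
      (by rw [← evT_map]; exact MvPowerSeries.map_residue_ne_zero (right_ne_zero_of_mul haxis))
      (fun b => by rw [← evT_map, ← evT_map]; exact map_dvd θ (hg' b))
  have hθ : ∀ i, θ (t (j i)) = finSuccEquiv K d (twistX 1 E i) := fun i => by
    rw [htj, ← twist_X 1 hE, ← hξ i]; rfl
  obtain ⟨p, hp, k, hk, hc, t₁, ζ, k1, k2, k3, k4, k5⟩ := H.exists_approx K a f g hα hv hw h1 h2 h3
    h4 (j 0) (fun i => j i.succ) E (hq _ _ (by rw [hθ]; simp [twistX]))
    (fun i => hq _ _ (by rw [hθ]; simp [twistX]))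
  have : IsDomain (MvPowerSeries (Fin d) k) := NoZeroDivisors.to_isDomain _
  obtain ⟨ψ, hψ⟩ := hψ _ (fun i => (t₁ i : PowerSeries (MvPowerSeries (Fin d) k))) ζ k1
    (by simpa [evT, evHom] using k2) (fun b => by simpa [evT, evHom] using k3 b)
  refine ⟨p, hp, k, hk, hc, ((twist (-1) hE).comp
    ((finSuccEquiv k d).symm.toRingEquiv.toRingHom.comp ψ)).comp φ.rangeRestrict, fun i => ?_⟩
  have key : ψ (φ.rangeRestrict (ξ i)) = finSuccEquiv k d (twistX 1 E i) := by
    rw [← htj, hψ]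
    refine Fin.cases ?_ (fun i => ?_) i
    · rw [k4]; simp [twistX]
    · rw [k5]; simp [twistX]
  have : twist (-1) hE (twistX (1 : k) E i) = MvPowerSeries.X i := by
    refine Fin.cases ?_ (fun i => ?_) i
    · simp [twistX, twist_X]
    · simp [twistX, twist_X]
  simpa [key] using this

theorem hasPoints : ∀ d, HasPoints d
  | 0 => HasPoints.zero
  | d + 1 => (hasPoints d).succ

end specialize

section
open DMod

theorem IsAlgClosed.exists_comp_eq {R S Ω : Type} [CommRing R] [IsDomain R] [CommRing S]
    [IsDomain S] [Field Ω] [IsAlgClosed Ω] {f : R →+* S} (hf : Function.Injective f)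
    (hintegral : f.IsIntegral) {g : R →+* Ω} (hg : Function.Injective g) :
    ∃ χ : S →+* Ω, χ.comp f = g := by
  let := f.toAlgebra
  let := g.toAlgebra
  have : FaithfulSMul R S := (faithfulSMul_iff_algebraMap_injective R S).mpr hf
  have : FaithfulSMul R Ω := (faithfulSMul_iff_algebraMap_injective R Ω).mpr hg
  have : Module.IsTorsionFree R S := inferInstance
  have : Module.IsTorsionFree R Ω := inferInstance
  have : Algebra.IsIntegral R S := ⟨hintegral⟩
  exact ⟨(IsAlgClosed.lift : S →ₐ[R] Ω).toRingHom, AlgHom.comp_algebraMap _⟩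

/-- A homomorphism from a domain to a field-like target extends along injective integral
extensions, up to a finite extension of the target. -/
theorem exists_finite_extension {C D₀ A : Type} [CommRing C] [IsDomain C] [CommRing D₀]
    [Algebra C D₀] [CommRing A] [IsDomain A] {Δ : Set D₀} (hΔ : Δ.Finite)
    (htop : Algebra.adjoin C Δ = ⊤) (hintegral : ∀ δ ∈ Δ, IsIntegral C δ)
    (hinj : Function.Injective (algebraMap C D₀)) (ψ : C →+* A) :
    ∃ (D : Type) (_ : CommRing D) (_ : Algebra A D) (χ : D₀ →+* D), Module.Finite A D ∧
      Function.Injective (algebraMap A D) ∧ ∀ c, χ (algebraMap C D₀ c) = algebraMap A D (ψ c) := by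
  have : Algebra.IsIntegral C D₀ := by
    refine ⟨fun x => ?_⟩
    have h : Algebra.adjoin C Δ ≤ integralClosure C D₀ := Algebra.adjoin_le hintegral
    exact h (htop ▸ Algebra.mem_top)
  have : (RingHom.ker ψ).IsPrime := RingHom.ker_isPrime ψ
  obtain ⟨P, -, hP, hPc⟩ := Ideal.exists_ideal_over_prime_of_isIntegral (RingHom.ker ψ)
    (⊥ : Ideal D₀) (by
      rw [← RingHom.ker_eq_comap_bot, (RingHom.injective_iff_ker_eq_bot _).1 hinj]
      exact bot_le)
  let R := C ⧸ RingHom.ker ψ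
  let S := D₀ ⧸ P
  let f : R →+* S := Ideal.quotientMap P (algebraMap C D₀) hPc.ge
  have hf : Function.Injective f := Ideal.quotientMap_injective' hPc.le
  let Ω := AlgebraicClosure (FractionRing A)
  let g : R →+* Ω := (algebraMap A Ω).comp (RingHom.kerLift ψ)
  have hAΩ : Function.Injective (algebraMap A Ω) := by
    rw [IsScalarTower.algebraMap_eq A (FractionRing A) Ω]
    exact (algebraMap (FractionRing A) Ω).injective.comp
      (IsFractionRing.injective A (FractionRing A))
  have hg : Function.Injective g := hAΩ.comp (RingHom.kerLift_injective ψ)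
  have hfint : f.IsIntegral := by
    intro x
    obtain ⟨y, rfl⟩ := Ideal.Quotient.mk_surjective x
    obtain ⟨q, hq, h0⟩ := Algebra.IsIntegral.isIntegral (R := C) y
    refine ⟨q.map (Ideal.Quotient.mk _), hq.map _, ?_⟩
    have e : f.comp (Ideal.Quotient.mk _) = (Ideal.Quotient.mk P).comp (algebraMap C D₀) := rfl
    rw [Polynomial.eval₂_map, e, ← Polynomial.hom_eval₂, h0, map_zero]
  obtain ⟨χ', hχ'⟩ := IsAlgClosed.exists_comp_eq hf hfint hg
  let χ : D₀ →+* Ω := χ'.comp (Ideal.Quotient.mk P)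
  have hχ : ∀ c, χ (algebraMap C D₀ c) = algebraMap A Ω (ψ c) := fun c =>
    congrArg (fun h => h (Ideal.Quotient.mk _ c)) hχ'
  let D := Algebra.adjoin A (χ '' Δ)
  have hmem : ∀ x, χ x ∈ D := by
    intro x
    let T : Subalgebra C D₀ := { D.toSubring.comap χ with
      algebraMap_mem' := fun c => by
        change χ _ ∈ D
        rw [hχ]
        exact D.algebraMap_mem _ }
    have hT : Algebra.adjoin C Δ ≤ T :=
      Algebra.adjoin_le fun δ hδ => Algebra.subset_adjoin (Set.mem_image_of_mem χ hδ)
    exact hT (htop ▸ Algebra.mem_top)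
  refine ⟨D, inferInstance, inferInstance, χ.codRestrict D.toSubring hmem, ?_,
    fun a b h => hAΩ (congrArg Subtype.val h), fun c => Subtype.ext (hχ c)⟩
  refine Algebra.finite_adjoin_of_finite_of_isIntegral (hΔ.image χ) ?_
  rintro _ ⟨δ, hδ, rfl⟩
  obtain ⟨q, hq, h0⟩ := hintegral δ hδ
  refine ⟨q.map ψ, hq.map ψ, ?_⟩
  have e : (algebraMap A Ω).comp ψ = χ.comp (algebraMap C D₀) := RingHom.ext fun c => (hχ c).symm
  rw [Polynomial.eval₂_map, e, ← Polynomial.hom_eval₂, h0, map_zero]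

namespace MC

/-- Restriction to a subring containing all the entries. -/
def restrict {D : Type} [CommRing D] {n d : ℕ} (F : MC D n d) (D₀ : Subring D)
    (h : ∀ i j, F.mat i j ∈ D₀) : MC D₀ n d where
  deg := F.deg
  mono := F.mono
  le := F.le
  mat := Matrix.of fun i j => ⟨F.mat i j, h i j⟩
  hmat i j h' := F.hmat i j fun h'' => h' (Subtype.ext h'')
  sq := by
    ext i j
    simpa [Matrix.mul_apply] using congrFun (congrFun F.sq i) j

theorem two_pow_le_of_charZero (K : Type) [Field K] [CharZero K] {d : ℕ}
    {D : Type} [CommRing D] [Algebra (MvPowerSeries (Fin d) K) D]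
    [Module.Finite (MvPowerSeries (Fin d) K) D]
    (hinj : Function.Injective (algebraMap (MvPowerSeries (Fin d) K) D))
    {n : ℕ} (F : MC D (n + 1) d) (h0 : F.deg 0 = 0) {N : ℕ}
    (hN : ∀ i, F.Null (algebraMap (MvPowerSeries (Fin d) K) D (MvPowerSeries.X i ^ N)))
    (hF : ∀ i j, F.mat i j ∈ ((Ideal.span (Set.range MvPowerSeries.X)).map
      (algebraMap (MvPowerSeries (Fin d) K) D)).radical) :
    2 ^ d ≤ n + 1 := by
  classical
  set A := MvPowerSeries (Fin d) K with hA
  have : IsDomain A := NoZeroDivisors.to_isDomain _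
  choose σ hσ1 hσ2 using hN
  have hγ : ∀ i j, ∃ (M : ℕ) (γ : Fin d → D),
      ∑ l, γ l * algebraMap A D (MvPowerSeries.X l) = F.mat i j ^ M := by
    intro i j
    obtain ⟨M, hM⟩ := hF i j
    rw [Ideal.map_span, ← Set.range_comp, Ideal.mem_span_range_iff_exists_fun] at hM
    exact ⟨M, hM⟩
  choose M γ hγ using hγ
  let Δ : Set D := (Set.range fun q : Fin (n + 1) × Fin (n + 1) => F.mat q.1 q.2) ∪
    (Set.range fun q : Fin d × Fin (n + 1) × Fin (n + 1) => σ q.1 q.2.1 q.2.2) ∪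
    (Set.range fun q : (Fin (n + 1) × Fin (n + 1)) × Fin d => γ q.1.1 q.1.2 q.2)
  have hΔ : Δ.Finite := ((Set.finite_range _).union (Set.finite_range _)).union (Set.finite_range _)
  have hintegral : ∀ δ : D, IsIntegral A δ := fun δ => Algebra.IsIntegral.isIntegral δ
  choose q hq1 hq2 using hintegral
  obtain ⟨C, hX, p, hp, k, hk, hc, ψ, hC, hψ⟩ := (hasPoints d).exists_subring K
    (hΔ.biUnion fun δ _ => (q δ).coeffs.finite_toSet)
  rw [Set.iUnion₂_subset_iff] at hC
  let D₀ := Algebra.adjoin C Δ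
  have hmem : ∀ δ ∈ Δ, δ ∈ D₀ := fun δ h => Algebra.subset_adjoin h
  have hF₀ : ∀ i j, F.mat i j ∈ D₀ := fun i j => hmem _ (Or.inl (Or.inl ⟨(i, j), rfl⟩))
  have hσ₀ : ∀ l i j, σ l i j ∈ D₀ := fun l i j => hmem _ (Or.inl (Or.inr ⟨(l, i, j), rfl⟩))
  have hγ₀ : ∀ i j l, γ i j l ∈ D₀ := fun i j l => hmem _ (Or.inr ⟨((i, j), l), rfl⟩)
  have hinj₀ : Function.Injective (algebraMap C D₀) := fun a b h =>
    Subtype.val_injective (hinj (congrArg Subtype.val h))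
  have hval : ∀ c : C, ((algebraMap C D₀ c : D₀) : D) = algebraMap A D c := fun c => rfl
  have hintegral₀ : ∀ δ ∈ (Subtype.val ⁻¹' Δ : Set D₀), IsIntegral C δ := by
    intro δ hδ
    obtain ⟨r, hr⟩ := C.exists_map_eq (hC δ hδ)
    refine ⟨r, Polynomial.monic_of_injective (f := C.subtype) Subtype.val_injective
      (by rw [hr]; exact hq1 _), ?_⟩
    apply Subtype.val_injective
    have e : (algebraMap A D).comp C.subtype = D₀.val.toRingHom.comp (algebraMap C D₀) := rfl
    change D₀.val.toRingHom _ = D₀.val.toRingHom 0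
    rw [Polynomial.hom_eval₂, ← e, ← Polynomial.eval₂_map, hr, map_zero]
    exact hq2 _
  have : IsDomain (MvPowerSeries (Fin d) k) := NoZeroDivisors.to_isDomain _
  obtain ⟨E, _, _, χ, hE, hEinj, hχ⟩ := exists_finite_extension
    (hΔ.preimage Subtype.val_injective.injOn) Algebra.adjoin_adjoin_coe_preimage hintegral₀ hinj₀ ψ
  have hχX : ∀ i, χ (algebraMap C D₀ ⟨MvPowerSeries.X i, hX i⟩) =
      algebraMap _ E (MvPowerSeries.X i) := fun i => by rw [hχ, hψ]
  refine two_pow_le_of_charP k p hEinj ((F.restrict D₀.toSubring hF₀).map χ) h0 (N := N)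
    (fun i => ?_) (fun i j => ?_)
  · rw [map_pow, ← hχX, ← map_pow]
    have hn : (F.restrict D₀.toSubring hF₀).Null
        (algebraMap C D₀ (⟨MvPowerSeries.X i, hX i⟩ ^ N)) := by
      refine ⟨Matrix.of fun a b => ⟨σ i a b, hσ₀ i a b⟩,
      fun a b h => hσ1 i a b fun h' => h (Subtype.ext h'), ?_⟩
      ext a b
      have := congrFun (congrFun (hσ2 i) a) b
      simpa [Matrix.mul_apply, restrict, Matrix.one_apply, apply_ite, hval] using this
    rw [map_pow] at hn
    exact hn.map χ
  · have h1 : (F.restrict D₀.toSubring hF₀).mat i j ∈ (Ideal.span (Set.range fun l =>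
        algebraMap C D₀ ⟨MvPowerSeries.X l, hX l⟩)).radical := by
      refine ⟨M i j, Ideal.mem_span_range_iff_exists_fun.mpr
        ⟨fun l => ⟨γ i j l, hγ₀ i j l⟩, Subtype.ext ?_⟩⟩
      simpa [restrict, hval] using hγ i j
    have h2 := mem_radical_map χ h1
    rw [Ideal.map_span, ← Set.range_comp] at h2
    rw [Ideal.map_span, ← Set.range_comp]
    have e : (χ ∘ fun l => algebraMap C D₀ ⟨MvPowerSeries.X l, hX l⟩) =
        algebraMap _ E ∘ MvPowerSeries.X := funext hχX
    rwa [e] at h2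

theorem two_pow_le (K : Type) [Field K] {d : ℕ}
    {D : Type} [CommRing D] [Algebra (MvPowerSeries (Fin d) K) D]
    [Module.Finite (MvPowerSeries (Fin d) K) D]
    (hinj : Function.Injective (algebraMap (MvPowerSeries (Fin d) K) D))
    {n : ℕ} (F : MC D (n + 1) d) (h0 : F.deg 0 = 0) {N : ℕ}
    (hN : ∀ i, F.Null (algebraMap (MvPowerSeries (Fin d) K) D (MvPowerSeries.X i ^ N)))
    (hF : ∀ i j, F.mat i j ∈ ((Ideal.span (Set.range MvPowerSeries.X)).map
      (algebraMap (MvPowerSeries (Fin d) K) D)).radical) :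
    2 ^ d ≤ n + 1 := by
  obtain ⟨p, hp⟩ := CharP.exists K
  rcases CharP.char_is_prime_or_zero K p with h | rfl
  · have : Fact p.Prime := ⟨h⟩
    exact two_pow_le_of_charP K p hinj F h0 hN hF
  · have : CharZero K := CharP.charP_to_charZero _
    exact two_pow_le_of_charZero K hinj F h0 hN hF

end MC
end

open scoped TensorProduct in
/-- Injectivity of the conormal map, for a presentation by a polynomial ring, tested on partial
derivatives. -/
theorem Algebra.subsingleton_h1Cotangent_iff_pderiv {F A ι : Type} [Field F] [CommRing A]
    [Algebra F A] (f : MvPolynomial ι F →ₐ[F] A) (hf : Function.Surjective f) :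
    Subsingleton (Algebra.H1Cotangent F A) ↔
      ∀ x ∈ RingHom.ker f, (∀ i, f (MvPolynomial.pderiv i x) = 0) → x ∈ RingHom.ker f ^ 2 := by
  let := f.toAlgebra
  have : IsScalarTower F (MvPolynomial ι F) A := .of_algebraMap_eq fun r => (f.commutes r).symm
  have hs : Function.Surjective (algebraMap (MvPolynomial ι F) A) := hf
  rw [← Algebra.FormallySmooth.kerCotangentToTensor_injective_iff hs,
    injective_iff_map_eq_zero]
  have key (x : RingHom.ker (algebraMap (MvPolynomial ι F) A)) :
      KaehlerDifferential.kerCotangentToTensor F (MvPolynomial ι F) A (Ideal.toCotangent _ x) = 0 ↔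
        ∀ i, f (MvPolynomial.pderiv i x.1) = 0 := by
    rw [KaehlerDifferential.kerCotangentToTensor_toCotangent]
    let b := (KaehlerDifferential.mvPolynomialBasis F ι).baseChange A
    rw [← b.repr.map_eq_zero_iff, Finsupp.ext_iff]
    refine forall_congr' fun i => ?_
    simp only [b, Module.Basis.baseChange_repr_tmul, KaehlerDifferential.mvPolynomialBasis_repr_apply,
      Algebra.smul_def, mul_one, Finsupp.zero_apply]
    rfl
  constructor
  · intro h x hx hd
    have := h _ ((key ⟨x, hx⟩).2 hd)
    rwa [Ideal.toCotangent_eq_zero] at this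
  · intro h y hy
    obtain ⟨x, rfl⟩ := Ideal.toCotangent_surjective _ y
    rw [Ideal.toCotangent_eq_zero]
    exact h _ x.2 ((key x).1 hy)

/-- Any extension of a perfect field is formally smooth. -/
theorem Algebra.FormallySmooth.of_perfectField' (F κ : Type) [Field F] [PerfectField F] [Field κ]
    [Algebra F κ] : Algebra.FormallySmooth F κ := by
  refine ⟨inferInstance, ?_⟩
  have hsurj (L : Type) [Field L] [Algebra F L] :
      Function.Surjective (MvPolynomial.aeval (R := F) (_root_.id : L → L)) :=
    fun a => ⟨MvPolynomial.X a, by simp⟩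
  rw [Algebra.subsingleton_h1Cotangent_iff_pderiv _ (hsurj κ)]
  intro x hx hd
  let L := IntermediateField.adjoin F (x.vars : Set κ)
  have hess : Algebra.EssFiniteType F L := by
    rw [IntermediateField.essFiniteType_iff]
    exact ⟨x.vars, rfl⟩
  have hsm : Algebra.FormallySmooth F L := inferInstance
  have hL := (Algebra.subsingleton_h1Cotangent_iff_pderiv _ (hsurj L)).1
    hsm.subsingleton_h1Cotangent
  obtain ⟨y, hyx⟩ := MvPolynomial.exists_rename_eq_of_vars_subset_range x
    (Subtype.val : L → κ) Subtype.val_injective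
    (fun a ha => ⟨⟨a, IntermediateField.subset_adjoin F _ ha⟩, rfl⟩)
  have hval (z : MvPolynomial L F) : MvPolynomial.aeval (R := F) (_root_.id : κ → κ)
      (MvPolynomial.rename (Subtype.val : L → κ) z) =
        algebraMap L κ (MvPolynomial.aeval (R := F) (_root_.id : L → L) z) := by
    rw [MvPolynomial.aeval_rename, ← MvPolynomial.aeval_algebraMap_apply]
    rfl
  have hinj := (algebraMap L κ).injective
  have hy := hL y (hinj (by rw [← hval, map_zero, hyx]; exact hx)) fun i => hinj (by
    rw [← hval, ← MvPolynomial.pderiv_rename Subtype.val_injective, map_zero, hyx]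
    exact hd _)
  have := Ideal.mem_map_of_mem (MvPolynomial.rename (R := F) (Subtype.val : L → κ)) hy
  rw [Ideal.map_pow, hyx] at this
  refine Ideal.pow_right_mono (Ideal.map_le_iff_le_comap.2 fun z hz => ?_) 2 this
  change MvPolynomial.aeval (R := F) (_root_.id : κ → κ) (MvPolynomial.rename (Subtype.val : L → κ) z) = 0
  rw [hval, show MvPolynomial.aeval (R := F) (_root_.id : L → L) z = 0 from hz, map_zero]

theorem IsPrecomplete.pi_fin {A : Type} [CommRing A] (I : Ideal A) [IsPrecomplete I A] (n : ℕ) :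
    IsPrecomplete I (Fin n → A) := by
  rw [← AdicCompletion.of_surjective_iff]
  intro y
  choose a ha using fun i => AdicCompletion.of_surjective I A (AdicCompletion.piEquivFin I n y i)
  refine ⟨a, (AdicCompletion.piEquivFin I n).injective (funext fun i => ?_)⟩
  rw [← ha i, AdicCompletion.piEquivFin_apply]
  rfl

open Pointwise in
/-- A separated module over a complete ring is finite as soon as its reduction is. -/
theorem Module.Finite.of_isAdicComplete {A M : Type} [CommRing A] [AddCommGroup M] [Module A M]
    (I : Ideal A) [IsAdicComplete I A] [IsHausdorff I M] (L : Submodule A M) (hL : L.FG)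
    (h : L ⊔ I • (⊤ : Submodule A M) = ⊤) : Module.Finite A M := by
  have : Module.Finite A L := .of_fg hL
  obtain ⟨n, f, hf⟩ := Module.Finite.exists_fin' A L
  have := IsPrecomplete.pi_fin I n
  refine Module.Finite.of_surjective (L.subtype ∘ₗ f)
    (surjective_of_mkQ_comp_surjective (I := I) fun q => ?_)
  obtain ⟨x, rfl⟩ := Submodule.mkQ_surjective _ q
  obtain ⟨l, hl, z, hz, rfl⟩ := Submodule.mem_sup.1 (show x ∈ L ⊔ I • ⊤ from h.ge trivial)
  obtain ⟨v, hv⟩ := hf ⟨l, hl⟩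
  refine ⟨v, ?_⟩
  rw [map_add, (Submodule.Quotient.mk_eq_zero _).2 hz |> (Submodule.mkQ_apply _ _).trans, add_zero]
  simp [hv]

theorem Module.Finite.of_residually_surjective {A C : Type} [CommRing A] [CommRing C] [Algebra A C]
    (I : Ideal A) [IsAdicComplete I A] (m : Ideal C) [IsHausdorff m C] (hfg : m.FG)
    (hI : I.map (algebraMap A C) ≤ m) {N : ℕ} (hN : m ^ N ≤ I.map (algebraMap A C))
    (hres : ∀ c : C, ∃ a : A, c - algebraMap A C a ∈ m) : Module.Finite A C := by
  have : IsHausdorff I C := IsHausdorff.of_map hI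
  have key (n : ℕ) : ∃ L : Submodule A C, L.FG ∧ L ⊔ (m ^ n).restrictScalars A = ⊤ := by
    induction n with
    | zero => exact ⟨⊥, Submodule.fg_bot, by simp⟩
    | succ n ih =>
      obtain ⟨L, hL, h⟩ := ih
      obtain ⟨T, hT⟩ := Ideal.FG.pow (n := n) hfg
      refine ⟨L ⊔ Submodule.span A T, hL.sup (Submodule.fg_span T.finite_toSet), ?_⟩
      rw [eq_top_iff, ← h, sup_assoc]
      refine sup_le_sup_left ?_ L
      intro x hx
      have hx' : x ∈ Ideal.span (T : Set C) := hT ▸ hx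
      clear hx
      refine Submodule.span_induction (fun t ht => Submodule.mem_sup_left (Submodule.subset_span ht))
        (Submodule.zero_mem _) (fun a b _ _ ha hb => Submodule.add_mem _ ha hb) ?_ hx'
      intro c t _ ht
      obtain ⟨a, ha⟩ := hres c
      obtain ⟨u, hu, v, hv, rfl⟩ := Submodule.mem_sup.1 ht
      have hun : u ∈ m ^ n :=
        (Submodule.span_le.2 fun t ht => hT ▸ Ideal.subset_span ht :
          Submodule.span A (T : Set C) ≤ (m ^ n).restrictScalars A) hu
      rw [show c • (u + v) = a • u + ((c - algebraMap A C a) * u + c * v) by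
        rw [smul_eq_mul, Algebra.smul_def a]; ring]
      refine Submodule.add_mem_sup (Submodule.smul_mem _ _ hu) (Ideal.add_mem _ ?_ ?_)
      · rw [pow_succ']
        exact Ideal.mul_mem_mul ha hun
      · exact Ideal.mul_mem_left _ _ hv
  obtain ⟨L, hL, h⟩ := key N
  refine Module.Finite.of_isAdicComplete I L hL (top_unique (h.ge.trans (sup_le_sup_left ?_ L)))
  rw [Ideal.smul_top_eq_map]
  exact hN

open IsLocalRing in
/-- The structure map of a power series ring into a complete local ring. -/
theorem MvPowerSeries.exists_algHom {K C : Type} [Field K] [CommRing C] [Algebra K C]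
    (I : Ideal C) [IsAdicComplete I C] {d : ℕ} (s : Fin d → C) (hs : ∀ i, s i ∈ I) :
    ∃ φ : MvPowerSeries (Fin d) K →ₐ[K] C, ∀ i, φ (MvPowerSeries.X i) = s i := by
  let e : MvPolynomial (Fin d) K →ₐ[K] C := MvPolynomial.aeval s
  have he : (MvPolynomial.idealOfVars (Fin d) K).map e ≤ I := by
    rw [MvPolynomial.idealOfVars, Ideal.map_span, Ideal.span_le]
    rintro _ ⟨_, ⟨i, rfl⟩, rfl⟩
    simpa [e] using hs i
  have hle (n : ℕ) : MvPolynomial.idealOfVars (Fin d) K ^ n ≤ (I ^ n).comap e := by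
    rw [← Ideal.map_le_iff_le_comap, Ideal.map_pow]
    exact Ideal.pow_right_mono he n
  let f (n : ℕ) : MvPowerSeries (Fin d) K →ₐ[K] C ⧸ I ^ n :=
    (Ideal.quotientMapₐ (I ^ n) e (hle n)).comp
      ((MvPowerSeries.truncTotalAlgHom (Fin d) K n).restrictScalars K)
  have hf {m n : ℕ} (h : m ≤ n) :
      (Ideal.Quotient.factorₐ K (Ideal.pow_le_pow_right h)).comp (f n) = f m := by
    ext p
    simp only [f, AlgHom.comp_apply, AlgHom.restrictScalars_apply,
      MvPowerSeries.truncTotalAlgHom_apply, Ideal.quotient_map_mkₐ]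
    change Ideal.Quotient.mk (I ^ m) (e _) = Ideal.Quotient.mk (I ^ m) (e _)
    rw [Ideal.Quotient.eq, ← map_sub]
    exact hle m (MvPowerSeries.truncTotal_sub_truncTotal_mem_pow_idealOfVars h le_rfl p)
  refine ⟨IsAdicComplete.liftAlgHom I f hf, fun i => ?_⟩
  refine (IsHausdorff.eq_iff_smodEq (I := I)).2 fun n => ?_
  rw [smul_eq_mul, Ideal.mul_top]
  change Ideal.Quotient.mk (I ^ n) _ = Ideal.Quotient.mk (I ^ n) _
  rw [IsAdicComplete.mk_liftAlgHom]
  change Ideal.Quotient.mk (I ^ n) (e _) = Ideal.Quotient.mk (I ^ n) _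
  rw [← show e (MvPolynomial.X i) = s i by simp [e], Ideal.Quotient.eq, ← map_sub]
  refine hle n ((MvPolynomial.mem_pow_idealOfVars_iff' ..).2 fun x hx => ?_)
  rw [MvPolynomial.coeff_sub, MvPowerSeries.coeff_truncTotal _ hx, ← MvPolynomial.coe_X,
    MvPolynomial.coeff_coe, sub_self]

theorem ringKrullDim_le_of_isIntegral {A B : Type} [CommRing A] [CommRing B] [Algebra A B]
    [Algebra.IsIntegral A B] : ringKrullDim B ≤ ringKrullDim A :=
  Order.krullDim_le_of_strictMono (PrimeSpectrum.comap (algebraMap A B)) fun p q h =>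
    Ideal.IsIntegral.comap_lt_comap (R := A) (show p.asIdeal < q.asIdeal from h)

theorem RingHom.injective_of_le_ringKrullDim {A B : Type} [CommRing A] [IsDomain A] [CommRing B]
    (φ : A →+* B) (hφ : φ.Finite) {d : ℕ} (hA : ringKrullDim A ≤ d) (hB : d ≤ ringKrullDim B) :
    Function.Injective φ := by
  rw [injective_iff_map_eq_zero]
  by_contra! ⟨r, hr, hr0⟩
  have hd := ringKrullDim_quotient_succ_le_of_nonZeroDivisor (mem_nonZeroDivisors_of_ne_zero hr0)
  let ψ := Ideal.Quotient.lift (Ideal.span {r}) φ fun a ha => by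
    obtain ⟨b, rfl⟩ := Ideal.mem_span_singleton'.1 ha
    rw [map_mul, hr, mul_zero]
  let := ψ.toAlgebra
  have hψ : Algebra.IsIntegral (A ⧸ Ideal.span {r}) B :=
    ⟨RingHom.IsIntegral.tower_top (Ideal.Quotient.mk (Ideal.span {r})) ψ hφ.to_isIntegral⟩
  have h1 := hB.trans (ringKrullDim_le_of_isIntegral (A := A ⧸ Ideal.span {r}) (B := B))
  have h2 : ((d : WithBot ℕ∞) + 1) ≤ d := (add_le_add_left h1 1).trans (hd.trans hA)
  exact absurd h2 (by exact_mod_cast Nat.not_succ_le_self d)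

theorem MvPowerSeries.ringKrullDim_le (K : Type) [Field K] (d : ℕ) :
    ringKrullDim (MvPowerSeries (Fin d) K) ≤ d := by
  refine (ringKrullDim_le_spanFinrank_maximalIdeal _).trans ?_
  rw [MvPowerSeries.maximalIdeal_eq_span_range_X]
  refine Nat.cast_le.2 ((Submodule.spanFinrank_span_le_ncard_of_finite (Set.finite_range _)).trans ?_)
  rw [← Set.image_univ]
  exact (Set.ncard_image_le Set.finite_univ).trans_eq (by simp)

theorem IsLocalRing.ringKrullDim_le_of_flat {A B : Type} [CommRing A] [CommRing B] [IsLocalRing A]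
    [IsLocalRing B] [Algebra A B] [IsLocalHom (algebraMap A B)] [Module.Flat A B] :
    ringKrullDim A ≤ ringKrullDim B := by
  have hlo : (maximalIdeal B).LiesOver (maximalIdeal A) := inferInstance
  refine iSup_le fun l => ?_
  obtain ⟨P, -, hP, hover⟩ := Ideal.exists_ideal_le_liesOver_of_le (maximalIdeal B)
    (le_maximalIdeal (J := l.last.asIdeal) l.last.2.ne_top)
  obtain ⟨L, hL, -⟩ := Ideal.exists_ltSeries_of_hasGoingDown l P
  rw [← hL]
  exact Order.LTSeries.length_le_krullDim L

section
open IsLocalRing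

theorem Subring.exists_perfectField_hom {R : Type} [CommRing R] (K : Subring R) (hK : IsField K) :
    ∃ (F : Type) (_ : Field F), PerfectField F ∧ Nonempty (F →+* R) := by
  let := hK.toField
  obtain ⟨p, hp⟩ := CharP.exists K
  rcases CharP.char_is_prime_or_zero K p with h | rfl
  · have := Fact.mk h
    exact ⟨ZMod p, inferInstance, inferInstance, ⟨K.subtype.comp (ZMod.castHom dvd_rfl K)⟩⟩
  · have := CharP.charP_to_charZero K
    exact ⟨ℚ, inferInstance, inferInstance, ⟨K.subtype.comp (algebraMap ℚ K)⟩⟩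

theorem IsLocalRing.exists_coefficientField (C : Type) [CommRing C] [IsLocalRing C]
    [IsAdicComplete (maximalIdeal C) C] {F : Type} [Field F] [PerfectField F] (i : F →+* C) :
    ∃ g : ResidueField C →+* C, ∀ x, residue C (g x) = x := by
  let := i.toAlgebra
  have := Algebra.FormallySmooth.of_perfectField' F (ResidueField C)
  obtain ⟨g, hg⟩ := Algebra.FormallySmooth.exists_mkₐ_comp_eq_of_isAdicComplete
    (I := maximalIdeal C) (AlgHom.id F (ResidueField C))
  exact ⟨g.toRingHom, fun x => DFunLike.congr_fun hg x⟩

theorem IsLocalRing.exists_systemOfParameters (R : Type) [CommRing R] [IsNoetherianRing R]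
    [IsLocalRing R] {d : ℕ} (hdim : ringKrullDim R = d) :
    ∃ (r : Fin d → R) (N : ℕ), (∀ i, r i ∈ maximalIdeal R) ∧
      maximalIdeal R ^ N ≤ Ideal.span (Set.range r) := by
  obtain ⟨s, hs, hcard⟩ := (maximalIdeal R).exists_finset_card_eq_height_of_isNoetherianRing
  have hsd : s.card = d := by
    rw [← maximalIdeal_height_eq_ringKrullDim, ← hcard] at hdim
    exact_mod_cast hdim
  let e := s.equivFinOfCardEq hsd
  have hr : Set.range (fun i => (e.symm i : R)) = s := by
    rw [← Function.comp_def, Set.range_comp, e.symm.range_eq_univ]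
    simp
  have hrad : (Ideal.span (s : Set R)).radical = maximalIdeal R := by
    rw [← Ideal.sInf_minimalPrimes]
    refine le_antisymm (sInf_le hs) (le_sInf fun p hp => ?_)
    exact hs.2 hp.1 (le_maximalIdeal hp.1.1.ne_top)
  obtain ⟨N, hN⟩ := Ideal.exists_radical_pow_le_of_fg (Ideal.span (s : Set R))
    (IsNoetherian.noetherian _)
  refine ⟨fun i => e.symm i, N, fun i => hs.1.2 (Ideal.subset_span (e.symm i).2), ?_⟩
  rwa [hr, ← hrad]

/-- Noether normalization for the completion of an equicharacteristic local ring. -/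
theorem IsLocalRing.exists_finite_injective_mvPowerSeries (R : Type) [CommRing R]
    [IsNoetherianRing R] [IsLocalRing R] (hfield : ∃ K : Subring R, IsField K) {d : ℕ}
    (hdim : ringKrullDim R = d) :
    ∃ (K : Type) (_ : Field K)
      (φ : MvPowerSeries (Fin d) K →+* AdicCompletion (maximalIdeal R) R) (r : Fin d → R) (N : ℕ),
      Function.Injective φ ∧ φ.Finite ∧ (∀ i, r i ∈ maximalIdeal R) ∧
        maximalIdeal R ^ N ≤ Ideal.span (Set.range r) ∧
          ∀ i, φ (MvPowerSeries.X i) = algebraMap R _ (r i) := by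
  obtain ⟨L, hL⟩ := hfield
  obtain ⟨F, _, _, ⟨i⟩⟩ := L.exists_perfectField_hom hL
  obtain ⟨r, N, hr, hN⟩ := exists_systemOfParameters R hdim
  set C := AdicCompletion (maximalIdeal R) R
  let ι := algebraMap R C
  have hm : maximalIdeal C = (maximalIdeal R).map ι := AdicCompletion.maximalIdeal_eq_map
  obtain ⟨g, hg⟩ := exists_coefficientField C (ι.comp i)
  let := g.toAlgebra
  obtain ⟨φ, hφ⟩ := MvPowerSeries.exists_algHom (K := ResidueField C) (maximalIdeal C)
    (fun j => ι (r j)) fun j => hm ▸ Ideal.mem_map_of_mem _ (hr j)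
  have hspan : (Ideal.span (Set.range MvPowerSeries.X)).map φ.toRingHom =
      (Ideal.span (Set.range r)).map ι := by
    rw [Ideal.map_span, Ideal.map_span, ← Set.range_comp, ← Set.range_comp]
    exact congrArg _ (congrArg _ (funext hφ))
  have hfin : φ.toRingHom.Finite := by
    let := φ.toRingHom.toAlgebra
    have := MvPowerSeries.isAdicComplete_maximalIdeal (K := ResidueField C) (d := d)
    refine Module.Finite.of_residually_surjective
      (maximalIdeal (MvPowerSeries (Fin d) (ResidueField C))) (maximalIdeal C) (N := N) ?_ ?_ ?_ ?_
    · rw [hm]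
      exact Ideal.FG.map (IsNoetherian.noetherian (maximalIdeal R)) ι
    · rw [MvPowerSeries.maximalIdeal_eq_span_range_X, hm]
      exact hspan.le.trans (Ideal.map_mono (Ideal.span_le.2 (Set.range_subset_iff.2 hr)))
    · rw [MvPowerSeries.maximalIdeal_eq_span_range_X, hm, ← Ideal.map_pow]
      exact (Ideal.map_mono hN).trans hspan.ge
    · refine fun c => ⟨MvPowerSeries.C (residue C c), ?_⟩
      rw [← residue_eq_zero_iff, map_sub, sub_eq_zero]
      exact (hg _).symm.trans (congrArg (residue C) (φ.commutes (residue C c)).symm)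
  refine ⟨ResidueField C, inferInstance, φ.toRingHom, r, N, ?_, hfin, hr, hN, hφ⟩
  have : IsDomain (MvPowerSeries (Fin d) (ResidueField C)) := NoZeroDivisors.to_isDomain _
  exact RingHom.injective_of_le_ringKrullDim _ hfin (MvPowerSeries.ringKrullDim_le _ d)
    (hdim ▸ ringKrullDim_le_of_flat)
end

namespace Matrix
variable {R ι κ μ : Type} [CommRing R] {p : ι → ℕ} {q : κ → ℕ} {s : μ → ℕ}

/-- A matrix all of whose nonzero entries shift degrees by `k`. -/
def IsHomog (p : ι → ℕ) (q : κ → ℕ) (k : ℤ) (M : Matrix ι κ R) : Prop :=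
  ∀ a b, M a b ≠ 0 → (q b : ℤ) = p a + k

theorem IsHomog.mul [Fintype κ] {k l m : ℤ} {M : Matrix ι κ R} {M' : Matrix κ μ R}
    (h : M.IsHomog p q k) (h' : M'.IsHomog q s l) (hm : k + l = m) : (M * M').IsHomog p s m := by
  intro a b hab
  rw [mul_apply] at hab
  obtain ⟨c, -, hc⟩ := Finset.exists_ne_zero_of_sum_ne_zero hab
  have h1 := h a c (left_ne_zero_of_mul hc)
  have h2 := h' c b (right_ne_zero_of_mul hc)
  omega

theorem IsHomog.add {k : ℤ} {M M' : Matrix ι κ R} (h : M.IsHomog p q k) (h' : M'.IsHomog p q k) :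
    (M + M').IsHomog p q k := by
  intro a b hab
  by_cases h0 : M a b = 0
  · exact h' a b fun h1 => hab (by simp [h0, h1])
  · exact h a b h0

theorem IsHomog.neg {k : ℤ} {M : Matrix ι κ R} (h : M.IsHomog p q k) : (-M).IsHomog p q k :=
  fun a b hab => h a b fun h0 => hab (by simp [h0])

theorem IsHomog.smul {k : ℤ} {M : Matrix ι κ R} (h : M.IsHomog p q k) (c : R) :
    (c • M).IsHomog p q k :=
  fun a b hab => h a b fun h0 => hab (by simp [h0])

theorem IsHomog.sub {k : ℤ} {M M' : Matrix ι κ R} (h : M.IsHomog p q k) (h' : M'.IsHomog p q k) :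
    (M - M').IsHomog p q k := by
  rw [sub_eq_add_neg]
  exact h.add h'.neg

theorem IsHomog.one [DecidableEq ι] : (1 : Matrix ι ι R).IsHomog p p 0 := by
  intro a b hab
  rw [one_apply] at hab
  split_ifs at hab with h
  · simp [h]
  · exact absurd rfl hab

end Matrix

/-- A finite complex of free modules with chosen bases. -/
structure BasedComplex (R ι : Type) [CommRing R] [Fintype ι] where
  deg : ι → ℕ
  mat : Matrix ι ι R
  homog : mat.IsHomog deg deg 1
  sq : mat * mat = 0

namespace BasedComplex
variable {R ι : Type} [CommRing R] [Fintype ι] [DecidableEq ι]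

/-- Multiplication by `c` is null-homotopic. -/
def Null (F : BasedComplex R ι) (c : R) : Prop :=
  ∃ σ : Matrix ι ι R, σ.IsHomog F.deg F.deg (-1) ∧ F.mat * σ + σ * F.mat = c • 1

/-- Cancelling a unit entry of the differential. -/
theorem exists_cancel (F : BasedComplex R ι) {i j : ι} (hu : IsUnit (F.mat i j)) (hij : i ≠ j) :
    ∃ G : BasedComplex R {a // a ≠ i ∧ a ≠ j}, (∀ a, G.deg a = F.deg a) ∧
      (∀ c, F.Null c → G.Null c) ∧ (G.Null 1 → F.Null 1) := by
  classical
  obtain ⟨u, hu⟩ := hu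
  rcases subsingleton_or_nontrivial R with hR | hR
  · refine ⟨⟨fun a => F.deg a, 0, fun a b h => absurd (Subsingleton.elim _ _) h, by simp⟩,
      fun a => rfl, fun c _ => ⟨0, fun a b h => absurd (Subsingleton.elim _ _) h,
        Subsingleton.elim _ _⟩, fun _ => ⟨0, fun a b h => absurd (Subsingleton.elim _ _) h,
        Subsingleton.elim _ _⟩⟩
  let κ := {a // a ≠ i ∧ a ≠ j}
  let D := F.mat
  have hD : D * D = 0 := F.sq
  let h : Matrix ι ι R := Matrix.single j i (↑u⁻¹ : R)
  let S : Matrix ι κ R := (1 : Matrix ι ι R).submatrix id Subtype.val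
  let T : Matrix κ ι R := (1 : Matrix ι ι R).submatrix Subtype.val id
  let p : κ → ℕ := fun a => F.deg a
  have hS : S.IsHomog F.deg p 0 := fun a b => Matrix.IsHomog.one (p := F.deg) a b
  have hT : T.IsHomog p F.deg 0 := fun a b => Matrix.IsHomog.one (p := F.deg) a b
  have hh : h.IsHomog F.deg F.deg (-1) := by
    intro a b hab
    have hd := F.homog i j (hu ▸ u.ne_zero)
    simp only [h, Matrix.single_apply, ne_eq, ite_eq_right_iff, not_forall] at hab
    obtain ⟨⟨rfl, rfl⟩, -⟩ := hab
    omega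
  have hh2 : h * h = 0 := Matrix.single_mul_single_of_ne (h := hij) ..
  have hDh : h * D * h = h := by
    simp only [h, D, Matrix.single_mul_mul_single, ← hu]
    simp
  have hhS : h * S = 0 := by
    ext a b
    have h1 : i ≠ b.1 := fun e => b.2.1 e.symm
    rw [Matrix.mul_apply]
    refine Finset.sum_eq_zero fun c _ => ?_
    simp only [h, S, Matrix.single_apply, Matrix.submatrix_apply, Matrix.one_apply]
    by_cases hc : i = c
    · subst hc
      simp [h1]
    · simp [hc]
  have hTh : T * h = 0 := by
    ext a b
    have h1 : a.1 ≠ j := a.2.2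
    rw [Matrix.mul_apply]
    refine Finset.sum_eq_zero fun c _ => ?_
    simp only [h, T, Matrix.single_apply, Matrix.submatrix_apply, Matrix.one_apply]
    by_cases hc : j = c
    · subst hc
      simp [h1]
    · simp [hc]
  have hTS : T * S = 1 := by
    rw [← Matrix.submatrix_mul _ _ _ _ _ Function.bijective_id, Matrix.one_mul,
      Matrix.submatrix_one _ Subtype.val_injective]
  have hST : S * T = 1 - Matrix.single i i 1 - Matrix.single j j 1 := by
    ext a b
    rw [Matrix.mul_apply]
    simp only [S, T, Matrix.submatrix_apply, Matrix.one_apply, Matrix.sub_apply,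
      Matrix.single_apply, _root_.id]
    by_cases ha : a ≠ i ∧ a ≠ j
    · rw [Finset.sum_eq_single (⟨a, ha⟩ : κ)]
      · simp [ha.1.symm, ha.2.symm]
      · intro c _ hc
        have : a ≠ c.1 := fun e => hc (Subtype.ext e.symm)
        simp [this]
      · simp
    · rw [Finset.sum_eq_zero]
      · by_cases h1 : a = i
        · subst h1
          simp [hij.symm]
        · have h2 : a = j := by tauto
          subst h2
          simp [hij]
      · intro c _
        have : a ≠ c.1 := fun e => ha (e ▸ c.2)
        simp [this]
  have hj : (1 - h * D) * Matrix.single j j 1 = 0 := by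
    have : h * D * Matrix.single j j 1 = Matrix.single j j 1 := by
      simp only [h, D, Matrix.single_mul_mul_single, ← hu]
      simp
    rw [sub_mul, this, one_mul, sub_self]
  have hi : Matrix.single i i 1 * (1 - D * h) = 0 := by
    have : Matrix.single i i 1 * D * h = Matrix.single i i 1 := by
      simp only [h, D, Matrix.single_mul_mul_single, ← hu]
      simp
    rw [mul_sub, ← mul_assoc, this, mul_one, sub_self]
  have key : (1 - h * D) * (S * T) * (1 - D * h) = 1 - h * D - D * h := by
    have expand : ∀ A B E E' : Matrix ι ι R,
        A * (1 - E - E') * B = A * B - A * (E * B) - A * E' * B := fun A B E E' => by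
      noncomm_ring
    rw [hST, expand, hj, hi, mul_zero, sub_zero, zero_mul, sub_zero]
    have : h * D * (D * h) = 0 := by
      rw [mul_assoc, ← mul_assoc D D, hD, zero_mul, mul_zero]
    rw [sub_mul, one_mul, mul_sub, mul_one, this, sub_zero]
    abel
  let e : Matrix ι ι R := 1 - h * D - D * h
  let r : Matrix κ ι R := T * (1 - D * h)
  let m : Matrix ι κ R := (1 - h * D) * S
  have hmr : m * r = e := by
    simp only [m, r, e, ← key, Matrix.mul_assoc]
  have hrm : r * m = 1 := by
    have : r * m = T * S - T * D * (h * S) - (T * h) * (D * S) + T * D * (h * h) * (D * S) := by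
      simp only [m, r, Matrix.mul_sub, Matrix.sub_mul, Matrix.mul_one, Matrix.one_mul,
        Matrix.mul_assoc]
      abel
    rw [this, hhS, hTh, hh2, hTS]
    simp
  have heD : e * D = D * e := by
    simp only [e, mul_sub, sub_mul, mul_one, one_mul, mul_assoc, hD, mul_zero, sub_zero]
    rw [← mul_assoc D D, hD, zero_mul, sub_zero]
  have hre : r * e = r := by rw [← hmr, ← Matrix.mul_assoc, hrm, Matrix.one_mul]
  have hem : e * m = m := by rw [← hmr, Matrix.mul_assoc, hrm, Matrix.mul_one]
  have hrD : r * D * m * r = r * D := by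
    rw [Matrix.mul_assoc, hmr, Matrix.mul_assoc, ← heD, ← Matrix.mul_assoc, hre]
  have hDm : m * (r * D * m) = D * m := by
    rw [Matrix.mul_assoc r, ← Matrix.mul_assoc m, hmr, ← Matrix.mul_assoc, heD, Matrix.mul_assoc,
      hem]
  have hDd : D.IsHomog F.deg F.deg 1 := F.homog
  have h1d : (1 : Matrix ι ι R).IsHomog F.deg F.deg 0 := Matrix.IsHomog.one
  have hrd : r.IsHomog p F.deg 0 := hT.mul (h1d.sub (hDd.mul hh (by norm_num))) (by norm_num)
  have hmd : m.IsHomog F.deg p 0 :=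
    Matrix.IsHomog.mul (h1d.sub (hh.mul hDd (by norm_num))) hS (by norm_num)
  refine ⟨⟨p, r * D * m, (hrd.mul hDd rfl).mul hmd (by norm_num), ?_⟩, fun a => rfl, ?_, ?_⟩
  · rw [← Matrix.mul_assoc (r * D * m) (r * D) m, ← Matrix.mul_assoc (r * D * m) r D, hrD,
      Matrix.mul_assoc r, hD, Matrix.mul_zero, Matrix.zero_mul]
  · rintro c ⟨σ, hσ, hc⟩
    refine ⟨r * σ * m, (hrd.mul hσ rfl).mul hmd (by norm_num), ?_⟩
    change r * D * m * (r * σ * m) + r * σ * m * (r * D * m) = c • 1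
    have e1 : r * D * m * (r * σ * m) = r * (D * σ) * m := by
      simp only [← Matrix.mul_assoc]
      rw [hrD]
    have e2 : r * σ * m * (r * D * m) = r * (σ * D) * m := by
      rw [Matrix.mul_assoc _ m, hDm]
      simp only [Matrix.mul_assoc]
    rw [e1, e2, ← Matrix.add_mul, ← Matrix.mul_add]
    have hc' : D * σ + σ * D = c • 1 := hc
    rw [hc', Matrix.mul_smul, Matrix.mul_one, Matrix.smul_mul, hrm]
  · rintro ⟨σ, hσ, hc⟩
    refine ⟨m * σ * r + h, ((hmd.mul hσ rfl).mul hrd (by norm_num)).add hh, ?_⟩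
    change D * (m * σ * r + h) + (m * σ * r + h) * D = (1 : R) • 1
    have hc' : r * D * m * σ + σ * (r * D * m) = (1 : R) • 1 := hc
    have e1 : D * (m * σ * r) = m * (r * D * m * σ) * r := by
      simp only [← Matrix.mul_assoc]
      rw [← hDm]
      simp only [← Matrix.mul_assoc]
    have e2 : m * σ * r * D = m * (σ * (r * D * m)) * r := by
      rw [Matrix.mul_assoc (m * σ) r]
      conv_lhs => rw [← hrD]
      simp only [Matrix.mul_assoc]
    have e3 : m * (r * D * m * σ) * r + m * (σ * (r * D * m)) * r = e := by
      rw [← Matrix.add_mul, ← Matrix.mul_add, hc', one_smul, Matrix.mul_one, hmr]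
    rw [mul_add, add_mul, e1, e2, add_add_add_comm, e3, one_smul]
    simp only [e]
    abel

end BasedComplex

namespace BasedComplex

/-- Every based complex over a local ring is homotopy equivalent to a minimal one. -/
theorem exists_minimal {R : Type} [CommRing R] [Nontrivial R] {ι : Type} [Fintype ι]
    [DecidableEq ι] (F : BasedComplex R ι) :
    ∃ (κ : Type) (_ : Fintype κ) (_ : DecidableEq κ) (G : BasedComplex R κ),
      Fintype.card κ ≤ Fintype.card ι ∧ (∀ a, ∃ b, G.deg a = F.deg b) ∧
      (∀ c, F.Null c → G.Null c) ∧ (G.Null 1 → F.Null 1) ∧ ∀ a b, ¬ IsUnit (G.mat a b) := by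
  classical
  obtain ⟨n, hn⟩ : ∃ n, n = Fintype.card ι := ⟨_, rfl⟩
  induction n using Nat.strong_induction_on generalizing ι with
  | _ n ih =>
    by_cases hF : ∀ a b, ¬ IsUnit (F.mat a b)
    · exact ⟨ι, inferInstance, inferInstance, F, le_rfl, fun a => ⟨a, rfl⟩, fun _ => id, id, hF⟩
    push Not at hF
    obtain ⟨i, j, hu⟩ := hF
    have hij : i ≠ j := by
      rintro rfl
      have := F.homog i i hu.ne_zero
      omega
    obtain ⟨G, h1, h2, h3⟩ := F.exists_cancel hu hij
    have hlt : Fintype.card {a // a ≠ i ∧ a ≠ j} < n :=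
      hn ▸ Fintype.card_subtype_lt (x := i) (by simp)
    obtain ⟨κ, i1, i2, H, g0, g1, g2, g3, g4⟩ := ih _ hlt G rfl
    refine ⟨κ, i1, i2, H, by omega, fun a => ?_, fun c hc => g2 c (h2 c hc),
      fun hc => h3 (g3 hc), g4⟩
    obtain ⟨b, hb⟩ := g1 a
    exact ⟨b, hb.trans (h1 b)⟩

open Matrix in
/-- If `r` kills the homology of a based complex, then some power of `r` is null-homotopic. -/
theorem exists_null_pow {R ι : Type} [CommRing R] [Fintype ι] [DecidableEq ι]
    (F : BasedComplex R ι) (r : R)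
    (h : ∀ k (v : ι → R), (∀ a, v a ≠ 0 → F.deg a = k) → F.mat *ᵥ v = 0 →
      ∃ w : ι → R, (∀ a, w a ≠ 0 → F.deg a = k + 1) ∧ F.mat *ᵥ w = r • v) :
    ∃ M, F.Null (r ^ M) := by
  suffices H : ∀ k, ∃ (M : ℕ) (σ : Matrix ι ι R), σ.IsHomog F.deg F.deg (-1) ∧
      ∀ b, F.deg b < k → ∀ a, (F.mat * σ + σ * F.mat) a b = (r ^ M • (1 : Matrix ι ι R)) a b by
    obtain ⟨M, σ, hσ, hh⟩ := H (Finset.univ.sup F.deg + 1)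
    exact ⟨M, σ, hσ, Matrix.ext fun a b =>
      hh b (Nat.lt_succ_of_le (Finset.le_sup (Finset.mem_univ b))) a⟩
  intro k
  induction k with
  | zero => exact ⟨0, 0, fun a b hab => absurd rfl hab, fun b hb => absurd hb (Nat.not_lt_zero _)⟩
  | succ k ih =>
    obtain ⟨M, σ, hσ, hh⟩ := ih
    let g : Matrix ι ι R := r ^ M • 1 - σ * F.mat
    have hg : g.IsHomog F.deg F.deg 0 :=
      (Matrix.IsHomog.one.smul _).sub (hσ.mul F.homog (by norm_num))
    have hDg : ∀ b, F.deg b = k → ∀ a, (F.mat * g) a b = 0 := by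
      intro b hb a
      have e : F.mat * g = (r ^ M • 1 - (F.mat * σ + σ * F.mat)) * F.mat := by
        simp only [g, mul_sub, sub_mul, add_mul, mul_assoc, F.sq]
        simp
      rw [e, Matrix.mul_apply]
      refine Finset.sum_eq_zero fun c _ => ?_
      by_cases hc : F.mat c b = 0
      · rw [hc, mul_zero]
      · have := F.homog c b hc
        rw [Matrix.sub_apply, hh c (by omega) a, sub_self, zero_mul]
    have hw : ∀ b, ∃ w : ι → R, F.deg b = k →
        (∀ a, w a ≠ 0 → F.deg a = k + 1) ∧ F.mat *ᵥ w = r • fun a => g a b := by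
      intro b
      by_cases hb : F.deg b = k
      · obtain ⟨w, hw⟩ := h k (fun a => g a b)
          (fun a ha => by have := hg a b ha; omega) (funext fun a => hDg b hb a)
        exact ⟨w, fun _ => hw⟩
      · exact ⟨0, fun h => absurd h hb⟩
    choose w hw using hw
    let τ : Matrix ι ι R := Matrix.of fun a b => if F.deg b = k then w b a else r * σ a b
    have hτD : ∀ b, F.deg b < k + 1 → ∀ a, (τ * F.mat) a b = r * (σ * F.mat) a b := by
      intro b hb a
      rw [Matrix.mul_apply, Matrix.mul_apply, Finset.mul_sum]
      refine Finset.sum_congr rfl fun c _ => ?_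
      by_cases hc : F.mat c b = 0
      · simp [hc]
      · have := F.homog c b hc
        have hck : F.deg c ≠ k := by omega
        simp [τ, hck, mul_assoc]
    refine ⟨M + 1, τ, fun a b hab => ?_, fun b hb a => ?_⟩
    · simp only [τ, Matrix.of_apply] at hab
      split_ifs at hab with hb
      · have := (hw b hb).1 a hab
        omega
      · exact hσ a b (right_ne_zero_of_mul hab)
    · rw [Matrix.add_apply, hτD b hb a]
      by_cases hb' : F.deg b = k
      · have e : (F.mat * τ) a b = r * g a b := by
          have := congrFun (hw b hb').2 a
          rw [Pi.smul_apply, smul_eq_mul] at this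
          rw [← this, Matrix.mul_apply, Matrix.mulVec, dotProduct]
          simp [τ, hb']
        rw [e]
        simp only [g, Matrix.sub_apply, Matrix.smul_apply, smul_eq_mul]
        ring
      · have e : (F.mat * τ) a b = r * (F.mat * σ) a b := by
          rw [Matrix.mul_apply, Matrix.mul_apply, Finset.mul_sum]
          refine Finset.sum_congr rfl fun c _ => ?_
          simp only [τ, Matrix.of_apply, if_neg hb']
          ring
        have := hh b (by omega) a
        rw [Matrix.add_apply] at this
        rw [e, ← mul_add, this]
        simp only [Matrix.smul_apply, smul_eq_mul]
        ring

end BasedComplex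

open Matrix in
/-- A bounded complex of finite free modules gives a based complex. -/
theorem BasedComplex.exists_of_linearMap {R : Type} [CommRing R] [Nontrivial R] {M : ℕ → Type*}
    [∀ i, AddCommGroup (M i)] [∀ i, Module R (M i)] [∀ i, Module.Free R (M i)]
    [∀ i, Module.Finite R (M i)] (δ : ∀ i j, M i →ₗ[R] M j)
    (hs : ∀ i j, j + 1 ≠ i → δ i j = 0) (hδ : ∀ i j k, ∀ x, δ j k (δ i j x) = 0) (d : ℕ)
    (hd : ∀ j, d < j → Subsingleton (M j)) :
    ∃ (ι : Type) (_ : Fintype ι) (_ : DecidableEq ι) (F : BasedComplex R ι),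
      Fintype.card ι = ∑ j ∈ Finset.range (d + 1), Module.finrank R (M j) ∧
      (∀ a, F.deg a ≤ d) ∧
      (∀ r : R, (∀ i x, (∀ j, δ i j x = 0) → ∃ y, δ (i + 1) i y = r • x) →
        ∃ N, F.Null (r ^ N)) ∧
      (F.Null 1 → ∀ i x, (∀ j, δ i j x = 0) → ∃ y, δ (i + 1) i y = x) := by
  classical
  let ι : Type := Σ j : Fin (d + 1), Fin (Module.finrank R (M j))
  let b : ∀ j : Fin (d + 1), Module.Basis (Fin (Module.finrank R (M j))) R (M j) :=
    fun j => Module.finBasis R (M j)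
  let V : (∀ j : Fin (d + 1), M j) ≃ₗ[R] (ι → R) := (Pi.basis b).equivFun
  have hV : ∀ x a, V x a = (b a.1).repr (x a.1) a.2 := fun x a => by
    simp [V, Module.Basis.equivFun_apply, Pi.basis_repr]
  let E : (∀ j : Fin (d + 1), M j) →ₗ[R] (∀ j : Fin (d + 1), M j) :=
    LinearMap.pi fun i => ∑ j : Fin (d + 1), δ j i ∘ₗ LinearMap.proj j
  have hE : ∀ x i, E x i = ∑ j : Fin (d + 1), δ j i (x j) := fun x i => by simp [E]
  have hEE : E ∘ₗ E = 0 := by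
    refine LinearMap.ext fun x => funext fun i => ?_
    rw [LinearMap.comp_apply, hE]
    refine Finset.sum_eq_zero fun j _ => ?_
    rw [hE, map_sum]
    exact Finset.sum_eq_zero fun l _ => hδ _ _ _ _
  have hEs : ∀ (k : Fin (d + 1)) x i, E (Pi.single k x) i = δ k i x := by
    intro k x i
    rw [hE, Finset.sum_eq_single k]
    · simp
    · intro j _ hj
      simp [hj]
    · simp
  let D : Matrix ι ι R := LinearMap.toMatrix (Pi.basis b) (Pi.basis b) E
  have hD : ∀ x, D *ᵥ V x = V (E x) := fun x => by
    simpa [V] using LinearMap.toMatrix_mulVec_repr (Pi.basis b) (Pi.basis b) E x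
  let deg : ι → ℕ := fun a => a.1
  have hhom : D.IsHomog deg deg 1 := by
    intro a c hac
    by_contra hne
    refine hac ?_
    have : (D a c) = V (E (Pi.single c.1 (b c.1 c.2))) a := by
      simp only [D, LinearMap.toMatrix_apply, Pi.basis_apply]
      rfl
    rw [this, hV, hEs, hs _ _ (fun h => hne (by simp only [deg]; omega))]
    simp
  let F : BasedComplex R ι := ⟨deg, D, hhom, by
    rw [← LinearMap.toMatrix_comp, hEE, map_zero]⟩
  have hsupp : ∀ (k : ℕ) (x : ∀ j : Fin (d + 1), M j), (∀ a, V x a ≠ 0 → deg a = k) →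
      ∀ j : Fin (d + 1), (j : ℕ) ≠ k → x j = 0 := by
    intro k x hx j hj
    refine (b j).ext_elem fun i => ?_
    by_contra hne
    refine hj (hx ⟨j, i⟩ ?_)
    rw [hV]
    simpa using hne
  refine ⟨ι, inferInstance, inferInstance, F, ?_, fun a => Nat.le_of_lt_succ a.1.2, ?_, ?_⟩
  · rw [Fintype.card_sigma, Finset.sum_range]
    simp
  · intro r hr
    refine F.exists_null_pow r fun k v hv hDv => ?_
    obtain ⟨x, rfl⟩ := V.surjective v
    have hx := hsupp k x hv
    by_cases hk : k < d + 1
    · have hxs : x = Pi.single ⟨k, hk⟩ (x ⟨k, hk⟩) := by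
        funext j
        by_cases hj : j = ⟨k, hk⟩
        · subst hj
          simp
        · rw [Pi.single_eq_of_ne hj, hx j fun h => hj (Fin.ext h)]
      have hEx : E x = 0 := V.injective (by rw [← hD, map_zero]; exact hDv)
      have hcyc : ∀ j, δ k j (x ⟨k, hk⟩) = 0 := by
        intro j
        by_cases hj : j < d + 1
        · rw [hxs] at hEx
          exact (hEs ⟨k, hk⟩ (x ⟨k, hk⟩) ⟨j, hj⟩).symm.trans (congrFun hEx ⟨j, hj⟩)
        · have := hd j (by omega)
          exact Subsingleton.elim _ _
      obtain ⟨y, hy⟩ := hr k _ hcyc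
      by_cases hk1 : k + 1 < d + 1
      · refine ⟨V (Pi.single ⟨k + 1, hk1⟩ y), fun a ha => ?_, ?_⟩
        · by_contra hne
          refine ha ?_
          rw [hV, Pi.single_eq_of_ne fun h => hne (by simp only [F, deg, h])]
          simp
        · change D *ᵥ _ = _
          rw [hD, ← map_smul]
          congr 1
          funext i
          rw [hEs, Pi.smul_apply]
          by_cases hi : i = ⟨k, hk⟩
          · subst hi
            exact hy
          · have hik : (i : ℕ) ≠ k := fun h => hi (Fin.ext h)
            rw [hx i hik, hs (k + 1) i (by omega)]
            simp
      · have := hd (k + 1) (by omega)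
        refine ⟨0, fun a ha => absurd rfl ha, ?_⟩
        rw [Matrix.mulVec_zero, ← map_smul, hxs, ← Pi.single_smul, ← hy,
          Subsingleton.elim y 0]
        simp
    · have : x = 0 := funext fun j => hx j (by omega)
      exact ⟨0, fun a ha => absurd rfl ha, by simp [this]⟩
  · rintro ⟨σ, hσ, hh⟩ k x hx
    by_cases hk : k < d + 1
    · let v := V (Pi.single ⟨k, hk⟩ x)
      have hDv : D *ᵥ v = 0 := by
        rw [hD]
        have : E (Pi.single ⟨k, hk⟩ x) = 0 := funext fun i => (hEs ⟨k, hk⟩ x i).trans (hx i)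
        rw [this, map_zero]
      obtain ⟨z, hz⟩ := V.surjective (σ *ᵥ v)
      have hzx : E z = Pi.single ⟨k, hk⟩ x := by
        refine V.injective ?_
        have h1 := congrArg (· *ᵥ v) hh
        simp only [Matrix.add_mulVec, ← Matrix.mulVec_mulVec, one_smul, Matrix.one_mulVec] at h1
        have h2 : F.mat *ᵥ v = 0 := hDv
        rw [h2, Matrix.mulVec_zero, add_zero] at h1
        rw [← hD, hz]
        exact h1
      have hzk := congrFun hzx ⟨k, hk⟩
      rw [hE, Pi.single_eq_same] at hzk
      by_cases hk1 : k + 1 < d + 1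
      · refine ⟨z ⟨k + 1, hk1⟩, ?_⟩
        rw [← hzk, Finset.sum_eq_single ⟨k + 1, hk1⟩]
        · intro j _ hj
          rw [hs _ _ fun h => hj (Fin.ext h.symm)]
          simp
        · simp
      · refine ⟨0, ?_⟩
        rw [map_zero, ← hzk, Finset.sum_eq_zero]
        intro j _
        rw [hs _ _ fun h => by have := j.2; simp only at h; omega]
        simp
    · have := hd k (by omega)
      exact ⟨0, Subsingleton.elim _ _⟩

open IsLocalRing in
/-- A power of the maximal ideal kills a module of finite length, elementwise. -/
theorem IsFiniteLength.exists_pow_smul_eq_zero {R : Type*} [CommRing R] [IsLocalRing R] {M : Type*}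
    [AddCommGroup M] [Module R M] (h : IsFiniteLength R M) :
    ∃ N : ℕ, ∀ r ∈ maximalIdeal R, ∀ x : M, r ^ N • x = 0 := by
  induction h with
  | of_subsingleton => exact ⟨0, fun r _ x => Subsingleton.elim _ _⟩
  | @of_simple_quotient M _ _ N _ hN ih =>
    obtain ⟨n, hn⟩ := ih
    refine ⟨n + 1, fun r hr x => ?_⟩
    have hrx : r • x ∈ N := by
      have h1 : r ∈ Module.annihilator R (M ⧸ N) := by
        have := IsSimpleModule.annihilator_isMaximal (R := R) (M := M ⧸ N)
        rw [eq_maximalIdeal this]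
        exact hr
      have h2 := Module.mem_annihilator.1 h1 (N.mkQ x)
      rwa [← map_smul, Submodule.mkQ_apply, Submodule.Quotient.mk_eq_zero] at h2
    have := hn r hr ⟨r • x, hrx⟩
    rw [pow_succ, mul_smul]
    exact congrArg Subtype.val this

open CategoryTheory

theorem CategoryTheory.ShortComplex.exists_of_smul_homology_eq_zero {R : Type*} [CommRing R]
    (S : ShortComplex (ModuleCat R)) (r : R) (h : ∀ z : S.homology, r • z = 0) (x : S.X₂)
    (hx : S.g.hom x = 0) : ∃ y, S.f.hom y = r • x := by
  let e : S.homology ≃ₗ[R] LinearMap.ker S.g.hom ⧸ LinearMap.range S.moduleCatToCycles :=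
    S.moduleCatHomologyIso.toLinearEquiv
  have h1 : ∀ z : LinearMap.ker S.g.hom ⧸ LinearMap.range S.moduleCatToCycles, r • z = 0 := by
    intro z
    have := congrArg e (h (e.symm z))
    rw [map_smul, map_zero, LinearEquiv.apply_symm_apply] at this
    exact this
  have h2 := h1 ((LinearMap.range S.moduleCatToCycles).mkQ ⟨x, hx⟩)
  rw [← map_smul, Submodule.mkQ_apply, Submodule.Quotient.mk_eq_zero] at h2
  obtain ⟨y, hy⟩ := h2
  exact ⟨y, congrArg Subtype.val hy⟩

theorem CategoryTheory.ShortComplex.subsingleton_homology {R : Type*} [CommRing R]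
    (S : ShortComplex (ModuleCat R)) (h : ∀ x : S.X₂, S.g.hom x = 0 → ∃ y, S.f.hom y = x) :
    Subsingleton S.homology := by
  have : S.Exact := S.moduleCat_exact_iff.2 fun x hx => h x hx
  exact ModuleCat.subsingleton_of_isZero (S.exact_iff_isZero_homology.1 this)

/-- A bounded complex of finite free modules whose homology has finite length and is not zero
yields a minimal based complex. -/
theorem ChainComplex.exists_basedComplex {R : Type} [CommRing R] [IsLocalRing R] {d : ℕ}
    (P : ChainComplex (ModuleCat R) ℕ) (hfree : ∀ j, Module.Free R (P.X j))
    (hfin : ∀ j, Module.Finite R (P.X j)) (hconc : ∀ j, d < j → Subsingleton (P.X j))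
    (hfl : ∀ i, IsFiniteLength R (P.homology i)) (hne : ∃ i, Nontrivial (P.homology i)) :
    ∃ (ι : Type) (_ : Fintype ι) (_ : DecidableEq ι) (F : BasedComplex R ι),
      Nonempty ι ∧
      Fintype.card ι ≤ ∑ j ∈ Finset.range (d + 1), Module.finrank R (P.X j) ∧
      (∀ a, F.deg a ≤ d) ∧ (∀ r ∈ IsLocalRing.maximalIdeal R, ∃ N, F.Null (r ^ N)) ∧
      ∀ a b, F.mat a b ∈ IsLocalRing.maximalIdeal R := by
  have hcyc : ∀ i (x : P.X i), (∀ j, (P.d i j).hom x = 0) → (P.sc i).g.hom x = 0 :=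
    fun i x hx => hx _
  have hbd : ∀ i (x : P.X i), (∃ y, (P.sc i).f.hom y = x) → ∃ y, (P.d (i + 1) i).hom y = x := by
    rintro i x ⟨y, hy⟩
    have key : ∀ l (_ : l = i + 1) (y : P.X l), (P.d l i).hom y = x →
        ∃ y, (P.d (i + 1) i).hom y = x := by
      rintro l rfl y hy
      exact ⟨y, hy⟩
    exact key _ (ChainComplex.prev ℕ i) y hy
  have hcyc' : ∀ i (x : P.X i), (P.sc i).g.hom x = 0 → ∀ j, (P.d i j).hom x = 0 := by
    intro i x hx j
    by_cases hij : (ComplexShape.down ℕ).Rel i j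
    · have := (ComplexShape.down ℕ).next_eq' hij
      subst this
      exact hx
    · rw [P.shape i j hij]
      rfl
  obtain ⟨ι, i1, i2, F, hcard, hdeg, hnull, hone⟩ :=
    BasedComplex.exists_of_linearMap (R := R) (M := fun i => P.X i) (fun i j => (P.d i j).hom)
      (fun i j hij => by rw [P.shape i j hij]; rfl)
      (fun i j k x => by
        have := congrArg (fun f => f.hom x) (P.d_comp_d i j k)
        exact this) d hconc
  have hF1 : ¬ F.Null 1 := by
    intro h1
    obtain ⟨i, hi⟩ := hne
    have : Subsingleton (P.homology i) := by
      refine (P.sc i).subsingleton_homology fun x hx => ?_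
      obtain ⟨y, hy⟩ := hone h1 i x (hcyc' i x hx)
      have key : ∀ l (_ : l = i + 1), ∃ y, (P.d l i).hom y = x := by
        rintro l rfl
        exact ⟨y, hy⟩
      exact key _ (ChainComplex.prev ℕ i)
    exact not_subsingleton _ this
  have hFnull : ∀ r ∈ IsLocalRing.maximalIdeal R, ∃ N, F.Null (r ^ N) := by
    intro r hr
    choose N hN using fun i => (hfl i).exists_pow_smul_eq_zero
    let N' := ∑ i ∈ Finset.range (d + 1), N i
    obtain ⟨M, hM⟩ := hnull (r ^ N') (by
      intro i x hx
      by_cases hi : i < d + 1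
      · have hle : N i ≤ N' := Finset.single_le_sum (f := N) (fun _ _ => bot_le)
          (Finset.mem_range.2 hi)
        obtain ⟨c, hc⟩ := Nat.exists_eq_add_of_le' hle
        have hz : ∀ z : P.homology i, r ^ N' • z = 0 := fun z => by
          rw [hc, pow_add, mul_smul, hN i r hr z, smul_zero]
        exact hbd i _ ((P.sc i).exists_of_smul_homology_eq_zero _ hz x (hcyc i x hx))
      · have := hconc i (by omega)
        exact ⟨0, Subsingleton.elim _ _⟩)
    exact ⟨N' * M, by rwa [pow_mul]⟩
  obtain ⟨κ, j1, j2, G, g0, g1, g2, g3, g4⟩ := F.exists_minimal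
  refine ⟨κ, j1, j2, G, ?_, g0.trans hcard.le, fun a => ?_, fun r hr => ?_, fun a b => g4 a b⟩
  · by_contra hemp
    rw [not_nonempty_iff] at hemp
    exact hF1 (g3 ⟨0, fun a => hemp.elim a, Subsingleton.elim _ _⟩)
  · obtain ⟨b, hb⟩ := g1 a
    exact hb ▸ hdeg b
  · obtain ⟨N, hN⟩ := hFnull r hr
    exact ⟨N, g2 _ hN⟩

/-- Sorting the basis of a based complex by degree. -/
theorem BasedComplex.exists_MC {R ι : Type} [CommRing R] [Fintype ι] [DecidableEq ι] [Nonempty ι]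
    (F : BasedComplex R ι) {d : ℕ} (hd : ∀ a, F.deg a ≤ d) :
    ∃ (n : ℕ) (e : Fin (n + 1) ≃ ι) (G : MC R (n + 1) d), G.deg 0 = 0 ∧
      G.mat = F.mat.submatrix e e ∧ ∀ c, F.Null c → G.Null c := by
  obtain ⟨n, hn⟩ := Nat.exists_eq_succ_of_ne_zero (Fintype.card_ne_zero (α := ι))
  let e₀ : Fin (n + 1) ≃ ι := (Fintype.equivFinOfCardEq hn).symm
  let e : Fin (n + 1) ≃ ι := (Tuple.sort (F.deg ∘ e₀)).trans e₀
  have he : Monotone fun j => F.deg (e j) := Tuple.monotone_sort (F.deg ∘ e₀)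
  have h0 : ∀ j, F.deg (e 0) ≤ F.deg (e j) := fun j => he (Fin.zero_le j)
  refine ⟨n, e, ⟨fun j => F.deg (e j) - F.deg (e 0), fun i j hij => Nat.sub_le_sub_right (he hij) _,
    fun j => (Nat.sub_le _ _).trans (hd _), F.mat.submatrix e e, fun i j hij => ?_, ?_⟩,
    Nat.sub_self _, rfl, ?_⟩
  · have := F.homog _ _ hij
    have := h0 i
    have := h0 j
    omega
  · rw [Matrix.submatrix_mul_equiv, F.sq]
    rfl
  · rintro c ⟨σ, h1, h2⟩
    refine ⟨σ.submatrix e e, fun i j hij => ?_, ?_⟩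
    · have := h1 _ _ hij
      have := h0 i
      have := h0 j
      simp only
      omega
    · change F.mat.submatrix e e * σ.submatrix e e + σ.submatrix e e * F.mat.submatrix e e = _
      rw [Matrix.submatrix_mul_equiv, Matrix.submatrix_mul_equiv]
      refine (congrArg (·.submatrix e e) h2).trans ?_
      ext i j
      simp [Matrix.one_apply]

/-- Let `(R, m, k)` be a Noetherian local ring of Krull dimension `d`
containing a field, and let `P` be a tiny complex over `R`: a complex of finite rank free
`R`-modules concentrated in homological degrees `0, …, d` whose homology has finite length
in every degree and is nonzero in some degree.  Then `∑_{j=0}^{d} rank_R(P_j) ≥ 2^d`. -/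
theorem stmt6 (R : Type) [CommRing R] [IsNoetherianRing R] [IsLocalRing R]
    (hfield : ∃ K : Subring R, IsField K)
    (d : ℕ) (hdim : ringKrullDim R = d)
    (P : ChainComplex (ModuleCat R) ℕ)
    (hfree : ∀ j, Module.Free R (P.X j)) (hfin : ∀ j, Module.Finite R (P.X j))
    (hconc : ∀ j, d < j → Subsingleton (P.X j))
    (hfl : ∀ i, IsFiniteLength R (P.homology i))
    (hne : ∃ i, Nontrivial (P.homology i)) :
    2 ^ d ≤ ∑ j ∈ Finset.range (d + 1), Module.finrank R (P.X j) := by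
  obtain ⟨ι, _, _, F, _, hcard, hdeg, hnull, hmat⟩ :=
    P.exists_basedComplex hfree hfin hconc hfl hne
  obtain ⟨n, e, G, hG0, hGmat, hGnull⟩ := F.exists_MC hdeg
  obtain ⟨K, _, φ, r, N, hinj, hφ, hr, hN, hφr⟩ :=
    IsLocalRing.exists_finite_injective_mvPowerSeries R hfield hdim
  refine le_trans ?_ hcard
  rw [← Fintype.card_congr e, Fintype.card_fin]
  algebraize [φ]
  choose M hM using fun i => hnull (r i) (hr i)
  refine MC.two_pow_le K hinj (G.map (algebraMap R _)) hG0 (N := ∑ i, M i) (fun i => ?_)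
    fun a b => ?_
  · have hle : M i ≤ ∑ i, M i := Finset.single_le_sum (f := M) (fun _ _ => bot_le)
      (Finset.mem_univ i)
    obtain ⟨c, hc⟩ := Nat.exists_eq_add_of_le' hle
    have h1 := ((hGnull _ (hM i)).mul (r i ^ c)).map
      (algebraMap R (AdicCompletion (IsLocalRing.maximalIdeal R) R))
    rw [← pow_add, ← hc, map_pow, ← hφr, ← map_pow] at h1
    exact h1
  · refine ⟨N, ?_⟩
    change algebraMap R _ (G.mat a b) ^ N ∈ _
    rw [hGmat, Matrix.submatrix_apply, ← map_pow]
    have h1 : F.mat (e a) (e b) ^ N ∈ Ideal.span (Set.range r) :=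
      hN (Ideal.pow_mem_pow (hmat _ _) N)
    have h2 := Ideal.mem_map_of_mem
      (algebraMap R (AdicCompletion (IsLocalRing.maximalIdeal R) R)) h1
    rw [Ideal.map_span] at h2 ⊢
    refine Ideal.span_mono ?_ h2
    rintro _ ⟨_, ⟨i, rfl⟩, rfl⟩
    exact ⟨_, ⟨i, rfl⟩, hφr i⟩
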